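/- Under the hypotheses of the main existence theorem (conditions (H1), (H3), existence of an exponential dichotomy on ℝ for the evolution family generated by the linearized problem, and ‖f‖_{BC²} ≤ ε), assume additionally that A(x,t,v) and B(x,t,v) are Bohr almost periodic in t uniformly in x ∈ [0,1] and v with ‖v‖ ≤ δ₀, and f(x,t) is Bohr almost periodic in t uniformly in x ∈ [0,1]. Then the unique classical solution u ∈ C¹([0,1]×ℝ;ℝⁿ) of the quasilinear problem with ‖u‖_{BC¹} ≤ δ is Bohr almost periodic in t uniformly in x ∈ [0,1]. -/

import Mathlib

noncomputable section

open MeasureTheory Set Filter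

/-- `ℝⁿ` with the Euclidean norm. -/
abbrev Vn (n : ℕ) : Type := EuclideanSpace ℝ (Fin n)

/-- The strip `[0,1] × ℝ`. -/
def strip : Set (ℝ × ℝ) := Set.Icc (0:ℝ) 1 ×ˢ (Set.univ : Set ℝ)

/-- `g` is `C^k` on the strip `[0,1] × ℝ` with the function and all its partial
derivatives up to order `k` bounded by `C` there (the `BC^k`-norm is `≤ C`). -/
def BCle (k : ℕ) (g : ℝ → ℝ → ℝ) (C : ℝ) : Prop :=
  ContDiffOn ℝ k (fun q : ℝ × ℝ => g q.1 q.2) strip ∧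
  ∀ i : ℕ, i ≤ k → ∀ q ∈ strip,
    ‖iteratedFDerivWithin ℝ i (fun q : ℝ × ℝ => g q.1 q.2) strip q‖ ≤ C

/-- The reflection boundary conditions relating the boundary values
`w0 = u(0,t)` and `w1 = u(1,t)`. -/
def BCrel (n m : ℕ) (p : Fin n → Fin n → ℝ) (w0 w1 : Vn n) : Prop :=
  ∀ j : Fin n,
    ((j : ℕ) < m →
      w0 j = ∑ k : Fin n, if m ≤ (k : ℕ) then p j k * w0 k else p j k * w1 k) ∧
    (m ≤ (j : ℕ) →
      w1 j = ∑ k : Fin n, if m ≤ (k : ℕ) then p j k * w0 k else p j k * w1 k)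

/-- Assumption (H3). -/
def H3cond (n : ℕ) (p : Fin n → Fin n → ℝ) : Prop :=
  ∀ i : Fin (n + 1) → Fin n, ∏ l : Fin n, p (i l.castSucc) (i l.succ) = 0

/-- The `Λ₀`-condition on the diagonal coefficients `a`. -/
def LamCond (n m : ℕ) (Λ₀ : ℝ) (a : ℝ → ℝ → Fin n → ℝ) : Prop :=
  ∀ x ∈ Set.Icc (0:ℝ) 1, ∀ t : ℝ,
    (∀ j : Fin n, ((j : ℕ) < m → Λ₀ ≤ a x t j) ∧ (m ≤ (j : ℕ) → a x t j ≤ -Λ₀)) ∧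
    ∀ j k : Fin n, j ≠ k → Λ₀ ≤ |a x t j - a x t k|

/-- A classical solution `u` (with partial derivatives `ux`, `ut`) of the linear
problem `∂ₜu + a ∂ₓu + b u = f` on `[0,1] × [s,∞)` with the reflection boundary
conditions and initial datum `φ` at time `s`. -/
def IsLinSol (n m : ℕ) (p : Fin n → Fin n → ℝ)
    (a : ℝ → ℝ → Fin n → ℝ) (b : ℝ → ℝ → Fin n → Fin n → ℝ)
    (f : ℝ → ℝ → Fin n → ℝ) (s : ℝ) (φ : ℝ → Vn n)
    (u ux ut : ℝ → ℝ → Vn n) : Prop :=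
  ContinuousOn (fun q : ℝ × ℝ => u q.1 q.2) (Set.Icc 0 1 ×ˢ Set.Ici s) ∧
  ContinuousOn (fun q : ℝ × ℝ => ux q.1 q.2) (Set.Icc 0 1 ×ˢ Set.Ici s) ∧
  ContinuousOn (fun q : ℝ × ℝ => ut q.1 q.2) (Set.Icc 0 1 ×ˢ Set.Ici s) ∧
  (∀ x ∈ Set.Icc (0:ℝ) 1, ∀ t ∈ Set.Ici s, ∀ j : Fin n,
    HasDerivWithinAt (fun y => u y t j) (ux x t j) (Set.Icc 0 1) x ∧
    HasDerivWithinAt (fun τ => u x τ j) (ut x t j) (Set.Ici s) t) ∧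
  (∀ x ∈ Set.Icc (0:ℝ) 1, ∀ t ∈ Set.Ici s, ∀ j : Fin n,
    ut x t j + a x t j * ux x t j + ∑ k : Fin n, b x t j k * u x t k = f x t j) ∧
  (∀ t ∈ Set.Ici s, BCrel n m p (u 0 t) (u 1 t)) ∧
  (∀ x ∈ Set.Icc (0:ℝ) 1, u x s = φ x)

/-- Lebesgue measure restricted to `(0,1)`. -/
abbrev μ01 : Measure ℝ := volume.restrict (Set.Ioo (0:ℝ) 1)

/-- The space `L²((0,1); ℝⁿ)`. -/
abbrev L2 (n : ℕ) := Lp (Vn n) 2 μ01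

/-- An evolution family of bounded linear operators. -/
def IsEvoFam {X : Type*} [NormedAddCommGroup X] [NormedSpace ℝ X]
    (U : ℝ → ℝ → X →L[ℝ] X) : Prop :=
  (∀ t : ℝ, U t t = ContinuousLinearMap.id ℝ X) ∧
  (∀ s r t : ℝ, s ≤ r → r ≤ t → ∀ x : X, U t r (U r s x) = U t s x)

/-- `U` is the evolution family on `L²((0,1);ℝⁿ)` generated by the linear
problem with coefficients `a`, `b`: it is a strongly continuous, exponentially
bounded evolution family which, on `C¹` data with compact support in `(0,1)`,
is given by the classical solutions. -/
def GeneratedBy (n m : ℕ) (p : Fin n → Fin n → ℝ)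
    (a : ℝ → ℝ → Fin n → ℝ) (b : ℝ → ℝ → Fin n → Fin n → ℝ)
    (U : ℝ → ℝ → L2 n →L[ℝ] L2 n) : Prop :=
  IsEvoFam U ∧
  (∀ φ : L2 n, ContinuousOn (fun q : ℝ × ℝ => U q.1 q.2 φ) {q : ℝ × ℝ | q.2 ≤ q.1}) ∧
  (∃ K : ℝ, 1 ≤ K ∧ ∃ ν : ℝ, ∀ s t : ℝ, s ≤ t →
    ‖U t s‖ ≤ K * Real.exp (ν * (t - s))) ∧
  ∀ s : ℝ, ∀ φ : ℝ → Vn n, ContDiff ℝ 1 φ → tsupport φ ⊆ Set.Ioo 0 1 →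
    ∀ φh : L2 n, (∀ᵐ x ∂μ01, φh x = φ x) →
    ∀ u ux ut : ℝ → ℝ → Vn n,
      IsLinSol n m p a b (fun _ _ _ => 0) s φ u ux ut →
      ∀ t : ℝ, s ≤ t → ∀ᵐ x ∂μ01, (U t s φh) x = u x t

/-- Exponential dichotomy on `ℝ` with exponent `α` and bound `M`. -/
def HasExpDichotomy {X : Type*} [NormedAddCommGroup X] [NormedSpace ℝ X]
    (U : ℝ → ℝ → X →L[ℝ] X) (α M : ℝ) : Prop :=
  ∃ P : ℝ → X →L[ℝ] X, ∃ W : ℝ → ℝ → X →L[ℝ] X,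
    (∀ t, (P t).comp (P t) = P t) ∧
    (∀ x : X, Continuous fun t => P t x) ∧
    (∀ x : X, ∃ C : ℝ, ∀ t, ‖P t x‖ ≤ C) ∧
    (∀ s t : ℝ, s ≤ t → (U t s).comp (P s) = (P t).comp (U t s)) ∧
    (∀ s t : ℝ, s ≤ t → ∀ x : X, W s t (U t s (x - P s x)) = x - P s x) ∧
    (∀ s t : ℝ, s ≤ t → ∀ x : X, U t s (W s t (x - P t x)) = x - P t x) ∧
    (∀ s t : ℝ, s ≤ t → ∀ x : X, P s (W s t (x - P t x)) = 0) ∧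
    (∀ s t : ℝ, s ≤ t → ‖(U t s).comp (P s)‖ ≤ M * Real.exp (-α * (t - s))) ∧
    (∀ s t : ℝ, s ≤ t →
      ‖(W s t).comp (ContinuousLinearMap.id ℝ X - P t)‖ ≤ M * Real.exp (-α * (t - s)))

/-- The domain `[0,1] × ℝ × {‖v‖ ≤ δ₀}`. -/
def qdom (n : ℕ) (δ₀ : ℝ) : Set (ℝ × ℝ × Vn n) :=
  Set.Icc (0:ℝ) 1 ×ˢ (Set.univ : Set ℝ) ×ˢ Metric.closedBall (0 : Vn n) δ₀

/-- (H1)-type smoothness: `g(x,t,v)` has continuous partial derivatives up to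
second order, bounded by `C`, on `[0,1] × ℝ × {‖v‖ ≤ δ₀}`. -/
def H1smooth (n : ℕ) (δ₀ : ℝ) (g : ℝ → ℝ → Vn n → ℝ) (C : ℝ) : Prop :=
  ContDiffOn ℝ 2 (fun q : ℝ × ℝ × Vn n => g q.1 q.2.1 q.2.2) (qdom n δ₀) ∧
  ∀ i : ℕ, i ≤ 2 → ∀ q ∈ qdom n δ₀,
    ‖iteratedFDerivWithin ℝ i (fun q : ℝ × ℝ × Vn n => g q.1 q.2.1 q.2.2)
      (qdom n δ₀) q‖ ≤ C

/-- The sign/separation conditions of (H1) on the diagonal coefficients `A`. -/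
def H1sign (n m : ℕ) (δ₀ Λ₀ : ℝ) (A : ℝ → ℝ → Vn n → Fin n → ℝ) : Prop :=
  ∀ x ∈ Set.Icc (0:ℝ) 1, ∀ t : ℝ, ∀ v : Vn n, ‖v‖ ≤ δ₀ →
    (∀ j : Fin n, ((j : ℕ) < m → Λ₀ ≤ A x t v j) ∧ (m ≤ (j : ℕ) → A x t v j ≤ -Λ₀)) ∧
    ∀ j k : Fin n, j ≠ k → Λ₀ ≤ |A x t v j - A x t v k|

/-- A classical (C¹) solution `u` (with partial derivatives `ux`, `ut`) of the
quasilinear problem `∂ₜu + A(x,t,u)∂ₓu + B(x,t,u)u = f` on the strip `[0,1] × ℝ`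
with the reflection boundary conditions. -/
def IsQLSol (n m : ℕ) (p : Fin n → Fin n → ℝ)
    (A : ℝ → ℝ → Vn n → Fin n → ℝ) (B : ℝ → ℝ → Vn n → Fin n → Fin n → ℝ)
    (f : ℝ → ℝ → Fin n → ℝ) (u ux ut : ℝ → ℝ → Vn n) : Prop :=
  ContinuousOn (fun q : ℝ × ℝ => u q.1 q.2) strip ∧
  ContinuousOn (fun q : ℝ × ℝ => ux q.1 q.2) strip ∧
  ContinuousOn (fun q : ℝ × ℝ => ut q.1 q.2) strip ∧
  (∀ x ∈ Set.Icc (0:ℝ) 1, ∀ t : ℝ, ∀ j : Fin n,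
    HasDerivWithinAt (fun y => u y t j) (ux x t j) (Set.Icc 0 1) x ∧
    HasDerivAt (fun τ => u x τ j) (ut x t j) t) ∧
  (∀ x ∈ Set.Icc (0:ℝ) 1, ∀ t : ℝ, ∀ j : Fin n,
    ut x t j + A x t (u x t) j * ux x t j
      + ∑ k : Fin n, B x t (u x t) j k * u x t k = f x t j) ∧
  (∀ t : ℝ, BCrel n m p (u 0 t) (u 1 t))

/-- `‖u‖_{BC¹} ≤ δ` on the strip. -/
def BC1le (n : ℕ) (u ux ut : ℝ → ℝ → Vn n) (δ : ℝ) : Prop :=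
  ∀ x ∈ Set.Icc (0:ℝ) 1, ∀ t : ℝ, ‖u x t‖ ≤ δ ∧ ‖ux x t‖ ≤ δ ∧ ‖ut x t‖ ≤ δ

/-- `f` has bounded continuous partial derivatives up to second order on the
strip, with `‖f‖_{BC²} ≤ ε`. -/
def FBC2le (n : ℕ) (f : ℝ → ℝ → Fin n → ℝ) (ε : ℝ) : Prop :=
  (∀ j : Fin n, ContDiffOn ℝ 2 (fun q : ℝ × ℝ => f q.1 q.2 j) strip) ∧
  ∀ j : Fin n, ∀ i : ℕ, i ≤ 2 → ∀ q ∈ strip,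
    ‖iteratedFDerivWithin ℝ i (fun q : ℝ × ℝ => f q.1 q.2 j) strip q‖ ≤ ε

/-- Bohr almost periodicity in `t` uniformly in `x ∈ [0,1]` and `‖v‖ ≤ δ₀`. -/
def APcoef (n : ℕ) (δ₀ : ℝ) (g : ℝ → ℝ → Vn n → ℝ) : Prop :=
  ∀ ε : ℝ, 0 < ε → ∃ l : ℝ, 0 < l ∧ ∀ r : ℝ, ∃ τ ∈ Set.Icc r (r + l),
    ∀ x ∈ Set.Icc (0:ℝ) 1, ∀ t : ℝ, ∀ v : Vn n, ‖v‖ ≤ δ₀ →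
      |g x (t + τ) v - g x t v| < ε

/-- Bohr almost periodicity in `t` uniformly in `x ∈ [0,1]`. -/
def APfun (n : ℕ) (g : ℝ → ℝ → Fin n → ℝ) : Prop :=
  ∀ ε : ℝ, 0 < ε → ∃ l : ℝ, 0 < l ∧ ∀ r : ℝ, ∃ τ ∈ Set.Icc r (r + l),
    ∀ x ∈ Set.Icc (0:ℝ) 1, ∀ t : ℝ, ∀ j : Fin n, |g x (t + τ) j - g x t j| < ε

/-- Bohr almost periodicity in `t` uniformly in `x ∈ [0,1]` of a vector-valued
function on the strip. -/
def APsol (n : ℕ) (u : ℝ → ℝ → Vn n) : Prop :=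
  ∀ ε : ℝ, 0 < ε → ∃ l : ℝ, 0 < l ∧ ∀ r : ℝ, ∃ τ ∈ Set.Icc r (r + l),
    ∀ x ∈ Set.Icc (0:ℝ) 1, ∀ t : ℝ, ‖u x (t + τ) - u x t‖ < ε

open scoped Topology NNReal

/-- The retraction of `ℝ` onto `[0,1]`. -/
def cl (x : ℝ) : ℝ := max 0 (min 1 x)

lemma cl_mem (x : ℝ) : cl x ∈ Icc (0:ℝ) 1 :=
  ⟨le_max_left _ _, max_le zero_le_one (min_le_left _ _)⟩

lemma cl_of_mem {x : ℝ} (h : x ∈ Icc (0:ℝ) 1) : cl x = x := by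
  simp [cl, h.1, h.2]

@[simp] lemma cl_cl (x : ℝ) : cl (cl x) = cl x := cl_of_mem (cl_mem x)

@[fun_prop] lemma continuous_cl : Continuous cl := by unfold cl; fun_prop

lemma abs_cl_sub_le (x y : ℝ) : |cl x - cl y| ≤ |x - y| := by
  unfold cl
  calc |max 0 (min 1 x) - max 0 (min 1 y)| ≤ |min 1 x - min 1 y| := by
        simpa using abs_max_sub_max_le_max 0 (min 1 x) 0 (min 1 y)
    _ ≤ |x - y| := by simpa using abs_min_sub_min_le_max 1 x 1 y

/-- Fundamental theorem of calculus inside `[0,1]`. -/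
lemma integral_eq_of_deriv_Icc {F f : ℝ → ℝ}
    (hF : ∀ x ∈ Icc (0:ℝ) 1, HasDerivWithinAt F (f x) (Icc 0 1) x)
    (hf : ContinuousOn f (Icc 0 1)) {a b : ℝ} (ha : a ∈ Icc (0:ℝ) 1) (hb : b ∈ Icc (0:ℝ) 1) :
    ∫ s in a..b, f s = F b - F a := by
  have hsub : uIcc a b ⊆ Icc 0 1 := uIcc_subset_Icc ha hb
  apply intervalIntegral.integral_eq_sub_of_hasDeriv_right
  · exact fun x hx => ((hF x (hsub hx)).continuousWithinAt).mono hsub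
  · intro x hx
    have hx' : x ∈ Ioo (0:ℝ) 1 :=
      ⟨lt_of_le_of_lt (le_min ha.1 hb.1) hx.1, lt_of_lt_of_le hx.2 (max_le ha.2 hb.2)⟩
    exact ((hF x (Ioo_subset_Icc_self hx')).hasDerivAt (Icc_mem_nhds hx'.1 hx'.2)).hasDerivWithinAt
  · exact (hf.mono hsub).intervalIntegrable

lemma deriv_integral_Icc {f : ℝ → ℝ} (hf : Continuous f) (a x : ℝ) (s : Set ℝ) :
    HasDerivWithinAt (fun y => ∫ r in a..y, f r) (f x) s x :=
  (intervalIntegral.integral_hasDerivAt_right (hf.intervalIntegrable _ _)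
    hf.aestronglyMeasurable.stronglyMeasurableAtFilter hf.continuousAt).hasDerivWithinAt

/-- Solution formula for a scalar linear ordinary differential equation on `[0,1]`. -/
lemma linear_ode_Icc {y q r : ℝ → ℝ} (hq : Continuous q) (hr : Continuous r)
    (hy : ∀ x ∈ Icc (0:ℝ) 1, HasDerivWithinAt y (q x * y x + r x) (Icc 0 1) x)
    {a b : ℝ} (ha : a ∈ Icc (0:ℝ) 1) (hb : b ∈ Icc (0:ℝ) 1) :
    y b = Real.exp (∫ s in a..b, q s) *
      (y a + ∫ s in a..b, Real.exp (-∫ z in a..s, q z) * r s) := by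
  have hQ : Continuous fun s => ∫ z in a..s, q z :=
    continuous_iff_continuousAt.2 fun s =>
      ((deriv_integral_Icc hq a s univ).continuousWithinAt).continuousAt univ_mem
  have key : ∀ x ∈ Icc (0:ℝ) 1, HasDerivWithinAt
      (fun s => Real.exp (-∫ z in a..s, q z) * y s)
      (Real.exp (-∫ z in a..x, q z) * r x) (Icc 0 1) x := by
    intro x hx
    have h1 := ((deriv_integral_Icc hq a x (Icc 0 1)).neg).exp.mul (hy x hx)
    refine h1.congr_deriv ?_
    simp only [Pi.neg_apply]
    ring
  have h := integral_eq_of_deriv_Icc key (by fun_prop) ha hb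
  simp only [intervalIntegral.integral_same, neg_zero, Real.exp_zero, one_mul] at h
  rw [h, add_sub_cancel, ← mul_assoc, ← Real.exp_add, add_neg_cancel, Real.exp_zero, one_mul]

lemma homogeneous_ode_Icc {y q : ℝ → ℝ} (hq : Continuous q)
    (hy : ∀ x ∈ Icc (0:ℝ) 1, HasDerivWithinAt y (q x * y x) (Icc 0 1) x)
    {a b : ℝ} (ha : a ∈ Icc (0:ℝ) 1) (hb : b ∈ Icc (0:ℝ) 1) :
    y b = y a * Real.exp (∫ s in a..b, q s) := by
  have := linear_ode_Icc (r := fun _ => 0) hq continuous_const (by simpa using hy) ha hb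
  simpa [mul_comm] using this

/-- `g` is continuous with a continuous `t`-derivative `gt`. -/
structure TD (g gt : ℝ → ℝ → ℝ) : Prop where
  cont : Continuous fun q : ℝ × ℝ => g q.1 q.2
  contt : Continuous fun q : ℝ × ℝ => gt q.1 q.2
  deriv : ∀ x t, HasDerivAt (g x) (gt x t) t

/-- `g` is continuous, bounded by `M`, with a continuous `t`-derivative `gt` bounded by `M`. -/
structure CT (M : ℝ) (g gt : ℝ → ℝ → ℝ) : Prop extends TD g gt where
  bd : ∀ x t, |g x t| ≤ M
  bdt : ∀ x t, |gt x t| ≤ M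

lemma CT.nonneg {M : ℝ} {g gt : ℝ → ℝ → ℝ} (h : CT M g gt) : 0 ≤ M :=
  (abs_nonneg _).trans (h.bd 0 0)

/-- The averaged difference quotient of a function with `t`-derivative `gt`. -/
def avgDeriv (gt : ℝ → ℝ → ℝ) (s a b : ℝ) : ℝ := ∫ θ in (0:ℝ)..1, gt s (a + θ * (b - a))

lemma continuous_avgDeriv {gt : ℝ → ℝ → ℝ} (h : Continuous fun q : ℝ × ℝ => gt q.1 q.2)
    {X : Type*} [TopologicalSpace X] {s a b : X → ℝ} (hs : Continuous s) (ha : Continuous a)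
    (hb : Continuous b) : Continuous fun x => avgDeriv gt (s x) (a x) (b x) := by
  unfold avgDeriv
  apply intervalIntegral.continuous_parametric_intervalIntegral_of_continuous'
  exact h.comp (by fun_prop : Continuous fun q : X × ℝ =>
    ((s q.1, a q.1 + q.2 * (b q.1 - a q.1)) : ℝ × ℝ))

lemma abs_avgDeriv_le {gt : ℝ → ℝ → ℝ} {M : ℝ} (h : ∀ x t, |gt x t| ≤ M) (s a b : ℝ) :
    |avgDeriv gt s a b| ≤ M := by
  have := intervalIntegral.norm_integral_le_of_norm_le_const (a := (0:ℝ)) (b := 1)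
    (f := fun θ => gt s (a + θ * (b - a))) (C := M) (fun θ _ => h _ _)
  simpa [avgDeriv] using this

lemma avgDeriv_self (gt : ℝ → ℝ → ℝ) (s a : ℝ) : avgDeriv gt s a a = gt s a := by
  simp [avgDeriv]

lemma TD.sub_eq {g gt : ℝ → ℝ → ℝ} (h : TD g gt) (s a b : ℝ) :
    g s b - g s a = (b - a) * avgDeriv gt s a b := by
  have hc : Continuous fun θ : ℝ => gt s (a + θ * (b - a)) := h.contt.comp (by fun_prop :
    Continuous fun θ : ℝ => ((s, a + θ * (b - a)) : ℝ × ℝ))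
  have : ∫ θ in (0:ℝ)..1, gt s (a + θ * (b - a)) * (b - a)
      = g s (a + 1 * (b - a)) - g s (a + 0 * (b - a)) := by
    refine intervalIntegral.integral_eq_sub_of_hasDerivAt
      (f := fun θ => g s (a + θ * (b - a))) ?_ ?_
    · intro θ _
      have h1 : HasDerivAt (fun θ : ℝ => a + θ * (b - a)) (b - a) θ := by
        simpa using ((hasDerivAt_id θ).mul_const (b - a)).const_add a
      exact (h.deriv s _).comp θ h1
    · exact (hc.mul continuous_const).intervalIntegrable _ _
  rw [intervalIntegral.integral_mul_const] at this
  simp only [one_mul, zero_mul, add_zero, add_sub_cancel] at this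
  rw [← this, avgDeriv, mul_comm]

lemma CT.lip {M : ℝ} {g gt : ℝ → ℝ → ℝ} (h : CT M g gt) (s a b : ℝ) :
    |g s b - g s a| ≤ M * |b - a| := by
  rw [h.sub_eq, abs_mul, mul_comm]
  exact mul_le_mul_of_nonneg_right (abs_avgDeriv_le h.bdt _ _ _) (abs_nonneg _)

/-- `τ` is the characteristic curve `τ' = α(ξ, τ)` through `(x, t)`. -/
def IsChar (α : ℝ → ℝ → ℝ) (x t : ℝ) (τ : ℝ → ℝ) : Prop :=
  τ (cl x) = t ∧ ∀ ξ ∈ Icc (0:ℝ) 1, HasDerivWithinAt τ (α ξ (τ ξ)) (Icc 0 1) ξ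

lemma CT.exists_isChar {M : ℝ} {α αt : ℝ → ℝ → ℝ} (h : CT M α αt) (x t : ℝ) :
    ∃ τ, IsChar α x t τ := by
  have hM := h.nonneg
  have hp : IsPicardLindelof α (tmin := 0) (tmax := 1) ⟨cl x, cl_mem x⟩ t (⟨M, hM⟩ : ℝ≥0) 0
      ⟨M, hM⟩ ⟨M, hM⟩ := by
    refine ⟨fun s _ => ?_, fun y _ => ?_, fun s _ y _ => h.bd s y, ?_⟩
    · apply LipschitzWith.lipschitzOnWith
      apply LipschitzWith.of_dist_le_mul
      intro a b
      rw [Real.dist_eq, Real.dist_eq]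
      exact h.lip s b a
    · exact (h.cont.comp (by fun_prop : Continuous fun s : ℝ => (s, y))).continuousOn
    · have := cl_mem x
      change M * max (1 - cl x) (cl x - 0) ≤ M - 0
      have h2 : max (1 - cl x) (cl x - 0) ≤ 1 := max_le (by linarith [this.1]) (by linarith [this.2])
      nlinarith
  obtain ⟨τ, h1, h2⟩ := hp.exists_eq_forall_mem_Icc_hasDerivWithinAt₀
  exact ⟨τ, h1, h2⟩

open Classical in
/-- The characteristic flow: the value at `ξ` of the characteristic through `(x, t)`. -/
def fl (α : ℝ → ℝ → ℝ) (ξ x t : ℝ) : ℝ :=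
  if h : ∃ τ, IsChar α x t τ then h.choose (cl ξ) else t

lemma fl_cl (α : ℝ → ℝ → ℝ) (ξ x t : ℝ) : fl α (cl ξ) x t = fl α ξ x t := by
  simp [fl]

lemma fl_cl_right (α : ℝ → ℝ → ℝ) (ξ x t : ℝ) : fl α ξ (cl x) t = fl α ξ x t := by
  have : IsChar α (cl x) t = IsChar α x t := by
    funext τ; simp [IsChar]
  classical
  exact congrArg (fun Q : (ℝ → ℝ) → Prop => if h : ∃ τ, Q τ then h.choose (cl ξ) else t) this

section flow

variable {M : ℝ} {α αt : ℝ → ℝ → ℝ}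

lemma CT.fl_spec (h : CT M α αt) (x t : ℝ) : IsChar α x t (fun ξ => fl α ξ x t) := by
  have hex := h.exists_isChar x t
  have hs := hex.choose_spec
  have he : ∀ ξ, fl α ξ x t = hex.choose (cl ξ) := fun ξ => by simp [fl, hex]
  refine ⟨by simp only [he, cl_cl]; exact hs.1, fun ξ hξ => ?_⟩
  change HasDerivWithinAt (fun ξ => fl α ξ x t) (α ξ (fl α ξ x t)) (Icc 0 1) ξ
  rw [he ξ, cl_of_mem hξ]
  refine (hs.2 ξ hξ).congr (fun y hy => ?_) ?_
  · rw [he, cl_of_mem hy]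
  · rw [he, cl_of_mem hξ]

lemma CT.fl_self (h : CT M α αt) (x t : ℝ) : fl α x x t = t := by
  rw [← fl_cl]; exact (h.fl_spec x t).1

lemma CT.fl_deriv (h : CT M α αt) (x t : ℝ) {ξ : ℝ} (hξ : ξ ∈ Icc (0:ℝ) 1) :
    HasDerivWithinAt (fun s => fl α s x t) (α ξ (fl α ξ x t)) (Icc 0 1) ξ :=
  (h.fl_spec x t).2 ξ hξ

lemma CT.fl_cont₁ (h : CT M α αt) (x t : ℝ) : Continuous fun ξ => fl α ξ x t := by
  have h1 : ContinuousOn (fun s => fl α s x t) (Icc 0 1) :=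
    fun ξ hξ => (h.fl_deriv x t hξ).continuousWithinAt
  have := h1.comp_continuous continuous_cl cl_mem
  simpa only [Function.comp_def, fl_cl] using this

/-- Two characteristic curves differ by an exponential factor. -/
lemma CT.char_sub (h : CT M α αt) {x t x' t' : ℝ} {a b : ℝ}
    (ha : a ∈ Icc (0:ℝ) 1) (hb : b ∈ Icc (0:ℝ) 1) :
    fl α b x' t' - fl α b x t = (fl α a x' t' - fl α a x t) *
      Real.exp (∫ s in a..b, avgDeriv αt s (fl α s x t) (fl α s x' t')) := by
  refine homogeneous_ode_Icc (y := fun s => fl α s x' t' - fl α s x t)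
    (q := fun s => avgDeriv αt s (fl α s x t) (fl α s x' t')) ?_ ?_ ha hb
  · exact continuous_avgDeriv h.contt continuous_id (h.fl_cont₁ _ _) (h.fl_cont₁ _ _)
  · intro s hs
    refine ((h.fl_deriv x' t' hs).sub (h.fl_deriv x t hs)).congr_deriv ?_
    rw [h.sub_eq, mul_comm]

lemma CT.fl_unique (h : CT M α αt) {τ : ℝ → ℝ}
    (hτ : ∀ ξ ∈ Icc (0:ℝ) 1, HasDerivWithinAt τ (α ξ (τ ξ)) (Icc 0 1) ξ)
    {a b : ℝ} (ha : a ∈ Icc (0:ℝ) 1) (hb : b ∈ Icc (0:ℝ) 1) :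
    fl α b a (τ a) = τ b := by
  have hτc : Continuous fun s => τ (cl s) :=
    ContinuousOn.comp_continuous (fun ξ hξ => (hτ ξ hξ).continuousWithinAt) continuous_cl cl_mem
  have := homogeneous_ode_Icc (y := fun s => τ s - fl α s a (τ a))
    (q := fun s => avgDeriv αt s (fl α s a (τ a)) (τ (cl s)))
    (continuous_avgDeriv h.contt continuous_id (h.fl_cont₁ _ _) hτc) ?_ ha hb
  · rw [h.fl_self, sub_self, zero_mul] at this
    linarith
  · intro s hs
    refine ((hτ s hs).sub (h.fl_deriv a _ hs)).congr_deriv ?_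
    rw [h.sub_eq, mul_comm, cl_of_mem hs]

lemma CT.fl_fl (h : CT M α αt) (b a x t : ℝ) : fl α b a (fl α a x t) = fl α b x t := by
  have := h.fl_unique (τ := fun s => fl α s x t) (fun ξ hξ => h.fl_deriv x t hξ) (cl_mem a) (cl_mem b)
  simpa only [fl_cl, fl_cl_right] using this

/-- The `t`-derivative of the flow. -/
def flt (α αt : ℝ → ℝ → ℝ) (ξ x t : ℝ) : ℝ :=
  Real.exp (∫ s in cl x..cl ξ, αt s (fl α s x t))

lemma abs_integral_cl_le {f : ℝ → ℝ} {C : ℝ} (hf : ∀ s, |f s| ≤ C) (a b : ℝ) :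
    |∫ s in cl a..cl b, f s| ≤ C := by
  have h1 := intervalIntegral.norm_integral_le_of_norm_le_const (a := cl a) (b := cl b)
    (f := f) (C := C) (fun s _ => hf s)
  have hC : 0 ≤ C := (abs_nonneg _).trans (hf 0)
  have h2 : |cl b - cl a| ≤ 1 := by
    have := cl_mem a; have := cl_mem b
    rw [abs_le]; constructor <;> linarith [this.1, this.2, (cl_mem a).1, (cl_mem a).2]
  rw [Real.norm_eq_abs] at h1
  nlinarith

lemma flt_pos (α αt : ℝ → ℝ → ℝ) (ξ x t : ℝ) : 0 < flt α αt ξ x t := Real.exp_pos _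

lemma CT.flt_le (h : CT M α αt) (ξ x t : ℝ) : flt α αt ξ x t ≤ Real.exp M :=
  Real.exp_le_exp.2 ((le_abs_self _).trans (abs_integral_cl_le (fun _ => h.bdt _ _) _ _))

lemma CT.le_flt (h : CT M α αt) (ξ x t : ℝ) : Real.exp (-M) ≤ flt α αt ξ x t :=
  Real.exp_le_exp.2 ((abs_le.1 (abs_integral_cl_le (fun _ => h.bdt _ _) _ _)).1)

lemma CT.fl_lip_t (h : CT M α αt) (ξ x t t' : ℝ) :
    |fl α ξ x t' - fl α ξ x t| ≤ Real.exp M * |t' - t| := by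
  have := h.char_sub (x := x) (t := t) (x' := x) (t' := t') (cl_mem x) (cl_mem ξ)
  simp only [fl_cl, h.fl_self] at this
  rw [this, abs_mul, mul_comm, Real.abs_exp]
  refine mul_le_mul_of_nonneg_right (Real.exp_le_exp.2 ?_) (abs_nonneg _)
  exact (le_abs_self _).trans (abs_integral_cl_le (fun _ => abs_avgDeriv_le h.bdt _ _ _) _ _)

lemma CT.fl_lip_ξ (h : CT M α αt) (ξ ξ' x t : ℝ) :
    |fl α ξ' x t - fl α ξ x t| ≤ M * |ξ' - ξ| := by
  have h1 := integral_eq_of_deriv_Icc (fun s hs => h.fl_deriv x t hs)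
    (h.cont.comp (continuous_id.prodMk (h.fl_cont₁ x t))).continuousOn (cl_mem ξ) (cl_mem ξ')
  simp only [fl_cl] at h1
  rw [← h1]
  refine (intervalIntegral.norm_integral_le_of_norm_le_const
    (f := fun s => α s (fl α s x t)) (C := M) (fun s _ => h.bd _ _)).trans ?_
  exact mul_le_mul_of_nonneg_left (abs_cl_sub_le _ _) h.nonneg

lemma CT.fl_lip_x (h : CT M α αt) (ξ x x' t : ℝ) :
    |fl α ξ x' t - fl α ξ x t| ≤ Real.exp M * (M * |x' - x|) := by
  have h1 := h.fl_lip_t ξ x t (fl α x x' t)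
  rw [h.fl_fl] at h1
  refine h1.trans (mul_le_mul_of_nonneg_left ?_ (Real.exp_pos _).le)
  have h2 := h.fl_lip_ξ x' x x' t
  rwa [h.fl_self, abs_sub_comm x x'] at h2

lemma CT.fl_cont (h : CT M α αt) {X : Type*} [TopologicalSpace X] {ξ x t : X → ℝ}
    (hξ : Continuous ξ) (hx : Continuous x) (ht : Continuous t) :
    Continuous fun y => fl α (ξ y) (x y) (t y) := by
  rw [continuous_iff_continuousAt]
  intro y₀
  rw [ContinuousAt, tendsto_iff_norm_sub_tendsto_zero]
  have hb : ∀ y, ‖fl α (ξ y) (x y) (t y) - fl α (ξ y₀) (x y₀) (t y₀)‖ ≤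
      M * |ξ y - ξ y₀| + Real.exp M * (M * |x y - x y₀|) + Real.exp M * |t y - t y₀| := by
    intro y
    have h1 := h.fl_lip_ξ (ξ y₀) (ξ y) (x y) (t y)
    have h2 := h.fl_lip_x (ξ y₀) (x y₀) (x y) (t y)
    have h3 := h.fl_lip_t (ξ y₀) (x y₀) (t y₀) (t y)
    rw [Real.norm_eq_abs]
    have : fl α (ξ y) (x y) (t y) - fl α (ξ y₀) (x y₀) (t y₀) =
      (fl α (ξ y) (x y) (t y) - fl α (ξ y₀) (x y) (t y)) +
      (fl α (ξ y₀) (x y) (t y) - fl α (ξ y₀) (x y₀) (t y)) +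
      (fl α (ξ y₀) (x y₀) (t y) - fl α (ξ y₀) (x y₀) (t y₀)) := by ring
    rw [this]
    exact (abs_add_three _ _ _).trans (by linarith)
  refine squeeze_zero (fun _ => norm_nonneg _) hb ?_
  have hc : Continuous fun y => M * |ξ y - ξ y₀| + Real.exp M * (M * |x y - x y₀|) +
      Real.exp M * |t y - t y₀| := by fun_prop
  simpa using hc.tendsto y₀

lemma CT.flt_cont (h : CT M α αt) {X : Type*} [TopologicalSpace X] {ξ x t : X → ℝ}
    (hξ : Continuous ξ) (hx : Continuous x) (ht : Continuous t) :
    Continuous fun y => flt α αt (ξ y) (x y) (t y) := by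
  unfold flt
  have key : Continuous fun y => ∫ s in cl (x y)..cl (ξ y), αt s (fl α s (x y) (t y)) := by
    have hs : ∀ y, ∫ s in cl (x y)..cl (ξ y), αt s (fl α s (x y) (t y)) =
      (∫ s in (0:ℝ)..cl (ξ y), αt s (fl α s (x y) (t y))) -
        ∫ s in (0:ℝ)..cl (x y), αt s (fl α s (x y) (t y)) := by
      intro y
      have hc : Continuous fun s => αt s (fl α s (x y) (t y)) :=
        h.contt.comp (continuous_id.prodMk (h.fl_cont₁ _ _))
      rw [intervalIntegral.integral_interval_sub_left (hc.intervalIntegrable _ _)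
        (hc.intervalIntegrable _ _)]
    simp only [hs]
    have hcc : Continuous (Function.uncurry fun (y : X) (s : ℝ) => αt s (fl α s (x y) (t y))) :=
      h.contt.comp (continuous_snd.prodMk (h.fl_cont continuous_snd (hx.comp continuous_fst)
        (ht.comp continuous_fst)))
    exact (intervalIntegral.continuous_parametric_intervalIntegral_of_continuous hcc
      (continuous_cl.comp hξ)).sub
      (intervalIntegral.continuous_parametric_intervalIntegral_of_continuous hcc
      (continuous_cl.comp hx))
  exact Real.continuous_exp.comp key

lemma CT.fl_deriv_t (h : CT M α αt) (ξ x t : ℝ) :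
    HasDerivAt (fun t' => fl α ξ x t') (flt α αt ξ x t) t := by
  have key : ∀ t', fl α ξ x t' - fl α ξ x t = (t' - t) *
      Real.exp (∫ s in cl x..cl ξ, avgDeriv αt s (fl α s x t) (fl α s x t')) := by
    intro t'
    have := h.char_sub (x := x) (t := t) (x' := x) (t' := t') (cl_mem x) (cl_mem ξ)
    simpa only [fl_cl, h.fl_self] using this
  have hc : Continuous fun t' =>
      Real.exp (∫ s in cl x..cl ξ, avgDeriv αt s (fl α s x t) (fl α s x t')) := by
    apply Real.continuous_exp.comp
    apply intervalIntegral.continuous_parametric_intervalIntegral_of_continuous'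
    exact continuous_avgDeriv h.contt continuous_snd (h.fl_cont continuous_snd continuous_const
      continuous_const) (h.fl_cont continuous_snd continuous_const continuous_fst)
  rw [hasDerivAt_iff_tendsto_slope]
  have h2 := (hc.tendsto t).mono_left (nhdsWithin_le_nhds (s := {t}ᶜ))
  simp only [avgDeriv_self] at h2
  refine h2.congr' ?_
  filter_upwards [self_mem_nhdsWithin] with s hs
  rw [slope_def_field, key, mul_div_assoc, mul_comm, div_mul_cancel₀]
  exact sub_ne_zero.2 hs

lemma CT.flt_self (x t : ℝ) : flt α αt x x t = 1 := by simp [flt]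

lemma CT.flt_deriv (h : CT M α αt) (x t : ℝ) {ξ : ℝ} (hξ : ξ ∈ Icc (0:ℝ) 1) :
    HasDerivWithinAt (fun s => flt α αt s x t)
      (αt ξ (fl α ξ x t) * flt α αt ξ x t) (Icc 0 1) ξ := by
  have hc : Continuous fun s => αt s (fl α s x t) :=
    h.contt.comp (continuous_id.prodMk (h.fl_cont₁ _ _))
  have h1 := (deriv_integral_Icc hc (cl x) ξ (Icc 0 1)).exp
  rw [mul_comm, flt, cl_of_mem hξ]
  refine h1.congr (fun y hy => ?_) ?_
  · simp [flt, cl_of_mem hy]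
  · simp [flt, cl_of_mem hξ]

end flow

section derivation

lemma TD.comp_cont {g gt : ℝ → ℝ → ℝ} (h : TD g gt) {X : Type*} [TopologicalSpace X]
    {a b : X → ℝ} (ha : Continuous a) (hb : Continuous b) : Continuous fun y => g (a y) (b y) :=
  h.cont.comp (ha.prodMk hb)

lemma TD.zero : TD (fun _ _ => 0) (fun _ _ => 0) :=
  ⟨continuous_const, continuous_const, fun _ _ => hasDerivAt_const _ _⟩

lemma CT.zero {M : ℝ} (hM : 0 ≤ M) : CT M (fun _ _ => 0) (fun _ _ => 0) :=
  ⟨TD.zero, fun _ _ => by simpa using hM, fun _ _ => by simpa using hM⟩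

lemma TD.add {f ft g gt : ℝ → ℝ → ℝ} (hf : TD f ft) (hg : TD g gt) :
    TD (fun x t => f x t + g x t) (fun x t => ft x t + gt x t) :=
  ⟨hf.cont.add hg.cont, hf.contt.add hg.contt, fun x t => (hf.deriv x t).add (hg.deriv x t)⟩

lemma TD.neg {f ft : ℝ → ℝ → ℝ} (hf : TD f ft) : TD (fun x t => -f x t) (fun x t => -ft x t) :=
  ⟨hf.cont.neg, hf.contt.neg, fun x t => (hf.deriv x t).neg⟩

lemma TD.sub {f ft g gt : ℝ → ℝ → ℝ} (hf : TD f ft) (hg : TD g gt) :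
    TD (fun x t => f x t - g x t) (fun x t => ft x t - gt x t) :=
  ⟨hf.cont.sub hg.cont, hf.contt.sub hg.contt, fun x t => (hf.deriv x t).sub (hg.deriv x t)⟩

lemma TD.mul {f ft g gt : ℝ → ℝ → ℝ} (hf : TD f ft) (hg : TD g gt) :
    TD (fun x t => f x t * g x t) (fun x t => ft x t * g x t + f x t * gt x t) :=
  ⟨hf.cont.mul hg.cont, (hf.contt.mul hg.cont).add (hf.cont.mul hg.contt),
    fun x t => (hf.deriv x t).mul (hg.deriv x t)⟩

lemma TD.exp {f ft : ℝ → ℝ → ℝ} (hf : TD f ft) :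
    TD (fun x t => Real.exp (f x t)) (fun x t => Real.exp (f x t) * ft x t) :=
  ⟨Real.continuous_exp.comp hf.cont, (Real.continuous_exp.comp hf.cont).mul hf.contt,
    fun x t => (hf.deriv x t).exp⟩

lemma TD.sum {ι : Type*} (s : Finset ι) {f ft : ι → ℝ → ℝ → ℝ} (h : ∀ i ∈ s, TD (f i) (ft i)) :
    TD (fun x t => ∑ i ∈ s, f i x t) (fun x t => ∑ i ∈ s, ft i x t) :=
  ⟨continuous_finsetSum _ fun i hi => (h i hi).cont,
    continuous_finsetSum _ fun i hi => (h i hi).contt,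
    fun x t => HasDerivAt.fun_sum fun i hi => (h i hi).deriv x t⟩

lemma TD.const_mul {f ft : ℝ → ℝ → ℝ} (c : ℝ) (hf : TD f ft) :
    TD (fun x t => c * f x t) (fun x t => c * ft x t) :=
  ⟨continuous_const.mul hf.cont, continuous_const.mul hf.contt,
    fun x t => (hf.deriv x t).const_mul c⟩

lemma TD.inv {f ft : ℝ → ℝ → ℝ} (hf : TD f ft) (h0 : ∀ x t, f x t ≠ 0) :
    TD (fun x t => (f x t)⁻¹) (fun x t => -ft x t / f x t ^ 2) :=
  ⟨hf.cont.inv₀ fun _ => h0 _ _, hf.contt.neg.div (hf.cont.pow 2) fun _ => pow_ne_zero 2 (h0 _ _),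
    fun x t => (hf.deriv x t).inv (h0 x t)⟩

/-- Functions of `t` alone. -/
lemma TD.of_time {w w' : ℝ → ℝ} (h : ∀ t, HasDerivAt w (w' t) t) (h' : Continuous w') :
    TD (fun _ t => w t) (fun _ t => w' t) :=
  ⟨(continuous_iff_continuousAt.2 fun t => (h t).continuousAt).comp continuous_snd,
    h'.comp continuous_snd, fun _ t => h t⟩

lemma TD.congr_t {f ft ft' : ℝ → ℝ → ℝ} (hf : TD f ft) (h : ∀ x t, ft x t = ft' x t) :
    TD f ft' := by
  have : ft = ft' := by funext x t; exact h x t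
  exact this ▸ hf

/-- Differentiation under the integral sign. -/
lemma TD.integral {F Ft : ℝ → ℝ → ℝ} (h : TD F Ft) (a b t : ℝ) :
    HasDerivAt (fun t => ∫ ξ in a..b, F ξ t) (∫ ξ in a..b, Ft ξ t) t := by
  have key : ∀ t', (∫ ξ in a..b, F ξ t') - (∫ ξ in a..b, F ξ t) =
      (t' - t) * ∫ ξ in a..b, avgDeriv Ft ξ t t' := by
    intro t'
    rw [← intervalIntegral.integral_sub, ← intervalIntegral.integral_const_mul]
    · exact intervalIntegral.integral_congr fun ξ _ => h.sub_eq ξ t t'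
    · exact (h.comp_cont continuous_id continuous_const).intervalIntegrable _ _
    · exact (h.comp_cont continuous_id continuous_const).intervalIntegrable _ _
  have hc : Continuous fun t' => ∫ ξ in a..b, avgDeriv Ft ξ t t' := by
    apply intervalIntegral.continuous_parametric_intervalIntegral_of_continuous'
    exact continuous_avgDeriv h.contt continuous_snd continuous_const continuous_fst
  rw [hasDerivAt_iff_tendsto_slope]
  have h2 := (hc.tendsto t).mono_left (nhdsWithin_le_nhds (s := {t}ᶜ))
  simp only [avgDeriv_self] at h2
  refine h2.congr' ?_
  filter_upwards [self_mem_nhdsWithin] with s hs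
  rw [slope_def_field, key, mul_div_assoc, mul_comm, div_mul_cancel₀]
  exact sub_ne_zero.2 hs

/-- A product whose first factor vanishes at the point only needs a continuous second factor. -/
lemma HasDerivWithinAt.mul_of_eq_zero {f g : ℝ → ℝ} {f' x : ℝ} {s : Set ℝ}
    (hf : HasDerivWithinAt f f' s x) (h0 : f x = 0) (hg : ContinuousWithinAt g s x) :
    HasDerivWithinAt (fun y => f y * g y) (f' * g x) s x := by
  rw [hasDerivWithinAt_iff_tendsto_slope] at hf ⊢
  have h1 : Tendsto g (𝓝[s \ {x}] x) (𝓝 (g x)) := hg.mono_left (nhdsWithin_mono _ sdiff_subset)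
  refine (hf.mul h1).congr fun y => ?_
  simp only [slope_def_field, h0, zero_mul, sub_zero]
  ring

end derivation

/-- `h` is the derivative of `v` along the characteristics of `α`. -/
def CharD (α v h : ℝ → ℝ → ℝ) : Prop :=
  ∀ x ∈ Icc (0:ℝ) 1, ∀ t, HasDerivWithinAt (fun s => v s (fl α s x t)) (h x t) (Icc 0 1) x

section chard

variable {M : ℝ} {α αt : ℝ → ℝ → ℝ}

lemma CharD.along (hα : CT M α αt) {v h : ℝ → ℝ → ℝ} (hv : CharD α v h) (x t : ℝ) {ξ : ℝ}
    (hξ : ξ ∈ Icc (0:ℝ) 1) :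
    HasDerivWithinAt (fun s => v s (fl α s x t)) (h ξ (fl α ξ x t)) (Icc 0 1) ξ := by
  have := hv ξ hξ (fl α ξ x t)
  simpa only [hα.fl_fl] using this

/-- Increment of `v` along a characteristic. -/
lemma CharD.sub_eq (hα : CT M α αt) {v h : ℝ → ℝ → ℝ} (hv : CharD α v h)
    (hh : Continuous fun q : ℝ × ℝ => h q.1 q.2) (x t : ℝ) {a b : ℝ}
    (ha : a ∈ Icc (0:ℝ) 1) (hb : b ∈ Icc (0:ℝ) 1) :
    v b (fl α b x t) - v a (fl α a x t) = ∫ ξ in a..b, h ξ (fl α ξ x t) :=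
  (integral_eq_of_deriv_Icc (fun _ hξ => hv.along hα x t hξ)
    (hh.comp (continuous_id.prodMk (hα.fl_cont₁ x t))).continuousOn ha hb).symm

/-- The chain rule along an arbitrary curve, given the derivative along characteristics. -/
lemma CharD.chain (hα : CT M α αt) {v vt h : ℝ → ℝ → ℝ} (hv : CharD α v h) (hd : TD v vt)
    {τ : ℝ → ℝ} {τ' ξ : ℝ} (hξ : ξ ∈ Icc (0:ℝ) 1) (hτ : HasDerivWithinAt τ τ' (Icc 0 1) ξ) :
    HasDerivWithinAt (fun s => v s (τ s)) (h ξ (τ ξ) + (τ' - α ξ (τ ξ)) * vt ξ (τ ξ))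
      (Icc 0 1) ξ := by
  have h1 := hv ξ hξ (τ ξ)
  have h2 := hτ.sub (hα.fl_deriv ξ (τ ξ) hξ)
  rw [hα.fl_self] at h2
  have hg : ContinuousWithinAt (fun s => avgDeriv vt s (fl α s ξ (τ ξ)) (τ s)) (Icc 0 1) ξ := by
    have hF : Continuous fun q : ℝ × ℝ × ℝ => avgDeriv vt q.1 q.2.1 q.2.2 :=
      continuous_avgDeriv hd.contt (by fun_prop) (by fun_prop) (by fun_prop)
    exact hF.continuousAt.comp_continuousWithinAt (f := fun s => (s, fl α s ξ (τ ξ), τ s))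
      (continuousWithinAt_id.prodMk ((hα.fl_cont₁ ξ (τ ξ)).continuousWithinAt.prodMk
        hτ.continuousWithinAt))
  have h3 := h2.mul_of_eq_zero (by simp [hα.fl_self]) hg
  have h4 := h1.add h3
  simp only [hα.fl_self, avgDeriv_self] at h4
  refine h4.congr (fun s _ => ?_) ?_
  · simp only [Pi.add_apply, Pi.sub_apply, ← hd.sub_eq]; ring
  · simp [hα.fl_self]

lemma fl_zero (ξ x t : ℝ) : fl (fun _ _ => 0) ξ x t = t := by
  have h0 := CT.zero (M := 0) le_rfl
  have := h0.fl_lip_ξ x ξ x t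
  rw [h0.fl_self, zero_mul] at this
  linarith [abs_nonpos_iff.1 this]

lemma charD_zero_iff {v h : ℝ → ℝ → ℝ} : CharD (fun _ _ => 0) v h ↔
    ∀ x ∈ Icc (0:ℝ) 1, ∀ t, HasDerivWithinAt (fun s => v s t) (h x t) (Icc 0 1) x := by
  simp only [CharD, fl_zero]

/-- A `C¹` function is differentiable along characteristics. -/
lemma CharD.of_partial (hα : CT M α αt) {v vx vt : ℝ → ℝ → ℝ} (hd : TD v vt)
    (hx : ∀ x ∈ Icc (0:ℝ) 1, ∀ t, HasDerivWithinAt (fun s => v s t) (vx x t) (Icc 0 1) x) :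
    CharD α v (fun x t => vx x t + α x t * vt x t) := by
  intro x hx' t
  have := (charD_zero_iff.2 hx).chain (CT.zero le_rfl) hd hx' (hα.fl_deriv x t hx')
  simpa only [hα.fl_self, sub_zero] using this

lemma CharD.partial_x (hα : CT M α αt) {v vt h : ℝ → ℝ → ℝ} (hv : CharD α v h) (hd : TD v vt) :
    ∀ x ∈ Icc (0:ℝ) 1, ∀ t,
      HasDerivWithinAt (fun s => v s t) (h x t - α x t * vt x t) (Icc 0 1) x := by
  intro x hx t
  have := hv.chain hα hd (τ := fun _ => t) hx (hasDerivWithinAt_const _ _ _)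
  simpa [sub_eq_add_neg] using this

/-- Change of the characteristic field. -/
lemma CharD.change {M' : ℝ} {α' αt' : ℝ → ℝ → ℝ} (hα : CT M α αt) (hα' : CT M' α' αt')
    {v vt h : ℝ → ℝ → ℝ} (hv : CharD α v h) (hd : TD v vt) :
    CharD α' v (fun x t => h x t + (α' x t - α x t) * vt x t) := by
  intro x hx t
  have := hv.chain hα hd hx (hα'.fl_deriv x t hx)
  simpa only [hα'.fl_self] using this

lemma CharD.congr {v h h' : ℝ → ℝ → ℝ} (hv : CharD α v h)
    (he : ∀ x ∈ Icc (0:ℝ) 1, ∀ t, h x t = h' x t) : CharD α v h' :=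
  fun x hx t => he x hx t ▸ hv x hx t

lemma CharD.add {v h w g : ℝ → ℝ → ℝ} (hv : CharD α v h) (hw : CharD α w g) :
    CharD α (fun x t => v x t + w x t) (fun x t => h x t + g x t) :=
  fun x hx t => (hv x hx t).add (hw x hx t)

lemma CharD.sub {v h w g : ℝ → ℝ → ℝ} (hv : CharD α v h) (hw : CharD α w g) :
    CharD α (fun x t => v x t - w x t) (fun x t => h x t - g x t) :=
  fun x hx t => (hv x hx t).sub (hw x hx t)

lemma CharD.const_mul {v h : ℝ → ℝ → ℝ} (c : ℝ) (hv : CharD α v h) :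
    CharD α (fun x t => c * v x t) (fun x t => c * h x t) :=
  fun x hx t => (hv x hx t).const_mul c

lemma CharD.mul (hα : CT M α αt) {v h w g : ℝ → ℝ → ℝ} (hv : CharD α v h) (hw : CharD α w g) :
    CharD α (fun x t => v x t * w x t) (fun x t => h x t * w x t + v x t * g x t) := by
  intro x hx t
  have := (hv x hx t).fun_mul (hw x hx t)
  simp only [hα.fl_self] at this
  exact this

lemma CharD.exp (hα : CT M α αt) {v h : ℝ → ℝ → ℝ} (hv : CharD α v h) :
    CharD α (fun x t => Real.exp (v x t)) (fun x t => Real.exp (v x t) * h x t) := by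
  intro x hx t
  have := (hv x hx t).exp
  simpa only [hα.fl_self] using this

/-- The flow to a fixed abscissa is constant along characteristics. -/
lemma charD_fl (hα : CT M α αt) (η : ℝ) : CharD α (fun ξ s => fl α η ξ s) (fun _ _ => 0) := by
  intro x hx t
  simp only [hα.fl_fl]
  exact hasDerivWithinAt_const _ _ _

lemma CT.fl_TD (hα : CT M α αt) (η : ℝ) :
    TD (fun ξ s => fl α η ξ s) (fun ξ s => flt α αt η ξ s) :=
  ⟨hα.fl_cont continuous_const continuous_fst continuous_snd,
    hα.flt_cont continuous_const continuous_fst continuous_snd, fun x t => hα.fl_deriv_t η x t⟩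

lemma TD.comp_fl (hα : CT M α αt) {h ht : ℝ → ℝ → ℝ} (hh : TD h ht) (x : ℝ) :
    TD (fun ξ t => h ξ (fl α ξ x t))
      (fun ξ t => ht ξ (fl α ξ x t) * flt α αt ξ x t) := by
  have hc : Continuous fun q : ℝ × ℝ => fl α q.1 x q.2 :=
    hα.fl_cont continuous_fst continuous_const continuous_snd
  refine ⟨hh.cont.comp (continuous_fst.prodMk hc), (hh.contt.comp (continuous_fst.prodMk hc)).mul
    (hα.flt_cont continuous_fst continuous_const continuous_snd), fun ξ t => ?_⟩
  exact (hh.deriv ξ _).comp t (hα.fl_deriv_t ξ x t)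

/-- The `t`-derivative of a solution of a transport equation is again transported. -/
lemma CharD.deriv_t (hα : CT M α αt) {v vt h ht : ℝ → ℝ → ℝ} (hv : CharD α v h) (hd : TD v vt)
    (hh : TD h ht) : CharD α vt (fun x t => ht x t - αt x t * vt x t) := by
  intro x hx t
  have key : ∀ s ∈ Icc (0:ℝ) 1, vt s (fl α s x t) * flt α αt s x t =
      vt x t + ∫ ξ in x..s, ht ξ (fl α ξ x t) * flt α αt ξ x t := by
    intro s hs
    have h1 : HasDerivAt (fun t' => v s (fl α s x t'))
        (vt s (fl α s x t) * flt α αt s x t) t :=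
      (hd.deriv s _).comp t (hα.fl_deriv_t s x t)
    have h2 : HasDerivAt (fun t' => v x t' + ∫ ξ in x..s, h ξ (fl α ξ x t'))
        (vt x t + ∫ ξ in x..s, ht ξ (fl α ξ x t) * flt α αt ξ x t) t :=
      (hd.deriv x t).add ((hh.comp_fl hα x).integral x s t)
    refine h1.unique (h2.congr_of_eventuallyEq (Eventually.of_forall fun t' => ?_))
    have := hv.sub_eq hα hh.cont x t' hx hs
    rw [hα.fl_self] at this
    simp only
    linarith
  have hF := (hh.comp_fl hα x)
  have h1 := (deriv_integral_Icc (hF.contt.comp (by fun_prop : Continuous fun s : ℝ => (s, t)))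
    x x (Icc 0 1)).const_add (vt x t)
  have h2 := (hα.flt_deriv x t hx)
  have h3 := h1.div h2 (flt_pos _ _ _ _ _).ne'
  simp only [CT.flt_self, hα.fl_self, intervalIntegral.integral_same] at h3
  refine HasDerivWithinAt.congr (h3.congr_deriv (by simp [hα.fl_self, CT.flt_self]; ring)) (fun s hs => ?_) ?_
  · rw [Pi.div_apply, eq_div_iff (flt_pos _ _ _ _ _).ne', key s hs]; rfl
  · simp [hα.fl_self, CT.flt_self]

end chard

/-- Transport along `α` from the abscissa `x0` with inflow `q` and source `h`. -/
def T0 (α : ℝ → ℝ → ℝ) (x0 : ℝ) (q : ℝ → ℝ) (h : ℝ → ℝ → ℝ) (x t : ℝ) : ℝ :=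
  q (fl α x0 x t) + ∫ ξ in x0..cl x, h ξ (fl α ξ x t)

section transport

variable {M : ℝ} {α αt : ℝ → ℝ → ℝ} {x0 : ℝ}

lemma T0_cl (q : ℝ → ℝ) (h : ℝ → ℝ → ℝ) (x t : ℝ) : T0 α x0 q h (cl x) t = T0 α x0 q h x t := by
  simp [T0, fl_cl_right]

lemma T0_start (hα : CT M α αt) (h0 : x0 ∈ Icc (0:ℝ) 1) (q : ℝ → ℝ) (h : ℝ → ℝ → ℝ) (t : ℝ) :
    T0 α x0 q h x0 t = q t := by
  simp [T0, cl_of_mem h0, hα.fl_self]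

lemma T0_cont (hα : CT M α αt) {q : ℝ → ℝ} {h : ℝ → ℝ → ℝ} (hq : Continuous q)
    (hh : Continuous fun p : ℝ × ℝ => h p.1 p.2) :
    Continuous fun p : ℝ × ℝ => T0 α x0 q h p.1 p.2 := by
  unfold T0
  refine (hq.comp (hα.fl_cont continuous_const continuous_fst continuous_snd)).add ?_
  refine intervalIntegral.continuous_parametric_intervalIntegral_of_continuous ?_
    (continuous_cl.comp continuous_fst)
  exact hh.comp (continuous_snd.prodMk (hα.fl_cont continuous_snd (continuous_fst.comp continuous_fst)
    (continuous_snd.comp continuous_fst)))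

lemma T0_charD (hα : CT M α αt) (q : ℝ → ℝ) {h : ℝ → ℝ → ℝ}
    (hh : Continuous fun p : ℝ × ℝ => h p.1 p.2) : CharD α (T0 α x0 q h) h := by
  intro x hx t
  have hc : Continuous fun ξ => h ξ (fl α ξ x t) :=
    hh.comp (continuous_id.prodMk (hα.fl_cont₁ x t))
  have h1 := (deriv_integral_Icc hc x0 x (Icc 0 1)).const_add (q (fl α x0 x t))
  rw [hα.fl_self] at h1
  refine h1.congr (fun s hs => ?_) ?_
  · simp only [T0, hα.fl_fl, cl_of_mem hs]
  · simp only [T0, hα.fl_fl, cl_of_mem hx]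

/-- A function clamped in `x` is recovered from its inflow and characteristic derivative. -/
lemma CharD.eq_T0 (hα : CT M α αt) (h0 : x0 ∈ Icc (0:ℝ) 1) {v h : ℝ → ℝ → ℝ} (hv : CharD α v h)
    (hh : Continuous fun p : ℝ × ℝ => h p.1 p.2) (hcl : ∀ x t, v (cl x) t = v x t) (x t : ℝ) :
    v x t = T0 α x0 (v x0) h x t := by
  have := hv.sub_eq hα hh x t h0 (cl_mem x)
  rw [fl_cl, hα.fl_self, hcl] at this
  rw [T0, ← this]; ring

lemma T0_TD (hα : CT M α αt) {q q' : ℝ → ℝ} {h ht : ℝ → ℝ → ℝ}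
    (hq : ∀ t, HasDerivAt q (q' t) t) (hq' : Continuous q') (hh : TD h ht) :
    TD (T0 α x0 q h) (fun x t => q' (fl α x0 x t) * flt α αt x0 x t +
      ∫ ξ in x0..cl x, ht ξ (fl α ξ x t) * flt α αt ξ x t) := by
  have hqc : Continuous q := continuous_iff_continuousAt.2 fun t => (hq t).continuousAt
  refine ⟨T0_cont hα hqc hh.cont, ?_, fun x t => ?_⟩
  · refine ((hq'.comp (hα.fl_cont continuous_const continuous_fst continuous_snd)).mul
      (hα.flt_cont continuous_const continuous_fst continuous_snd)).add ?_
    refine intervalIntegral.continuous_parametric_intervalIntegral_of_continuous ?_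
      (continuous_cl.comp continuous_fst)
    exact (hh.contt.comp (continuous_snd.prodMk (hα.fl_cont continuous_snd
      (continuous_fst.comp continuous_fst) (continuous_snd.comp continuous_fst)))).mul
      (hα.flt_cont continuous_snd (continuous_fst.comp continuous_fst)
        (continuous_snd.comp continuous_fst))
  · exact ((hq _).comp t (hα.fl_deriv_t x0 x t)).add ((hh.comp_fl hα x).integral _ _ t)

end transport

lemma abs_integral_cl_le_of_mem {f : ℝ → ℝ} {C a : ℝ} (ha : a ∈ Icc (0:ℝ) 1)
    (hf : ∀ s ∈ Icc (0:ℝ) 1, |f s| ≤ C) (x : ℝ) : |∫ s in a..cl x, f s| ≤ C := by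
  have hx := cl_mem x
  have h1 := intervalIntegral.norm_integral_le_of_norm_le_const (a := a) (b := cl x)
    (f := f) (C := C) (fun s hs => hf s ((uIcc_subset_Icc ha hx) (uIoc_subset_uIcc hs)))
  have hC : 0 ≤ C := (abs_nonneg _).trans (hf a ha)
  have h2 : |cl x - a| ≤ 1 := by
    rw [abs_le]; constructor <;> linarith [hx.1, hx.2, ha.1, ha.2]
  rw [Real.norm_eq_abs] at h1
  nlinarith

/-- Integration by parts along a characteristic of `α`, for a function `v` transported by a
different field `κ`: the `t`-derivative of `v` does not enter the bound. -/
lemma smoothing_bound {M A W : ℝ} {α αt κ κt v vt h c ct w wd : ℝ → ℝ → ℝ} {x0 : ℝ}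
    (hα : CT M α αt) (hκ : CT M κ κt) (h0 : x0 ∈ Icc (0:ℝ) 1)
    (hv : CharD κ v h) (hd : TD v vt) (hh : Continuous fun q : ℝ × ℝ => h q.1 q.2)
    (hw : CharD α w wd) (hwc : Continuous fun q : ℝ × ℝ => w q.1 q.2)
    (hwd : Continuous fun q : ℝ × ℝ => wd q.1 q.2)
    (hct : Continuous fun q : ℝ × ℝ => ct q.1 q.2)
    (hcw : ∀ x t, c x t = w x t * (α x t - κ x t))
    (bct : ∀ x t, |ct x t| ≤ W) (bw : ∀ x t, |w x t| ≤ W) (bwd : ∀ x t, |wd x t| ≤ W) (x t : ℝ)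
    (bv : ∀ ξ, |v ξ (fl α ξ x t)| ≤ A) (bh : ∀ ξ, |h ξ (fl α ξ x t)| ≤ A) :
    |∫ ξ in x0..cl x, (ct ξ (fl α ξ x t) * v ξ (fl α ξ x t) +
      c ξ (fl α ξ x t) * vt ξ (fl α ξ x t)) * flt α αt ξ x t| ≤
      Real.exp M * (A * W * (5 + M)) := by
  set τ := fun ξ => fl α ξ x t with hτ
  set e := fun ξ => flt α αt ξ x t with he
  have hA : 0 ≤ A := (abs_nonneg _).trans (bv 0)
  have hW : 0 ≤ W := (abs_nonneg _).trans (bw 0 0)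
  have hM := hα.nonneg
  have hτc : Continuous τ := hα.fl_cont₁ x t
  have hec : Continuous e := hα.flt_cont continuous_id continuous_const continuous_const
  have cc : ∀ {f : ℝ → ℝ → ℝ}, (Continuous fun q : ℝ × ℝ => f q.1 q.2) →
      Continuous fun ξ => f ξ (τ ξ) := fun hf => hf.comp (continuous_id.prodMk hτc)
  have be : ∀ ξ, |e ξ| ≤ Real.exp M := fun ξ => by
    rw [abs_of_pos (flt_pos _ _ _ _ _)]; exact hα.flt_le ξ x t
  set D : ℝ → ℝ := fun ξ => (wd ξ (τ ξ) * v ξ (τ ξ) + w ξ (τ ξ) *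
    (h ξ (τ ξ) + (α ξ (τ ξ) - κ ξ (τ ξ)) * vt ξ (τ ξ))) * e ξ +
    w ξ (τ ξ) * v ξ (τ ξ) * (αt ξ (τ ξ) * e ξ) with hD
  have hder : ∀ ξ ∈ Icc (0:ℝ) 1,
      HasDerivWithinAt (fun s => w s (τ s) * v s (τ s) * e s) (D ξ) (Icc 0 1) ξ := by
    intro ξ hξ
    exact ((hw.along hα x t hξ).fun_mul (hv.chain hκ hd hξ (hα.fl_deriv x t hξ))).fun_mul
      (hα.flt_deriv x t hξ)
  have hDc : Continuous D := by
    exact ((((cc hwd).mul (cc hd.cont)).add ((cc hwc).mul ((cc hh).add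
      (((cc hα.cont).sub (cc hκ.cont)).mul (cc hd.contt))))).mul hec).add
      (((cc hwc).mul (cc hd.cont)).mul ((cc hα.contt).mul hec))
  have hI0 := integral_eq_of_deriv_Icc hder hDc.continuousOn h0 (cl_mem x)
  set R : ℝ → ℝ := fun ξ => (ct ξ (τ ξ) * v ξ (τ ξ) - wd ξ (τ ξ) * v ξ (τ ξ) -
    w ξ (τ ξ) * h ξ (τ ξ) - w ξ (τ ξ) * v ξ (τ ξ) * αt ξ (τ ξ)) * e ξ with hR
  have hRc : Continuous R := by
    exact (((((cc hct).mul (cc hd.cont)).sub ((cc hwd).mul (cc hd.cont))).sub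
      ((cc hwc).mul (cc hh))).sub (((cc hwc).mul (cc hd.cont)).mul (cc hα.contt))).mul hec
  have hsplit : ∫ ξ in x0..cl x, (ct ξ (τ ξ) * v ξ (τ ξ) + c ξ (τ ξ) * vt ξ (τ ξ)) * e ξ =
      (∫ ξ in x0..cl x, R ξ) + ∫ ξ in x0..cl x, D ξ := by
    rw [← intervalIntegral.integral_add (hRc.intervalIntegrable _ _) (hDc.intervalIntegrable _ _)]
    refine intervalIntegral.integral_congr fun ξ _ => ?_
    simp only [hR, hD, hcw]; ring
  rw [hsplit, hI0]
  have m2 : ∀ {a b : ℝ}, |a| ≤ W → |b| ≤ A → |a * b| ≤ A * W := fun ha hb => by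
    rw [abs_mul, mul_comm A]; exact mul_le_mul ha hb (abs_nonneg _) hW
  have bR : ∀ ξ ∈ Icc (0:ℝ) 1, |R ξ| ≤ Real.exp M * (A * W * (3 + M)) := by
    intro ξ _
    rw [hR, abs_mul, mul_comm]
    refine mul_le_mul (be ξ) ?_ (abs_nonneg _) (Real.exp_pos _).le
    have h1 := m2 (bct ξ (τ ξ)) (bv ξ)
    have h2 := m2 (bwd ξ (τ ξ)) (bv ξ)
    have h3 := m2 (bw ξ (τ ξ)) (bh ξ)
    have h4 : |w ξ (τ ξ) * v ξ (τ ξ) * αt ξ (τ ξ)| ≤ A * W * M := by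
      rw [abs_mul]
      exact mul_le_mul (m2 (bw _ _) (bv _)) (hα.bdt _ _) (abs_nonneg _) (by positivity)
    rw [abs_le] at h1 h2 h3 h4 ⊢
    constructor <;> nlinarith
  have bE : ∀ ξ, |w ξ (τ ξ) * v ξ (τ ξ) * e ξ| ≤ Real.exp M * (A * W) := by
    intro ξ
    rw [abs_mul, mul_comm]
    exact mul_le_mul (be ξ) (m2 (bw _ _) (bv _)) (abs_nonneg _) (Real.exp_pos _).le
  have h1 := abs_integral_cl_le_of_mem h0 bR x
  have h2 := bE (cl x)
  have h3 := bE x0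
  rw [abs_le] at h1 h2 h3 ⊢
  constructor <;> nlinarith

lemma interval_swap {f : ℝ → ℝ → ℝ} (hf : Continuous fun q : ℝ × ℝ => f q.1 q.2) {a b c d : ℝ}
    (hab : a ≤ b) (hcd : c ≤ d) :
    ∫ x in a..b, ∫ y in c..d, f x y = ∫ y in c..d, ∫ x in a..b, f x y := by
  simp only [intervalIntegral.integral_of_le hab, intervalIntegral.integral_of_le hcd]
  refine integral_integral_swap ?_
  rw [Measure.prod_restrict]
  refine IntegrableOn.mono_set (t := Icc a b ×ˢ Icc c d) ?_
    (prod_mono Ioc_subset_Icc_self Ioc_subset_Icc_self)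
  exact hf.continuousOn.integrableOn_compact (isCompact_Icc.prod isCompact_Icc)

/-- A function on `[0,1]` is bounded by the integrals of itself and its derivative. -/
lemma abs_le_integral_add {φ φ' F : ℝ → ℝ} (hφ : ∀ x ∈ Icc (0:ℝ) 1,
      HasDerivWithinAt φ (φ' x) (Icc 0 1) x) (hφ' : Continuous φ') (hF : Continuous F)
    (hle : ∀ x ∈ Icc (0:ℝ) 1, |φ x| + |φ' x| ≤ F x) {ξ : ℝ} (hξ : ξ ∈ Icc (0:ℝ) 1) :
    |φ ξ| ≤ ∫ η in (0:ℝ)..1, F η := by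
  have hφc : ContinuousOn φ (Icc 0 1) := fun x hx => (hφ x hx).continuousWithinAt
  have i1 : IntervalIntegrable (fun η => |φ η|) volume 0 1 :=
    (ContinuousOn.abs (by rwa [uIcc_of_le zero_le_one])).intervalIntegrable
  have i2 : IntervalIntegrable (fun η => |φ' η|) volume 0 1 := hφ'.abs.intervalIntegrable _ _
  set J := ∫ η in (0:ℝ)..1, |φ' η| with hJ
  have h1 : ∀ η ∈ Icc (0:ℝ) 1, |φ ξ| ≤ |φ η| + J := by
    intro η hη
    have h2 := integral_eq_of_deriv_Icc hφ hφ'.continuousOn hη hξ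
    have h3 : |∫ s in η..ξ, φ' s| ≤ J := by
      rw [hJ, intervalIntegral.integral_of_le zero_le_one]
      rw [← Real.norm_eq_abs]
      refine (intervalIntegral.norm_integral_le_integral_norm_uIoc (f := φ')).trans ?_
      refine setIntegral_mono_set ?_ ?_ ?_
      · exact (intervalIntegrable_iff_integrableOn_Ioc_of_le zero_le_one).1 i2
      · exact Eventually.of_forall fun _ => abs_nonneg _
      · exact LE.le.eventuallyLE
          (Ioc_subset_Ioc (le_min hη.1 hξ.1) (max_le hη.2 hξ.2))
    rw [h2] at h3
    have := abs_sub_abs_le_abs_sub (φ ξ) (φ η)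
    linarith
  calc |φ ξ| = ∫ _η in (0:ℝ)..1, |φ ξ| := by simp
    _ ≤ ∫ η in (0:ℝ)..1, (|φ η| + J) :=
        intervalIntegral.integral_mono_on zero_le_one (by simp)
          (i1.add (by simp)) h1
    _ = ∫ η in (0:ℝ)..1, (|φ η| + |φ' η|) := by
        rw [intervalIntegral.integral_add i1 (by simp), intervalIntegral.integral_add i1 i2]
        simp [hJ]
    _ ≤ _ := intervalIntegral.integral_mono_on zero_le_one (i1.add i2)
        (hF.intervalIntegrable _ _) hle

/-- Averaging across two transversal families of characteristics: the integral along a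
characteristic of `α` of a function transported by `κ` is bounded by its `L¹`-norms in `x`. -/
lemma averaging_bound {M lam B W : ℝ} {α αt κ κt v h F c : ℝ → ℝ → ℝ} {x0 : ℝ}
    (hα : CT M α αt) (hκ : CT M κ κt) (h0 : x0 ∈ Icc (0:ℝ) 1) (hlam : 0 < lam)
    (hsep : (∀ x t, lam ≤ α x t - κ x t) ∨ (∀ x t, lam ≤ κ x t - α x t))
    (hv : CharD κ v h) (hvc : Continuous fun q : ℝ × ℝ => v q.1 q.2)
    (hh : Continuous fun q : ℝ × ℝ => h q.1 q.2)
    (hc : Continuous fun q : ℝ × ℝ => c q.1 q.2) (bc : ∀ x t, |c x t| ≤ W)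
    (hF : Continuous fun q : ℝ × ℝ => F q.1 q.2)
    (hle : ∀ x t, |v x t| + |h x t| ≤ F x t) (x t : ℝ)
    (hB : ∀ s ∈ Icc (t - 2 * M) (t + 2 * M), ∫ η in (0:ℝ)..1, F η s ≤ B) :
    |∫ ξ in x0..cl x, c ξ (fl α ξ x t) * v ξ (fl α ξ x t)| ≤
      W * (Real.exp M / lam * (4 * M * B)) := by
  obtain ⟨σ, hσ, hσ2⟩ : ∃ σ : ℝ, |σ| = 1 ∧ ∀ x t, lam ≤ σ * (α x t - κ x t) := by
    rcases hsep with h | h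
    · exact ⟨1, by simp, by simpa using h⟩
    · exact ⟨-1, by simp, fun x t => by simpa using h x t⟩
  have hM := hα.nonneg
  have hW : 0 ≤ W := (abs_nonneg _).trans (bc 0 0)
  have hFn : ∀ x t, 0 ≤ F x t := fun x t => le_trans (by positivity) (hle x t)
  set τ := fun ξ => fl α ξ x t with hτ
  have hτc : Continuous τ := hα.fl_cont₁ x t
  have hmc : Continuous fun q : ℝ × ℝ => fl κ q.2 q.1 (τ q.1) :=
    hκ.fl_cont continuous_snd continuous_fst (hτc.comp continuous_fst)
  have hmr : ∀ ξ η, fl κ η ξ (τ ξ) ∈ Icc (t - 2 * M) (t + 2 * M) := by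
    intro ξ η
    have h1 := hα.fl_lip_ξ (cl x) (cl ξ) x t
    have h2 := hκ.fl_lip_ξ (cl ξ) (cl η) ξ (τ ξ)
    simp only [fl_cl, hα.fl_self, hκ.fl_self] at h1 h2
    have a1 : |cl ξ - cl x| ≤ 1 := by
      rw [abs_le]; constructor <;> linarith [(cl_mem x).1, (cl_mem x).2, (cl_mem ξ).1, (cl_mem ξ).2]
    have a2 : |cl η - cl ξ| ≤ 1 := by
      rw [abs_le]; constructor <;> linarith [(cl_mem η).1, (cl_mem η).2, (cl_mem ξ).1, (cl_mem ξ).2]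
    have h1' : |fl α ξ x t - t| ≤ M := h1.trans (by nlinarith)
    have h2' : |fl κ η ξ (τ ξ) - τ ξ| ≤ M := h2.trans (by nlinarith)
    rw [abs_le] at h1' h2'
    simp only [hτ] at h2' ⊢
    constructor <;> linarith [h1'.1, h1'.2, h2'.1, h2'.2]
  have s1 : ∀ ξ ∈ Icc (0:ℝ) 1, |v ξ (τ ξ)| ≤ ∫ η in (0:ℝ)..1, F η (fl κ η ξ (τ ξ)) := by
    intro ξ hξ
    have hfc := hκ.fl_cont₁ ξ (τ ξ)
    have := abs_le_integral_add (F := fun η => F η (fl κ η ξ (τ ξ)))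
      (fun η hη => hv.along hκ ξ (τ ξ) hη) (hh.comp (continuous_id.prodMk hfc))
      (hF.comp (continuous_id.prodMk hfc)) (fun η _ => hle _ _) hξ
    simpa only [hκ.fl_self] using this
  have s2 : ∀ η, ∫ ξ in (0:ℝ)..1, F η (fl κ η ξ (τ ξ)) ≤
      Real.exp M / lam * ∫ s in (t - 2 * M)..(t + 2 * M), F η s := by
    intro η
    set m := fun ξ => fl κ η ξ (τ ξ) with hm
    set m' := fun ξ => 0 + (α ξ (τ ξ) - κ ξ (τ ξ)) * flt κ κt η ξ (τ ξ) with hm'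
    have hder : ∀ ξ ∈ Icc (0:ℝ) 1, HasDerivWithinAt m (m' ξ) (Icc 0 1) ξ := fun ξ hξ =>
      (charD_fl hκ η).chain hκ (hκ.fl_TD η) hξ (hα.fl_deriv x t hξ)
    have hm'c : Continuous m' := by
      have h1 : Continuous fun ξ => α ξ (τ ξ) := hα.cont.comp (continuous_id.prodMk hτc)
      have h2 : Continuous fun ξ => κ ξ (τ ξ) := hκ.cont.comp (continuous_id.prodMk hτc)
      have h3 : Continuous fun ξ => flt κ κt η ξ (τ ξ) :=
        hκ.flt_cont continuous_const continuous_id hτc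
      exact continuous_const.add ((h1.sub h2).mul h3)
    have hmcont : Continuous m := hκ.fl_cont continuous_const continuous_id hτc
    have hFη : Continuous (F η) := hF.comp (by fun_prop : Continuous fun s : ℝ => (η, s))
    have cov := intervalIntegral.integral_comp_mul_deriv'' (a := 0) (b := 1) (f := m) (f' := m')
      (g := F η) hmcont.continuousOn (fun ξ hξ => by
        rw [min_eq_left zero_le_one, max_eq_right zero_le_one] at hξ
        exact ((hder ξ (Ioo_subset_Icc_self hξ)).hasDerivAt
          (Icc_mem_nhds hξ.1 hξ.2)).hasDerivWithinAt) hm'c.continuousOn hFη.continuousOn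
    have lowm : ∀ ξ, lam * Real.exp (-M) ≤ σ * m' ξ := by
      intro ξ
      have h1 := hκ.le_flt η ξ (τ ξ)
      have h2 := hσ2 ξ (τ ξ)
      calc lam * Real.exp (-M) ≤ (σ * (α ξ (τ ξ) - κ ξ (τ ξ))) * flt κ κt η ξ (τ ξ) :=
            mul_le_mul h2 h1 (Real.exp_pos _).le (hlam.le.trans h2)
        _ = σ * m' ξ := by simp only [hm']; ring
    have hmono : ∫ ξ in (0:ℝ)..1, F η (m ξ) * (lam * Real.exp (-M)) ≤
        ∫ ξ in (0:ℝ)..1, σ * ((F η ∘ m) ξ * m' ξ) := by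
      refine intervalIntegral.integral_mono_on zero_le_one ?_ ?_ fun ξ _ => ?_
      · exact ((hFη.comp hmcont).mul continuous_const).intervalIntegrable _ _
      · exact (continuous_const.mul ((hFη.comp hmcont).mul hm'c)).intervalIntegrable _ _
      · have := mul_le_mul_of_nonneg_left (lowm ξ) (hFn η (m ξ))
        simp only [Function.comp]; linarith
    rw [intervalIntegral.integral_mul_const, intervalIntegral.integral_const_mul, cov] at hmono
    have hup : σ * ∫ s in m 0..m 1, F η s ≤ ∫ s in (t - 2 * M)..(t + 2 * M), F η s := by
      calc σ * ∫ s in m 0..m 1, F η s ≤ |σ * ∫ s in m 0..m 1, F η s| := le_abs_self _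
        _ = |∫ s in m 0..m 1, F η s| := by rw [abs_mul, hσ, one_mul]
        _ ≤ ∫ s in uIoc (m 0) (m 1), ‖F η s‖ := by
            rw [← Real.norm_eq_abs]
            exact intervalIntegral.norm_integral_le_integral_norm_uIoc
        _ ≤ ∫ s in Ioc (t - 2 * M) (t + 2 * M), ‖F η s‖ := by
            refine setIntegral_mono_set ?_ ?_ ?_
            · exact hFη.norm.integrableOn_Ioc
            · exact Eventually.of_forall fun _ => norm_nonneg _
            · exact LE.le.eventuallyLE (Ioc_subset_Ioc
                (le_min (hmr 0 η).1 (hmr 1 η).1) (max_le (hmr 0 η).2 (hmr 1 η).2))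
        _ = _ := by
            rw [intervalIntegral.integral_of_le (by linarith)]
            exact integral_congr_ae (Eventually.of_forall fun s => by
              simp [abs_of_nonneg (hFn η s)])
    have hpos : 0 < lam * Real.exp (-M) := by positivity
    have : Real.exp M / lam = 1 / (lam * Real.exp (-M)) := by
      rw [Real.exp_neg]; field_simp
    rw [this, div_mul_eq_mul_div, one_mul, le_div_iff₀ hpos]
    linarith
  have hI2 : Continuous fun ξ => ∫ η in (0:ℝ)..1, F η (fl κ η ξ (τ ξ)) :=
    intervalIntegral.continuous_parametric_intervalIntegral_of_continuous'
      (f := fun ξ η => F η (fl κ η ξ (τ ξ))) (hF.comp (continuous_snd.prodMk hmc)) _ _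
  have hFm : Continuous fun q : ℝ × ℝ => F q.2 (fl κ q.2 q.1 (τ q.1)) :=
    hF.comp (continuous_snd.prodMk hmc)
  have s3 : ∫ ξ in (0:ℝ)..1, ∫ η in (0:ℝ)..1, F η (fl κ η ξ (τ ξ)) ≤
      Real.exp M / lam * (4 * M * B) := by
    rw [interval_swap (f := fun ξ η => F η (fl κ η ξ (τ ξ))) hFm zero_le_one zero_le_one]
    have c1 : Continuous fun η => ∫ s in (t - 2 * M)..(t + 2 * M), F η s :=
      intervalIntegral.continuous_parametric_intervalIntegral_of_continuous' hF _ _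
    calc ∫ η in (0:ℝ)..1, ∫ ξ in (0:ℝ)..1, F η (fl κ η ξ (τ ξ))
        ≤ ∫ η in (0:ℝ)..1, Real.exp M / lam * ∫ s in (t - 2 * M)..(t + 2 * M), F η s := by
          refine intervalIntegral.integral_mono_on zero_le_one ?_ ?_ fun η _ => s2 η
          · exact (intervalIntegral.continuous_parametric_intervalIntegral_of_continuous'
              (f := fun η ξ => F η (fl κ η ξ (τ ξ)))
              (hFm.comp continuous_swap) _ _).intervalIntegrable _ _
          · exact (continuous_const.mul c1).intervalIntegrable _ _
      _ = Real.exp M / lam * ∫ s in (t - 2 * M)..(t + 2 * M), ∫ η in (0:ℝ)..1, F η s := by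
          rw [intervalIntegral.integral_const_mul, interval_swap hF zero_le_one (by linarith)]
      _ ≤ Real.exp M / lam * (4 * M * B) := by
          refine mul_le_mul_of_nonneg_left ?_ (by positivity)
          calc ∫ s in (t - 2 * M)..(t + 2 * M), ∫ η in (0:ℝ)..1, F η s
              ≤ ∫ _s in (t - 2 * M)..(t + 2 * M), B := by
                refine intervalIntegral.integral_mono_on (by linarith) ?_ (by simp) hB
                exact (intervalIntegral.continuous_parametric_intervalIntegral_of_continuous'
                  (f := fun s η => F η s) (hF.comp continuous_swap) _ _).intervalIntegrable _ _
            _ = 4 * M * B := by simp; left; ring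
  have hcv : Continuous fun ξ => c ξ (τ ξ) * v ξ (τ ξ) :=
    (hc.comp (continuous_id.prodMk hτc)).mul (hvc.comp (continuous_id.prodMk hτc))
  calc |∫ ξ in x0..cl x, c ξ (τ ξ) * v ξ (τ ξ)|
      ≤ ∫ ξ in uIoc x0 (cl x), ‖c ξ (τ ξ) * v ξ (τ ξ)‖ := by
        rw [← Real.norm_eq_abs]
        exact intervalIntegral.norm_integral_le_integral_norm_uIoc
    _ ≤ ∫ ξ in Ioc (0:ℝ) 1, ‖c ξ (τ ξ) * v ξ (τ ξ)‖ := by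
        refine setIntegral_mono_set hcv.norm.integrableOn_Ioc
          (Eventually.of_forall fun _ => norm_nonneg _) ?_
        exact LE.le.eventuallyLE (Ioc_subset_Ioc (le_min h0.1 (cl_mem x).1)
          (max_le h0.2 (cl_mem x).2))
    _ = ∫ ξ in (0:ℝ)..1, ‖c ξ (τ ξ) * v ξ (τ ξ)‖ := by
        rw [intervalIntegral.integral_of_le zero_le_one]
    _ ≤ ∫ ξ in (0:ℝ)..1, W * ∫ η in (0:ℝ)..1, F η (fl κ η ξ (τ ξ)) := by
        refine intervalIntegral.integral_mono_on zero_le_one (hcv.norm.intervalIntegrable _ _)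
          ((continuous_const.mul hI2).intervalIntegrable _ _) fun ξ hξ => ?_
        rw [norm_mul]
        exact mul_le_mul (bc _ _) (s1 ξ hξ) (abs_nonneg _) hW
    _ ≤ _ := by
        rw [intervalIntegral.integral_const_mul]
        exact mul_le_mul_of_nonneg_left s3 hW

/-- The `t`-derivative. -/
def dt (v : ℝ → ℝ → ℝ) (x t : ℝ) : ℝ := deriv (v x) t

lemma TD.eq_dt {v vt : ℝ → ℝ → ℝ} (h : TD v vt) : vt = dt v := by
  funext x t; exact (h.deriv x t).deriv.symm

lemma TD.to_dt {v vt : ℝ → ℝ → ℝ} (h : TD v vt) : TD v (dt v) := h.eq_dt ▸ h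

lemma CT.to_dt {M : ℝ} {v vt : ℝ → ℝ → ℝ} (h : CT M v vt) : CT M v (dt v) := h.eq_dt ▸ h

lemma CT.fl_near {M : ℝ} {α αt : ℝ → ℝ → ℝ} (h : CT M α αt) (ξ x t : ℝ) :
    |fl α ξ x t - t| ≤ M := by
  have h1 := h.fl_lip_ξ (cl x) (cl ξ) x t
  simp only [fl_cl, h.fl_self] at h1
  have a1 : |cl ξ - cl x| ≤ 1 := by
    rw [abs_le]; constructor <;> linarith [(cl_mem x).1, (cl_mem x).2, (cl_mem ξ).1, (cl_mem ξ).2]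
  exact h1.trans (by nlinarith [h.nonneg])

/-- The solution of `v_x + α v_t + b v = h` with `v(x0, ·) = q`. -/
def Ls (α b : ℝ → ℝ → ℝ) (x0 : ℝ) (q : ℝ → ℝ) (h : ℝ → ℝ → ℝ) (x t : ℝ) : ℝ :=
  Real.exp (-T0 α x0 (fun _ => 0) b x t) *
    T0 α x0 q (fun x t => Real.exp (T0 α x0 (fun _ => 0) b x t) * h x t) x t

section Ls

variable {M : ℝ} {α αt b bt : ℝ → ℝ → ℝ} {x0 : ℝ}

lemma Ls_cl (q : ℝ → ℝ) (h : ℝ → ℝ → ℝ) (x t : ℝ) :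
    Ls α b x0 q h (cl x) t = Ls α b x0 q h x t := by
  simp only [Ls, T0_cl]

lemma T0_zero_bd {B : ℝ} (h0 : x0 ∈ Icc (0:ℝ) 1) (hb : ∀ x t, |b x t| ≤ B) (x t : ℝ) :
    |T0 α x0 (fun _ => 0) b x t| ≤ B := by
  simp only [T0, zero_add]
  exact abs_integral_cl_le_of_mem h0 (fun s _ => hb _ _) x

lemma T0_expTD (hα : CT M α αt) (hb : CT M b bt) :
    Continuous fun p : ℝ × ℝ => Real.exp (T0 α x0 (fun _ => 0) b p.1 p.2) :=
  Real.continuous_exp.comp (T0_cont hα continuous_const hb.cont)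

lemma Ls_cont (hα : CT M α αt) (hb : CT M b bt) {q : ℝ → ℝ} {h : ℝ → ℝ → ℝ} (hq : Continuous q)
    (hh : Continuous fun p : ℝ × ℝ => h p.1 p.2) :
    Continuous fun p : ℝ × ℝ => Ls α b x0 q h p.1 p.2 :=
  (Real.continuous_exp.comp (T0_cont hα continuous_const hb.cont).neg).mul
    (T0_cont hα hq ((T0_expTD hα hb).mul hh))

lemma Ls_start (hα : CT M α αt) (h0 : x0 ∈ Icc (0:ℝ) 1) (q : ℝ → ℝ) (h : ℝ → ℝ → ℝ) (t : ℝ) :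
    Ls α b x0 q h x0 t = q t := by
  simp [Ls, T0_start hα h0]

lemma CharD.neg {v h : ℝ → ℝ → ℝ} (hv : CharD α v h) :
    CharD α (fun x t => -v x t) (fun x t => -h x t) := by
  have := hv.const_mul (-1)
  simpa using this

lemma Ls_charD (hα : CT M α αt) (hb : CT M b bt) (q : ℝ → ℝ) {h : ℝ → ℝ → ℝ}
    (hh : Continuous fun p : ℝ × ℝ => h p.1 p.2) :
    CharD α (Ls α b x0 q h) (fun x t => h x t - b x t * Ls α b x0 q h x t) := by
  have h1 := CharD.mul hα (CharD.exp hα (T0_charD (x0 := x0) hα (fun _ => 0) hb.cont).neg)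
    (T0_charD (x0 := x0) (h := fun x t => Real.exp (T0 α x0 (fun _ => 0) b x t) * h x t) hα q
      ((T0_expTD (x0 := x0) hα hb).mul hh))
  refine h1.congr fun x _ t => ?_
  have h2 : Real.exp (-T0 α x0 (fun _ => 0) b x t) * Real.exp (T0 α x0 (fun _ => 0) b x t) = 1 := by
    rw [← Real.exp_add]; simp
  simp only [Ls]
  linear_combination (h x t) * h2

lemma Ls_unique (hα : CT M α αt) (hb : CT M b bt) (h0 : x0 ∈ Icc (0:ℝ) 1) {v h : ℝ → ℝ → ℝ}
    (hv : CharD α v (fun x t => h x t - b x t * v x t))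
    (hh : Continuous fun p : ℝ × ℝ => h p.1 p.2)
    (hcl : ∀ x t, v (cl x) t = v x t) (x t : ℝ) :
    v x t = Ls α b x0 (v x0) h x t := by
  set e := fun x t => Real.exp (T0 α x0 (fun _ => 0) b x t) with he
  have h1 : CharD α (fun x t => e x t * v x t) (fun x t => e x t * h x t) :=
    (CharD.mul hα (CharD.exp hα (T0_charD (x0 := x0) hα (fun _ => 0) hb.cont)) hv).congr
      fun x _ t => by simp only [he]; ring
  have h2 := h1.eq_T0 hα h0 ((T0_expTD (x0 := x0) hα hb).mul hh)
    (fun x t => by simp only [he, T0_cl, hcl]) x t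
  have h3 : (fun t => e x0 t * v x0 t) = v x0 := by
    funext t; simp [he, T0_start hα h0]
  rw [h3] at h2
  simp only [Ls]
  rw [← h2, ← mul_assoc, ← Real.exp_add]
  simp

lemma Ls_bd_int (hα : CT M α αt) (hb : CT M b bt) (h0 : x0 ∈ Icc (0:ℝ) 1) (q : ℝ → ℝ)
    {h : ℝ → ℝ → ℝ} {B : ℝ → ℝ} (hB : Continuous B) {x t : ℝ}
    (hh : ∀ ξ ∈ uIcc x0 (cl x), |h ξ (fl α ξ x t)| ≤ B ξ) :
    |Ls α b x0 q h x t| ≤ Real.exp (2 * M) *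
      (|q (fl α x0 x t)| + |∫ ξ in x0..cl x, B ξ|) := by
  have hM := hα.nonneg
  have hθ : ∀ x t, |T0 α x0 (fun _ => 0) b x t| ≤ M := T0_zero_bd h0 hb.bd
  have e1 : Real.exp (-T0 α x0 (fun _ => 0) b x t) ≤ Real.exp M :=
    Real.exp_le_exp.2 (by linarith [(abs_le.1 (hθ x t)).1])
  have e2 : |∫ ξ in x0..cl x, Real.exp (T0 α x0 (fun _ => 0) b ξ (fl α ξ x t)) *
      h ξ (fl α ξ x t)| ≤ Real.exp M * |∫ ξ in x0..cl x, B ξ| := by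
    rw [← Real.norm_eq_abs, ← abs_of_pos (Real.exp_pos M), ← abs_mul,
      ← intervalIntegral.integral_const_mul]
    refine intervalIntegral.norm_integral_le_abs_of_norm_le ?_
      ((continuous_const.mul hB).intervalIntegrable _ _)
    refine (ae_restrict_iff' measurableSet_uIoc).2 (Eventually.of_forall fun ξ hξ => ?_)
    rw [norm_mul, Real.norm_eq_abs, Real.norm_eq_abs, Real.abs_exp]
    exact mul_le_mul (Real.exp_le_exp.2 ((le_abs_self _).trans (hθ _ _)))
      (hh ξ (uIoc_subset_uIcc hξ)) (abs_nonneg _) (Real.exp_pos _).le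
  have e3 : |T0 α x0 q (fun x t => Real.exp (T0 α x0 (fun _ => 0) b x t) * h x t) x t| ≤
      Real.exp M * (|q (fl α x0 x t)| + |∫ ξ in x0..cl x, B ξ|) := by
    rw [T0]
    refine (abs_add_le _ _).trans ?_
    have : 1 ≤ Real.exp M := Real.one_le_exp hM
    nlinarith [abs_nonneg (q (fl α x0 x t))]
  rw [Ls, abs_mul, Real.abs_exp, two_mul, Real.exp_add, mul_assoc]
  exact mul_le_mul e1 e3 (abs_nonneg _) (Real.exp_pos _).le

lemma Ls_bd (hα : CT M α αt) (hb : CT M b bt) (h0 : x0 ∈ Icc (0:ℝ) 1) {q : ℝ → ℝ}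
    {h : ℝ → ℝ → ℝ} {A B x t : ℝ} (hq : |q (fl α x0 x t)| ≤ A)
    (hh : ∀ ξ ∈ uIcc x0 (cl x), |h ξ (fl α ξ x t)| ≤ B) :
    |Ls α b x0 q h x t| ≤ Real.exp (2 * M) * (A + B) := by
  refine (Ls_bd_int hα hb h0 q continuous_const hh).trans ?_
  have hB : 0 ≤ B := (abs_nonneg _).trans (hh x0 left_mem_uIcc)
  have := abs_integral_cl_le_of_mem (f := fun _ => B) h0 (fun _ _ => (abs_of_nonneg hB).le) x
  gcongr

lemma T0_add {q q' : ℝ → ℝ} {h h' : ℝ → ℝ → ℝ} (hα : CT M α αt)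
    (hh : Continuous fun p : ℝ × ℝ => h p.1 p.2) (hh' : Continuous fun p : ℝ × ℝ => h' p.1 p.2)
    (x t : ℝ) : T0 α x0 (fun t => q t + q' t) (fun x t => h x t + h' x t) x t =
      T0 α x0 q h x t + T0 α x0 q' h' x t := by
  have c := hα.fl_cont₁ x t
  simp only [T0]
  rw [intervalIntegral.integral_add]
  · ring
  · exact (hh.comp (continuous_id.prodMk c)).intervalIntegrable _ _
  · exact (hh'.comp (continuous_id.prodMk c)).intervalIntegrable _ _

lemma Ls_add {q q' : ℝ → ℝ} {h h' : ℝ → ℝ → ℝ} (hα : CT M α αt) (hb : CT M b bt)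
    (hh : Continuous fun p : ℝ × ℝ => h p.1 p.2) (hh' : Continuous fun p : ℝ × ℝ => h' p.1 p.2)
    (x t : ℝ) : Ls α b x0 (fun t => q t + q' t) (fun x t => h x t + h' x t) x t =
      Ls α b x0 q h x t + Ls α b x0 q' h' x t := by
  simp only [Ls, mul_add]
  rw [T0_add hα ((T0_expTD (x0 := x0) hα hb).mul hh) ((T0_expTD (x0 := x0) hα hb).mul hh')]
  ring

lemma Ls_smul {q : ℝ → ℝ} {h : ℝ → ℝ → ℝ} (c : ℝ) (x t : ℝ) :
    Ls α b x0 (fun t => c * q t) (fun x t => c * h x t) x t = c * Ls α b x0 q h x t := by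
  simp only [Ls, T0, mul_left_comm _ c, intervalIntegral.integral_const_mul]
  ring

/-- The explicit `t`-derivative of `Ls`. -/
lemma Ls_TD (hα : CT M α αt) (hb : CT M b bt) {q q' : ℝ → ℝ} {h ht : ℝ → ℝ → ℝ}
    (hq : ∀ t, HasDerivAt q (q' t) t) (hq' : Continuous q') (hh : TD h ht) :
    TD (Ls α b x0 q h) (fun x t => -dt (T0 α x0 (fun _ => 0) b) x t * Ls α b x0 q h x t +
      Real.exp (-T0 α x0 (fun _ => 0) b x t) * (q' (fl α x0 x t) * flt α αt x0 x t +
      ∫ ξ in x0..cl x, (dt (fun x t => Real.exp (T0 α x0 (fun _ => 0) b x t)) ξ (fl α ξ x t) *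
        h ξ (fl α ξ x t) + Real.exp (T0 α x0 (fun _ => 0) b ξ (fl α ξ x t)) *
        ht ξ (fl α ξ x t)) * flt α αt ξ x t)) := by
  have hθ := (T0_TD (x0 := x0) hα (fun t => hasDerivAt_const t (0:ℝ)) continuous_const
    hb.toTD).to_dt
  have he := hθ.exp.to_dt
  have h1 := hθ.neg.exp.mul (T0_TD (x0 := x0) hα hq hq' (he.mul hh))
  refine h1.congr_t fun x t => ?_
  simp only [Ls]
  ring

lemma T0_dt_bd (hα : CT M α αt) (hb : CT M b bt) (h0 : x0 ∈ Icc (0:ℝ) 1) (x t : ℝ) :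
    |dt (T0 α x0 (fun _ => 0) b) x t| ≤ M * Real.exp M := by
  have hθ := (T0_TD (x0 := x0) hα (fun t => hasDerivAt_const t (0:ℝ)) continuous_const
    hb.toTD).eq_dt
  rw [← hθ]
  simp only [zero_mul, zero_add]
  refine abs_integral_cl_le_of_mem h0 (fun s _ => ?_) x
  rw [abs_mul, abs_of_pos (flt_pos _ _ _ _ _)]
  exact mul_le_mul (hb.bdt _ _) (hα.flt_le _ _ _) (flt_pos _ _ _ _ _).le hα.nonneg

lemma T0_expCT (hα : CT M α αt) (hb : CT M b bt) (h0 : x0 ∈ Icc (0:ℝ) 1) :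
    CT (M * Real.exp (2 * M) + Real.exp M) (fun x t => Real.exp (T0 α x0 (fun _ => 0) b x t))
      (dt fun x t => Real.exp (T0 α x0 (fun _ => 0) b x t)) := by
  have hM := hα.nonneg
  have hθ := (T0_TD (x0 := x0) hα (fun t => hasDerivAt_const t (0:ℝ)) continuous_const
    hb.toTD).to_dt
  have e1 : ∀ x t, Real.exp (T0 α x0 (fun _ => 0) b x t) ≤ Real.exp M := fun x t =>
    Real.exp_le_exp.2 ((le_abs_self _).trans (T0_zero_bd h0 hb.bd x t))
  refine ⟨hθ.exp.to_dt, fun x t => ?_, fun x t => ?_⟩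
  · rw [Real.abs_exp]
    exact (e1 x t).trans (le_add_of_nonneg_left (by positivity))
  · rw [← hθ.exp.eq_dt, abs_mul, Real.abs_exp]
    refine (mul_le_mul (e1 x t) (T0_dt_bd hα hb h0 x t) (abs_nonneg _)
      (Real.exp_pos _).le).trans ?_
    rw [two_mul, Real.exp_add]
    nlinarith [Real.exp_pos M]

/-- Bound of the `t`-derivative of `Ls` by those of the data. -/
lemma Ls_dt_bd (hα : CT M α αt) (hb : CT M b bt) (h0 : x0 ∈ Icc (0:ℝ) 1) {q q' : ℝ → ℝ}
    {h ht : ℝ → ℝ → ℝ} (hq : ∀ t, HasDerivAt q (q' t) t) (hq' : Continuous q') (hh : TD h ht)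
    {A B J x t : ℝ} (bq : |q (fl α x0 x t)| ≤ A) (bq' : |q' (fl α x0 x t)| ≤ B)
    (bh : ∀ ξ ∈ uIcc x0 (cl x), |h ξ (fl α ξ x t)| ≤ A)
    (bJ : |∫ ξ in x0..cl x, (dt (fun x t => Real.exp (T0 α x0 (fun _ => 0) b x t)) ξ (fl α ξ x t) *
        h ξ (fl α ξ x t) + Real.exp (T0 α x0 (fun _ => 0) b ξ (fl α ξ x t)) *
        ht ξ (fl α ξ x t)) * flt α αt ξ x t| ≤ J) :
    |dt (Ls α b x0 q h) x t| ≤ 2 * M * Real.exp (3 * M) * A + Real.exp (2 * M) * B +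
      Real.exp M * J := by
  rw [← (Ls_TD (x0 := x0) hα hb hq hq' hh).eq_dt]
  have hM := hα.nonneg
  have e1 : Real.exp (-T0 α x0 (fun _ => 0) b x t) ≤ Real.exp M :=
    Real.exp_le_exp.2 (by linarith [(abs_le.1 (T0_zero_bd (α := α) h0 hb.bd x t)).1])
  have i1 := Ls_bd hα hb h0 bq bh
  have i2 := T0_dt_bd hα hb h0 x t
  have hA : 0 ≤ A := (abs_nonneg _).trans bq
  have hB : 0 ≤ B := (abs_nonneg _).trans bq'
  have hJ : 0 ≤ J := (abs_nonneg _).trans bJ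
  refine (abs_add_le _ _).trans ?_
  have t1 : |-dt (T0 α x0 (fun _ => 0) b) x t * Ls α b x0 q h x t| ≤
      2 * M * Real.exp (3 * M) * A := by
    rw [abs_mul, abs_neg]
    refine (mul_le_mul i2 i1 (abs_nonneg _) (by positivity)).trans (le_of_eq ?_)
    rw [show 3 * M = M + 2 * M by ring, Real.exp_add]; ring
  have t2 : |q' (fl α x0 x t) * flt α αt x0 x t| ≤ Real.exp M * B := by
    rw [abs_mul, abs_of_pos (flt_pos _ _ _ _ _), mul_comm]
    exact mul_le_mul (hα.flt_le _ _ _) bq' (abs_nonneg _) (Real.exp_pos _).le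
  have t3 : ∀ z, |z| ≤ Real.exp M * B + J →
      |Real.exp (-T0 α x0 (fun _ => 0) b x t) * z| ≤ Real.exp (2 * M) * B + Real.exp M * J := by
    intro z hz
    rw [abs_mul, Real.abs_exp]
    refine (mul_le_mul e1 hz (abs_nonneg _) (Real.exp_pos _).le).trans (le_of_eq ?_)
    rw [two_mul, Real.exp_add]; ring
  have := t3 _ ((abs_add_le _ _).trans (add_le_add t2 bJ))
  linarith

end Ls

/-- A family of `n` functions of `(x,t)`. -/
abbrev Fd (n : ℕ) := Fin n → ℝ → ℝ → ℝ

/-- Coefficients of `∂ₓu_j + α_j ∂ₜu_j + ∑ₖ β_jk u_k = g_j`. -/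
structure LD (n : ℕ) where
  α : Fd n
  β : Fin n → Fd n

def xin {n : ℕ} (m : ℕ) (j : Fin n) : ℝ := if (j : ℕ) < m then 0 else 1

def xout {n : ℕ} (m : ℕ) (j : Fin n) : ℝ := if (j : ℕ) < m then 1 else 0

lemma xin_mem {n : ℕ} (m : ℕ) (j : Fin n) : xin m j ∈ Icc (0:ℝ) 1 := by
  unfold xin; split_ifs <;> simp

lemma xout_mem {n : ℕ} (m : ℕ) (j : Fin n) : xout m j ∈ Icc (0:ℝ) 1 := by
  unfold xout; split_ifs <;> simp

/-- `v` has a continuous `x`-derivative on `[0,1]` bounded by `M`. -/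
def XD (M : ℝ) (v : ℝ → ℝ → ℝ) : Prop :=
  ∃ vx : ℝ → ℝ → ℝ, (Continuous fun q : ℝ × ℝ => vx q.1 q.2) ∧ (∀ x t, |vx x t| ≤ M) ∧
    ∀ x ∈ Icc (0:ℝ) 1, ∀ t, HasDerivWithinAt (fun s => v s t) (vx x t) (Icc 0 1) x

structure Good {n : ℕ} (m : ℕ) (p : Fin n → Fin n → ℝ) (M lam : ℝ) (d : LD n) : Prop where
  hM : 1 ≤ M
  hlam : 0 < lam
  hp : ∀ j k, |p j k| ≤ M
  hα : ∀ j, CT M (d.α j) (dt (d.α j))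
  hβ : ∀ j k, CT M (d.β j k) (dt (d.β j k))
  αx : ∀ j, XD M (d.α j)
  βx : ∀ j k, j ≠ k → XD M (d.β j k)
  pos : ∀ j : Fin n, (j : ℕ) < m → ∀ x t, lam ≤ d.α j x t
  neg : ∀ j : Fin n, m ≤ (j : ℕ) → ∀ x t, d.α j x t ≤ -lam
  sep : ∀ j k : Fin n, j ≠ k → (∀ x t, lam ≤ d.α j x t - d.α k x t) ∨
    (∀ x t, lam ≤ d.α k x t - d.α j x t)

/-- Continuous fields, extended to all `x` by clamping. -/
structure CF {n : ℕ} (u : Fd n) : Prop where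
  cont : ∀ j, Continuous fun q : ℝ × ℝ => u j q.1 q.2
  clamp : ∀ j x t, u j (cl x) t = u j x t

/-- The `t`-derivative of a field. -/
def dF {n : ℕ} (u : Fd n) : Fd n := fun j => dt (u j)

/-- Clamped fields with a continuous `t`-derivative. -/
structure TF {n : ℕ} (u : Fd n) : Prop where
  td : ∀ j, TD (u j) (dF u j)
  clamp : ∀ j x t, u j (cl x) t = u j x t

lemma TF.toCF {n : ℕ} {u : Fd n} (h : TF u) : CF u := ⟨fun j => (h.td j).cont, h.clamp⟩

/-- `u` is bounded by `A` on the time window of radius `R` around `t`. -/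
def LB {n : ℕ} (R t A : ℝ) (u : Fd n) : Prop := ∀ j x s, |s - t| ≤ R → |u j x s| ≤ A

def bq {n : ℕ} (m : ℕ) (p : Fin n → Fin n → ℝ) (u : Fd n) (j : Fin n) (t : ℝ) : ℝ :=
  ∑ k, p j k * u k (xout m k) t

def off {n : ℕ} (d : LD n) (u : Fd n) : Fd n := fun j x t =>
  ∑ k ∈ Finset.univ.erase j, -(d.β j k x t * u k x t)

def Kop {n : ℕ} (m : ℕ) (p : Fin n → Fin n → ℝ) (d : LD n) (u : Fd n) : Fd n := fun j =>
  Ls (d.α j) (d.β j j) (xin m j) (bq m p u j) (off d u j)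

def Fop {n : ℕ} (m : ℕ) (d : LD n) (g : Fd n) : Fd n := fun j =>
  Ls (d.α j) (d.β j j) (xin m j) (fun _ => 0) (g j)

section ops

variable {n m : ℕ} {p : Fin n → Fin n → ℝ} {M lam : ℝ} {d : LD n} {u v g : Fd n}

lemma LB.mono {R R' t t' A A' : ℝ} (h : LB R t A u) (hR : |t' - t| + R' ≤ R) (hA : A ≤ A') :
    LB R' t' A' u := fun j x s hs => (h j x s (by
      have := abs_sub_le s t' t; linarith)).trans hA

lemma CF.add (hu : CF u) (hv : CF v) : CF (u + v) :=
  ⟨fun j => (hu.cont j).add (hv.cont j), fun j x t => by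
    simp only [Pi.add_apply, hu.clamp, hv.clamp]⟩

lemma CF.smul (c : ℝ) (hu : CF u) : CF (c • u) :=
  ⟨fun j => (hu.cont j).const_smul c, fun j x t => by simp only [Pi.smul_apply, hu.clamp]⟩

lemma CF.sub (hu : CF u) (hv : CF v) : CF (u - v) :=
  ⟨fun j => (hu.cont j).sub (hv.cont j), fun j x t => by
    simp only [Pi.sub_apply, hu.clamp, hv.clamp]⟩

lemma TF.add (hu : TF u) (hv : TF v) : TF (u + v) :=
  ⟨fun j => ((hu.td j).add (hv.td j)).to_dt, (hu.toCF.add hv.toCF).clamp⟩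

lemma TF.sub (hu : TF u) (hv : TF v) : TF (u - v) :=
  ⟨fun j => ((hu.td j).sub (hv.td j)).to_dt, (hu.toCF.sub hv.toCF).clamp⟩

lemma TF.zero : TF (0 : Fd n) := ⟨fun _ => TD.zero.to_dt, fun _ _ _ => rfl⟩

lemma TF.dF_add (hu : TF u) (hv : TF v) : dF (u + v) = dF u + dF v := by
  funext j; exact ((hu.td j).add (hv.td j)).eq_dt.symm

lemma TF.dF_sub (hu : TF u) (hv : TF v) : dF (u - v) = dF u - dF v := by
  funext j; exact ((hu.td j).sub (hv.td j)).eq_dt.symm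

lemma bq_cont (hu : CF u) (j : Fin n) : Continuous (bq m p u j) := by
  unfold bq
  refine continuous_finsetSum _ fun k _ => continuous_const.mul ?_
  exact (hu.cont k).comp (continuous_const.prodMk continuous_id)

lemma off_cont (hd : Good m p M lam d) (hu : CF u) (j : Fin n) :
    Continuous fun q : ℝ × ℝ => off d u j q.1 q.2 := by
  unfold off
  exact continuous_finsetSum _ fun k _ => ((hd.hβ j k).cont.mul (hu.cont k)).neg

lemma bq_deriv (hu : TF u) (j : Fin n) (t : ℝ) : HasDerivAt (bq m p u j) (bq m p (dF u) j t) t := by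
  unfold bq
  exact HasDerivAt.fun_sum fun k _ => ((hu.td k).deriv _ t).const_mul _

lemma bq_dF_cont (hu : TF u) (j : Fin n) : Continuous (bq m p (dF u) j) := by
  unfold bq
  refine continuous_finsetSum _ fun k _ => continuous_const.mul ?_
  exact (hu.td k).contt.comp (continuous_const.prodMk continuous_id)

lemma off_TD (hd : Good m p M lam d) (hu : TF u) (j : Fin n) :
    TD (off d u j) (fun x t => ∑ k ∈ Finset.univ.erase j,
      -(dt (d.β j k) x t * u k x t + d.β j k x t * dF u k x t)) :=
  TD.sum _ fun k _ => ((hd.hβ j k).toTD.mul (hu.td k)).neg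

lemma Kop_CF (hd : Good m p M lam d) (hu : CF u) : CF (Kop m p d u) :=
  ⟨fun j => Ls_cont (hd.hα j) (hd.hβ j j) (bq_cont hu j) (off_cont hd hu j), fun _ _ _ => Ls_cl _ _ _ _⟩

lemma Kop_TF (hd : Good m p M lam d) (hu : TF u) : TF (Kop m p d u) :=
  ⟨fun j => (Ls_TD (hd.hα j) (hd.hβ j j) (bq_deriv hu j) (bq_dF_cont hu j) (off_TD hd hu j)).to_dt,
    fun _ _ _ => Ls_cl _ _ _ _⟩

lemma Fop_TF (hd : Good m p M lam d) (hg : TF g) : TF (Fop m d g) :=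
  ⟨fun j => (Ls_TD (hd.hα j) (hd.hβ j j) (fun t => hasDerivAt_const t (0:ℝ)) continuous_const
    (hg.td j)).to_dt, fun _ _ _ => Ls_cl _ _ _ _⟩

lemma bq_add (u v : Fd n) (j : Fin n) : bq m p (u + v) j = fun t => bq m p u j t + bq m p v j t := by
  funext t; simp only [bq, Pi.add_apply, mul_add, Finset.sum_add_distrib]

lemma off_add (u v : Fd n) (j : Fin n) :
    off d (u + v) j = fun x t => off d u j x t + off d v j x t := by
  funext x t; simp only [off, Pi.add_apply, mul_add, neg_add, Finset.sum_add_distrib]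

lemma Kop_add (hd : Good m p M lam d) (hu : CF u) (hv : CF v) :
    Kop m p d (u + v) = Kop m p d u + Kop m p d v := by
  funext j x t
  simp only [Kop, Pi.add_apply]
  rw [bq_add, off_add, Ls_add (hd.hα j) (hd.hβ j j) (off_cont hd hu j) (off_cont hd hv j)]

lemma Kop_smul (c : ℝ) : Kop m p d (c • u) = c • Kop m p d u := by
  funext j x t
  simp only [Kop, Pi.smul_apply, smul_eq_mul]
  rw [← Ls_smul]
  congr 1
  · funext t; simp only [bq, Pi.smul_apply, smul_eq_mul, Finset.mul_sum]
    exact Finset.sum_congr rfl fun k _ => by ring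
  · funext x t; simp only [off, Pi.smul_apply, smul_eq_mul, Finset.mul_sum]
    exact Finset.sum_congr rfl fun k _ => by ring

lemma Kop_sub (hd : Good m p M lam d) (hu : CF u) (hv : CF v) :
    Kop m p d (u - v) = Kop m p d u - Kop m p d v := by
  have h : u - v = u + (-1 : ℝ) • v := by
    funext j x t; simp only [Pi.sub_apply, Pi.add_apply, Pi.smul_apply, smul_eq_mul]; ring
  rw [h, Kop_add hd hu (hv.smul _), Kop_smul]
  funext j x t; simp only [Pi.sub_apply, Pi.add_apply, Pi.smul_apply, smul_eq_mul]; ring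

lemma Fop_add (hd : Good m p M lam d) {g' : Fd n} (hg : CF g) (hg' : CF g') :
    Fop m d (g + g') = Fop m d g + Fop m d g' := by
  funext j x t
  simp only [Fop, Pi.add_apply]
  rw [← Ls_add (hd.hα j) (hd.hβ j j) (hg.cont j) (hg'.cont j)]
  simp only [add_zero]
  rfl

lemma Fop_smul (c : ℝ) : Fop m d (c • g) = c • Fop m d g := by
  funext j x t
  simp only [Fop, Pi.smul_apply, smul_eq_mul]
  rw [← Ls_smul]
  simp only [mul_zero]
  rfl

lemma Fop_sub (hd : Good m p M lam d) {g' : Fd n} (hg : CF g) (hg' : CF g') :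
    Fop m d (g - g') = Fop m d g - Fop m d g' := by
  have h : ∀ a b : Fd n, a - b = a + (-1 : ℝ) • b := fun a b => by
    funext j x t; simp only [Pi.sub_apply, Pi.add_apply, Pi.smul_apply, smul_eq_mul]; ring
  rw [h, Fop_add hd hg (hg'.smul _), Fop_smul, ← h]

lemma bq_bd (hp : ∀ j k, |p j k| ≤ M) {A s : ℝ} (h : ∀ k x, |u k x s| ≤ A) (j : Fin n) :
    |bq m p u j s| ≤ n * M * A := by
  refine (Finset.abs_sum_le_sum_abs _ _).trans ?_
  have : ∀ k ∈ (Finset.univ : Finset (Fin n)), |p j k * u k (xout m k) s| ≤ M * A := fun k _ => by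
    rw [abs_mul]
    exact mul_le_mul (hp j k) (h _ _) (abs_nonneg _) ((abs_nonneg _).trans (hp j k))
  refine (Finset.sum_le_card_nsmul _ _ _ this).trans (le_of_eq ?_)
  simp; ring

lemma off_bd (hd : Good m p M lam d) {A s x : ℝ} (h : ∀ k, |u k x s| ≤ A) (j : Fin n) :
    |off d u j x s| ≤ n * M * A := by
  have hM := hd.hM
  have hA : 0 ≤ A := (abs_nonneg _).trans (h j)
  refine (Finset.abs_sum_le_sum_abs _ _).trans ?_
  have : ∀ k ∈ (Finset.univ : Finset (Fin n)).erase j, |-(d.β j k x s * u k x s)| ≤ M * A :=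
    fun k _ => by
      rw [abs_neg, abs_mul]
      exact mul_le_mul ((hd.hβ j k).bd _ _) (h _) (abs_nonneg _) (by linarith)
  refine (Finset.sum_le_card_nsmul _ _ _ this).trans ?_
  rw [nsmul_eq_mul, mul_assoc]
  refine mul_le_mul_of_nonneg_right ?_ (by positivity)
  exact_mod_cast (Finset.card_le_univ _).trans (by simp)

/-- Operator bound of `Kop`. -/
def cK (n : ℕ) (M : ℝ) : ℝ := Real.exp (2 * M) * (2 * n * M)

lemma Kop_bd (hd : Good m p M lam d) {R t A : ℝ} (h : LB (R + M) t A u) :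
    LB R t (cK n M * A) (Kop m p d u) := by
  intro j x s hs
  have hw : ∀ ξ, |fl (d.α j) ξ x s - t| ≤ R + M := fun ξ => by
    have := abs_sub_le (fl (d.α j) ξ x s) s t
    linarith [(hd.hα j).fl_near ξ x s]
  refine (Ls_bd (hd.hα j) (hd.hβ j j) (xin_mem m j)
    (bq_bd hd.hp (fun k x => h k x _ (hw _)) j)
    (fun ξ _ => off_bd hd (fun k => h k ξ _ (hw ξ)) j)).trans (le_of_eq ?_)
  rw [cK]; ring

lemma Fop_bd (hd : Good m p M lam d) {R t A : ℝ} (h : LB (R + M) t A g) :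
    LB R t (Real.exp (2 * M) * A) (Fop m d g) := by
  intro j x s hs
  have hw : ∀ ξ, |fl (d.α j) ξ x s - t| ≤ R + M := fun ξ => by
    have := abs_sub_le (fl (d.α j) ξ x s) s t
    linarith [(hd.hα j).fl_near ξ x s]
  refine (Ls_bd (hd.hα j) (hd.hβ j j) (xin_mem m j) (A := 0) (by simp)
    (fun ξ _ => h j ξ _ (hw ξ))).trans (le_of_eq ?_)
  ring

/-- The equation along characteristics and the boundary conditions. -/
structure Sol (m : ℕ) (p : Fin n → Fin n → ℝ) (d : LD n) (g u : Fd n) : Prop where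
  char : ∀ j, CharD (d.α j) (u j) (fun x t => g j x t - ∑ k, d.β j k x t * u k x t)
  bc : ∀ j t, u j (xin m j) t = ∑ k, p j k * u k (xout m k) t

lemma sum_eq_off (d : LD n) (u : Fd n) (j : Fin n) (x t : ℝ) :
    ∑ k, d.β j k x t * u k x t = d.β j j x t * u j x t - off d u j x t := by
  rw [← Finset.add_sum_erase _ _ (Finset.mem_univ j), off, Finset.sum_neg_distrib]; ring

lemma Sol.eq (hd : Good m p M lam d) (hu : CF u) (hg : CF g) (h : Sol m p d g u) :
    u = Kop m p d u + Fop m d g := by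
  funext j x t
  have h1 := Ls_unique (h := fun x t => off d u j x t + g j x t) (hd.hα j) (hd.hβ j j)
    (xin_mem m j) ((h.char j).congr fun x _ t => by rw [sum_eq_off]; ring)
    ((off_cont hd hu j).add (hg.cont j)) (hu.clamp j) x t
  have h2 : u j (xin m j) = fun t => bq m p u j t + 0 := by
    funext t; rw [add_zero]; exact h.bc j t
  rw [h1, h2, Ls_add (q' := fun _ => 0) (hd.hα j) (hd.hβ j j) (off_cont hd hu j) (hg.cont j)]
  rfl

lemma Sol.of_eq (hd : Good m p M lam d) (hu : CF u) (hg : CF g)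
    (h : u = Kop m p d u + Fop m d g) : Sol m p d g u := by
  constructor
  · intro j
    have h1 := (Ls_charD (x0 := xin m j) (hd.hα j) (hd.hβ j j) (bq m p u j) (off_cont hd hu j)).add
      (Ls_charD (x0 := xin m j) (hd.hα j) (hd.hβ j j) (fun _ => 0) (hg.cont j))
    have h2 : u j = fun x t => Ls (d.α j) (d.β j j) (xin m j) (bq m p u j) (off d u j) x t +
      Ls (d.α j) (d.β j j) (xin m j) (fun _ => 0) (g j) x t := congrFun h j
    rw [← h2] at h1
    refine h1.congr fun x _ t => ?_
    have h3 := congrFun (congrFun h2 x) t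
    rw [sum_eq_off]
    linear_combination (d.β j j x t) * h3
  · intro j t
    have := congrFun (congrFun (congrFun h j) (xin m j)) t
    rw [this]
    simp only [Pi.add_apply, Kop, Fop, Ls_start (hd.hα j) (xin_mem m j), bq, add_zero]

lemma Kop_charD (hd : Good m p M lam d) (hu : CF u) (j : Fin n) :
    CharD (d.α j) (Kop m p d u j) (fun x t => off d u j x t - d.β j j x t * Kop m p d u j x t) :=
  Ls_charD (hd.hα j) (hd.hβ j j) _ (off_cont hd hu j)

end ops

section smoothing

variable {n m : ℕ} {p : Fin n → Fin n → ℝ} {M lam : ℝ} {d : LD n} {u v g : Fd n}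

/-- Integrating factor of the `j`-th equation. -/
def eF (m : ℕ) (d : LD n) (j : Fin n) (x t : ℝ) : ℝ :=
  Real.exp (T0 (d.α j) (xin m j) (fun _ => 0) (d.β j j) x t)

lemma eF_charD (hd : Good m p M lam d) (j : Fin n) :
    CharD (d.α j) (eF m d j) (fun x t => eF m d j x t * d.β j j x t) :=
  (T0_charD (hd.hα j) _ (hd.hβ j j).cont).exp (hd.hα j)

lemma eF_CT (hd : Good m p M lam d) (j : Fin n) :
    CT (M * Real.exp (2 * M) + Real.exp M) (eF m d j) (dt (eF m d j)) :=
  T0_expCT (hd.hα j) (hd.hβ j j) (xin_mem m j)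

lemma inv_sep_charD (hd : Good m p M lam d) {j k : Fin n} (hjk : j ≠ k) :
    ∃ rd : ℝ → ℝ → ℝ, (Continuous fun q : ℝ × ℝ => rd q.1 q.2) ∧
      (Continuous fun q : ℝ × ℝ => (d.α j q.1 q.2 - d.α k q.1 q.2)⁻¹) ∧
      (∀ x t, d.α j x t - d.α k x t ≠ 0) ∧
      (∀ x t, |(d.α j x t - d.α k x t)⁻¹| ≤ lam⁻¹) ∧
      (∀ x t, |rd x t| ≤ 2 * M * (1 + M) / lam ^ 2) ∧
      CharD (d.α j) (fun x t => (d.α j x t - d.α k x t)⁻¹) rd := by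
  obtain ⟨ax, cax, bax, dax⟩ := hd.αx j
  obtain ⟨bx, cbx, bbx, dbx⟩ := hd.αx k
  have hM := hd.hM
  have hlam := hd.hlam
  have hs : ∀ x t, lam ≤ |d.α j x t - d.α k x t| := fun x t => by
    rcases hd.sep j k hjk with h | h
    · exact (h x t).trans (le_abs_self _)
    · exact (h x t).trans (by rw [abs_sub_comm]; exact le_abs_self _)
  have h0 : ∀ x t, d.α j x t - d.α k x t ≠ 0 := fun x t h => by
    have := hs x t; rw [h, abs_zero] at this; linarith
  have hD := (hd.hα j).toTD.sub (hd.hα k).toTD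
  have hI := hD.inv h0
  have hc2 : ∀ {f : ℝ → ℝ → ℝ}, (Continuous fun q : ℝ × ℝ => f q.1 q.2) →
      Continuous fun q : ℝ × ℝ => f q.1 q.2 / (d.α j q.1 q.2 - d.α k q.1 q.2) ^ 2 := fun hf =>
    hf.div (hD.cont.pow 2) fun q => pow_ne_zero 2 (h0 _ _)
  have hb2 : ∀ {a b : ℝ} (x t : ℝ), |a| ≤ M → |b| ≤ M →
      |-(a - b) / (d.α j x t - d.α k x t) ^ 2| ≤ 2 * M / lam ^ 2 := fun x t ha hb => by
    rw [abs_div, abs_neg, abs_pow]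
    have := hs x t
    have := abs_sub _ _ |>.trans (add_le_add ha hb)
    gcongr
    linarith
  refine ⟨fun x t => -(ax x t - bx x t) / (d.α j x t - d.α k x t) ^ 2 + d.α j x t *
    (-(dt (d.α j) x t - dt (d.α k) x t) / (d.α j x t - d.α k x t) ^ 2), ?_, hI.cont, h0, ?_, ?_, ?_⟩
  · exact (hc2 (f := fun x t => -(ax x t - bx x t)) (cax.sub cbx).neg).add
      ((hd.hα j).cont.mul hI.contt)
  · intro x t
    rw [abs_inv]
    exact inv_anti₀ hlam (hs x t)
  · intro x t
    refine (abs_add_le _ _).trans ?_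
    rw [abs_mul]
    have h1 := hb2 x t (bax x t) (bbx x t)
    have h2 := hb2 x t ((hd.hα j).bdt x t) ((hd.hα k).bdt x t)
    have h3 := mul_le_mul ((hd.hα j).bd x t) h2 (abs_nonneg _) (by linarith)
    calc _ ≤ 2 * M / lam ^ 2 + M * (2 * M / lam ^ 2) := add_le_add h1 h3
      _ = _ := by ring
  · refine CharD.of_partial (hd.hα j) hI fun x hx t => ?_
    exact ((dax x hx t).fun_sub (dbx x hx t)).fun_inv (h0 x t)

/-- The weight in the integration by parts of the `k`-th term of the `j`-th equation. -/
lemma exists_weight (n m : ℕ) (p : Fin n → Fin n → ℝ) (M lam : ℝ) : ∃ W : ℝ, 0 ≤ W ∧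
    ∀ d : LD n, Good m p M lam d → ∀ j k : Fin n, j ≠ k → ∃ w wd : ℝ → ℝ → ℝ,
      CharD (d.α j) w wd ∧ (Continuous fun q : ℝ × ℝ => w q.1 q.2) ∧
      (Continuous fun q : ℝ × ℝ => wd q.1 q.2) ∧
      (∀ x t, -(eF m d j x t * d.β j k x t) = w x t * (d.α j x t - d.α k x t)) ∧
      (∀ x t, |-(dt (eF m d j) x t * d.β j k x t + eF m d j x t * dt (d.β j k) x t)| ≤ W) ∧
      (∀ x t, |w x t| ≤ W) ∧ ∀ x t, |wd x t| ≤ W := by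
  by_cases hMl : 0 ≤ M ∧ 0 < lam
  swap
  · exact ⟨0, le_rfl, fun d hd => absurd ⟨by linarith [hd.hM], hd.hlam⟩ hMl⟩
  obtain ⟨hM, hlam⟩ := hMl
  set E := M * Real.exp (2 * M) + Real.exp M
  have hE : 0 ≤ E := by positivity
  refine ⟨(E * M + E * M) + E * M * lam⁻¹ + ((E * M * M + E * (M + M * M)) * lam⁻¹ +
    E * M * (2 * M * (1 + M) / lam ^ 2)), by positivity, fun d hd j k hjk => ?_⟩
  obtain ⟨rd, crd, cr, h0, br, brd, hr⟩ := inv_sep_charD hd hjk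
  obtain ⟨bx, cbx, bbx, dbx⟩ := hd.βx j k hjk
  have he := eF_CT hd j
  have hβ := hd.hβ j k
  have hcβ := CharD.of_partial (hd.hα j) hβ.toTD dbx
  have hc := (((eF_charD hd j).mul (hd.hα j) hcβ).mul (hd.hα j) hr).neg
  have ab : ∀ {a b A B : ℝ}, |a| ≤ A → |b| ≤ B → |a * b| ≤ A * B := fun ha hb => by
    rw [abs_mul]; exact mul_le_mul ha hb (abs_nonneg _) ((abs_nonneg _).trans ha)
  have ad : ∀ {a b A B : ℝ}, |a| ≤ A → |b| ≤ B → |a + b| ≤ A + B := fun ha hb =>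
    (abs_add_le _ _).trans (add_le_add ha hb)
  have p1 : 0 ≤ E * M + E * M := by positivity
  have p2 : 0 ≤ E * M * lam⁻¹ := by positivity
  have p3 : 0 ≤ (E * M * M + E * (M + M * M)) * lam⁻¹ +
    E * M * (2 * M * (1 + M) / lam ^ 2) := by positivity
  refine ⟨_, _, hc, ((he.cont.mul hβ.cont).mul cr).neg, ?_, ?_, ?_, ?_, ?_⟩
  · exact (((((he.cont.mul (hd.hβ j j).cont).mul hβ.cont).add (he.cont.mul
      (cbx.add ((hd.hα j).cont.mul hβ.contt)))).mul cr).add ((he.cont.mul hβ.cont).mul crd)).neg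
  · intro x t
    have := h0 x t
    field_simp
  · intro x t
    rw [abs_neg]
    refine (ad (ab (he.bdt x t) (hβ.bd x t)) (ab (he.bd x t) (hβ.bdt x t))).trans ?_
    linarith
  · intro x t
    rw [abs_neg]
    refine (ab (ab (he.bd x t) (hβ.bd x t)) (br x t)).trans ?_
    linarith
  · intro x t
    rw [abs_neg]
    refine (ad (ab (ad (ab (ab (he.bd x t) ((hd.hβ j j).bd x t)) (hβ.bd x t)) (ab (he.bd x t)
      (ad (bbx x t) (ab ((hd.hα j).bd x t) (hβ.bdt x t))))) (br x t))
      (ab (ab (he.bd x t) (hβ.bd x t)) (brd x t))).trans ?_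
    linarith

lemma Kop_row_smoothing (n m : ℕ) (p : Fin n → Fin n → ℝ) (M lam : ℝ) : ∃ C : ℝ, 0 ≤ C ∧
    ∀ d : LD n, Good m p M lam d → ∀ v h : Fd n, TF v → (∀ k, CharD (d.α k) (v k) (h k)) →
      (∀ k, Continuous fun q : ℝ × ℝ => h k q.1 q.2) → ∀ (j : Fin n) (x t A B : ℝ),
      LB M t A v → LB M t A h → |bq m p (dF v) j (fl (d.α j) (xin m j) x t)| ≤ B →
      |dF (Kop m p d v) j x t| ≤ C * (A + B) := by
  obtain ⟨W, hW, hw⟩ := exists_weight n m p M lam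
  by_cases hM : 1 ≤ M
  swap
  · exact ⟨0, le_rfl, fun d hd => absurd hd.hM hM⟩
  refine ⟨2 * M * Real.exp (3 * M) * (n * M) + Real.exp (2 * M) +
    Real.exp M * (n * (Real.exp M * (W * (5 + M)))), by positivity, ?_⟩
  intro d hd v h hv hvh hh j x t A B hA hB hb
  have hA0 : 0 ≤ A := (abs_nonneg _).trans (hA j x t (by simp; linarith))
  have hB0 : 0 ≤ B := (abs_nonneg _).trans hb
  have hwd : ∀ ξ, |fl (d.α j) ξ x t - t| ≤ M := fun ξ => (hd.hα j).fl_near ξ x t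
  have hJ : |∫ ξ in xin m j..cl x, (dt (eF m d j) ξ (fl (d.α j) ξ x t) *
        off d v j ξ (fl (d.α j) ξ x t) + eF m d j ξ (fl (d.α j) ξ x t) *
        (∑ k ∈ Finset.univ.erase j, -(dt (d.β j k) ξ (fl (d.α j) ξ x t) * v k ξ (fl (d.α j) ξ x t) +
          d.β j k ξ (fl (d.α j) ξ x t) * dF v k ξ (fl (d.α j) ξ x t)))) *
        flt (d.α j) (dt (d.α j)) ξ x t| ≤ n * (Real.exp M * (A * W * (5 + M))) := by
    have hce : ∀ {f : ℝ → ℝ → ℝ}, (Continuous fun q : ℝ × ℝ => f q.1 q.2) →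
        Continuous fun ξ => f ξ (fl (d.α j) ξ x t) := fun hf =>
      hf.comp (continuous_id.prodMk ((hd.hα j).fl_cont₁ x t))
    have hflt : Continuous fun ξ => flt (d.α j) (dt (d.α j)) ξ x t :=
      (hd.hα j).flt_cont continuous_id continuous_const continuous_const
    have hct : ∀ k, Continuous fun q : ℝ × ℝ => -(dt (eF m d j) q.1 q.2 * d.β j k q.1 q.2 +
        eF m d j q.1 q.2 * dt (d.β j k) q.1 q.2) := fun k =>
      (((eF_CT hd j).contt.mul (hd.hβ j k).cont).add ((eF_CT hd j).cont.mul (hd.hβ j k).contt)).neg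
    rw [intervalIntegral.integral_congr (g := fun ξ => ∑ k ∈ Finset.univ.erase j,
      ((-(dt (eF m d j) ξ (fl (d.α j) ξ x t) * d.β j k ξ (fl (d.α j) ξ x t) +
        eF m d j ξ (fl (d.α j) ξ x t) * dt (d.β j k) ξ (fl (d.α j) ξ x t))) *
        v k ξ (fl (d.α j) ξ x t) + -(eF m d j ξ (fl (d.α j) ξ x t) * d.β j k ξ (fl (d.α j) ξ x t)) *
        dF v k ξ (fl (d.α j) ξ x t)) * flt (d.α j) (dt (d.α j)) ξ x t)]
    · rw [intervalIntegral.integral_finsetSum]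
      · refine (Finset.abs_sum_le_sum_abs _ _).trans ?_
        have : ∀ k ∈ (Finset.univ : Finset (Fin n)).erase j, _ ≤ Real.exp M * (A * W * (5 + M)) :=
          fun k hk => by
          have hjk : j ≠ k := fun h => (Finset.ne_of_mem_erase hk) h.symm
          obtain ⟨w, wd, h1, h2, h3, h4, h5, h6, h7⟩ := hw d hd j k hjk
          exact smoothing_bound (ct := fun x t => -(dt (eF m d j) x t * d.β j k x t +
            eF m d j x t * dt (d.β j k) x t)) (c := fun x t => -(eF m d j x t * d.β j k x t))
            (x0 := xin m j) (hd.hα j) (hd.hα k) (xin_mem m j) (hvh k) (hv.td k) (hh k) h1 h2 h3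
            (hct k) h4 h5 h6 h7 x t (fun ξ => hA k ξ _ (hwd ξ)) (fun ξ => hB k ξ _ (hwd ξ))
        refine (Finset.sum_le_card_nsmul _ _ _ this).trans ?_
        rw [nsmul_eq_mul]
        refine mul_le_mul_of_nonneg_right ?_ (by positivity)
        exact_mod_cast (Finset.card_le_univ _).trans (by simp)
      · intro k _
        refine Continuous.intervalIntegrable ?_ _ _
        exact (((hce (f := fun x t => -(dt (eF m d j) x t * d.β j k x t +
            eF m d j x t * dt (d.β j k) x t)) (hct k)).mul (hce (hv.td k).cont)).add
          ((hce (f := fun x t => -(eF m d j x t * d.β j k x t))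
            ((eF_CT hd j).cont.mul (hd.hβ j k).cont).neg).mul (hce (hv.td k).contt))).mul hflt
    · intro ξ _
      simp only [off]
      rw [Finset.mul_sum, Finset.mul_sum, ← Finset.sum_add_distrib, Finset.sum_mul]
      refine Finset.sum_congr rfl fun k _ => ?_
      ring
  have := Ls_dt_bd (hd.hα j) (hd.hβ j j) (xin_mem m j) (bq_deriv hv j) (bq_dF_cont hv j)
    (off_TD hd hv j) (A := n * M * A) (B := B) (x := x) (t := t)
    (bq_bd hd.hp (fun k x => hA k x _ (hwd _)) j) hb
    (fun ξ _ => off_bd hd (fun k => hA k ξ _ (hwd ξ)) j) hJ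
  refine (show |dF (Kop m p d v) j x t| ≤ _ from this).trans ?_
  have e1 : 0 ≤ 2 * M * Real.exp (3 * M) * (n * M) := by positivity
  have e2 : 0 ≤ Real.exp (2 * M) := by positivity
  have e3 : 0 ≤ Real.exp M * (n * (Real.exp M * (W * (5 + M)))) := by positivity
  nlinarith [mul_nonneg e1 hB0, mul_nonneg e2 hA0, mul_nonneg e3 hB0]

end smoothing

section regularity

variable {n m : ℕ} {p : Fin n → Fin n → ℝ} {M lam : ℝ} {d : LD n} {u v g : Fd n}

/-- Derivative bound of the transport solution operator. -/
def cL (M : ℝ) : ℝ := 2 * M * Real.exp (3 * M) + Real.exp (2 * M) +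
  Real.exp M * ((M * Real.exp (2 * M) + Real.exp M) * Real.exp M)

lemma Ls_dt_bd_of_dt {α αt b bt : ℝ → ℝ → ℝ} {x0 : ℝ} (hα : CT M α αt) (hb : CT M b bt)
    (h0 : x0 ∈ Icc (0:ℝ) 1) {q q' : ℝ → ℝ}
    {h ht : ℝ → ℝ → ℝ} (hq : ∀ t, HasDerivAt q (q' t) t) (hq' : Continuous q') (hh : TD h ht)
    {A B x t : ℝ} (bq : |q (fl α x0 x t)| ≤ A) (bq' : |q' (fl α x0 x t)| ≤ B)
    (bh : ∀ ξ, |h ξ (fl α ξ x t)| ≤ A) (bht : ∀ ξ, |ht ξ (fl α ξ x t)| ≤ B) :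
    |dt (Ls α b x0 q h) x t| ≤ cL M * (A + B) := by
  have hM := hα.nonneg
  have hA : 0 ≤ A := (abs_nonneg _).trans bq
  have hB : 0 ≤ B := (abs_nonneg _).trans bq'
  have he := T0_expCT (x0 := x0) hα hb h0
  set E := M * Real.exp (2 * M) + Real.exp M
  have hE : 0 ≤ E := by positivity
  refine (Ls_dt_bd hα hb h0 hq hq' hh bq bq' (fun ξ _ => bh ξ)
    (J := (E * A + E * B) * Real.exp M) ?_).trans ?_
  · refine abs_integral_cl_le_of_mem h0 (fun ξ _ => ?_) x
    rw [abs_mul, abs_of_pos (flt_pos _ _ _ _ _)]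
    refine mul_le_mul ?_ (hα.flt_le _ _ _) (flt_pos _ _ _ _ _).le (by positivity)
    refine (abs_add_le _ _).trans (add_le_add ?_ ?_)
    · rw [abs_mul]; exact mul_le_mul (he.bdt _ _) (bh ξ) (abs_nonneg _) hE
    · rw [abs_mul]; exact mul_le_mul (he.bd _ _) (bht ξ) (abs_nonneg _) hE
  · rw [cL]
    have e1 : 0 ≤ 2 * M * Real.exp (3 * M) * B := by positivity
    have e2 : 0 ≤ Real.exp (2 * M) * A := by positivity
    linarith [mul_comm (Real.exp M) 1]

/-- Derivative bound of `Kop`. -/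
def cD (n : ℕ) (M : ℝ) : ℝ := cL M * (3 * (n * M + 1))

lemma cL_nonneg {M : ℝ} (hM : 0 ≤ M) : 0 ≤ cL M := by unfold cL; positivity

lemma cK_nonneg (n : ℕ) {M : ℝ} (hM : 1 ≤ M) : 0 ≤ cK n M := by unfold cK; positivity

lemma cD_nonneg (n : ℕ) {M : ℝ} (hM : 1 ≤ M) : 0 ≤ cD n M := by
  have := cL_nonneg (show 0 ≤ M by linarith)
  unfold cD; positivity

lemma Kop_dt_bd (hd : Good m p M lam d) (hu : TF u) {R t A B : ℝ} (h : LB (R + M) t A u)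
    (h' : LB (R + M) t B (dF u)) : LB R t (cD n M * (A + B)) (dF (Kop m p d u)) := by
  intro j x s hs
  have hM := hd.hM
  have hw : ∀ ξ, |fl (d.α j) ξ x s - t| ≤ R + M := fun ξ => by
    have := abs_sub_le (fl (d.α j) ξ x s) s t
    linarith [(hd.hα j).fl_near ξ x s]
  have hA : 0 ≤ A := (abs_nonneg _).trans (h j x s (by linarith))
  have hB : 0 ≤ B := (abs_nonneg _).trans (h' j x s (by linarith))
  have b1 : ∀ ξ, |off d (dF u) j ξ (fl (d.α j) ξ x s)| ≤ n * M * B := fun ξ =>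
    off_bd hd (fun k => h' k ξ _ (hw ξ)) j
  have b2 : ∀ ξ, |∑ k ∈ Finset.univ.erase j, -(dt (d.β j k) ξ (fl (d.α j) ξ x s) *
      u k ξ (fl (d.α j) ξ x s))| ≤ n * M * A := fun ξ => by
    refine (Finset.abs_sum_le_sum_abs _ _).trans ?_
    have : ∀ k ∈ (Finset.univ : Finset (Fin n)).erase j, |-(dt (d.β j k) ξ (fl (d.α j) ξ x s) *
        u k ξ (fl (d.α j) ξ x s))| ≤ M * A :=
      fun k _ => by
        rw [abs_neg, abs_mul]
        exact mul_le_mul ((hd.hβ j k).bdt _ _) (h k ξ _ (hw ξ)) (abs_nonneg _) (by linarith)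
    refine (Finset.sum_le_card_nsmul _ _ _ this).trans ?_
    rw [nsmul_eq_mul, mul_assoc]
    refine mul_le_mul_of_nonneg_right ?_ (by positivity)
    exact_mod_cast (Finset.card_le_univ _).trans (by simp)
  have hnM : 0 ≤ n * M := by positivity
  refine (Ls_dt_bd_of_dt (hd.hα j) (hd.hβ j j) (xin_mem m j) (bq_deriv hu j) (bq_dF_cont hu j)
    (off_TD hd hu j) (A := n * M * A) (B := n * M * (A + B))
    (bq_bd hd.hp (fun k x => h k x _ (hw _)) j)
    ((bq_bd hd.hp (fun k x => h' k x _ (hw _)) j).trans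
      (mul_le_mul_of_nonneg_left (by linarith) hnM))
    (fun ξ => off_bd hd (fun k => h k ξ _ (hw ξ)) j) (fun ξ => ?_)).trans ?_
  · simp only [neg_add, Finset.sum_add_distrib]
    refine (abs_add_le _ _).trans ((add_le_add (b2 ξ) (b1 ξ)).trans (le_of_eq (by ring)))
  · rw [cD, mul_assoc (cL M)]
    refine mul_le_mul_of_nonneg_left ?_ (cL_nonneg (by linarith))
    nlinarith [mul_nonneg hnM hA, mul_nonneg hnM hB]

lemma Fop_dt_bd (hd : Good m p M lam d) (hg : TF g) {R t A B : ℝ} (h : LB (R + M) t A g)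
    (h' : LB (R + M) t B (dF g)) : LB R t (cD n M * (A + B)) (dF (Fop m d g)) := by
  intro j x s hs
  have hM := hd.hM
  have hw : ∀ ξ, |fl (d.α j) ξ x s - t| ≤ R + M := fun ξ => by
    have := abs_sub_le (fl (d.α j) ξ x s) s t
    linarith [(hd.hα j).fl_near ξ x s]
  have hA : 0 ≤ A := (abs_nonneg _).trans (h j x s (by linarith))
  have hB : 0 ≤ B := (abs_nonneg _).trans (h' j x s (by linarith))
  refine (Ls_dt_bd_of_dt (hd.hα j) (hd.hβ j j) (xin_mem m j) (fun t => hasDerivAt_const t (0:ℝ))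
    continuous_const (hg.td j) (A := A) (B := B) (by simpa using hA) (by simpa using hB)
    (fun ξ => h j ξ _ (hw ξ)) (fun ξ => h' j ξ _ (hw ξ))).trans ?_
  rw [cD, mul_assoc (cL M)]
  refine mul_le_mul_of_nonneg_left ?_ (cL_nonneg (by linarith))
  have : 0 ≤ (n:ℝ) * M := by positivity
  nlinarith

/-- There is a chain of `i` nonzero reflection coefficients starting at `j`. -/
def RPath (p : Fin n → Fin n → ℝ) : ℕ → Fin n → Prop
  | 0, _ => True
  | i + 1, j => ∃ k, p j k ≠ 0 ∧ RPath p i k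

lemma RPath.exists_chain : ∀ (i : ℕ) (j : Fin n), RPath p i j →
    ∃ f : Fin (i + 1) → Fin n, f 0 = j ∧ ∀ l : Fin i, p (f l.castSucc) (f l.succ) ≠ 0
  | 0, j, _ => ⟨fun _ => j, rfl, fun l => l.elim0⟩
  | i + 1, j, ⟨k, hk, h⟩ => by
    obtain ⟨f, hf, hl⟩ := RPath.exists_chain i k h
    refine ⟨Fin.cons j f, rfl, fun l => ?_⟩
    refine Fin.cases ?_ (fun l => ?_) l
    · simpa [hf] using hk
    · simpa only [Fin.castSucc_succ, Fin.cons_succ] using hl l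

lemma H3cond.not_path (h : H3cond n p) (j : Fin n) : ¬ RPath p n j := fun hj => by
  obtain ⟨f, -, hf⟩ := RPath.exists_chain n j hj
  exact (Finset.prod_ne_zero_iff.mpr fun l _ => hf l) (h f)

lemma Kiter_TF (hd : Good m p M lam d) (hu : TF u) (i : ℕ) : TF ((Kop m p d)^[i] u) := by
  induction i with
  | zero => exact hu
  | succ i ih => rw [Function.iterate_succ_apply']; exact Kop_TF hd ih

lemma Kiter_bd (hd : Good m p M lam d) (i : ℕ) {R t A : ℝ} (h : LB (R + i * M) t A u) :
    LB R t (cK n M ^ i * A) ((Kop m p d)^[i] u) := by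
  induction i generalizing R with
  | zero => simpa using h
  | succ i ih =>
    rw [Function.iterate_succ_apply', pow_succ', mul_assoc]
    refine Kop_bd hd (ih ?_)
    push_cast at h
    convert h using 1; ring

lemma Kiter_row_smoothing (p : Fin n → Fin n → ℝ) (m : ℕ) (M lam : ℝ) (i : ℕ) : ∃ C : ℝ, 0 ≤ C ∧
    ∃ R : ℝ, 0 ≤ R ∧ ∀ d : LD n, Good m p M lam d → ∀ u, TF u → ∀ t A, LB R t A u → ∀ j,
      ¬ RPath p i j → ∀ x, |dF ((Kop m p d)^[i + 1] u) j x t| ≤ C * A := by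
  induction i with
  | zero => exact ⟨0, le_rfl, 0, le_rfl, fun d _ u _ t A _ j h => absurd trivial h⟩
  | succ i ih =>
    obtain ⟨C, hC, R, hR, H⟩ := ih
    obtain ⟨C', hC', H'⟩ := Kop_row_smoothing n m p M lam
    by_cases hM : 1 ≤ M
    swap
    · exact ⟨0, le_rfl, 0, le_rfl, fun d hd => absurd hd.hM hM⟩
    have hcK := cK_nonneg n hM
    refine ⟨C' * (cK n M ^ (i + 1) + n * M * cK n M ^ i + M * cK n M ^ (i + 1) + n * (M * C)),
      by positivity, R + (i + 2) * M, by positivity, fun d hd u hu t A hA j hj x => ?_⟩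
    have hA0 : 0 ≤ A := (abs_nonneg _).trans (hA j x t (by simp; positivity))
    have h1 : LB M t (cK n M ^ i * A) ((Kop m p d)^[i] u) :=
      Kiter_bd hd i (hA.mono (by simp; nlinarith) le_rfl)
    have h2 : LB M t (cK n M ^ (i + 1) * A) ((Kop m p d)^[i + 1] u) :=
      Kiter_bd hd (i + 1) (hA.mono (by push_cast; simp; nlinarith) le_rfl)
    have hv := Kiter_TF hd hu i
    have hv' := Kiter_TF hd hu (i + 1)
    rw [Function.iterate_succ_apply']
    set v := (Kop m p d)^[i] u with hvdef
    have hKv : (Kop m p d)^[i + 1] u = Kop m p d v := Function.iterate_succ_apply' _ _ _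
    have hq1 : 0 ≤ cK n M ^ (i + 1) * A := by positivity
    have hq2 : 0 ≤ n * M * (cK n M ^ i * A) := by positivity
    have hq3 : 0 ≤ M * (cK n M ^ (i + 1) * A) := by positivity
    refine (H' d hd _ (fun k x t => off d v k x t - d.β k k x t * (Kop m p d)^[i + 1] u k x t)
      hv' (fun k => ?_) (fun k => ?_) j x t (cK n M ^ (i + 1) * A + n * M * (cK n M ^ i * A) +
        M * (cK n M ^ (i + 1) * A)) (n * (M * C) * A) (h2.mono (by simp) (by linarith)) ?_ ?_).trans
        (le_of_eq (by ring))
    · rw [hKv]; exact Kop_charD hd hv.toCF k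
    · exact (off_cont hd hv.toCF k).sub ((hd.hβ k k).cont.mul (hv'.toCF.cont k))
    · intro k y s hs
      refine (abs_sub _ _).trans ?_
      have e1 := off_bd hd (fun l => h1 l y s hs) k
      have e2 : |d.β k k y s * (Kop m p d)^[i + 1] u k y s| ≤ M * (cK n M ^ (i + 1) * A) := by
        rw [abs_mul]
        exact mul_le_mul ((hd.hβ k k).bd _ _) (h2 k y s hs) (abs_nonneg _) (by linarith)
      linarith
    · refine (Finset.abs_sum_le_sum_abs _ _).trans ?_
      have : ∀ k ∈ (Finset.univ : Finset (Fin n)), |p j k * dF ((Kop m p d)^[i + 1] u) k (xout m k)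
          (fl (d.α j) (xin m j) x t)| ≤ M * C * A := fun k _ => by
        by_cases hk : p j k = 0
        · rw [hk, zero_mul, abs_zero]; positivity
        · rw [abs_mul, mul_assoc]
          refine mul_le_mul (hd.hp j k) (H d hd u hu _ A (hA.mono ?_ le_rfl) k
            (fun h => hj ⟨k, hk, h⟩) _) (abs_nonneg _) (by linarith)
          have := (hd.hα j).fl_near (xin m j) x t
          nlinarith
      refine (Finset.sum_le_card_nsmul _ _ _ this).trans (le_of_eq ?_)
      simp; ring

lemma Kiter_smoothing (hH : H3cond n p) (m : ℕ) (M lam : ℝ) : ∃ C : ℝ, 0 ≤ C ∧ ∃ R : ℝ, 0 ≤ R ∧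
    ∀ d : LD n, Good m p M lam d → ∀ u, TF u → ∀ R0 t A, LB (R0 + R) t A u →
      LB R0 t (C * A) (dF ((Kop m p d)^[n + 1] u)) := by
  obtain ⟨C, hC, R, hR, H⟩ := Kiter_row_smoothing p m M lam n
  exact ⟨C, hC, R, hR, fun d hd u hu R0 t A h j x s hs =>
    H d hd u hu s A (h.mono (by linarith) le_rfl) j (hH.not_path j) x⟩

lemma LB.add {R t A B : ℝ} (hu : LB R t A u) (hv : LB R t B v) : LB R t (A + B) (u + v) :=
  fun j x s hs => (abs_add_le _ _).trans (add_le_add (hu j x s hs) (hv j x s hs))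

lemma LB.sub {R t A B : ℝ} (hu : LB R t A u) (hv : LB R t B v) : LB R t (A + B) (u - v) :=
  fun j x s hs => (abs_sub _ _).trans (add_le_add (hu j x s hs) (hv j x s hs))

lemma sub_Kiter_succ (hd : Good m p M lam d) (hu : TF u) (i : ℕ) :
    u - (Kop m p d)^[i + 1] u = (u - Kop m p d u) + Kop m p d (u - (Kop m p d)^[i] u) := by
  rw [Function.iterate_succ_apply', Kop_sub hd hu.toCF (Kiter_TF hd hu i).toCF]
  abel

lemma sub_Kiter_dt (p : Fin n → Fin n → ℝ) (m : ℕ) (M lam : ℝ) (i : ℕ) : ∃ C : ℝ, 0 ≤ C ∧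
    ∀ d : LD n, Good m p M lam d → ∀ u, TF u → ∀ R0 t A B, LB (R0 + i * M) t A u →
      LB (R0 + i * M) t B (dF (u - Kop m p d u)) →
      LB R0 t (C * (A + B)) (dF (u - (Kop m p d)^[i] u)) := by
  induction i with
  | zero =>
    refine ⟨0, le_rfl, fun d hd u hu R0 t A B _ _ => ?_⟩
    simp only [Function.iterate_zero, id, sub_self, zero_mul]
    have : dF (0 : Fd n) = 0 := by
      funext j; exact TD.zero.eq_dt.symm
    rw [this]; intro j x s _; simp
  | succ i ih =>
    obtain ⟨C, hC, H⟩ := ih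
    by_cases hM : 1 ≤ M
    swap
    · exact ⟨0, le_rfl, fun d hd => absurd hd.hM hM⟩
    have hcK := cK_nonneg n hM
    have hcD := cD_nonneg n hM
    refine ⟨1 + cD n M * ((1 + cK n M ^ i) + C), by positivity, fun d hd u hu R0 t A B hA hB => ?_⟩
    intro j x s hs
    have hA0 : 0 ≤ A := (abs_nonneg _).trans (hA j x s (hs.trans (by
      have : 0 ≤ ((i + 1 : ℕ) : ℝ) * M := by positivity
      linarith)))
    have hB0 : 0 ≤ B := (abs_nonneg _).trans (hB j x s (hs.trans (by
      have : 0 ≤ ((i + 1 : ℕ) : ℝ) * M := by positivity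
      linarith)))
    have hK := Kop_TF hd hu
    have hKi := Kiter_TF hd hu i
    rw [sub_Kiter_succ hd hu, TF.dF_add (hu.sub hK) (Kop_TF hd (hu.sub hKi))]
    push_cast at hA hB
    have hiM : 0 ≤ (i:ℝ) * M := by positivity
    have b1 : LB (R0 + M) t (A + cK n M ^ i * A) (u - (Kop m p d)^[i] u) :=
      LB.sub (hA.mono (by simp; linarith) le_rfl) (Kiter_bd hd i (hA.mono (by simp; linarith) le_rfl))
    have b2 := Kop_dt_bd hd (hu.sub hKi) b1 (H d hd u hu (R0 + M) t A B
      (hA.mono (by simp; linarith) le_rfl) (hB.mono (by simp; linarith) le_rfl))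
    refine ((LB.add (hB.mono (R' := R0) (by simp; nlinarith) le_rfl) b2) j x s hs).trans ?_
    have k1 : 0 ≤ cD n M * ((1 + cK n M ^ i)) * B := by positivity
    nlinarith

/-- Local regularity: `u - Ku` controls the `t`-derivative of `u`. -/
lemma reg_local (hH : H3cond n p) (m : ℕ) (M lam : ℝ) : ∃ C : ℝ, 0 ≤ C ∧ ∃ R : ℝ, 0 ≤ R ∧
    ∀ d : LD n, Good m p M lam d → ∀ u, TF u → ∀ R0 t A B, LB (R0 + R) t A u →
      LB (R0 + R) t B (dF (u - Kop m p d u)) → LB R0 t (C * (A + B)) (dF u) := by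
  obtain ⟨C, hC, R, hR, H⟩ := Kiter_smoothing hH m M lam
  obtain ⟨C', hC', H'⟩ := sub_Kiter_dt p m M lam (n + 1)
  by_cases hM : 1 ≤ M
  swap
  · exact ⟨0, le_rfl, 0, le_rfl, fun d hd => absurd hd.hM hM⟩
  have hq : 0 ≤ ((n + 1 : ℕ) : ℝ) * M := by positivity
  refine ⟨C + C', by positivity, R + ((n + 1 : ℕ) : ℝ) * M, by positivity,
    fun d hd u hu R0 t A B hA hB => ?_⟩
  have hK := Kiter_TF hd hu (n + 1)
  have e : u = (u - (Kop m p d)^[n + 1] u) + (Kop m p d)^[n + 1] u := by abel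
  intro j x s hs
  have hB0 : 0 ≤ B := (abs_nonneg _).trans (hB j x s (by linarith))
  rw [e, TF.dF_add (hu.sub hK) hK]
  refine (LB.add (H' d hd u hu R0 t A B (hA.mono (by rw [sub_self, abs_zero]; linarith) le_rfl)
    (hB.mono (by rw [sub_self, abs_zero]; linarith) le_rfl)) (H d hd u hu R0 t A (hA.mono (by rw [sub_self, abs_zero]; linarith) le_rfl))
    j x s hs).trans ?_
  nlinarith [mul_nonneg hC hB0]

/-- Sup-closeness of the coefficients. -/
def Near (ρ : ℝ) (d d' : LD n) : Prop :=
  (∀ j x t, |d.α j x t - d'.α j x t| ≤ ρ) ∧ ∀ j k x t, |d.β j k x t - d'.β j k x t| ≤ ρ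

lemma Kop_diff_bd (p : Fin n → Fin n → ℝ) (m : ℕ) (M lam : ℝ) : ∃ C : ℝ, 0 ≤ C ∧
    ∀ d d' : LD n, Good m p M lam d → Good m p M lam d' → ∀ ρ, Near ρ d d' → ∀ u, TF u →
    ∀ R t A B, LB (R + 2 * M) t A u → LB (R + 2 * M) t B (dF u) →
      LB R t (C * ρ * (A + B)) (Kop m p d u - Kop m p d' u) := by
  by_cases hM : 1 ≤ M
  swap
  · exact ⟨0, le_rfl, fun d d' hd => absurd hd.hM hM⟩
  have hcK := cK_nonneg n hM
  have hcD := cD_nonneg n hM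
  refine ⟨Real.exp (2 * M) * (n + cK n M + cD n M), by positivity, ?_⟩
  intro d d' hd hd' ρ hρ u hu R t A B hA hB j x s hs
  have hρ0 : 0 ≤ ρ := (abs_nonneg _).trans (hρ.1 j x t)
  have hA0 : 0 ≤ A := (abs_nonneg _).trans (hA j x s (by linarith))
  have hB0 : 0 ≤ B := (abs_nonneg _).trans (hB j x s (by linarith))
  have hv := Kop_TF hd hu
  have hv' := Kop_TF hd' hu
  have bK : LB (R + M) t (cK n M * A) (Kop m p d u) :=
    Kop_bd hd (hA.mono (by rw [sub_self, abs_zero]; linarith) le_rfl)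
  have bD : LB (R + M) t (cD n M * (A + B)) (dF (Kop m p d u)) :=
    Kop_dt_bd hd hu (hA.mono (by simp; linarith) le_rfl) (hB.mono (by simp; linarith) le_rfl)
  set v := Kop m p d u
  set v' := Kop m p d' u
  have c1 := ((Kop_charD hd hu.toCF j).change (hd.hα j) (hd'.hα j) (hv.td j)).sub
    (Kop_charD hd' hu.toCF j)
  set H : ℝ → ℝ → ℝ := fun x t => (off d u j x t - off d' u j x t) -
    (d.β j j x t - d'.β j j x t) * v j x t + (d'.α j x t - d.α j x t) * dF v j x t with hH
  have cH : Continuous fun q : ℝ × ℝ => H q.1 q.2 :=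
    (((off_cont hd hu.toCF j).sub (off_cont hd' hu.toCF j)).sub
      (((hd.hβ j j).cont.sub (hd'.hβ j j).cont).mul (hv.toCF.cont j))).add
      (((hd'.hα j).cont.sub (hd.hα j).cont).mul (hv.td j).contt)
  have e := Ls_unique (v := fun x t => v j x t - v' j x t) (h := H) (hd'.hα j) (hd'.hβ j j)
    (xin_mem m j) (c1.congr fun x _ t => by simp only [hH]; ring) cH
    (fun x t => by rw [hv.clamp, hv'.clamp]) x s
  have e0 : (fun t => v j (xin m j) t - v' j (xin m j) t) = fun _ => 0 := by
    funext t
    simp only [v, v', Kop, Ls_start (hd.hα j) (xin_mem m j), Ls_start (hd'.hα j) (xin_mem m j),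
      sub_self]
  simp only [e0] at e
  have hw : ∀ ξ, |fl (d'.α j) ξ x s - t| ≤ R + M := fun ξ => by
    have := abs_sub_le (fl (d'.α j) ξ x s) s t
    linarith [(hd'.hα j).fl_near ξ x s]
  show |v j x s - v' j x s| ≤ _
  rw [e]
  refine (Ls_bd (hd'.hα j) (hd'.hβ j j) (xin_mem m j) (A := 0)
    (B := n * (ρ * A) + ρ * (cK n M * A) + ρ * (cD n M * (A + B))) (by simp) (fun ξ _ => ?_)).trans ?_
  · have hz := hw ξ
    generalize fl (d'.α j) ξ x s = z at hz
    refine (abs_add_le _ _).trans (add_le_add ((abs_sub _ _).trans (add_le_add ?_ ?_)) ?_)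
    · simp only [off]
      rw [← Finset.sum_sub_distrib]
      refine (Finset.abs_sum_le_sum_abs _ _).trans ?_
      have : ∀ k ∈ (Finset.univ : Finset (Fin n)).erase j, |-(d.β j k ξ z * u k ξ z) -
          -(d'.β j k ξ z * u k ξ z)| ≤ ρ * A := fun k _ => by
        rw [show -(d.β j k ξ z * u k ξ z) - -(d'.β j k ξ z * u k ξ z) =
          -((d.β j k ξ z - d'.β j k ξ z) * u k ξ z) by ring, abs_neg, abs_mul]
        exact mul_le_mul (hρ.2 j k _ _) (hA k ξ z (by linarith)) (abs_nonneg _) hρ0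
      refine (Finset.sum_le_card_nsmul _ _ _ this).trans ?_
      rw [nsmul_eq_mul]
      refine mul_le_mul_of_nonneg_right ?_ (by positivity)
      exact_mod_cast (Finset.card_le_univ _).trans (by simp)
    · rw [abs_mul]; exact mul_le_mul (hρ.2 j j _ _) (bK j ξ z hz) (abs_nonneg _) hρ0
    · rw [abs_mul, abs_sub_comm]
      exact mul_le_mul (hρ.1 j _ _) (bD j ξ z hz) (abs_nonneg _) hρ0
  · rw [zero_add, mul_assoc (Real.exp _), mul_assoc (Real.exp _)]
    refine mul_le_mul_of_nonneg_left ?_ (by positivity)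
    have k1 : 0 ≤ n * (ρ * B) := by positivity
    have k2 : 0 ≤ ρ * (cK n M * B) := by positivity
    nlinarith

end regularity

section limits

variable {n m : ℕ} {p : Fin n → Fin n → ℝ} {M lam : ℝ} {d : LD n} {u v g : Fd n}

/-- Locally uniform (in `t`) convergence of fields. -/
def LC (f : ℕ → Fd n) (u : Fd n) : Prop :=
  ∀ T ε : ℝ, 0 < ε → ∃ N, ∀ i ≥ N, LB T 0 ε (u - f i)

/-- Locally uniform Cauchy condition. -/
def LCauchy (f : ℕ → Fd n) : Prop :=
  ∀ T ε : ℝ, 0 < ε → ∃ N, ∀ i ≥ N, ∀ k ≥ N, LB T 0 ε (f i - f k)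

lemma LC.tendsto {f : ℕ → Fd n} (h : LC f u) (j : Fin n) (x t : ℝ) :
    Tendsto (fun i => f i j x t) atTop (𝓝 (u j x t)) := by
  rw [Metric.tendsto_atTop]
  intro ε hε
  obtain ⟨N, hN⟩ := h |t| (ε / 2) (by linarith)
  refine ⟨N, fun i hi => ?_⟩
  rw [dist_comm, Real.dist_eq]
  have := hN i hi j x t (by simp)
  simp only [Pi.sub_apply] at this
  linarith

lemma LCauchy.exists_LC {f : ℕ → Fd n} (h : LCauchy f) : ∃ u, LC f u := by
  have hc : ∀ j x t, ∃ y, Tendsto (fun i => f i j x t) atTop (𝓝 y) := fun j x t => by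
    refine cauchySeq_tendsto_of_complete (Metric.cauchySeq_iff.mpr fun ε hε => ?_)
    obtain ⟨N, hN⟩ := h |t| (ε / 2) (by linarith)
    refine ⟨N, fun i hi k hk => ?_⟩
    rw [Real.dist_eq]
    have := hN i hi k hk j x t (by simp)
    simp only [Pi.sub_apply] at this
    linarith
  choose u hu using hc
  refine ⟨u, fun T ε hε => ?_⟩
  obtain ⟨N, hN⟩ := h T ε hε
  refine ⟨N, fun i hi j x t ht => ?_⟩
  refine le_of_tendsto (((hu j x t).sub_const (f i j x t)).abs) ?_
  filter_upwards [eventually_ge_atTop N] with k hk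
  exact hN k hk i hi j x t ht

lemma LC.tlu {f : ℕ → Fd n} (h : LC f u) (j : Fin n) :
    TendstoLocallyUniformly (fun i (q : ℝ × ℝ) => f i j q.1 q.2) (fun q => u j q.1 q.2) atTop := by
  rw [Metric.tendstoLocallyUniformly_iff]
  intro ε hε q
  refine ⟨{q' : ℝ × ℝ | |q'.2| < |q.2| + 1}, ?_, ?_⟩
  · exact (isOpen_lt (continuous_abs.comp continuous_snd) continuous_const).mem_nhds (by simp)
  · obtain ⟨N, hN⟩ := h (|q.2| + 1) (ε / 2) (by linarith)
    filter_upwards [eventually_ge_atTop N] with i hi q' hq'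
    rw [Real.dist_eq]
    have := hN i hi j q'.1 q'.2 (by simpa using le_of_lt hq')
    simp only [Pi.sub_apply] at this
    linarith

lemma LC.cont {f : ℕ → Fd n} (h : LC f u) {j : Fin n}
    (hf : ∀ i, Continuous fun q : ℝ × ℝ => f i j q.1 q.2) :
    Continuous fun q : ℝ × ℝ => u j q.1 q.2 :=
  (h.tlu j).continuous (Eventually.frequently (Eventually.of_forall hf))

lemma TF.limit {f : ℕ → Fd n} (hf : ∀ i, TF (f i)) (h0 : LCauchy f)
    (h1 : LCauchy fun i => dF (f i)) : ∃ u, TF u ∧ LC f u ∧ LC (fun i => dF (f i)) (dF u) := by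
  obtain ⟨u, hu⟩ := h0.exists_LC
  obtain ⟨w, hw⟩ := h1.exists_LC
  have hd : ∀ j, TD (u j) (w j) := fun j => by
    refine ⟨hu.cont fun i => ((hf i).td j).cont, hw.cont fun i => ((hf i).td j).contt, fun x t => ?_⟩
    refine hasDerivAt_of_tendstoLocallyUniformlyOn (s := univ) isOpen_univ (l := atTop)
      (f := fun i => f i j x) (f' := fun i => dF (f i) j x) ?_ ?_ ?_ (mem_univ t)
    · rw [tendstoLocallyUniformlyOn_univ]
      exact (hw.tlu j).comp (fun t : ℝ => (x, t)) (by fun_prop)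
    · exact Eventually.of_forall fun i t _ => ((hf i).td j).deriv x t
    · exact fun t _ => hu.tendsto j x t
  have e : dF u = w := by funext j; exact (hd j).eq_dt.symm
  refine ⟨u, ⟨fun j => (hd j).to_dt, fun j x t => ?_⟩, hu, by rw [e]; exact hw⟩
  refine tendsto_nhds_unique (hu.tendsto j (cl x) t) ?_
  simp only [(hf _).clamp]
  exact hu.tendsto j x t

lemma LCauchy.of_geometric {f : ℕ → Fd n} {r : ℝ} (hr : 0 ≤ r) (hr1 : r < 1)
    (h : ∀ T, ∃ C, ∃ i0, ∀ i ≥ i0, LB T 0 (C * r ^ i) (f (i + 1) - f i)) : LCauchy f := by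
  intro T ε hε
  obtain ⟨C, i0, hC⟩ := h T
  have h1r : 0 < 1 - r := by linarith
  set D := |C| / (1 - r) with hD
  have hD0 : 0 ≤ D := by positivity
  have hDC : D * (1 - r) = |C| := by rw [hD]; field_simp
  have key : ∀ i ≥ i0, ∀ k, LB T 0 (D * (r ^ i - r ^ (i + k))) (f (i + k) - f i) := by
    intro i hi k
    induction k with
    | zero => intro j x t _; simp
    | succ k ih =>
      intro j x t ht
      have e1 := ih j x t ht
      have e2 := hC (i + k) (by omega) j x t ht
      simp only [Pi.sub_apply] at e1 e2 ⊢
      have e3 := abs_sub_le (f (i + (k + 1)) j x t) (f (i + k) j x t) (f i j x t)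
      have e4 : C * r ^ (i + k) ≤ |C| * r ^ (i + k) :=
        mul_le_mul_of_nonneg_right (le_abs_self C) (by positivity)
      rw [← hDC] at e4
      have e5 : r ^ (i + (k + 1)) = r ^ (i + k) * r := by rw [← add_assoc, pow_succ]
      rw [e5]
      rw [← add_assoc] at e3 ⊢
      nlinarith
  obtain ⟨N, hN⟩ := exists_pow_lt_of_lt_one (show 0 < ε / (D + 1) by positivity) hr1
  have hle : ∀ i ≥ max N i0, ∀ k, LB T 0 ε (f (i + k) - f i) := fun i hi k j x t ht => by
    refine (key i (le_trans (le_max_right _ _) hi) k j x t ht).trans ?_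
    have e1 : r ^ i ≤ r ^ N := pow_le_pow_of_le_one hr hr1.le (le_trans (le_max_left _ _) hi)
    have e2 : r ^ N * (D + 1) < ε := by rwa [lt_div_iff₀ (by positivity)] at hN
    have e3 : 0 ≤ r ^ (i + k) := by positivity
    have e4 : 0 ≤ r ^ N := by positivity
    nlinarith
  refine ⟨max N i0, fun i hi k hk j x t ht => ?_⟩
  rcases le_total i k with hik | hik
  · obtain ⟨l, rfl⟩ := Nat.exists_eq_add_of_le hik
    have := hle i hi l j x t ht
    simp only [Pi.sub_apply] at this ⊢
    rwa [abs_sub_comm]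
  · obtain ⟨l, rfl⟩ := Nat.exists_eq_add_of_le hik
    exact hle k hk l j x t ht

lemma LC.Kop {f : ℕ → Fd n} (hd : Good m p M lam d) (hf : ∀ i, CF (f i)) (hu : CF u) (h : LC f u) :
    LC (fun i => Kop m p d (f i)) (Kop m p d u) := by
  intro T ε hε
  have hc := cK_nonneg n hd.hM
  obtain ⟨N, hN⟩ := h (T + M) (ε / (cK n M + 1)) (by positivity)
  refine ⟨N, fun i hi => ?_⟩
  rw [← Kop_sub hd hu (hf i)]
  refine (Kop_bd hd (hN i hi)).mono (by simp) ?_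
  rw [← mul_div_assoc, div_le_iff₀ (by positivity)]
  nlinarith

lemma LC.fixed {f : ℕ → Fd n} (hd : Good m p M lam d) (hf : ∀ i, CF (f i)) (hu : CF u) (h : LC f u)
    {G : ℕ → Fd n} {H : Fd n} (hG : LC G H) (he : ∀ i, f i = _root_.Kop m p d (f i) + G i) :
    u = _root_.Kop m p d u + H := by
  funext j x t
  have h1 := (h.Kop hd hf hu).tendsto j x t
  refine tendsto_nhds_unique (h.tendsto j x t) ?_
  refine (h1.add (hG.tendsto j x t)).congr fun i => ?_
  exact (congrFun (congrFun (congrFun (he i) j) x) t).symm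

lemma LC.fixed_shift {f : ℕ → Fd n} (hd : Good m p M lam d) (hf : ∀ i, CF (f i)) (hu : CF u)
    (h : LC f u) {H : Fd n} (he : ∀ i, f (i + 1) = _root_.Kop m p d (f i) + H) :
    u = _root_.Kop m p d u + H := by
  funext j x t
  have h1 := (h.Kop hd hf hu).tendsto j x t
  refine tendsto_nhds_unique ((tendsto_add_atTop_iff_nat 1).mpr (h.tendsto j x t)) ?_
  refine (h1.add_const (H j x t)).congr fun i => ?_
  exact (congrFun (congrFun (congrFun (he i) j) x) t).symm

end limits

section forward

variable {n m : ℕ} {p : Fin n → Fin n → ℝ} {M lam : ℝ} {d : LD n} {u v g : Fd n}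

/-- Characteristics go backward in time toward the inflow boundary. -/
lemma Good.fl_causal (hd : Good m p M lam d) (j : Fin n) (x t : ℝ) {ξ : ℝ}
    (hξ : ξ ∈ uIcc (xin m j) (cl x)) : fl (d.α j) ξ x t ≤ t - lam * |cl x - ξ| := by
  have hx := cl_mem x
  have hself : fl (d.α j) (cl x) x t = t := by rw [fl_cl, (hd.hα j).fl_self]
  have hc : Continuous fun s => d.α j s (fl (d.α j) s x t) :=
    (hd.hα j).cont.comp (continuous_id.prodMk ((hd.hα j).fl_cont₁ x t))
  have hξ' : ξ ∈ Icc (0:ℝ) 1 := uIcc_subset_Icc (xin_mem m j) hx hξ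
  have hI := integral_eq_of_deriv_Icc (fun s hs => (hd.hα j).fl_deriv x t hs) hc.continuousOn hξ' hx
  rw [hself] at hI
  by_cases hj : (j : ℕ) < m
  · have e : xin m j = 0 := by simp [xin, hj]
    rw [e, uIcc_of_le hx.1] at hξ
    have := intervalIntegral.integral_mono_on (f := fun _ => lam) (μ := volume) hξ.2
      (continuous_const.intervalIntegrable _ _) (hc.intervalIntegrable _ _)
      (fun s _ => hd.pos j hj s _)
    rw [intervalIntegral.integral_const, smul_eq_mul] at this
    rw [abs_of_nonneg (by linarith [hξ.2])]
    linarith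
  · have e : xin m j = 1 := by simp [xin, hj]
    rw [e, uIcc_of_ge hx.2] at hξ
    have := intervalIntegral.integral_mono_on (g := fun _ => -lam) (μ := volume) hξ.1
      (hc.intervalIntegrable _ _) (continuous_const.intervalIntegrable _ _)
      (fun s _ => hd.neg j (by omega) s _)
    rw [intervalIntegral.integral_const, smul_eq_mul, intervalIntegral.integral_symm] at this
    rw [abs_of_nonpos (by linarith [hξ.1])]
    linarith

lemma abs_integral_exp_le (j : Fin n) {c : ℝ} (hc : 0 < c) {y : ℝ} (hy : y ∈ Icc (0:ℝ) 1) :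
    |∫ ξ in xin m j..y, Real.exp (-(c * |y - ξ|))| ≤ 1 / c := by
  have hcont : Continuous fun ξ => Real.exp (-(c * |y - ξ|)) := by fun_prop
  have key : ∀ (a : ℝ) (s : ℝ), s = 1 ∨ s = -1 → (∀ ξ ∈ uIcc a y, |y - ξ| = s * (y - ξ)) →
      |∫ ξ in a..y, Real.exp (-(c * |y - ξ|))| ≤ 1 / c := by
    intro a s hs h
    rw [intervalIntegral.integral_congr (g := fun ξ => Real.exp (-(c * (s * (y - ξ)))))
      (fun ξ hξ => by simp only [h ξ hξ])]
    have hs0 : s ≠ 0 := by rcases hs with rfl | rfl <;> norm_num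
    rw [intervalIntegral.integral_eq_sub_of_hasDerivAt
      (f := fun ξ => (c * s)⁻¹ * Real.exp (-(c * (s * (y - ξ)))))]
    · have h1 := h a left_mem_uIcc
      have h2 : 0 ≤ c * (s * (y - a)) := by rw [← h1]; positivity
      have h3 : Real.exp (-(c * (s * (y - a)))) ≤ 1 := Real.exp_le_one_iff.mpr (by linarith)
      have h4 := Real.exp_pos (-(c * (s * (y - a))))
      rw [← mul_sub, abs_mul, abs_inv, abs_mul, abs_of_pos hc,
        show |s| = 1 by rcases hs with rfl | rfl <;> norm_num, mul_one, ← one_div]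
      refine mul_le_of_le_one_right (by positivity) ?_
      rw [sub_self, mul_zero, mul_zero, neg_zero, Real.exp_zero, abs_le]
      constructor <;> linarith
    · intro ξ _
      have : HasDerivAt (fun ξ => -(c * (s * (y - ξ)))) (c * s) ξ := by
        exact ((((hasDerivAt_id ξ).const_sub y).const_mul s).const_mul c).neg.congr_deriv (by ring)
      refine (this.exp.const_mul (c * s)⁻¹).congr_deriv ?_
      have hcs : c * s ≠ 0 := mul_ne_zero hc.ne' hs0
      rw [mul_comm (Real.exp _), inv_mul_cancel_left₀ hcs]
    · exact Continuous.intervalIntegrable (by fun_prop) _ _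
  unfold xin
  split_ifs
  · refine key 0 1 (Or.inl rfl) fun ξ hξ => ?_
    rw [uIcc_of_le hy.1] at hξ
    rw [abs_of_nonneg (by linarith [hξ.2]), one_mul]
  · refine key 1 (-1) (Or.inr rfl) fun ξ hξ => ?_
    rw [uIcc_of_ge hy.2] at hξ
    rw [abs_of_nonpos (by linarith [hξ.1])]; ring

/-- Weighted bound adapted to forward solutions. -/
def WB (m : ℕ) (γ θ A : ℝ) (u : Fd n) : Prop :=
  ∀ j x t, |u j x t| ≤ A * Real.exp (γ * t - θ * |cl x - xin m j|)

lemma WB.bd {γ θ A : ℝ} (hθ : 0 ≤ θ) (hA : 0 ≤ A) (h : WB m γ θ A u) (j : Fin n) (x t : ℝ) :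
    |u j x t| ≤ A * Real.exp (γ * t) :=
  (h j x t).trans (mul_le_mul_of_nonneg_left (Real.exp_le_exp.mpr (by
    have : 0 ≤ θ * |cl x - xin m j| := by positivity
    linarith)) hA)

lemma abs_cl_sub_xin_le (j : Fin n) (x : ℝ) : |cl x - xin m j| ≤ 1 := by
  have h1 := cl_mem x
  have h2 := xin_mem m j
  rw [abs_le]; constructor <;> linarith [h1.1, h1.2, h2.1, h2.2]

lemma abs_xout_sub_xin (j : Fin n) : |xout m j - xin m j| = 1 := by
  unfold xin xout; split_ifs <;> norm_num

lemma Kop_WB (hd : Good m p M lam d) {γ θ A : ℝ} (hA : 0 ≤ A) (hγ : 0 < γ)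
    (h1 : Real.exp (2 * M) * (n * M) * Real.exp (-θ) ≤ 1 / 4) (h2 : θ ≤ γ * lam)
    (h3 : 4 * (Real.exp (2 * M) * (n * M)) * Real.exp θ ≤ γ * lam) (hθ : 0 ≤ θ)
    (hu : WB m γ θ A u) : WB m γ θ (A / 2) (Kop m p d u) := by
  intro j x t
  have hM := hd.hM
  have hlam := hd.hlam
  set y := cl x with hy
  set τ := fl (d.α j) (xin m j) x t with hτdef
  have hτ : τ ≤ t - lam * |y - xin m j| := hd.fl_causal j x t left_mem_uIcc
  have hb1 : |bq m p u j τ| ≤ n * M * (A * Real.exp (γ * τ - θ)) := by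
    refine (Finset.abs_sum_le_sum_abs _ _).trans ?_
    have : ∀ k ∈ (Finset.univ : Finset (Fin n)), |p j k * u k (xout m k) τ| ≤
        M * (A * Real.exp (γ * τ - θ)) := fun k _ => by
      rw [abs_mul]
      have := hu k (xout m k) τ
      rw [cl_of_mem (xout_mem m k), abs_xout_sub_xin, mul_one] at this
      exact mul_le_mul (hd.hp j k) this (abs_nonneg _) (by linarith)
    refine (Finset.sum_le_card_nsmul _ _ _ this).trans (le_of_eq ?_)
    simp; ring
  have hb2 : ∀ ξ ∈ uIcc (xin m j) y, |off d u j ξ (fl (d.α j) ξ x t)| ≤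
      n * M * (A * Real.exp (γ * t)) * Real.exp (-(γ * lam * |y - ξ|)) := fun ξ hξ => by
    have hs := hd.fl_causal j x t hξ
    refine (off_bd hd (fun k => WB.bd hθ hA hu k ξ _) j).trans ?_
    rw [mul_assoc (n * M : ℝ), mul_assoc A, ← Real.exp_add]
    have : γ * fl (d.α j) ξ x t ≤ γ * t + -(γ * lam * |y - ξ|) := by
      nlinarith [mul_le_mul_of_nonneg_left hs hγ.le]
    gcongr
  refine (Ls_bd_int (hd.hα j) (hd.hβ j j) (xin_mem m j) _ (by fun_prop) hb2).trans ?_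
  rw [intervalIntegral.integral_const_mul, abs_mul,
    abs_of_nonneg (by positivity : (0:ℝ) ≤ n * M * (A * Real.exp (γ * t)))]
  have hi := abs_integral_exp_le (m := m) j (c := γ * lam) (by positivity) (cl_mem x)
  rw [← hy] at hi
  set I := |∫ ξ in xin m j..y, Real.exp (-(γ * lam * |y - ξ|))|
  have hle1 : |y - xin m j| ≤ 1 := abs_cl_sub_xin_le j x
  set r := |y - xin m j| with hr
  have hr0 : 0 ≤ r := abs_nonneg _
  have g1 : Real.exp (2 * M) * (n * M * (A * Real.exp (γ * τ - θ))) ≤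
      A / 4 * Real.exp (γ * t - θ * r) := by
    have e1 : Real.exp (γ * τ - θ) ≤ Real.exp (-θ) * Real.exp (γ * t - θ * r) := by
      rw [← Real.exp_add]
      refine Real.exp_le_exp.mpr ?_
      nlinarith [mul_le_mul_of_nonneg_left hτ hγ.le, mul_le_mul_of_nonneg_right h2 hr0]
    calc _ ≤ Real.exp (2 * M) * (n * M * (A * (Real.exp (-θ) * Real.exp (γ * t - θ * r)))) := by
          gcongr
      _ = (Real.exp (2 * M) * (n * M) * Real.exp (-θ)) * (A * Real.exp (γ * t - θ * r)) := by ring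
      _ ≤ 1 / 4 * (A * Real.exp (γ * t - θ * r)) := by gcongr
      _ = _ := by ring
  have g2 : Real.exp (2 * M) * (n * M * (A * Real.exp (γ * t)) * I) ≤
      A / 4 * Real.exp (γ * t - θ * r) := by
    have e1 : Real.exp (γ * t) ≤ Real.exp θ * Real.exp (γ * t - θ * r) := by
      rw [← Real.exp_add]
      refine Real.exp_le_exp.mpr ?_
      nlinarith
    have e2 : (Real.exp (2 * M) * (n * M)) * Real.exp θ * I ≤ 1 / 4 := by
      calc _ ≤ (Real.exp (2 * M) * (n * M)) * Real.exp θ * (1 / (γ * lam)) := by gcongr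
        _ ≤ 1 / 4 := by
          rw [mul_one_div, div_le_iff₀ (by positivity)]; linarith
    have hI : 0 ≤ I := abs_nonneg _
    calc _ ≤ Real.exp (2 * M) * (n * M * (A * (Real.exp θ * Real.exp (γ * t - θ * r))) * I) := by
          gcongr
      _ = ((Real.exp (2 * M) * (n * M)) * Real.exp θ * I) * (A * Real.exp (γ * t - θ * r)) := by ring
      _ ≤ 1 / 4 * (A * Real.exp (γ * t - θ * r)) := by gcongr
      _ = _ := by ring
  calc _ ≤ Real.exp (2 * M) * (n * M * (A * Real.exp (γ * τ - θ))) +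
        Real.exp (2 * M) * (n * M * (A * Real.exp (γ * t)) * I) := by
        rw [mul_add]
        exact add_le_add (mul_le_mul_of_nonneg_left hb1 (by positivity)) le_rfl
    _ ≤ _ := by linarith

lemma Fop_WB (hd : Good m p M lam d) {γ θ G : ℝ} (hγ : 0 ≤ γ) (hθ : 0 ≤ θ) (hG : 0 ≤ G)
    (hg : ∀ j x t, |g j x t| ≤ G * Real.exp (γ * t)) :
    WB m γ θ (Real.exp (2 * M) * G * Real.exp θ) (Fop m d g) := by
  intro j x t
  refine (Ls_bd (hd.hα j) (hd.hβ j j) (xin_mem m j) (A := 0) (B := G * Real.exp (γ * t)) (by simp)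
    (fun ξ hξ => (hg j ξ _).trans ?_)).trans ?_
  · have hs := hd.fl_causal j x t hξ
    have : 0 ≤ lam * |cl x - ξ| := mul_nonneg hd.hlam.le (abs_nonneg _)
    have : γ * fl (d.α j) ξ x t ≤ γ * t := mul_le_mul_of_nonneg_left (by linarith) hγ
    gcongr
  · rw [zero_add, mul_assoc, mul_assoc, ← Real.exp_add]
    have := abs_cl_sub_xin_le (m := m) j x
    have : γ * t ≤ θ + (γ * t - θ * |cl x - xin m j|) := by nlinarith
    gcongr

/-- Vanishing on a backward closed region `t ≤ χ x`. -/
def Van (χ : ℝ → ℝ) (u : Fd n) : Prop := ∀ j, ∀ x ∈ Icc (0:ℝ) 1, ∀ t ≤ χ x, u j x t = 0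

structure BackCl (lam : ℝ) (χ : ℝ → ℝ) : Prop where
  lip : ∀ x ∈ Icc (0:ℝ) 1, ∀ y ∈ Icc (0:ℝ) 1, χ x - χ y ≤ lam * |x - y|
  ends : χ 0 = χ 1

lemma BackCl.xin_xout {χ : ℝ → ℝ} (h : BackCl lam χ) (j k : Fin n) :
    χ (xin m j) = χ (xout m k) := by
  have := h.ends
  unfold xin xout; split_ifs <;> simp [this]

lemma Ls_van (hd : Good m p M lam d) {χ : ℝ → ℝ} (hχ : BackCl lam χ) (j : Fin n) {q : ℝ → ℝ}
    {h : ℝ → ℝ → ℝ} (hq : ∀ t ≤ χ (xin m j), q t = 0)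
    (hh : ∀ x ∈ Icc (0:ℝ) 1, ∀ t ≤ χ x, h x t = 0) {x t : ℝ} (hx : x ∈ Icc (0:ℝ) 1) (ht : t ≤ χ x) :
    Ls (d.α j) (d.β j j) (xin m j) q h x t = 0 := by
  have hcx := cl_of_mem hx
  have hfl : ∀ ξ ∈ uIcc (xin m j) (cl x), fl (d.α j) ξ x t ≤ χ ξ := fun ξ hξ => by
    have h1 := hd.fl_causal j x t hξ
    have h2 := hχ.lip x hx ξ (uIcc_subset_Icc (xin_mem m j) (cl_mem x) hξ)
    rw [hcx] at h1
    linarith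
  have := Ls_bd (hd.hα j) (hd.hβ j j) (xin_mem m j) (A := 0) (B := 0) (q := q) (h := h) (x := x)
    (t := t) (by rw [hq _ (hfl _ left_mem_uIcc), abs_zero]) (fun ξ hξ => by
      rw [hh ξ (uIcc_subset_Icc (xin_mem m j) (cl_mem x) hξ) _ (hfl ξ hξ), abs_zero])
  simpa using this

lemma Kop_van (hd : Good m p M lam d) {χ : ℝ → ℝ} (hχ : BackCl lam χ) (hu : Van χ u) :
    Van χ (Kop m p d u) := fun j x hx t ht =>
  Ls_van hd hχ j (fun s hs => Finset.sum_eq_zero fun k _ => by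
      rw [hu k _ (xout_mem m k) s (by rw [← hχ.xin_xout j k]; exact hs), mul_zero])
    (fun y hy s hs => Finset.sum_eq_zero fun k _ => by rw [hu k y hy s hs, mul_zero, neg_zero]) hx ht

lemma Fop_van (hd : Good m p M lam d) {χ : ℝ → ℝ} (hχ : BackCl lam χ) (hg : Van χ g) :
    Van χ (Fop m d g) := fun j _ hx _ ht => Ls_van hd hχ j (fun _ _ => rfl) (hg j) hx ht

/-- Solution of the forward problem. -/
lemma exists_forward (hH : H3cond n p) (m : ℕ) {M lam : ℝ} (hM : 1 ≤ M) (hlam : 0 < lam) :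
    ∃ C : ℝ, 0 ≤ C ∧ ∃ γ : ℝ, 0 < γ ∧ ∀ d : LD n, Good m p M lam d → ∀ g : Fd n, TF g → ∀ G, 0 ≤ G →
      (∀ j x t, |g j x t| ≤ G * Real.exp (γ * t)) → ∃ v : Fd n, TF v ∧
        v = Kop m p d v + Fop m d g ∧ (∀ j x t, |v j x t| ≤ C * G * Real.exp (γ * t)) ∧
        ∀ χ, BackCl lam χ → Van χ g → Van χ v := by
  obtain ⟨C, hC, R, hR, hsm⟩ := Kiter_smoothing hH m M lam
  set Q := Real.exp (2 * M) * (n * M) with hQ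
  have hQ0 : 0 ≤ Q := by positivity
  set θ := 4 * Q with hθdef
  have hθ : 0 ≤ θ := by positivity
  have h1 : Q * Real.exp (-θ) ≤ 1 / 4 := by
    rw [Real.exp_neg, ← div_eq_mul_inv, div_le_iff₀ (Real.exp_pos _)]
    have := Real.add_one_le_exp θ
    nlinarith
  set γ := (θ + 4 * Q * Real.exp θ + 1) / lam with hγdef
  have hγ : 0 < γ := by positivity
  have hγl : γ * lam = θ + 4 * Q * Real.exp θ + 1 := by rw [hγdef]; field_simp
  have hpos : 0 ≤ 4 * Q * Real.exp θ := by positivity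
  refine ⟨2 * (Real.exp (2 * M) * Real.exp θ), by positivity, γ, hγ, ?_⟩
  intro d hd g hg G hG hgG
  set A := Real.exp (2 * M) * G * Real.exp θ with hA
  have hA0 : 0 ≤ A := by positivity
  have hF : WB m γ θ A (Fop m d g) := Fop_WB hd hγ.le hθ hG hgG
  have hK : ∀ {B : ℝ} {u : Fd n}, 0 ≤ B → WB m γ θ B u → WB m γ θ (B / 2) (Kop m p d u) :=
    fun hB hu => Kop_WB hd hB hγ h1 (by linarith) (by linarith) hθ hu
  obtain ⟨f, f0, fs⟩ : ∃ f : ℕ → Fd n, f 0 = 0 ∧ ∀ i, f (i + 1) = Kop m p d (f i) + Fop m d g :=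
    ⟨fun i => Nat.rec (0 : Fd n) (fun _ v => Kop m p d v + Fop m d g) i, rfl, fun _ => rfl⟩
  have hgF := Fop_TF hd hg
  have hf : ∀ i, TF (f i) := fun i => by
    induction i with
    | zero => rw [f0]; exact TF.zero
    | succ i ih => rw [fs]; exact (Kop_TF hd ih).add hgF
  have hfW : ∀ i, WB m γ θ (2 * A) (f i) := fun i => by
    induction i with
    | zero => intro j x t; rw [f0]; simp only [Pi.zero_apply, abs_zero]; positivity
    | succ i ih =>
      intro j x t
      rw [fs]
      refine (abs_add_le _ _).trans ((add_le_add (hK (by positivity) ih j x t) (hF j x t)).trans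
        (le_of_eq (by ring)))
  have hD : ∀ i, f (i + 1) - f i = (Kop m p d)^[i] (Fop m d g) := fun i => by
    induction i with
    | zero =>
      have : Kop m p d 0 = 0 := by
        have := Kop_smul (m := m) (p := p) (d := d) (u := (0 : Fd n)) 0
        simpa using this
      rw [fs, f0, this]; simp
    | succ i ih =>
      rw [Function.iterate_succ_apply', ← ih, Kop_sub hd (hf _).toCF (hf _).toCF, fs (i + 1), fs i]
      abel
  have hDW : ∀ i, WB m γ θ (A * (1 / 2) ^ i) ((Kop m p d)^[i] (Fop m d g)) := fun i => by
    induction i with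
    | zero => simpa using hF
    | succ i ih =>
      rw [Function.iterate_succ_apply', show A * (1 / 2) ^ (i + 1) = A * (1 / 2) ^ i / 2 by ring]
      exact hK (by positivity) ih
  have hDB : ∀ T i, LB T 0 (A * Real.exp (γ * T) * (1 / 2) ^ i)
      ((Kop m p d)^[i] (Fop m d g)) := fun T i j x t ht => by
    refine (WB.bd hθ (by positivity) (hDW i) j x t).trans ?_
    rw [sub_zero] at ht
    have : Real.exp (γ * t) ≤ Real.exp (γ * T) :=
      Real.exp_le_exp.mpr (mul_le_mul_of_nonneg_left ((le_abs_self t).trans ht) hγ.le)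
    calc _ ≤ A * (1 / 2) ^ i * Real.exp (γ * T) := by gcongr
      _ = _ := by ring
  have c0 : LCauchy f := LCauchy.of_geometric (r := 1 / 2) (by norm_num) (by norm_num) fun T =>
    ⟨_, 0, fun i _ => by rw [hD]; exact hDB T i⟩
  have c1 : LCauchy fun i => dF (f i) := by
    refine LCauchy.of_geometric (r := 1 / 2) (by norm_num) (by norm_num) fun T =>
      ⟨C * (A * Real.exp (γ * (T + R))) * 2 ^ (n + 1), n + 1, fun i hi => ?_⟩
    obtain ⟨k, rfl⟩ := Nat.exists_eq_add_of_le hi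
    show LB T 0 _ (dF (f (n + 1 + k + 1)) - dF (f (n + 1 + k)))
    rw [← TF.dF_sub (hf _) (hf _), hD, Function.iterate_add_apply]
    refine (hsm d hd _ (Kiter_TF hd hgF k) T 0 _ (hDB (T + R) k)).mono (by simp) (le_of_eq ?_)
    have h2 : (2:ℝ) ^ (n + 1) * (1 / 2) ^ (n + 1) = 1 := by rw [← mul_pow]; norm_num
    rw [pow_add (1 / 2 : ℝ) (n + 1) k]
    linear_combination (-(C * A * Real.exp (γ * (T + R)) * (1 / 2) ^ k)) * h2
  obtain ⟨v, hv, hfv, -⟩ := TF.limit hf c0 c1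
  refine ⟨v, hv, hfv.fixed_shift hd (fun i => (hf i).toCF) hv.toCF fs, fun j x t => ?_,
    fun χ hχ hgχ j x hx t ht => ?_⟩
  · refine le_of_tendsto (hfv.tendsto j x t).abs (Eventually.of_forall fun i => ?_)
    exact (WB.bd hθ (by positivity) (hfW i) j x t).trans (le_of_eq (by rw [hA]; ring))
  · have hz : ∀ i, Van χ (f i) := fun i => by
      induction i with
      | zero => intro j x _ t _; rw [f0]; rfl
      | succ i ih =>
        intro j x hx t ht
        rw [fs]
        show Kop m p d (f i) j x t + Fop m d g j x t = 0
        rw [Kop_van hd hχ ih j x hx t ht, Fop_van hd hχ hgχ j x hx t ht, add_zero]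
    refine tendsto_nhds_unique (hfv.tendsto j x t) ?_
    simp only [hz _ j x hx t ht]
    exact tendsto_const_nhds

end forward

section energy

variable {n m : ℕ} {p : Fin n → Fin n → ℝ} {M lam : ℝ} {d : LD n} {u v g w : Fd n}

lemma energy_row {α αt v vt h : ℝ → ℝ → ℝ} (hα : CT M α αt) (hv : CharD α v h) (hd : TD v vt)
    (hh : Continuous fun q : ℝ × ℝ => h q.1 q.2) (a b t : ℝ) :
    HasDerivAt (fun t => ∫ x in (0:ℝ)..1, (a + b * x) * (α x t * v x t ^ 2))
      ((∫ x in (0:ℝ)..1, ((a + b * x) * (αt x t * v x t ^ 2 + 2 * v x t * h x t) + b * v x t ^ 2))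
        - ((a + b) * v 1 t ^ 2 - a * v 0 t ^ 2)) t := by
  have hsq : TD (fun x t => v x t ^ 2) (fun x t => 2 * v x t * vt x t) :=
    ⟨hd.cont.pow 2, (continuous_const.mul hd.cont).mul hd.contt, fun x t => by
      exact ((hd.deriv x t).pow 2).congr_deriv (by simp)⟩
  have hW : TD (fun x _ => a + b * x) (fun _ _ => 0) :=
    ⟨by fun_prop, continuous_const, fun x t => hasDerivAt_const t _⟩
  have hF := hW.mul (hα.toTD.mul hsq)
  refine (hF.integral 0 1 t).congr_deriv ?_
  have hvx := hv.partial_x hα hd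
  have c1 : Continuous fun x => v x t := hd.comp_cont continuous_id continuous_const
  have c2 : Continuous fun x => vt x t := hd.contt.comp (continuous_id.prodMk continuous_const)
  have c3 : Continuous fun x => h x t := hh.comp (continuous_id.prodMk continuous_const)
  have c4 : Continuous fun x => α x t := hα.comp_cont continuous_id continuous_const
  have c5 : Continuous fun x => αt x t := hα.contt.comp (continuous_id.prodMk continuous_const)
  have hB := integral_eq_of_deriv_Icc (F := fun x => (a + b * x) * v x t ^ 2)
    (f := fun x => b * v x t ^ 2 + (a + b * x) * (2 * v x t * (h x t - α x t * vt x t)))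
    (fun x hx => by
      have h1 : HasDerivAt (fun x => a + b * x) b x := by
        simpa using ((hasDerivAt_id x).const_mul b).const_add a
      have h2 := (hvx x hx t).pow 2
      refine (h1.hasDerivWithinAt.mul h2).congr_deriv ?_
      simp)
    (Continuous.continuousOn (by fun_prop)) (left_mem_Icc.mpr zero_le_one)
    (right_mem_Icc.mpr zero_le_one)
  rw [mul_one, mul_zero, add_zero] at hB
  rw [← hB, ← intervalIntegral.integral_sub]
  · refine intervalIntegral.integral_congr fun x _ => ?_
    ring
  · exact Continuous.intervalIntegrable (by fun_prop) _ _
  · exact Continuous.intervalIntegrable (by fun_prop) _ _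

/-- The squared `L²` norm of `u` at time `t`. -/
def NT (u : Fd n) (t : ℝ) : ℝ := ∫ x in (0:ℝ)..1, ∑ j, u j x t ^ 2

def sgn (m : ℕ) (j : Fin n) : ℝ := if (j : ℕ) < m then 1 else -1

lemma CF.cont_x (hu : CF u) (j : Fin n) (t : ℝ) : Continuous fun x => u j x t :=
  (hu.cont j).comp (continuous_id.prodMk continuous_const)

lemma CF.cont_sq (hu : CF u) (t : ℝ) : Continuous fun x => ∑ j, u j x t ^ 2 :=
  continuous_finsetSum _ fun j _ => (hu.cont_x j t).pow 2

lemma NT_nonneg (u : Fd n) (t : ℝ) : 0 ≤ NT u t :=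
  intervalIntegral.integral_nonneg zero_le_one fun _ _ => Finset.sum_nonneg fun _ _ => sq_nonneg _

lemma sum_mul_sum_le (y : Fin n → ℝ) {b : ℝ} (hb : 0 ≤ b) :
    ∑ j, |y j| * ∑ k, b * |y k| ≤ n * b * ∑ j, y j ^ 2 := by
  rw [← Finset.sum_mul, ← Finset.mul_sum]
  have := sq_sum_le_card_mul_sum_sq (s := Finset.univ) (f := fun j : Fin n => |y j|)
  simp only [sq_abs, Finset.card_univ, Fintype.card_fin] at this
  nlinarith

lemma Sol.h_cont (hd : Good m p M lam d) (hu : CF u) (hg : CF g) (j : Fin n) :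
    Continuous fun q : ℝ × ℝ => g j q.1 q.2 - ∑ k, d.β j k q.1 q.2 * u k q.1 q.2 :=
  (hg.cont j).sub (continuous_finsetSum _ fun k _ => (hd.hβ j k).cont.mul (hu.cont k))

/-- Energy estimate. -/
lemma energy_bd (p : Fin n → Fin n → ℝ) (m : ℕ) (hM : 1 ≤ M) (hlam : 0 < lam) : ∃ C : ℝ, 0 ≤ C ∧
    ∀ d : LD n, Good m p M lam d → ∀ g w : Fd n, CF g → TF w → Sol m p d g w → ∀ s t G : ℝ,
      s ≤ t → (∀ r ∈ Icc s t, ∀ j x, |g j x r| ≤ G) →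
      NT w t ≤ C * (Real.exp (C * (t - s)) * NT w s + (Real.exp (C * (t - s)) - 1) * G ^ 2) := by
  set μ : ℝ := n * (n * M ^ 2) with hμ
  have hμ0 : 0 ≤ μ := by positivity
  set Θ : ℝ := 1 + μ with hΘ
  have hΘ1 : 1 ≤ Θ := by linarith
  set c : ℝ := (Θ * M + Θ + 2 * n * M * Θ + μ) / lam + n * Θ with hc
  have hc0 : 0 ≤ c := by positivity
  refine ⟨c + (M * Θ + 1) / lam, by positivity, ?_⟩
  intro d hd g w hg hw hS s t G hst hG
  have hwC := hw.toCF
  set a : Fin n → ℝ := fun j => sgn m j - μ * xin m j with ha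
  set e : ℝ → ℝ := fun t => ∑ j, ∫ x in (0:ℝ)..1, (a j + μ * x) * (d.α j x t * w j x t ^ 2) with he
  have hh := fun j => Sol.h_cont hd hwC hg j
  set h : Fd n := fun j x t => g j x t - ∑ k, d.β j k x t * w k x t with hhdef
  have hder : ∀ t, HasDerivAt e (∑ j, ((∫ x in (0:ℝ)..1, ((a j + μ * x) *
      (dt (d.α j) x t * w j x t ^ 2 + 2 * w j x t * h j x t) + μ * w j x t ^ 2))
        - ((a j + μ) * w j 1 t ^ 2 - a j * w j 0 t ^ 2))) t := fun t => by
    have := HasDerivAt.fun_sum (u := Finset.univ) fun j _ =>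
      energy_row (hd.hα j) (hS.char j) (hw.td j) (hh j) (a j) μ t
    exact this
  have hAb : ∀ j, ∀ x ∈ Icc (0:ℝ) 1, |a j + μ * x| ≤ Θ := fun j x hx => by
    have h1 : μ * x ≤ μ := mul_le_of_le_one_right hμ0 hx.2
    have h2 : 0 ≤ μ * x := mul_nonneg hμ0 hx.1
    simp only [ha, sgn, xin, abs_le]
    split_ifs <;> constructor <;> linarith
  have hAl : ∀ j, ∀ x ∈ Icc (0:ℝ) 1, ∀ t, lam ≤ (a j + μ * x) * d.α j x t ∧
      (a j + μ * x) * d.α j x t ≤ Θ * M := fun j x hx t => by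
    refine ⟨?_, (le_abs_self _).trans (by
      rw [abs_mul]; exact mul_le_mul (hAb j x hx) ((hd.hα j).bd x t) (abs_nonneg _) (by linarith))⟩
    have h1 : μ * x ≤ μ := mul_le_of_le_one_right hμ0 hx.2
    have h2 : 0 ≤ μ * x := mul_nonneg hμ0 hx.1
    simp only [ha, sgn, xin]
    by_cases hj : (j : ℕ) < m
    · have := hd.pos j hj x t
      simp only [hj, if_true]; nlinarith
    · have := hd.neg j (by omega) x t
      simp only [hj, if_false]; nlinarith
  have hcx : ∀ j t, Continuous fun x => w j x t := fun j t => hwC.cont_x j t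
  have hcα : ∀ j t, Continuous fun x => d.α j x t := fun j t =>
    (hd.hα j).comp_cont continuous_id continuous_const
  have hcαt : ∀ j t, Continuous fun x => dt (d.α j) x t := fun j t =>
    (hd.hα j).contt.comp (continuous_id.prodMk continuous_const)
  have hch : ∀ j t, Continuous fun x => h j x t := fun j t =>
    (hh j).comp (continuous_id.prodMk continuous_const)
  have hei : ∀ t, e t = ∫ x in (0:ℝ)..1, ∑ j, (a j + μ * x) * (d.α j x t * w j x t ^ 2) := fun t => by
    rw [intervalIntegral.integral_finsetSum]
    intro j _
    have := hcx j t; have := hcα j t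
    exact Continuous.intervalIntegrable (by fun_prop) _ _
  have hcont : ∀ t, Continuous fun x => ∑ j, (a j + μ * x) * (d.α j x t * w j x t ^ 2) := fun t =>
    continuous_finsetSum _ fun j _ => by
      have := hcx j t; have := hcα j t
      fun_prop
  have hlow : ∀ t, lam * NT w t ≤ e t := fun t => by
    rw [hei, NT, ← intervalIntegral.integral_const_mul]
    refine intervalIntegral.integral_mono_on zero_le_one
      (((hwC.cont_sq t).const_mul lam).intervalIntegrable _ _)
      ((hcont t).intervalIntegrable _ _) fun x hx => ?_
    rw [Finset.mul_sum]
    refine Finset.sum_le_sum fun j _ => ?_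
    rw [← mul_assoc]
    exact mul_le_mul_of_nonneg_right (hAl j x hx t).1 (sq_nonneg _)
  have hup : ∀ t, e t ≤ Θ * M * NT w t := fun t => by
    rw [hei, NT, ← intervalIntegral.integral_const_mul]
    refine intervalIntegral.integral_mono_on zero_le_one ((hcont t).intervalIntegrable _ _)
      (((hwC.cont_sq t).const_mul _).intervalIntegrable _ _) fun x hx => ?_
    rw [Finset.mul_sum]
    refine Finset.sum_le_sum fun j _ => ?_
    rw [← mul_assoc]
    exact mul_le_mul_of_nonneg_right (hAl j x hx t).2 (sq_nonneg _)
  have hbdry : ∀ t, 0 ≤ ∑ j, ((a j + μ) * w j 1 t ^ 2 - a j * w j 0 t ^ 2) := fun t => by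
    have e1 : ∀ j, (a j + μ) * w j 1 t ^ 2 - a j * w j 0 t ^ 2 =
        (1 + μ) * w j (xout m j) t ^ 2 - w j (xin m j) t ^ 2 := fun j => by
      simp only [ha, sgn, xin, xout]; split_ifs <;> ring
    have e2 : ∀ j, w j (xin m j) t ^ 2 ≤ n * M ^ 2 * ∑ k, w k (xout m k) t ^ 2 := fun j => by
      rw [hS.bc]
      refine (sq_sum_le_card_mul_sum_sq (s := Finset.univ)).trans ?_
      rw [Finset.card_univ, Fintype.card_fin, mul_assoc]
      refine mul_le_mul_of_nonneg_left ?_ (Nat.cast_nonneg _)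
      rw [Finset.mul_sum]
      refine Finset.sum_le_sum fun k _ => ?_
      rw [mul_pow]
      exact mul_le_mul_of_nonneg_right (sq_le_sq.mpr ((hd.hp j k).trans (le_abs_self _)))
        (sq_nonneg _)
    have e3 := Finset.sum_le_sum fun j (_ : j ∈ Finset.univ) => e2 j
    rw [Finset.sum_const, Finset.card_univ, Fintype.card_fin, nsmul_eq_mul, ← mul_assoc] at e3
    have e4 : 0 ≤ ∑ k, w k (xout m k) t ^ 2 := Finset.sum_nonneg fun _ _ => sq_nonneg _
    simp only [e1, Finset.sum_sub_distrib, ← Finset.mul_sum]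
    nlinarith
  have hbulk : ∀ r ∈ Icc s t, (∑ j, ∫ x in (0:ℝ)..1, ((a j + μ * x) *
      (dt (d.α j) x r * w j x r ^ 2 + 2 * w j x r * h j x r) + μ * w j x r ^ 2)) ≤
      c * (e r + G ^ 2) := by
    intro r hr
    have hGr := hG r hr
    clear hr hst hG
    revert r
    intro t hG
    rw [← intervalIntegral.integral_finsetSum]
    · set c1 := Θ * M + Θ + 2 * n * M * Θ + μ with hc1
      have hc10 : 0 ≤ c1 := by positivity
      have : (∫ x in (0:ℝ)..1, ∑ j, ((a j + μ * x) * (dt (d.α j) x t * w j x t ^ 2 +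
          2 * w j x t * h j x t) + μ * w j x t ^ 2)) ≤
          ∫ x in (0:ℝ)..1, (c1 * (∑ j, w j x t ^ 2) + n * Θ * G ^ 2) := by
        refine intervalIntegral.integral_mono_on zero_le_one
          (Continuous.intervalIntegrable (continuous_finsetSum _ fun j _ => ?_) _ _)
          (((hwC.cont_sq t).const_mul _).add continuous_const |>.intervalIntegrable _ _)
          fun x hx => ?_
        · have := hcx j t; have := hcαt j t; have := hch j t
          fun_prop
        have hrow : ∀ j, (a j + μ * x) * (dt (d.α j) x t * w j x t ^ 2 + 2 * w j x t * h j x t) +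
            μ * w j x t ^ 2 ≤ (Θ * M + Θ + μ) * w j x t ^ 2 + Θ * G ^ 2 +
              2 * Θ * (|w j x t| * ∑ k, M * |w k x t|) := fun j => by
          have h1 : (a j + μ * x) * (dt (d.α j) x t * w j x t ^ 2 + 2 * w j x t * h j x t) ≤
              Θ * (M * w j x t ^ 2 + 2 * |w j x t| * |h j x t|) := by
            refine (le_abs_self _).trans ?_
            rw [abs_mul]
            refine mul_le_mul (hAb j x hx) ((abs_add_le _ _).trans (add_le_add ?_ (le_of_eq ?_)))
              (abs_nonneg _) (by linarith)
            · rw [abs_mul, abs_of_nonneg (sq_nonneg (w j x t))]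
              exact mul_le_mul_of_nonneg_right ((hd.hα j).bdt x t) (sq_nonneg _)
            · rw [abs_mul, abs_mul, abs_two]
          have h2 : |h j x t| ≤ G + ∑ k, M * |w k x t| := by
            refine (abs_sub _ _).trans (add_le_add (hG j x) ?_)
            refine (Finset.abs_sum_le_sum_abs _ _).trans (Finset.sum_le_sum fun k _ => ?_)
            rw [abs_mul]
            exact mul_le_mul_of_nonneg_right ((hd.hβ j k).bd x t) (abs_nonneg _)
          have h3 : 2 * |w j x t| * G ≤ w j x t ^ 2 + G ^ 2 := by
            rw [← sq_abs (w j x t)]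
            nlinarith [sq_nonneg (|w j x t| - G)]
          have h4 : 2 * |w j x t| * |h j x t| ≤ w j x t ^ 2 + G ^ 2 +
              2 * (|w j x t| * ∑ k, M * |w k x t|) := by
            have := mul_le_mul_of_nonneg_left h2 (by positivity : 0 ≤ 2 * |w j x t|)
            rw [mul_add] at this
            linarith
          have h5 := mul_le_mul_of_nonneg_left h4 (by linarith : 0 ≤ Θ)
          linarith
        refine (Finset.sum_le_sum fun j _ => hrow j).trans ?_
        rw [Finset.sum_add_distrib, Finset.sum_add_distrib, ← Finset.mul_sum, ← Finset.mul_sum,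
          Finset.sum_const, Finset.card_univ, Fintype.card_fin, nsmul_eq_mul]
        have h6 := mul_le_mul_of_nonneg_left
          (sum_mul_sum_le (fun j => w j x t) (by linarith : 0 ≤ M)) (by linarith : 0 ≤ 2 * Θ)
        rw [← Finset.mul_sum (f := fun j => |w j x t| * ∑ k, M * |w k x t|), hc1]
        linarith
      refine this.trans ?_
      rw [intervalIntegral.integral_add (((hwC.cont_sq t).const_mul _).intervalIntegrable _ _)
        (continuous_const.intervalIntegrable _ _), intervalIntegral.integral_const_mul,
        intervalIntegral.integral_const, sub_zero, one_smul]
      have h7 : NT w t ≤ e t / lam := by rw [le_div_iff₀ hlam, mul_comm]; exact hlow t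
      have h8 : 0 ≤ e t := le_trans (mul_nonneg hlam.le (NT_nonneg w t)) (hlow t)
      have h9 : c1 * NT w t ≤ c1 / lam * e t := by
        rw [div_mul_eq_mul_div, ← mul_div_assoc']
        exact mul_le_mul_of_nonneg_left h7 hc10
      have h10 : 0 ≤ n * Θ * e t := by positivity
      have h11 : 0 ≤ c1 / lam * G ^ 2 := by positivity
      rw [hc, add_mul, mul_add, mul_add]
      unfold NT at h9
      linarith
    · intro j _
      have := hcx j t; have := hcαt j t; have := hch j t
      exact Continuous.intervalIntegrable (by fun_prop) _ _
  have hanti : AntitoneOn (fun r => (e r + G ^ 2) * Real.exp (-(c * r))) (Icc s t) := by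
    have hφ : ∀ r, HasDerivAt (fun r => (e r + G ^ 2) * Real.exp (-(c * r))) _ r := fun r =>
      ((hder r).add_const (G ^ 2)).mul (((hasDerivAt_id r).const_mul c).neg.exp)
    refine antitoneOn_of_deriv_nonpos (convex_Icc s t)
      (fun r _ => (hφ r).continuousAt.continuousWithinAt)
      (fun r _ => (hφ r).differentiableAt.differentiableWithinAt) fun r hr => ?_
    rw [(hφ r).deriv]
    have h1 := hbulk r (interior_subset hr)
    have h2 := hbdry r
    have h3 := Real.exp_pos (-(c * r))
    rw [Finset.sum_sub_distrib]
    show (_ - _) * _ + (e r + G ^ 2) * (Real.exp (-(c * r)) * -(c * 1)) ≤ 0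
    have h4 := mul_le_mul_of_nonneg_right (sub_le_self _ h2 |>.trans h1) h3.le
    linarith
  have h1 := hanti (left_mem_Icc.mpr hst) (right_mem_Icc.mpr hst) hst
  simp only at h1
  have h2 : e t + G ^ 2 ≤ (e s + G ^ 2) * Real.exp (c * (t - s)) := by
    have := mul_le_mul_of_nonneg_right h1 (Real.exp_pos (c * t)).le
    rw [mul_assoc, mul_assoc, ← Real.exp_add, ← Real.exp_add] at this
    rw [show -(c * t) + c * t = 0 by ring, Real.exp_zero, mul_one,
      show -(c * s) + c * t = c * (t - s) by ring] at this
    exact this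
  set C := c + (M * Θ + 1) / lam with hC
  have hcC : c ≤ C := by rw [hC]; linarith [show 0 ≤ (M * Θ + 1) / lam by positivity]
  have hlC : 1 ≤ C * lam ∧ Θ * M ≤ C * lam := by
    have : C * lam = c * lam + (M * Θ + 1) := by rw [hC]; field_simp
    have h0 : 0 ≤ c * lam := by positivity
    have h1 : 0 ≤ M * Θ := by positivity
    constructor <;> linarith
  have hE1 : Real.exp (c * (t - s)) ≤ Real.exp (C * (t - s)) :=
    Real.exp_le_exp.mpr (mul_le_mul_of_nonneg_right hcC (by linarith))
  have hE2 : 1 ≤ Real.exp (c * (t - s)) :=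
    Real.one_le_exp (mul_nonneg hc0 (by linarith))
  have h3 := hlow t
  have h4 := hup s
  have hN := NT_nonneg w s
  set X := Real.exp (C * (t - s)) with hX
  have h0 : 0 ≤ e s := le_trans (mul_nonneg hlam.le (NT_nonneg w s)) (hlow s)
  have h5 : (e s + G ^ 2) * Real.exp (c * (t - s)) ≤ (e s + G ^ 2) * X := by gcongr
  have h6 : X * e s ≤ X * (C * lam * NT w s) := by
    refine mul_le_mul_of_nonneg_left (h4.trans ?_) (by positivity)
    exact mul_le_mul_of_nonneg_right hlC.2 hN
  have h7 : (X - 1) * G ^ 2 ≤ C * lam * ((X - 1) * G ^ 2) :=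
    le_mul_of_one_le_left (mul_nonneg (by linarith) (sq_nonneg _)) hlC.1
  refine le_of_mul_le_mul_left ?_ hlam
  linarith

end energy

section link

variable {n m : ℕ} {p : Fin n → Fin n → ℝ} {M lam : ℝ} {d : LD n} {u v g w : Fd n}

def vec (u : Fd n) (x t : ℝ) : Vn n := WithLp.toLp 2 fun j => u j x t

@[simp] lemma vec_apply (u : Fd n) (x t : ℝ) (j : Fin n) : vec u x t j = u j x t := rfl

lemma vec_norm_sq (u : Fd n) (x t : ℝ) : ‖vec u x t‖ ^ 2 = ∑ j, u j x t ^ 2 := by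
  rw [EuclideanSpace.norm_sq_eq]
  simp

lemma vec_sub (u v : Fd n) (x t : ℝ) : vec (u - v) x t = vec u x t - vec v x t := rfl

lemma vec_cont {X : Type*} [TopologicalSpace X] {f : X → ℝ} {h : X → ℝ} (hf : Continuous f)
    (hh : Continuous h) (hu : ∀ j, Continuous fun q : ℝ × ℝ => u j q.1 q.2) :
    Continuous fun y => vec u (f y) (h y) :=
  (PiLp.continuous_toLp 2 _).comp (continuous_pi fun j => (hu j).comp (hf.prodMk hh))

lemma memLp_of_continuous {f : ℝ → Vn n} (hf : Continuous f) : MemLp f 2 μ01 := by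
  obtain ⟨C, hC⟩ := (isCompact_Icc (a := (0:ℝ)) (b := 1)).exists_bound_of_continuousOn hf.continuousOn
  exact MemLp.of_bound hf.aestronglyMeasurable C
    ((ae_restrict_iff' measurableSet_Ioo).mpr (ae_of_all _ fun x hx => hC x (Ioo_subset_Icc_self hx)))

open Classical in
/-- The class in `L²` of a continuous function. -/
def clsF (f : ℝ → Vn n) : L2 n := if h : Continuous f then (memLp_of_continuous h).toLp f else 0

lemma clsF_ae {f : ℝ → Vn n} (hf : Continuous f) : ∀ᵐ x ∂μ01, clsF f x = f x := by
  rw [clsF, dif_pos hf]; exact MemLp.coeFn_toLp _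

lemma clsF_eq {f : ℝ → Vn n} (hf : Continuous f) {φ : L2 n} (h : ∀ᵐ x ∂μ01, φ x = f x) :
    φ = clsF f := by
  refine Lp.ext ?_
  filter_upwards [h, clsF_ae hf] with x h1 h2 using h1.trans h2.symm

lemma clsF_sub {f f' : ℝ → Vn n} (hf : Continuous f) (hf' : Continuous f') :
    clsF (fun x => f x - f' x) = clsF f - clsF f' := by
  refine (clsF_eq (hf.sub hf') ?_).symm
  filter_upwards [Lp.coeFn_sub (clsF f) (clsF f'), clsF_ae hf, clsF_ae hf'] with x h1 h2 h3
  rw [h1, Pi.sub_apply, h2, h3]; rfl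

lemma clsF_norm_sq {f : ℝ → Vn n} (hf : Continuous f) :
    ‖clsF f‖ ^ 2 = ∫ x in (0:ℝ)..1, ‖f x‖ ^ 2 := by
  rw [← real_inner_self_eq_norm_sq, L2.inner_def, intervalIntegral.integral_of_le zero_le_one,
    integral_Ioc_eq_integral_Ioo]
  refine integral_congr_ae ?_
  filter_upwards [clsF_ae hf] with x hx
  rw [hx, real_inner_self_eq_norm_sq]

def cls (u : Fd n) (t : ℝ) : L2 n := clsF fun x => vec u x t

lemma CF.vec_cont_x (hu : CF u) (t : ℝ) : Continuous fun x => vec u x t :=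
  vec_cont continuous_id continuous_const hu.cont

lemma cls_norm_sq (hu : CF u) (t : ℝ) : ‖cls u t‖ ^ 2 = NT u t := by
  rw [cls, clsF_norm_sq (hu.vec_cont_x t), NT]
  simp only [vec_norm_sq]

lemma cls_sub (hu : CF u) (hv : CF v) (t : ℝ) : cls (u - v) t = cls u t - cls v t :=
  clsF_sub (hu.vec_cont_x t) (hv.vec_cont_x t)

lemma cls_norm_le (hu : CF u) {t A : ℝ} (h : ∀ j x, |u j x t| ≤ A) :
    ‖cls u t‖ ≤ n * A := by
  by_cases hn : n = 0
  · subst hn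
    have h2 : NT u t = 0 := by simp [NT]
    rw [← cls_norm_sq hu] at h2
    have := pow_eq_zero_iff (two_ne_zero) |>.mp h2
    rw [this]; simp
  have hA : 0 ≤ A := (abs_nonneg _).trans (h ⟨0, by omega⟩ 0)
  refine abs_le_of_sq_le_sq' ?_ (by positivity) |>.2
  rw [cls_norm_sq hu, NT]
  have : (∫ x in (0:ℝ)..1, ∑ j, u j x t ^ 2) ≤ ∫ x in (0:ℝ)..1, n * A ^ 2 := by
    refine intervalIntegral.integral_mono_on zero_le_one ((hu.cont_sq t).intervalIntegrable _ _)
      (continuous_const.intervalIntegrable _ _) fun x _ => ?_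
    refine (Finset.sum_le_sum (g := fun _ => A ^ 2) fun j _ => ?_).trans (by simp)
    exact sq_le_sq.mpr ((h j x).trans (le_abs_self A))
  refine this.trans ?_
  rw [intervalIntegral.integral_const, sub_zero, one_smul]
  have : (1:ℝ) ≤ n := by exact_mod_cast Nat.one_le_iff_ne_zero.mpr hn
  nlinarith [sq_nonneg A]

/-- Data `d` represent the coefficients `a`, `b`. -/
def CoefRep (a : ℝ → ℝ → Fin n → ℝ) (b : ℝ → ℝ → Fin n → Fin n → ℝ) (d : LD n) : Prop :=
  ∀ x ∈ Icc (0:ℝ) 1, ∀ t j, a x t j * d.α j x t = 1 ∧ ∀ k, b x t j k = a x t j * d.β j k x t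

lemma bcRel_iff (w0 w1 : Vn n) (u : Fd n) (t : ℝ) (h0 : ∀ j, w0 j = u j 0 t)
    (h1 : ∀ j, w1 j = u j 1 t) :
    BCrel n m p w0 w1 ↔ ∀ j, u j (xin m j) t = ∑ k, p j k * u k (xout m k) t := by
  have e : ∀ j, (∑ k : Fin n, if m ≤ (k : ℕ) then p j k * w0 k else p j k * w1 k) =
      ∑ k, p j k * u k (xout m k) t := fun j => by
    refine Finset.sum_congr rfl fun k _ => ?_
    unfold xout
    by_cases hk : (k : ℕ) < m
    · rw [if_neg (by omega), if_pos hk, h1]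
    · rw [if_pos (by omega), if_neg hk, h0]
  constructor
  · intro h j
    unfold xin
    by_cases hj : (j : ℕ) < m
    · rw [if_pos hj, ← h0, (h j).1 hj, e]
    · rw [if_neg hj, ← h1, (h j).2 (by omega), e]
  · intro h j
    have := h j
    unfold xin at this
    refine ⟨fun hj => ?_, fun hj => ?_⟩
    · rw [if_pos hj] at this; rw [h0, this, e]
    · rw [if_neg (by omega)] at this; rw [h1, this, e]

/-- The `x`-derivative of a solution, from the equation. -/
def dX (d : LD n) (g u : Fd n) : Fd n := fun j x t =>
  g j x t - ∑ k, d.β j k x t * u k x t - d.α j x t * dF u j x t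

lemma dX_cont (hd : Good m p M lam d) (hu : TF u) (hg : CF g) (j : Fin n) :
    Continuous fun q : ℝ × ℝ => dX d g u j q.1 q.2 :=
  (Sol.h_cont hd hu.toCF hg j).sub ((hd.hα j).cont.mul (hu.td j).contt)

lemma Sol.deriv_x (hd : Good m p M lam d) (hu : TF u) (h : Sol m p d g u) (j : Fin n) :
    ∀ x ∈ Icc (0:ℝ) 1, ∀ t, HasDerivWithinAt (fun s => u j s t) (dX d g u j x t) (Icc 0 1) x :=
  (h.char j).partial_x (hd.hα j) (hu.td j)

lemma contDiff_of_Icc {f f' : ℝ → ℝ} {κ : ℝ} (hκ : 0 < κ)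
    (hf : ∀ x ∈ Icc (0:ℝ) 1, HasDerivWithinAt f (f' x) (Icc 0 1) x) (hf' : Continuous f')
    (h0 : ∀ x < κ, f x = 0) (h1 : ∀ x > 1 - κ, f x = 0) : ContDiff ℝ 1 f := by
  rw [contDiff_iff_contDiffAt]
  intro x
  by_cases hx : x ∈ Ioo (0:ℝ) 1
  · have hd : ∀ y ∈ Ioo (0:ℝ) 1, HasDerivAt f (f' y) y := fun y hy =>
      (hf y (Ioo_subset_Icc_self hy)).hasDerivAt (Icc_mem_nhds hy.1 hy.2)
    have : ContDiffOn ℝ 1 f (Ioo 0 1) := by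
      rw [show (1 : WithTop ℕ∞) = 0 + 1 by rfl, contDiffOn_succ_iff_deriv_of_isOpen isOpen_Ioo]
      refine ⟨fun y hy => (hd y hy).differentiableAt.differentiableWithinAt, by simp, ?_⟩
      rw [contDiffOn_zero]
      exact hf'.continuousOn.congr fun y hy => (hd y hy).deriv
    exact this.contDiffAt (Ioo_mem_nhds hx.1 hx.2)
  · have : f =ᶠ[𝓝 x] fun _ => 0 := by
      rw [mem_Ioo, not_and_or, not_lt, not_lt] at hx
      rcases hx with hx | hx
      · filter_upwards [Iio_mem_nhds (show x < κ by linarith)] with y hy using h0 y hy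
      · filter_upwards [Ioi_mem_nhds (show 1 - κ < x by linarith)] with y hy using h1 y hy
    exact contDiffAt_const.congr_of_eventuallyEq this

/-- Solutions with compactly supported data are governed by the evolution family. -/
lemma link_compact {a : ℝ → ℝ → Fin n → ℝ} {b : ℝ → ℝ → Fin n → Fin n → ℝ}
    {U : ℝ → ℝ → L2 n →L[ℝ] L2 n} (hU : GeneratedBy n m p a b U) (hd : Good m p M lam d)
    (hr : CoefRep a b d) (hu : TF u) (hg : CF g) (h : Sol m p d g u) {s κ : ℝ} (hκ : 0 < κ)
    (hgs : ∀ j x t, s ≤ t → g j x t = 0)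
    (h0 : ∀ j, ∀ x < κ, u j x s = 0) (h1 : ∀ j, ∀ x > 1 - κ, u j x s = 0) {t : ℝ} (hst : s ≤ t) :
    U t s (cls u s) = cls u t := by
  have hc := dX_cont hd hu hg
  have hder := fun j => Sol.deriv_x hd hu h j
  refine clsF_eq (hu.toCF.vec_cont_x t) (hU.2.2.2 s (fun x => vec u x s) ?_ ?_ _
    (clsF_ae (hu.toCF.vec_cont_x s)) (vec u) (vec (dX d g u)) (vec (dF u)) ?_ t hst)
  · rw [contDiff_euclidean]
    exact fun j => contDiff_of_Icc hκ (fun x hx => hder j x hx s)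
      ((hc j).comp (continuous_id.prodMk continuous_const)) (h0 j) (h1 j)
  · refine (closure_minimal (fun x hx => ?_) isClosed_Icc).trans
      (Icc_subset_Ioo (a₁ := κ) (b₁ := 1 - κ) hκ (by linarith))
    by_contra hx'
    refine hx ?_
    ext j
    rw [mem_Icc, not_and_or, not_le, not_le] at hx'
    rcases hx' with hx' | hx'
    · exact h0 j x hx'
    · exact h1 j x hx'
  · refine ⟨(vec_cont continuous_fst continuous_snd hu.toCF.cont).continuousOn,
      (vec_cont continuous_fst continuous_snd hc).continuousOn,
      (vec_cont continuous_fst continuous_snd fun j => (hu.td j).contt).continuousOn,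
      fun x hx r _ j => ⟨hder j x hx r, ((hu.td j).deriv x r).hasDerivWithinAt⟩,
      fun x hx r hr' j => ?_, fun r _ => ?_, fun _ _ => rfl⟩
    · obtain ⟨ha, hb⟩ := hr x hx r j
      simp only [vec_apply, dX, hgs j x r hr', hb]
      simp only [mul_assoc, ← Finset.mul_sum]
      linear_combination (-dF u j x r) * ha
    · rw [bcRel_iff (vec u 0 r) (vec u 1 r) u r (fun _ => rfl) fun _ => rfl]
      exact fun j => h.bc j r

end link

section density

variable {n m : ℕ} {p : Fin n → Fin n → ℝ} {M lam : ℝ} {d : LD n} {u v g w : Fd n}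

/-- Classes of smooth functions with compact support in `(0,1)`. -/
def testSpace (n : ℕ) : Submodule ℝ (L2 n) where
  carrier := {ψ | ∃ φ : ℝ → Vn n, ContDiff ℝ 2 φ ∧ tsupport φ ⊆ Ioo 0 1 ∧ ∀ᵐ x ∂μ01, ψ x = φ x}
  zero_mem' := ⟨fun _ => 0, contDiff_const, by simp [tsupport, Function.support_fun_zero],
    Lp.coeFn_zero _ _ _⟩
  add_mem' := by
    rintro a b ⟨φ, h1, h2, h3⟩ ⟨φ', h1', h2', h3'⟩
    refine ⟨φ + φ', h1.add h1', (tsupport_add φ φ').trans (union_subset h2 h2'), ?_⟩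
    filter_upwards [Lp.coeFn_add a b, h3, h3'] with x e1 e2 e3
    rw [e1, Pi.add_apply, e2, e3]; rfl
  smul_mem' := by
    rintro c a ⟨φ, h1, h2, h3⟩
    refine ⟨fun x => c • φ x, (contDiff_const (c := c)).fun_smul h1,
      (closure_mono fun x hx => ?_).trans h2, ?_⟩
    · intro h0
      exact hx (by simp [h0])
    filter_upwards [Lp.coeFn_smul c a, h3] with x e1 e2
    rw [e1, Pi.smul_apply, e2]

lemma testSpace_dense (n : ℕ) (ψ : L2 n) {ε : ℝ} (hε : 0 < ε) :
    ∃ φ : ℝ → Vn n, ContDiff ℝ 2 φ ∧ tsupport φ ⊆ Ioo 0 1 ∧ ‖clsF φ - ψ‖ < ε := by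
  have key : (testSpace n).topologicalClosure = ⊤ := by
    rw [Submodule.topologicalClosure_eq_top_iff, Submodule.eq_bot_iff]
    intro χ hχ
    have hi : Integrable (fun x => χ x) μ01 := (Lp.memLp χ).integrable (by norm_num)
    have hz := (isOpen_Ioo (a := (0:ℝ)) (b := 1)).ae_eq_zero_of_integral_contDiff_smul_eq_zero
      (f := fun x => χ x) (μ := μ01) (hi.locallyIntegrable.locallyIntegrableOn _) ?_
    · refine (Lp.eq_zero_iff_ae_eq_zero).mpr ?_
      filter_upwards [hz, ae_restrict_mem measurableSet_Ioo] with x h1 h2 using h1 h2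
    · intro η hη hc hs
      have hb : ∃ C, ∀ x, ‖η x‖ ≤ C := hc.exists_bound_of_continuous hη.continuous
      obtain ⟨C, hC⟩ := hb
      have hI0 : Integrable (fun x => η x • χ x) μ01 :=
        hi.bdd_smul C hη.continuous.aestronglyMeasurable (ae_of_all _ hC)
      refine ext_inner_left ℝ fun e => ?_
      rw [inner_zero_right, ← integral_inner hI0]
      have hec : Continuous fun x => η x • e := hη.continuous.smul continuous_const
      have hmem : clsF (fun x => η x • e) ∈ testSpace n := by
        refine ⟨fun x => η x • e, (hη.of_le (WithTop.coe_le_coe.mpr le_top)).smul contDiff_const,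
          (closure_mono (t := Function.support η) fun x hx => ?_).trans hs, clsF_ae hec⟩
        exact fun h0 => hx (by simp [h0])
      have h0 := (Submodule.mem_orthogonal _ _).mp hχ _ hmem
      rw [L2.inner_def] at h0
      rw [← h0]
      refine integral_congr_ae ?_
      filter_upwards [clsF_ae hec] with x hx
      rw [hx, inner_smul_left, inner_smul_right]; rfl
  have hψ : ψ ∈ closure (testSpace n : Set (L2 n)) := by
    rw [← Submodule.topologicalClosure_coe, key]; trivial
  obtain ⟨ζ, ⟨φ, h1, h2, h3⟩, hd⟩ := Metric.mem_closure_iff.mp hψ ε hε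
  refine ⟨φ, h1, h2, ?_⟩
  rw [← clsF_eq h1.continuous h3, ← dist_eq_norm, dist_comm]
  exact hd

lemma Sol.add {g' : Fd n} (h : Sol m p d g u) (h' : Sol m p d g' v) :
    Sol m p d (g + g') (u + v) where
  char j := ((h.char j).add (h'.char j)).congr fun x _ t => by
    simp only [Pi.add_apply, mul_add, Finset.sum_add_distrib]; ring
  bc j t := by
    simp only [Pi.add_apply, mul_add, Finset.sum_add_distrib, h.bc, h'.bc]

lemma Sol.sub {g' : Fd n} (h : Sol m p d g u) (h' : Sol m p d g' v) :
    Sol m p d (g - g') (u - v) where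
  char j := ((h.char j).sub (h'.char j)).congr fun x _ t => by
    simp only [Pi.sub_apply, mul_sub, Finset.sum_sub_distrib]; ring
  bc j t := by
    simp only [h.bc, h'.bc, Pi.sub_apply, mul_sub, Finset.sum_sub_distrib]

/-- A smooth cutoff from `0` before time `a` to `1` after time `a + h`. -/
def ramp (a h t : ℝ) : ℝ := Real.smoothTransition ((t - a) / h)

lemma ramp_contDiff (a h : ℝ) : ContDiff ℝ 2 (ramp a h) :=
  Real.smoothTransition.contDiff.comp ((contDiff_id.sub contDiff_const).div_const h)

lemma ramp_zero {a h t : ℝ} (hh : 0 < h) (ht : t ≤ a) : ramp a h t = 0 :=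
  Real.smoothTransition.zero_of_nonpos (div_nonpos_of_nonpos_of_nonneg (by linarith) hh.le)

lemma ramp_one {a h t : ℝ} (hh : 0 < h) (ht : a + h ≤ t) : ramp a h t = 1 :=
  Real.smoothTransition.one_of_one_le ((one_le_div hh).mpr (by linarith))

lemma ramp_mem (a h t : ℝ) : ramp a h t ∈ Icc (0:ℝ) 1 :=
  ⟨Real.smoothTransition.nonneg _, Real.smoothTransition.le_one _⟩

lemma ramp_abs_le (a h t : ℝ) : |ramp a h t| ≤ 1 := by
  rw [abs_of_nonneg (ramp_mem a h t).1]; exact (ramp_mem a h t).2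

lemma ContDiff.td {w : ℝ → ℝ} (hw : ContDiff ℝ 2 w) : TD (fun _ t => w t) (fun _ t => deriv w t) :=
  TD.of_time (fun t => (hw.differentiable (by norm_num) t).hasDerivAt)
    (hw.continuous_deriv (by norm_num))

/-- Multiplication of a field by a function of time. -/
def tmul (w : ℝ → ℝ) (g : Fd n) : Fd n := fun j x t => w t * g j x t

lemma TD.to_TF (h : ∀ j, ∃ ut, TD (u j) ut) (hc : ∀ j x t, u j (cl x) t = u j x t) : TF u :=
  ⟨fun j => (h j).choose_spec.to_dt, hc⟩

lemma TF.tmul {w : ℝ → ℝ} (hw : ContDiff ℝ 2 w) (hg : TF g) : TF (tmul w g) :=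
  TD.to_TF (fun j => ⟨_, hw.td.mul (hg.td j)⟩) fun j x t => by simp only [_root_.tmul, hg.clamp]

lemma tsupport_gap {φ : ℝ → Vn n} (h : tsupport φ ⊆ Ioo 0 1) : ∃ κ : ℝ, 0 < κ ∧ κ ≤ 1 ∧
    ∀ x, φ x ≠ 0 → x ∈ Icc κ (1 - κ) := by
  have hc : IsCompact (tsupport φ) :=
    (isCompact_Icc (a := (0:ℝ)) (b := 1)).of_isClosed_subset (isClosed_tsupport φ)
      (h.trans Ioo_subset_Icc_self)
  rcases (tsupport φ).eq_empty_or_nonempty with he | hne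
  · refine ⟨1, one_pos, le_rfl, fun x hx => absurd (subset_tsupport φ hx) (by simp [he])⟩
  obtain ⟨a, ha, hamin⟩ := hc.exists_isMinOn hne continuous_id.continuousOn
  obtain ⟨b, hb, hbmax⟩ := hc.exists_isMaxOn hne continuous_id.continuousOn
  refine ⟨min a (1 - b), lt_min (h ha).1 (by linarith [(h hb).2]),
    (min_le_left _ _).trans (h ha).2.le, fun x hx => ⟨?_, ?_⟩⟩
  · exact (min_le_left _ _).trans (hamin (subset_tsupport φ hx))
  · have h1 : x ≤ b := hbmax (subset_tsupport φ hx)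
    linarith [min_le_right a (1 - b)]

/-- The residual of a time independent field. -/
def statRes (d : LD n) (φ : ℝ → Vn n) : Fd n := fun j x t =>
  deriv (fun y => φ y j) x + ∑ k, d.β j k x t * φ x k

lemma statRes_props (hd : Good m p M lam d) {φ : ℝ → Vn n} (hφ : ContDiff ℝ 2 φ) {κ : ℝ}
    (hκ : 0 < κ) (hs : ∀ x, φ x ≠ 0 → x ∈ Icc κ (1 - κ)) :
    TF (fun j x _ => φ x j : Fd n) ∧ TF (statRes d φ) ∧
    Sol m p d (statRes d φ) (fun j x _ => φ x j) ∧
    (∀ j x t, x ∉ Icc κ (1 - κ) → statRes d φ j x t = 0) ∧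
    ∃ G, 0 ≤ G ∧ ∀ j x t, |statRes d φ j x t| ≤ G := by
  have hj : ∀ j, ContDiff ℝ 2 fun y => φ y j := contDiff_euclidean.mp hφ
  have h0 : ∀ x, x ∉ Icc κ (1 - κ) → φ x = 0 := fun x hx => by
    by_contra h; exact hx (hs x h)
  have h0' : ∀ j x, x ∉ Icc κ (1 - κ) → deriv (fun y => φ y j) x = 0 := fun j x hx => by
    have : (fun y => φ y j) =ᶠ[𝓝 x] fun _ => 0 := by
      filter_upwards [isClosed_Icc.isOpen_compl.mem_nhds hx] with y hy
      rw [h0 y hy]; rfl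
    rw [this.deriv_eq, deriv_const]
  have hcd : ∀ j, Continuous (deriv fun y => φ y j) := fun j =>
    (hj j).continuous_deriv (by norm_num)
  have hz : ∀ j x t, x ∉ Icc κ (1 - κ) → statRes d φ j x t = 0 := fun j x t hx => by
    simp [statRes, h0' j x hx, h0 x hx]
  have hclx : ∀ x, cl x = x ∨ (cl x ∉ Icc κ (1 - κ) ∧ x ∉ Icc κ (1 - κ)) := fun x => by
    by_cases hx : x ∈ Icc (0:ℝ) 1
    · left; unfold cl; rw [min_eq_right hx.2, max_eq_right hx.1]
    · right
      rw [mem_Icc, not_and_or, not_le, not_le] at hx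
      unfold cl
      rcases hx with hx | hx
      · rw [min_eq_right (by linarith), max_eq_left hx.le]
        exact ⟨fun h => by linarith [h.1], fun h => by linarith [h.1]⟩
      · rw [min_eq_left hx.le, max_eq_right zero_le_one]
        exact ⟨fun h => by linarith [h.2], fun h => by linarith [h.2]⟩
  have td : ∀ j, TD (fun x _ => φ x j) (fun _ _ => 0) := fun j =>
    ⟨(hj j).continuous.comp continuous_fst, continuous_const, fun x t => hasDerivAt_const t _⟩
  have hTF : TF (fun j x _ => φ x j : Fd n) := TD.to_TF (fun j => ⟨_, td j⟩) fun j x t => by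
    rcases hclx x with h | ⟨h, h'⟩
    · rw [h]
    · rw [h0 _ h, h0 _ h']
  have hend : ∀ j : Fin n, φ (xin m j) = 0 ∧ φ (xout m j) = 0 := fun j => by
    constructor
    all_goals refine h0 _ fun h => ?_
    · unfold xin at h; split_ifs at h <;> linarith [h.1, h.2]
    · unfold xout at h; split_ifs at h <;> linarith [h.1, h.2]
  refine ⟨hTF, ?_, ⟨fun j => ?_, fun j t => by simp [hend]⟩, hz, ?_⟩
  · refine TD.to_TF (fun j => ⟨_, TD.add (⟨(hcd j).comp continuous_fst, continuous_const,
      fun x t => hasDerivAt_const t _⟩ : TD (fun x _ => deriv (fun y => φ y j) x) (fun _ _ => 0))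
      (TD.sum Finset.univ fun k _ => (hd.hβ j k).toTD.mul (td k))⟩) fun j x t => ?_
    rcases hclx x with h | ⟨h, h'⟩
    · rw [h]
    · rw [hz j _ t h, hz j _ t h']
  · refine (CharD.of_partial (hd.hα j) (td j) (vx := fun x _ => deriv (fun y => φ y j) x)
      fun x _ t => ((hj j).differentiable (by norm_num) x).hasDerivAt.hasDerivWithinAt).congr
      fun x _ t => ?_
    simp [statRes]
  · have hb : ∃ G, ∀ x ∈ Icc (0:ℝ) 1, ∀ j, |deriv (fun y => φ y j) x| ≤ G ∧ |φ x j| ≤ G := by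
      obtain ⟨G, hG⟩ := (isCompact_Icc (a := (0:ℝ)) (b := 1)).exists_bound_of_continuousOn
        (f := fun x => ((fun j => deriv (fun y => φ y j) x : Fin n → ℝ), (fun j => φ x j : Fin n → ℝ)))
        ((continuous_pi hcd).prodMk (continuous_pi fun j => (hj j).continuous)).continuousOn
      refine ⟨G, fun x hx j => ⟨?_, ?_⟩⟩
      · exact ((norm_le_pi_norm (fun j => deriv (fun y => φ y j) x) j).trans
          (le_max_left _ _)).trans (hG x hx)
      · exact ((norm_le_pi_norm (fun j => φ x j) j).trans (le_max_right _ _)).trans (hG x hx)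
    obtain ⟨G, hG⟩ := hb
    have hM := hd.hM
    refine ⟨|G| + n * (M * |G|), by positivity, fun j x t => ?_⟩
    by_cases hx : x ∈ Icc κ (1 - κ)
    · have hx' : x ∈ Icc (0:ℝ) 1 := ⟨hκ.le.trans hx.1, hx.2.trans (by linarith)⟩
      refine (abs_add_le _ _).trans (add_le_add ((hG x hx' j).1.trans (le_abs_self G)) ?_)
      refine (Finset.abs_sum_le_sum_abs _ _).trans
        ((Finset.sum_le_sum (g := fun _ => M * |G|) fun k _ => ?_).trans (by simp))
      rw [abs_mul]
      exact mul_le_mul ((hd.hβ j k).bd x t) ((hG x hx' k).2.trans (le_abs_self G)) (abs_nonneg _)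
        (by linarith)
    · rw [hz j x t hx, abs_zero]; positivity

lemma backCl_tent (hlam : 0 < lam) (c κ : ℝ) :
    BackCl lam fun x => c + lam * max 0 (max (κ - x) (κ - 1 + x)) where
  lip x _ y _ := by
    have h1 : max 0 (max (κ - x) (κ - 1 + x)) ≤ max 0 (max (κ - y) (κ - 1 + y)) + |x - y| := by
      have e1 := le_abs_self (x - y)
      have e2 := neg_abs_le (x - y)
      have a1 := le_max_left 0 (max (κ - y) (κ - 1 + y))
      have a2 := (le_max_left (κ - y) (κ - 1 + y)).trans (le_max_right 0 (max (κ - y) (κ - 1 + y)))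
      have a3 := (le_max_right (κ - y) (κ - 1 + y)).trans (le_max_right 0 (max (κ - y) (κ - 1 + y)))
      refine max_le ?_ (max_le ?_ ?_) <;> linarith [abs_nonneg (x - y)]
    have := mul_le_mul_of_nonneg_left h1 hlam.le
    linarith
  ends := by
    congr 2
    rw [max_comm (κ - 0)]
    congr 2 <;> ring

lemma exists_approx (hH : H3cond n p) (hd : Good m p M lam d) (s : ℝ) (ψ : L2 n) {ε : ℝ}
    (hε : 0 < ε) : ∃ u g : Fd n, ∃ κ : ℝ, TF u ∧ CF g ∧ Sol m p d g u ∧ 0 < κ ∧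
      (∀ j x t, s ≤ t → g j x t = 0) ∧ (∀ j, ∀ x < κ, u j x s = 0) ∧
      (∀ j, ∀ x > 1 - κ, u j x s = 0) ∧ ‖cls u s - ψ‖ < ε := by
  obtain ⟨φ, hφ, hsupp, hφψ⟩ := testSpace_dense n ψ (half_pos hε)
  obtain ⟨κ, hκ, hκ1, hs⟩ := tsupport_gap hsupp
  obtain ⟨hT, hRT, hS, hR0, G, hG, hRG⟩ := statRes_props hd hφ hκ hs
  obtain ⟨Cf, hCf, γ, hγ, hfor⟩ := exists_forward hH m hd.hM hd.hlam
  obtain ⟨C, hC, hen⟩ := energy_bd p m hd.hM hd.hlam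
  obtain ⟨h, hh, hh1, hh2⟩ : ∃ h : ℝ, 0 < h ∧ h ≤ lam * (κ / 2) ∧
      C * ((Real.exp (C * h) - 1) * G ^ 2) < (ε / 2) ^ 2 := by
    have hc : Continuous fun h : ℝ => C * ((Real.exp (C * h) - 1) * G ^ 2) := by fun_prop
    have e1 : ∀ᶠ h in 𝓝[>] (0:ℝ), C * ((Real.exp (C * h) - 1) * G ^ 2) < (ε / 2) ^ 2 := by
      refine (hc.tendsto 0).mono_left nhdsWithin_le_nhds |>.eventually (gt_mem_nhds ?_)
      simp only [mul_zero, Real.exp_zero, sub_self, zero_mul]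
      positivity
    have e2 : ∀ᶠ h in 𝓝[>] (0:ℝ), h < lam * (κ / 2) :=
      nhdsWithin_le_nhds (gt_mem_nhds (mul_pos hd.hlam (half_pos hκ)))
    obtain ⟨h, h1, h2, h3⟩ := (e1.and (e2.and self_mem_nhdsWithin)).exists
    exact ⟨h, h3, h2.le, h1⟩
  set us : Fd n := fun j x _ => φ x j with hus
  set src : Fd n := tmul (fun t => -ramp (s - h) h t) (statRes d φ) with hsrc
  have hsrcT : TF src := TF.tmul (ramp_contDiff _ _).neg hRT
  have hsrcb : ∀ j x t, |src j x t| ≤ G := fun j x t => by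
    simp only [hsrc, tmul, abs_mul, abs_neg]
    calc _ ≤ 1 * G := mul_le_mul (ramp_abs_le _ _ _) (hRG j x t) (abs_nonneg _) zero_le_one
      _ = G := one_mul G
  have hsrc0 : ∀ j x t, t ≤ s - h → src j x t = 0 := fun j x t ht => by
    simp [hsrc, tmul, ramp_zero hh ht]
  obtain ⟨v, hvT, hvE, -, hvV⟩ := hfor d hd src hsrcT (G * Real.exp (-(γ * (s - h))))
    (by positivity) fun j x t => by
      by_cases ht : t ≤ s - h
      · rw [hsrc0 j x t ht, abs_zero]; positivity
      · refine (hsrcb j x t).trans ?_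
        rw [mul_assoc, ← Real.exp_add]
        refine le_mul_of_one_le_right hG (Real.one_le_exp ?_)
        nlinarith
  have hvS : Sol m p d src v := Sol.of_eq hd hvT.toCF hsrcT.toCF hvE
  have hvan := hvV _ (backCl_tent hd.hlam (s - h) κ) fun j x hx t ht => by
    by_cases hx' : x ∈ Icc κ (1 - κ)
    · refine hsrc0 j x t (ht.trans_eq ?_)
      rw [max_eq_left (max_le (by linarith [hx'.1]) (by linarith [hx'.2])), mul_zero, add_zero]
    · simp [hsrc, tmul, hR0 j x t hx']
  have hv0 : ∀ j x t, t ≤ s - h → v j x t = 0 := fun j x t ht => by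
    rw [← hvT.clamp]
    refine hvan j _ (cl_mem x) t (ht.trans (le_add_of_nonneg_right ?_))
    exact mul_nonneg hd.hlam.le (le_max_left _ _)
  have hvs : ∀ j, ∀ y ∈ Icc (0:ℝ) 1, (y < κ / 2 ∨ 1 - κ / 2 < y) → v j y s = 0 :=
      fun j y hy hor => by
    refine hvan j y hy s ?_
    have : κ / 2 ≤ max 0 (max (κ - y) (κ - 1 + y)) := by
      refine le_trans ?_ (le_max_right _ _)
      rcases hor with h1 | h1
      · exact le_trans (by linarith) (le_max_left _ _)
      · exact le_trans (by linarith) (le_max_right _ _)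
    have := mul_le_mul_of_nonneg_left this hd.hlam.le
    linarith
  have hclt : ∀ x, x < κ / 2 → cl x < κ / 2 := fun x hx =>
    max_lt (half_pos hκ) (lt_of_le_of_lt (min_le_right _ _) hx)
  have hclt' : ∀ x, 1 - κ / 2 < x → 1 - κ / 2 < cl x := fun x hx =>
    lt_of_lt_of_le (lt_min (by linarith) hx) (le_max_right _ _)
  have hφ0 : ∀ x, x ∉ Icc κ (1 - κ) → φ x = 0 := fun x hx => by
    by_contra h0; exact hx (hs x h0)
  refine ⟨us + v, statRes d φ + src, κ / 2, hT.add hvT, hRT.toCF.add hsrcT.toCF, hS.add hvS,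
    half_pos hκ, fun j x t ht => ?_, fun j x hx => ?_, fun j x hx => ?_, ?_⟩
  · simp only [Pi.add_apply, hsrc, tmul, ramp_one hh (show s - h + h ≤ t by linarith)]; ring
  · rw [Pi.add_apply, Pi.add_apply, Pi.add_apply, ← hvT.clamp,
      hvs j _ (cl_mem x) (Or.inl (hclt x hx))]
    simp [hus, hφ0 x fun h' => by linarith [h'.1]]
  · rw [Pi.add_apply, Pi.add_apply, Pi.add_apply, ← hvT.clamp,
      hvs j _ (cl_mem x) (Or.inr (hclt' x hx))]
    simp [hus, hφ0 x fun h' => by linarith [h'.2]]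
  · have e0 : cls us s = clsF φ := rfl
    have e1 : cls (us + v) s - cls us s = cls v s := by
      rw [← cls_sub (hT.add hvT).toCF hT.toCF, add_sub_cancel_left]
    have e2 : ‖cls v s‖ < ε / 2 := by
      refine lt_of_pow_lt_pow_left₀ 2 (half_pos hε).le ?_
      rw [cls_norm_sq hvT.toCF]
      refine lt_of_le_of_lt (hen d hd src v hsrcT.toCF hvT hvS (s - h) s G (by linarith)
        fun r _ j x => hsrcb j x r) ?_
      have : NT v (s - h) = 0 := by simp [NT, hv0 _ _ _ le_rfl]
      rw [this, mul_zero, zero_add, sub_sub_cancel]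
      exact hh2
    calc ‖cls (us + v) s - ψ‖ = ‖cls v s + (clsF φ - ψ)‖ := by rw [← e1, e0]; congr 1; abel
      _ ≤ ‖cls v s‖ + ‖clsF φ - ψ‖ := norm_add_le _ _
      _ < ε := by linarith

lemma eq_of_norm_sub_le_mul {X : Type*} [NormedAddCommGroup X] {a b : X} {K : ℝ} (hK : 0 ≤ K)
    (h : ∀ ε > 0, ‖a - b‖ ≤ K * ε) : a = b := by
  refine eq_of_norm_sub_le_zero (le_of_forall_pos_le_add fun ε hε => ?_)
  rw [zero_add]
  refine (h (ε / (K + 1)) (by positivity)).trans ?_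
  rw [mul_div_assoc', div_le_iff₀ (by linarith)]
  nlinarith

/-- The energy estimate for the difference of two solutions with the same source. -/
lemma cls_diff_bd (p : Fin n → Fin n → ℝ) (m : ℕ) (hM : 1 ≤ M) (hlam : 0 < lam) :
    ∃ C : ℝ, 0 ≤ C ∧ ∀ d : LD n, Good m p M lam d → ∀ g w : Fd n, CF g → TF w → Sol m p d g w →
      ∀ s t, s ≤ t → (∀ r ∈ Icc s t, ∀ j x, g j x r = 0) →
      ‖cls w t‖ ≤ C * Real.exp (C * (t - s)) * ‖cls w s‖ := by
  obtain ⟨C, hC, hen⟩ := energy_bd p m hM hlam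
  refine ⟨C + 1, by linarith, fun d hd g w hg hw h s t hst h0 => ?_⟩
  have h1 := hen d hd g w hg hw h s t 0 hst fun r hr j x => by simp [h0 r hr]
  rw [← cls_norm_sq hw.toCF, ← cls_norm_sq hw.toCF] at h1
  refine abs_le_of_sq_le_sq' ?_ (by positivity) |>.2
  have e1 : Real.exp (C * (t - s)) ≤ Real.exp ((C + 1) * (t - s)) :=
    Real.exp_le_exp.mpr (by nlinarith)
  have e2 : 1 ≤ Real.exp ((C + 1) * (t - s)) := Real.one_le_exp (by nlinarith)
  calc _ ≤ C * (Real.exp (C * (t - s))) * ‖cls w s‖ ^ 2 := by linarith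
    _ ≤ (C + 1) ^ 2 * (Real.exp ((C + 1) * (t - s))) ^ 2 * ‖cls w s‖ ^ 2 := by
        refine mul_le_mul_of_nonneg_right (mul_le_mul (by nlinarith) ?_ (Real.exp_pos _).le
          (by positivity)) (by positivity)
        nlinarith
    _ = _ := by ring

/-- Solutions are governed by the evolution family from the time their source vanishes. -/
lemma link {a : ℝ → ℝ → Fin n → ℝ} {b : ℝ → ℝ → Fin n → Fin n → ℝ}
    {U : ℝ → ℝ → L2 n →L[ℝ] L2 n} (hU : GeneratedBy n m p a b U) (hH : H3cond n p)
    (hd : Good m p M lam d) (hr : CoefRep a b d) (hu : TF u) (hg : CF g) (h : Sol m p d g u) {s : ℝ}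
    (hgs : ∀ j x t, s ≤ t → g j x t = 0) {t : ℝ} (hst : s ≤ t) : U t s (cls u s) = cls u t := by
  obtain ⟨C, hC, hen⟩ := cls_diff_bd p m hd.hM hd.hlam
  refine eq_of_norm_sub_le_mul (K := ‖U t s‖ + C * Real.exp (C * (t - s))) (by positivity)
    fun ε hε => ?_
  obtain ⟨v, gv, κ, hv, hgv, hvS, hκ, hgv0, hv0, hv1, hve⟩ := exists_approx hH hd s (cls u s) hε
  have e1 := link_compact hU hd hr hv hgv hvS hκ hgv0 hv0 hv1 hst
  have e2 := hen d hd _ _ (hgv.sub hg) (hv.sub hu) (hvS.sub h) s t hst fun r hr j x => by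
    simp [hgv0 j x r hr.1, hgs j x r hr.1]
  rw [cls_sub hv.toCF hu.toCF, cls_sub hv.toCF hu.toCF] at e2
  calc ‖U t s (cls u s) - cls u t‖
      = ‖(cls v t - cls u t) - U t s (cls v s - cls u s)‖ := by rw [map_sub, e1]; congr 1; abel
    _ ≤ ‖cls v t - cls u t‖ + ‖U t s (cls v s - cls u s)‖ := norm_sub_le _ _
    _ ≤ C * Real.exp (C * (t - s)) * ε + ‖U t s‖ * ε := by
        refine add_le_add (e2.trans (mul_le_mul_of_nonneg_left hve.le (by positivity)))
          (((U t s).le_opNorm _).trans (mul_le_mul_of_nonneg_left hve.le (norm_nonneg _)))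
    _ = _ := by ring

end density

section sup_bound

variable {n m : ℕ} {p : Fin n → Fin n → ℝ} {M lam : ℝ} {d : LD n} {u v g w : Fd n}

lemma integral_abs_le_cls (hu : CF u) (k : Fin n) (t : ℝ) :
    ∫ x in (0:ℝ)..1, |u k x t| ≤ ‖cls u t‖ := by
  have hc := hu.cont_x k t
  have h1 : ∀ c : ℝ, 0 < c → ∫ x in (0:ℝ)..1, |u k x t| ≤ c / 2 + ‖cls u t‖ ^ 2 / (2 * c) := by
    intro c hc0
    rw [cls_norm_sq hu, NT]
    have : (∫ x in (0:ℝ)..1, |u k x t|) ≤ ∫ x in (0:ℝ)..1, (c / 2 + (∑ j, u j x t ^ 2) * (2 * c)⁻¹) := by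
      refine intervalIntegral.integral_mono_on zero_le_one (hc.abs.intervalIntegrable _ _)
        (((continuous_const).add ((hu.cont_sq t).mul continuous_const)).intervalIntegrable _ _)
        fun x _ => ?_
      have e1 : u k x t ^ 2 ≤ ∑ j, u j x t ^ 2 :=
        Finset.single_le_sum (f := fun j => u j x t ^ 2) (fun _ _ => sq_nonneg _) (Finset.mem_univ k)
      have e2 : u k x t ^ 2 * (2 * c)⁻¹ ≤ (∑ j, u j x t ^ 2) * (2 * c)⁻¹ :=
        mul_le_mul_of_nonneg_right e1 (by positivity)
      refine le_trans ?_ (add_le_add_right e2 _)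
      rw [← sq_abs, ← div_eq_mul_inv, ← sub_nonneg]
      have : c / 2 + |u k x t| ^ 2 / (2 * c) - |u k x t| = (c - |u k x t|) ^ 2 / (2 * c) := by
        field_simp; ring
      rw [this]; positivity
    refine this.trans_eq ?_
    have hcm : Continuous fun x => (∑ j, u j x t ^ 2) * (2 * c)⁻¹ :=
      (hu.cont_sq t).mul continuous_const
    rw [intervalIntegral.integral_add intervalIntegrable_const (hcm.intervalIntegrable _ _),
      intervalIntegral.integral_mul_const]
    simp [div_eq_mul_inv]
  refine le_of_forall_pos_le_add fun ε hε => ?_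
  have hN := norm_nonneg (cls u t)
  refine (h1 (‖cls u t‖ + ε) (by linarith)).trans ?_
  have : ‖cls u t‖ ^ 2 / (2 * (‖cls u t‖ + ε)) ≤ ‖cls u t‖ / 2 := by
    rw [div_le_iff₀ (by linarith)]; nlinarith
  linarith

lemma row_L2_bd (n m : ℕ) (p : Fin n → Fin n → ℝ) (hM : 1 ≤ M) (hlam : 0 < lam) :
    ∃ C : ℝ, 0 ≤ C ∧ ∀ d : LD n, Good m p M lam d → ∀ g w : Fd n, CF g → TF w → Sol m p d g w →
      ∀ t B, (∀ s, |s - t| ≤ 2 * M → (∀ j x, g j x s = 0) ∧ ‖cls w s‖ ≤ B) → ∀ j x,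
      |w j x t| ≤ Real.exp (2 * M) * |bq m p w j (fl (d.α j) (xin m j) x t)| + C * B := by
  set E := M * Real.exp (2 * M) + Real.exp M
  have hE : 0 ≤ E := by positivity
  refine ⟨Real.exp M * (n * (E * M * (Real.exp M / lam * (4 * M * (1 + n * M))))), by positivity,
    fun d hd g w hg hw hS t B hB j x => ?_⟩
  have hB0 : 0 ≤ B := (norm_nonneg _).trans (hB t (by simp; linarith)).2
  have hnear : ∀ ξ, |fl (d.α j) ξ x t - t| ≤ M := fun ξ => (hd.hα j).fl_near ξ x t
  have hFop : Fop m d g j x t = 0 := by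
    have : LB 0 t 0 (Fop m d g) := by
      have := Fop_bd hd (R := 0) (t := t) (A := 0) (g := g) fun k y s hs => by
        rw [(hB s (by linarith)).1 k y, abs_zero]
      simpa using this
    exact abs_nonpos_iff.mp (this j x t (by simp))
  have e0 : w j x t = Kop m p d w j x t := by
    conv_lhs => rw [hS.eq hd hw.toCF hg]
    simp [hFop]
  have hce : ∀ {f : ℝ → ℝ → ℝ}, (Continuous fun q : ℝ × ℝ => f q.1 q.2) →
      Continuous fun ξ => f ξ (fl (d.α j) ξ x t) := fun hf =>
    hf.comp (continuous_id.prodMk ((hd.hα j).fl_cont₁ x t))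
  have hterm : ∀ k, j ≠ k → |∫ ξ in xin m j..cl x, (-(eF m d j ξ (fl (d.α j) ξ x t) *
      d.β j k ξ (fl (d.α j) ξ x t))) * w k ξ (fl (d.α j) ξ x t)| ≤
      E * M * (Real.exp M / lam * (4 * M * ((1 + n * M) * B))) := fun k hjk => by
    refine averaging_bound (F := fun x t => |w k x t| + |g k x t - ∑ i, d.β k i x t * w i x t|)
      (c := fun x t => -(eF m d j x t * d.β j k x t)) (hd.hα j) (hd.hα k) (xin_mem m j) hd.hlam
      (hd.sep j k hjk) (hS.char k) (hw.td k).cont (Sol.h_cont hd hw.toCF hg k)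
      ((eF_CT hd j).cont.mul (hd.hβ j k).cont).neg (fun x t => ?_)
      ((hw.td k).cont.abs.add (Sol.h_cont hd hw.toCF hg k).abs) (fun x t => le_rfl) x t
      fun s hs => ?_
    · rw [abs_neg, abs_mul]
      exact mul_le_mul ((eF_CT hd j).bd x t) ((hd.hβ j k).bd x t) (abs_nonneg _) hE
    · obtain ⟨hg0, hws⟩ := hB s (abs_le.mpr ⟨by linarith [hs.1], by linarith [hs.2]⟩)
      have ci : ∀ i, Continuous fun η => |w i η s| := fun i => (hw.toCF.cont_x i s).abs
      have h1 : (∫ η in (0:ℝ)..1, (|w k η s| + |g k η s - ∑ i, d.β k i η s * w i η s|)) ≤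
          ∫ η in (0:ℝ)..1, (|w k η s| + ∑ i, M * |w i η s|) := by
        refine intervalIntegral.integral_mono_on (μ := volume) zero_le_one ?_ ?_ fun η _ => ?_
        · exact ((ci k).add ((Sol.h_cont hd hw.toCF hg k).comp
            (continuous_id.prodMk continuous_const)).abs).intervalIntegrable _ _
        · exact ((ci k).add (continuous_finsetSum _ fun i _ =>
            continuous_const.mul (ci i))).intervalIntegrable _ _
        · rw [hg0, zero_sub, abs_neg]
          refine add_le_add_right ((Finset.abs_sum_le_sum_abs _ _).trans
            (Finset.sum_le_sum fun i _ => ?_)) _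
          rw [abs_mul]
          exact mul_le_mul_of_nonneg_right ((hd.hβ k i).bd _ _) (abs_nonneg _)
      refine h1.trans ?_
      have cmi : ∀ i, Continuous fun η => M * |w i η s| := fun i => continuous_const.mul (ci i)
      have cs : Continuous fun η => ∑ i, M * |w i η s| := continuous_finsetSum _ fun i _ => cmi i
      rw [intervalIntegral.integral_add ((ci k).intervalIntegrable _ _)
        (cs.intervalIntegrable _ _), intervalIntegral.integral_finsetSum fun i _ =>
          (cmi i).intervalIntegrable _ _]
      have h2 : ∑ i, ∫ η in (0:ℝ)..1, M * |w i η s| ≤ n * (M * B) := by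
        refine (Finset.sum_le_sum (g := fun _ => M * B) fun i _ => ?_).trans (by simp)
        rw [intervalIntegral.integral_const_mul]
        exact mul_le_mul_of_nonneg_left ((integral_abs_le_cls hw.toCF i s).trans hws) (by linarith)
      have h3 := (integral_abs_le_cls hw.toCF k s).trans hws
      calc _ ≤ B + n * (M * B) := add_le_add h3 h2
        _ = _ := by ring
  have hI0 : |∫ ξ in xin m j..cl x, eF m d j ξ (fl (d.α j) ξ x t) *
      off d w j ξ (fl (d.α j) ξ x t)| ≤
      n * (E * M * (Real.exp M / lam * (4 * M * ((1 + n * M) * B)))) := by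
    rw [intervalIntegral.integral_congr (g := fun ξ => ∑ k ∈ Finset.univ.erase j,
      (-(eF m d j ξ (fl (d.α j) ξ x t) * d.β j k ξ (fl (d.α j) ξ x t))) *
        w k ξ (fl (d.α j) ξ x t))]
    · rw [intervalIntegral.integral_finsetSum]
      · refine (Finset.abs_sum_le_sum_abs _ _).trans ?_
        refine (Finset.sum_le_card_nsmul _ _ _ fun k hk =>
          hterm k fun h => (Finset.ne_of_mem_erase hk) h.symm).trans ?_
        rw [nsmul_eq_mul]
        refine mul_le_mul_of_nonneg_right ?_ (by positivity)
        exact_mod_cast (Finset.card_le_univ _).trans (by simp)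
      · intro k _
        refine Continuous.intervalIntegrable ?_ _ _
        exact (hce (f := fun x t => -(eF m d j x t * d.β j k x t))
            ((eF_CT hd j).cont.mul (hd.hβ j k).cont).neg).mul (hce (hw.td k).cont)
    · intro ξ _
      simp only [off, Finset.mul_sum]
      exact Finset.sum_congr rfl fun k _ => by ring
  have hex : |Real.exp (-T0 (d.α j) (xin m j) (fun _ => 0) (d.β j j) x t)| ≤ Real.exp M := by
    rw [abs_of_pos (Real.exp_pos _)]
    exact Real.exp_le_exp.mpr
      (by linarith [(abs_le.mp (T0_zero_bd (α := d.α j) (xin_mem m j) (hd.hβ j j).bd x t)).1])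
  rw [e0, Kop, Ls, abs_mul]
  have h4 : Real.exp M ≤ Real.exp (2 * M) := Real.exp_le_exp.mpr (by linarith)
  calc _ ≤ Real.exp M * (|bq m p w j (fl (d.α j) (xin m j) x t)| +
        n * (E * M * (Real.exp M / lam * (4 * M * ((1 + n * M) * B))))) := by
        refine mul_le_mul hex ((abs_add_le _ _).trans (add_le_add_right hI0 _)) (abs_nonneg _)
          (Real.exp_pos _).le
    _ ≤ _ := by
        rw [mul_add]
        refine add_le_add (mul_le_mul_of_nonneg_right h4 (abs_nonneg _)) (le_of_eq ?_)
        ring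

/-- Local sup bound of source-free solutions by their `L²` norms. -/
lemma sup_L2_bd (hH : H3cond n p) (m : ℕ) (hM : 1 ≤ M) (hlam : 0 < lam) :
    ∃ C : ℝ, 0 ≤ C ∧ ∃ R : ℝ, 0 ≤ R ∧ ∀ d : LD n, Good m p M lam d → ∀ g w : Fd n, CF g → TF w →
      Sol m p d g w → ∀ t B, (∀ s, |s - t| ≤ R → (∀ j x, g j x s = 0) ∧ ‖cls w s‖ ≤ B) →
      ∀ j x, |w j x t| ≤ C * B := by
  obtain ⟨C1, hC1, h1⟩ := row_L2_bd n m p hM hlam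
  have key : ∀ i : ℕ, ∃ C : ℝ, 0 ≤ C ∧ ∃ R : ℝ, 2 * M ≤ R ∧ ∀ d : LD n, Good m p M lam d →
      ∀ g w : Fd n, CF g → TF w → Sol m p d g w → ∀ t B,
      (∀ s, |s - t| ≤ R → (∀ j x, g j x s = 0) ∧ ‖cls w s‖ ≤ B) →
      ∀ j, ¬ RPath p i j → ∀ x, |w j x t| ≤ C * B := by
    intro i
    induction i with
    | zero => exact ⟨0, le_rfl, 2 * M, le_rfl, fun d _ g w _ _ _ t B _ j h => absurd trivial h⟩
    | succ i ih =>
      obtain ⟨C, hC, R, hR, h⟩ := ih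
      refine ⟨Real.exp (2 * M) * (n * (M * C)) + C1, by positivity, R + 2 * M, by linarith,
        fun d hd g w hg hw hS t B hB j hj x => ?_⟩
      have hB0 : 0 ≤ B := (norm_nonneg _).trans (hB t (by simp; linarith)).2
      refine (h1 d hd g w hg hw hS t B (fun s hs => hB s (by linarith)) j x).trans ?_
      have : |bq m p w j (fl (d.α j) (xin m j) x t)| ≤ n * (M * (C * B)) := by
        refine (Finset.abs_sum_le_sum_abs _ _).trans
          ((Finset.sum_le_sum (g := fun _ => M * (C * B)) fun k _ => ?_).trans (by simp))
        rw [abs_mul]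
        by_cases hk : p j k = 0
        · rw [hk, abs_zero, zero_mul]; positivity
        · refine mul_le_mul (hd.hp j k) (h d hd g w hg hw hS _ B (fun s hs => hB s ?_) k
            (fun hk' => hj ⟨k, hk, hk'⟩) _) (abs_nonneg _) (by linarith)
          have := (hd.hα j).fl_near (xin m j) x t
          calc |s - t| ≤ |s - fl (d.α j) (xin m j) x t| + |fl (d.α j) (xin m j) x t - t| :=
                abs_sub_le _ _ _
            _ ≤ _ := by linarith
      calc _ ≤ Real.exp (2 * M) * (n * (M * (C * B))) + C1 * B := by gcongr
        _ = _ := by ring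
  obtain ⟨C, hC, R, hR, h⟩ := key n
  exact ⟨C, hC, R, by linarith, fun d hd g w hg hw hS t B hB j x =>
    h d hd g w hg hw hS t B hB j (hH.not_path j) x⟩

end sup_bound

section entire

variable {n m : ℕ} {p : Fin n → Fin n → ℝ} {M lam : ℝ} {d : LD n} {u v g w : Fd n}

lemma LB.dF_zero {R t : ℝ} (h : LB (R + 1) t 0 u) : LB R t 0 (dF u) := by
  intro j x s hs
  have : u j x =ᶠ[𝓝 s] fun _ => (0:ℝ) := by
    filter_upwards [Metric.ball_mem_nhds s one_pos] with r hr
    rw [Metric.mem_ball, Real.dist_eq] at hr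
    exact abs_nonpos_iff.mp (h j x r (by linarith [abs_sub_le r s t]))
  rw [dF, dt, this.deriv_eq, deriv_const, abs_zero]

lemma Sol.sub_Kop_eq (hd : Good m p M lam d) (hu : CF u) (hg : CF g) (h : Sol m p d g u) :
    u - Kop m p d u = Fop m d g :=
  sub_eq_of_eq_add' (h.eq hd hu hg)

lemma Fop_LB_zero (hd : Good m p M lam d) {R t : ℝ} (h : LB (R + M) t 0 g) :
    LB R t 0 (Fop m d g) := by
  simpa using Fop_bd hd h

/-- Local bounds, including the time derivative, of source-free solutions by `L²` norms. -/
lemma src_free_bd (hH : H3cond n p) (m : ℕ) (hM : 1 ≤ M) (hlam : 0 < lam) :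
    ∃ C : ℝ, 0 ≤ C ∧ ∃ R : ℝ, 0 ≤ R ∧ ∀ d : LD n, Good m p M lam d → ∀ g w : Fd n, CF g → TF w →
      Sol m p d g w → ∀ R0 t B, (∀ s, |s - t| ≤ R0 + R → (∀ j x, g j x s = 0) ∧ ‖cls w s‖ ≤ B) →
      LB R0 t (C * B) w ∧ LB R0 t (C * B) (dF w) := by
  obtain ⟨C1, hC1, R1, hR1, h1⟩ := sup_L2_bd hH m hM hlam
  obtain ⟨C2, hC2, R2, hR2, h2⟩ := reg_local hH m M lam
  refine ⟨max C1 (C2 * C1), le_max_of_le_left hC1, R1 + R2 + 1 + M, by positivity,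
    fun d hd g w hg hw hS R0 t B hB => ?_⟩
  have hw0 : ∀ R', R' ≤ R0 + R2 → LB R' t (C1 * B) w := fun R' hR' j x s hs => by
    refine h1 d hd g w hg hw hS s B (fun r hr => hB r ?_) j x
    linarith [abs_sub_le r s t]
  by_cases hR0 : 0 ≤ R0
  · have hB0 : 0 ≤ B := (norm_nonneg _).trans (hB t (by simp; linarith)).2
    refine ⟨fun j x s hs => (hw0 R0 (by linarith) j x s hs).trans
      (mul_le_mul_of_nonneg_right (le_max_left _ _) hB0), fun j x s hs => ?_⟩
    refine (h2 d hd w hw R0 t (C1 * B) 0 (hw0 _ le_rfl) ?_ j x s hs).trans ?_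
    · rw [hS.sub_Kop_eq hd hw.toCF hg]
      refine LB.dF_zero (Fop_LB_zero hd fun k y r hr => ?_)
      rw [(hB r (by linarith)).1, abs_zero]
    · rw [add_zero, ← mul_assoc]
      exact mul_le_mul_of_nonneg_right (le_max_right _ _) hB0
  · constructor <;> intro j x s hs <;> linarith [abs_nonneg (s - t)]

lemma Fop_zero (m : ℕ) (d : LD n) : Fop m d (0 : Fd n) = 0 := by
  have := Fop_smul (m := m) (d := d) (g := 0) 0
  simpa using this

/-- Orbits of the evolution family defined on all of `ℝ` are solutions. -/
lemma exists_entire {a : ℝ → ℝ → Fin n → ℝ} {b : ℝ → ℝ → Fin n → Fin n → ℝ}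
    {U : ℝ → ℝ → L2 n →L[ℝ] L2 n} (hU : GeneratedBy n m p a b U) (hH : H3cond n p)
    (hd : Good m p M lam d) (hr : CoefRep a b d) {Y : ℝ → L2 n}
    (hY : ∀ s t, s ≤ t → U t s (Y s) = Y t) :
    ∃ y, TF y ∧ Sol m p d 0 y ∧ ∀ t, cls y t = Y t := by
  obtain ⟨K, hK, ν, hν⟩ := hU.2.2.1
  obtain ⟨C, hC, R, hR, hsf⟩ := src_free_bd hH m hd.hM hd.hlam
  have hex := fun N : ℕ => exists_approx hH hd (-(N:ℝ)) (Y (-N))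
    (ε := (1/2) ^ N * (K * Real.exp (|ν| * (2 * N)))⁻¹) (by positivity)
  choose f g κ hf hg hS hκ hgs _ _ happ using hex
  have hcl : ∀ (N : ℕ) t, -(N:ℝ) ≤ t → t ≤ N → ‖cls (f N) t - Y t‖ ≤ (1/2) ^ N := by
    intro N t h1 h2
    rw [← link hU hH hd hr (hf N) (hg N) (hS N) (hgs N) h1, ← hY _ _ h1, ← map_sub]
    have e1 : ‖U t (-N)‖ ≤ K * Real.exp (|ν| * (2 * N)) := by
      refine (hν _ _ h1).trans (mul_le_mul_of_nonneg_left (Real.exp_le_exp.mpr ?_) (by linarith))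
      calc ν * (t - -N) ≤ |ν| * (t - -N) := mul_le_mul_of_nonneg_right (le_abs_self _) (by linarith)
        _ ≤ _ := mul_le_mul_of_nonneg_left (by linarith) (abs_nonneg _)
    refine (ContinuousLinearMap.le_opNorm _ _).trans ?_
    refine (mul_le_mul e1 (happ N).le (norm_nonneg _) (by positivity)).trans_eq ?_
    field_simp
  have hstep : ∀ T, ∃ C', ∃ i0, ∀ i ≥ i0, LB T 0 (C' * (1/2) ^ i) (f (i + 1) - f i) ∧
      LB T 0 (C' * (1/2) ^ i) (dF (f (i + 1)) - dF (f i)) := by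
    intro T
    obtain ⟨i0, hi0⟩ := exists_nat_ge (T + R)
    refine ⟨C * 2, i0, fun i hi => ?_⟩
    have hi' : (i0:ℝ) ≤ i := by exact_mod_cast hi
    rw [← (hf (i+1)).dF_sub (hf i), mul_assoc]
    refine hsf d hd _ _ ((hg (i+1)).sub (hg i)) ((hf (i+1)).sub (hf i)) ((hS (i+1)).sub (hS i)) T 0 _
      fun s hs => ⟨fun j x => ?_, ?_⟩
    · have := (abs_le.mp hs).1
      simp only [Pi.sub_apply]
      rw [hgs i j x s (by linarith), hgs (i+1) j x s (by push_cast; linarith), sub_zero]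
    · have h1 := (abs_le.mp hs).1
      have h2 := (abs_le.mp hs).2
      rw [cls_sub (hf _).toCF (hf _).toCF]
      have e1 := hcl i s (by linarith) (by linarith)
      have e2 := hcl (i+1) s (by push_cast; linarith) (by push_cast; linarith)
      have e3 : ((1:ℝ)/2) ^ (i+1) ≤ (1/2) ^ i :=
        pow_le_pow_of_le_one (by norm_num) (by norm_num) (Nat.le_succ i)
      calc _ = ‖(cls (f (i+1)) s - Y s) - (cls (f i) s - Y s)‖ := by congr 1; abel
        _ ≤ _ := (norm_sub_le _ _).trans (by linarith)
  obtain ⟨y, hy, hLC, -⟩ := TF.limit hf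
    (LCauchy.of_geometric (r := 1/2) (by norm_num) (by norm_num) fun T =>
      (hstep T).imp fun C' h => h.imp fun i0 h i hi => (h i hi).1)
    (LCauchy.of_geometric (r := 1/2) (by norm_num) (by norm_num) fun T =>
      (hstep T).imp fun C' h => h.imp fun i0 h i hi => (h i hi).2)
  refine ⟨y, hy, Sol.of_eq hd hy.toCF TF.zero.toCF ?_, fun t => ?_⟩
  · rw [Fop_zero]
    refine LC.fixed hd (fun i => (hf i).toCF) hy.toCF hLC (G := fun i => Fop m d (g i)) ?_
      fun i => (hS i).eq hd (hf i).toCF (hg i)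
    intro T ε hε
    obtain ⟨i0, hi0⟩ := exists_nat_ge (T + M)
    refine ⟨i0, fun i hi => ?_⟩
    have hi' : (i0:ℝ) ≤ i := by exact_mod_cast hi
    have : LB T 0 0 (Fop m d (g i)) := Fop_LB_zero hd fun k x s hs => by
      rw [hgs i k x s (by linarith [(abs_le.mp hs).1]), abs_zero]
    intro j x s hs
    have := this j x s hs
    simp only [Pi.sub_apply, Pi.zero_apply, zero_sub, abs_neg]
    linarith
  · refine eq_of_norm_sub_le_mul (K := n + 1) (by positivity) fun ε hε => ?_
    obtain ⟨N1, hN1⟩ := hLC |t| ε hε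
    obtain ⟨N2, hN2⟩ := exists_nat_ge |t|
    obtain ⟨N3, hN3⟩ := exists_pow_lt_of_lt_one hε (show (1/2:ℝ) < 1 by norm_num)
    set N := max N1 (max N2 N3)
    have hN2' : (N2:ℝ) ≤ N := by exact_mod_cast (le_max_left N2 N3).trans (le_max_right _ _)
    have ht := abs_le.mp (hN2.trans hN2')
    have e1 := hcl N t ht.1 ht.2
    have e2 : ((1:ℝ)/2) ^ N ≤ (1/2) ^ N3 := pow_le_pow_of_le_one (by norm_num) (by norm_num)
      ((le_max_right N2 N3).trans (le_max_right _ _))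
    have e3 := cls_norm_le (hy.toCF.sub (hf N).toCF) (t := t) (A := ε) fun j x =>
      hN1 N (le_max_left _ _) j x t (by simp)
    rw [cls_sub hy.toCF (hf N).toCF] at e3
    calc ‖cls y t - Y t‖ = ‖(cls y t - cls (f N) t) + (cls (f N) t - Y t)‖ := by congr 1; abel
      _ ≤ _ := (norm_add_le _ _).trans (by linarith)

end entire

section dichotomy

lemma eq_zero_of_exp_decay {X : Type*} [NormedAddCommGroup X] {x : X} {ω D : ℝ} (hω : 0 < ω)
    (h : ∀ s, 0 ≤ s → ‖x‖ ≤ D * Real.exp (-ω * s)) : x = 0 := by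
  have h1 : Tendsto (fun s : ℝ => D * Real.exp (-ω * s)) atTop (𝓝 (D * 0)) := by
    refine Tendsto.const_mul _ (Real.tendsto_exp_atBot.comp ?_)
    exact tendsto_id.const_mul_atTop_of_neg (by linarith)
  have h2 := ge_of_tendsto h1 ((eventually_ge_atTop 0).mono h)
  rw [mul_zero] at h2
  exact norm_le_zero_iff.mp h2

variable {X : Type*} [NormedAddCommGroup X] [NormedSpace ℝ X] {U : ℝ → ℝ → X →L[ℝ] X} {ω K : ℝ}

lemma HasExpDichotomy.exists_orbit (hd : HasExpDichotomy U ω K) (hU : IsEvoFam U) (r : ℝ) (ζ : X) :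
    ∃ Y : ℝ → X, (∀ s t, s ≤ t → U t s (Y s) = Y t) ∧
      (∀ t ≤ r, ‖Y t‖ ≤ K * Real.exp (-ω * (r - t)) * ‖ζ‖) ∧
      ∀ t, r ≤ t → ‖U t r ζ - Y t‖ ≤ K * Real.exp (-ω * (t - r)) * ‖ζ‖ := by
  obtain ⟨P, W, hP, -, -, hUP, hWU, hUW, hPW, hbP, hbW⟩ := hd
  set q := ζ - P r ζ
  have hWrr : W r r q = q := by
    have := hUW r r le_rfl ζ
    rwa [hU.1, ContinuousLinearMap.id_apply] at this
  refine ⟨fun t => if t ≤ r then W t r q else U t r q, fun s t hst => ?_, fun t ht => ?_,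
    fun t ht => ?_⟩
  · dsimp only
    by_cases ht : t ≤ r
    · rw [if_pos ht, if_pos (hst.trans ht)]
      set z := U t s (W s r q)
      have h1 : P t z = 0 := by
        have := congrArg (fun T => T (W s r q)) (hUP s t hst)
        simp only [ContinuousLinearMap.comp_apply] at this
        rw [← this, hPW s r (hst.trans ht), map_zero]
      have h2 : U r t z = q := by
        rw [hU.2 s t r hst ht, hUW s r (hst.trans ht)]
      have h3 := hWU t r ht z
      rw [h1, sub_zero, h2] at h3
      exact h3.symm
    · rw [if_neg ht]
      by_cases hs : s ≤ r
      · rw [if_pos hs, ← hU.2 s r t hs (not_le.mp ht).le, hUW s r hs]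
      · rw [if_neg hs, hU.2 r s t (not_le.mp hs).le hst]
  · dsimp only
    rw [if_pos ht]
    have h1 : W t r q = ((W t r).comp (ContinuousLinearMap.id ℝ X - P r)) ζ := by simp [q]
    rw [h1]
    exact (ContinuousLinearMap.le_opNorm _ _).trans
      (mul_le_mul_of_nonneg_right (hbW t r ht) (norm_nonneg _))
  · have h1 : (if t ≤ r then W t r q else U t r q) = U t r q := by
      split_ifs with h
      · obtain rfl := le_antisymm ht h
        rw [hWrr, hU.1, ContinuousLinearMap.id_apply]
      · rfl
    have h2 : U t r ζ - U t r q = ((U t r).comp (P r)) ζ := by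
      rw [← map_sub]; simp [q]
    dsimp only
    rw [h1, h2]
    exact (ContinuousLinearMap.le_opNorm _ _).trans
      (mul_le_mul_of_nonneg_right (hbP r t ht) (norm_nonneg _))

lemma HasExpDichotomy.orbit_eq_zero (hd : HasExpDichotomy U ω K) (hω : 0 < ω) {Y : ℝ → X}
    (hY : ∀ s t, s ≤ t → U t s (Y s) = Y t) {B : ℝ} (hB : ∀ t, ‖Y t‖ ≤ B) (t : ℝ) : Y t = 0 := by
  obtain ⟨P, W, hP, -, -, hUP, hWU, hUW, hPW, hbP, hbW⟩ := hd
  have hK : ∀ s, 0 ≤ K * Real.exp (-ω * s) := by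
    have h0 : 0 ≤ K := by
      have := (norm_nonneg _).trans (hbP 0 0 le_rfl)
      simpa using this
    intro s; positivity
  have h1 : P t (Y t) = 0 := eq_zero_of_exp_decay (D := K * B) hω fun s hs => by
    have e : P t (Y t) = ((U t (t - s)).comp (P (t - s))) (Y (t - s)) := by
      rw [hUP _ _ (by linarith), ContinuousLinearMap.comp_apply, hY _ _ (by linarith)]
    rw [e]
    refine (ContinuousLinearMap.le_opNorm _ _).trans ((mul_le_mul (hbP _ _ (by linarith)) (hB _)
      (norm_nonneg _) (hK _)).trans_eq ?_)
    rw [sub_sub_cancel]; ring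
  have h2 : Y t - P t (Y t) = 0 := eq_zero_of_exp_decay (D := K * B) hω fun s hs => by
    have e : Y t - P t (Y t) = ((W t (t + s)).comp (ContinuousLinearMap.id ℝ X - P (t + s)))
        (Y (t + s)) := by
      have e1 := congrArg (fun T => T (Y t)) (hUP t (t + s) (by linarith))
      simp only [ContinuousLinearMap.comp_apply] at e1
      rw [← hWU t (t + s) (by linarith), map_sub, hY _ _ (by linarith), e1, hY _ _ (by linarith)]
      simp
    rw [e]
    refine (ContinuousLinearMap.le_opNorm _ _).trans ((mul_le_mul (hbW _ _ (by linarith)) (hB _)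
      (norm_nonneg _) (hK _)).trans_eq ?_)
    rw [add_sub_cancel_left]; ring
  rwa [h1, sub_zero] at h2

end dichotomy

section sum_exp

lemma summable_exp_abs_int {ω : ℝ} (hω : 0 < ω) :
    Summable fun i : ℤ => Real.exp (-(ω * |(i:ℝ)|)) := by
  have h : Summable fun i : ℕ => Real.exp (-(ω * i)) := by
    simpa [mul_comm, neg_mul] using Real.summable_exp_nat_mul_iff.mpr (neg_lt_zero.mpr hω)
  refine Summable.of_nat_of_neg ?_ ?_ <;> simpa using h

lemma sum_exp_abs_le {ω : ℝ} (hω : 0 < ω) : ∃ S : ℝ, 0 ≤ S ∧ ∀ (t : ℝ) (N : ℕ),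
    ∑ i ∈ Finset.range N, Real.exp (-(ω * |t - i|)) ≤ S := by
  refine ⟨Real.exp ω * ∑' i : ℤ, Real.exp (-(ω * |(i:ℝ)|)), by positivity, fun t N => ?_⟩
  set F : ℤ → ℝ := fun i => Real.exp (-(ω * |(i:ℝ)|))
  have h1 : ∀ i ∈ Finset.range N, Real.exp (-(ω * |t - i|)) ≤
      Real.exp ω * F ((i:ℤ) - ⌊t⌋) := fun i _ => by
    rw [← Real.exp_add]
    refine Real.exp_le_exp.mpr ?_
    have e1 : |((((i:ℤ) - ⌊t⌋ : ℤ)) : ℝ)| ≤ |t - i| + 1 := by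
      push_cast
      rw [abs_sub_comm t]
      refine (abs_sub_le (i:ℝ) t ⌊t⌋).trans (add_le_add_right ?_ _)
      rw [abs_of_nonneg (by linarith [Int.floor_le t])]
      linarith [Int.lt_floor_add_one t]
    nlinarith
  refine (Finset.sum_le_sum h1).trans ?_
  rw [← Finset.mul_sum]
  refine mul_le_mul_of_nonneg_left ?_ (Real.exp_pos _).le
  have e2 : ∑ i ∈ Finset.range N, F ((i:ℤ) - ⌊t⌋) =
      ∑ k ∈ (Finset.range N).image (fun i : ℕ => (i:ℤ) - ⌊t⌋), F k := by
    rw [Finset.sum_image]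
    intro i _ j _ h
    simpa using h
  rw [e2]
  exact (summable_exp_abs_int hω).sum_le_tsum _ fun _ _ => (Real.exp_pos _).le

end sum_exp

section solve_local

variable {n m : ℕ} {p : Fin n → Fin n → ℝ} {M lam : ℝ} {d : LD n} {u v g w : Fd n}

lemma backCl_const (hlam : 0 < lam) (c : ℝ) : BackCl lam fun _ => c where
  lip x _ y _ := by rw [sub_self]; positivity
  ends := rfl

lemma cls_eq_zero (hu : CF u) {t : ℝ} (h : ∀ j x, u j x t = 0) : cls u t = 0 := by
  have := cls_norm_le hu (t := t) (A := 0) fun j x => by rw [h, abs_zero]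
  rw [mul_zero] at this
  exact norm_le_zero_iff.mp this

variable {a : ℝ → ℝ → Fin n → ℝ} {b : ℝ → ℝ → Fin n → Fin n → ℝ} {U : ℝ → ℝ → L2 n →L[ℝ] L2 n}
  {ω K : ℝ}

/-- Sources supported in a unit time window have exponentially localized solutions. -/
lemma solve_local (hU : GeneratedBy n m p a b U) (hH : H3cond n p) (hd : Good m p M lam d)
    (hr : CoefRep a b d) (hω : 0 < ω) (hK : 1 ≤ K) (hdi : HasExpDichotomy U ω K) :
    ∃ C : ℝ, 0 ≤ C ∧ ∀ (k G : ℝ) (g : Fd n), TF g → (∀ j x t, |g j x t| ≤ G) → 0 ≤ G →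
      (∀ j x t, 1 ≤ |t - k| → g j x t = 0) → ∃ u, TF u ∧ u = Kop m p d u + Fop m d g ∧
      ∀ j x t, |u j x t| ≤ C * G * Real.exp (-(ω * |t - k|)) := by
  obtain ⟨C1, hC1, γ, hγ, hfw⟩ := exists_forward hH m hd.hM hd.hlam
  obtain ⟨C2, hC2, R, hR, hsup⟩ := sup_L2_bd hH m hd.hM hd.hlam
  set Z := n * (C1 * Real.exp (2 * γ)) with hZ
  have hZ0 : 0 ≤ Z := by positivity
  set D := (1 + K) * Z * Real.exp ω with hD
  have hD0 : 0 ≤ D := by positivity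
  set D' := C1 * Real.exp (γ * (R + 2)) + C2 * (n * (C1 * Real.exp (γ * (2 * R + 2))) + D) with hD'
  have hD'0 : 0 ≤ D' := by positivity
  refine ⟨C2 * D * Real.exp (ω * R) + D' * Real.exp (ω * (R + 1)), by positivity,
    fun k G g hg hgG hG hgk => ?_⟩
  obtain ⟨v, hv, hve, hvb, hvan⟩ := hfw d hd g hg (G * Real.exp (γ * (1 - k))) (by positivity)
    fun j x t => by
      by_cases h : 1 ≤ |t - k|
      · rw [hgk j x t h, abs_zero]; positivity
      · have := (abs_lt.mp (not_le.mp h)).1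
        rw [mul_assoc, ← Real.exp_add]
        refine (hgG j x t).trans (le_mul_of_one_le_right hG (Real.one_le_exp ?_))
        nlinarith
  have hvb' : ∀ T t, t - k ≤ T → ∀ j x, |v j x t| ≤ C1 * Real.exp (γ * (T + 1)) * G := by
    intro T t hT j x
    refine (hvb j x t).trans ?_
    have : Real.exp (γ * (1 - k)) * Real.exp (γ * t) ≤ Real.exp (γ * (T + 1)) := by
      rw [← Real.exp_add]; exact Real.exp_le_exp.mpr (by nlinarith)
    calc _ = C1 * G * (Real.exp (γ * (1 - k)) * Real.exp (γ * t)) := by ring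
      _ ≤ C1 * G * Real.exp (γ * (T + 1)) := by gcongr
      _ = _ := by ring
  have hv0 : ∀ j x t, t ≤ k - 1 → v j x t = 0 := fun j x t ht => by
    rw [← hv.clamp]
    exact hvan (fun _ => k - 1) (backCl_const hd.hlam _) (fun i y _ s hs => hgk i y s (by
      rw [abs_of_nonpos (by linarith)]; linarith)) j (cl x) (cl_mem x) t ht
  have hvS := Sol.of_eq hd hv.toCF hg.toCF hve
  have hgr : ∀ j x t, k + 1 ≤ t → g j x t = 0 := fun j x t ht => hgk j x t (by
    rw [abs_of_nonneg (by linarith)]; linarith)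
  have hvn : ∀ T t, t - k ≤ T → ‖cls v t‖ ≤ n * (C1 * Real.exp (γ * (T + 1))) * G := fun T t hT => by
    rw [mul_assoc]; exact cls_norm_le hv.toCF (hvb' T t hT)
  have hvZ : ∀ t ≤ k + 1, ‖cls v t‖ ≤ Z * G := fun t ht => by
    have := hvn 1 t (by linarith)
    rwa [show γ * (1 + 1) = 2 * γ by ring] at this
  obtain ⟨Y, hY, hY1, hY2⟩ := hdi.exists_orbit hU.1 (k + 1) (cls v (k + 1))
  obtain ⟨y, hy, hyS, hyY⟩ := exists_entire hU hH hd hr hY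
  have hu : TF (v - y) := hv.sub hy
  have huS : Sol m p d g (v - y) := by simpa using hvS.sub hyS
  have hmono : ∀ s t, s ≤ 1 - t → Real.exp (ω * s) ≤ Real.exp ω * Real.exp (-(ω * t)) := by
    intro s t h
    rw [← Real.exp_add]; exact Real.exp_le_exp.mpr (by nlinarith)
  have huc : ∀ t, ‖cls (v - y) t‖ ≤ D * G * Real.exp (-(ω * |t - k|)) := by
    intro t
    rw [cls_sub hv.toCF hy.toCF, hyY]
    rcases le_total t (k + 1) with ht | ht
    · have e1 : ‖cls v t‖ ≤ Z * G * (Real.exp ω * Real.exp (-(ω * |t - k|))) := by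
        rcases le_total t (k - 1) with h | h
        · rw [cls_eq_zero hv.toCF fun j x => hv0 j x t h, norm_zero]; positivity
        · refine (hvZ t ht).trans (le_mul_of_one_le_right (by positivity) ?_)
          have := hmono 0 |t - k| (by
            have : |t - k| ≤ 1 := abs_le.mpr ⟨by linarith, by linarith⟩
            linarith)
          simpa using this
      have e2 : ‖Y t‖ ≤ K * (Real.exp ω * Real.exp (-(ω * |t - k|))) * (Z * G) := by
        refine (hY1 t ht).trans (mul_le_mul ?_ (hvZ _ le_rfl) (norm_nonneg _) (by positivity))
        refine mul_le_mul_of_nonneg_left ?_ (by linarith)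
        have := hmono (-(k + 1 - t)) |t - k| (by
          rcases abs_cases (t - k) with h | h <;> linarith)
        rwa [mul_neg, ← neg_mul] at this
      calc _ ≤ ‖cls v t‖ + ‖Y t‖ := norm_sub_le _ _
        _ ≤ _ := add_le_add e1 e2
        _ = _ := by rw [hD]; ring
    · rw [← link hU hH hd hr hv hg.toCF hvS hgr ht]
      refine (hY2 t ht).trans ?_
      have e1 := hmono (-(t - (k + 1))) |t - k| (by rw [abs_of_nonneg] <;> linarith)
      rw [mul_neg, ← neg_mul] at e1
      calc _ ≤ K * (Real.exp ω * Real.exp (-(ω * |t - k|))) * (Z * G) := by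
            refine mul_le_mul ?_ (hvZ _ le_rfl) (norm_nonneg _) (by positivity)
            exact mul_le_mul_of_nonneg_left e1 (by linarith)
        _ ≤ (1 + K) * (Real.exp ω * Real.exp (-(ω * |t - k|))) * (Z * G) := by
            gcongr; linarith
        _ = _ := by rw [hD]; ring
  refine ⟨v - y, hu, huS.eq hd hu.toCF hg.toCF, fun j x t => ?_⟩
  by_cases ht : R + 1 ≤ |t - k|
  · refine (hsup d hd g _ hg.toCF hu huS t (D * G * (Real.exp (ω * R) * Real.exp (-(ω * |t - k|))))
      (fun s hs => ⟨fun i z => hgk i z s ?_, (huc s).trans ?_⟩) j x).trans ?_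
    · have := abs_sub_le t s k
      rw [abs_sub_comm t s] at this
      linarith
    · refine mul_le_mul_of_nonneg_left ?_ (by positivity)
      rw [← Real.exp_add]
      refine Real.exp_le_exp.mpr ?_
      have := abs_sub_le t s k
      rw [abs_sub_comm t s] at this
      nlinarith
    · have : 0 ≤ D' * Real.exp (ω * (R + 1)) * G * Real.exp (-(ω * |t - k|)) := by positivity
      nlinarith
  · have ht' := (not_le.mp ht).le
    have e1 : |v j x t| ≤ C1 * Real.exp (γ * (R + 2)) * G := by
      have := hvb' (R + 1) t ((le_abs_self _).trans ht') j x
      rwa [show R + 1 + 1 = R + 2 by ring] at this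
    have e2 : |y j x t| ≤ C2 * ((n * (C1 * Real.exp (γ * (2 * R + 2))) + D) * G) := by
      refine hsup d hd 0 y TF.zero.toCF hy hyS t _ (fun s hs => ⟨fun _ _ => rfl, ?_⟩) j x
      have h1 := hvn (2 * R + 1) s (by
        linarith [le_abs_self (s - t), le_abs_self (t - k)])
      rw [show 2 * R + 1 + 1 = 2 * R + 2 by ring] at h1
      have h2 : ‖cls (v - y) s‖ ≤ D * G := (huc s).trans
        (mul_le_of_le_one_right (by positivity) (Real.exp_le_one_iff.mpr (by
          have := abs_nonneg (s - k); nlinarith)))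
      rw [cls_sub hv.toCF hy.toCF] at h2
      calc ‖cls y s‖ = ‖cls v s - (cls v s - cls y s)‖ := by congr 1; abel
        _ ≤ _ := norm_sub_le _ _
        _ ≤ _ := add_le_add h1 h2
        _ = _ := by ring
    have e3 : |(v - y) j x t| ≤ D' * G := by
      calc _ ≤ |v j x t| + |y j x t| := abs_sub _ _
        _ ≤ _ := add_le_add e1 e2
        _ = _ := by rw [hD']; ring
    have e4 : 1 ≤ Real.exp (ω * (R + 1)) * Real.exp (-(ω * |t - k|)) := by
      rw [← Real.exp_add]; exact Real.one_le_exp (by nlinarith)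
    have e5 : 0 ≤ C2 * D * Real.exp (ω * R) * G * Real.exp (-(ω * |t - k|)) := by positivity
    calc _ ≤ D' * G * 1 := by rw [mul_one]; exact e3
      _ ≤ D' * G * (Real.exp (ω * (R + 1)) * Real.exp (-(ω * |t - k|))) := by gcongr
      _ ≤ _ := by linarith

end solve_local

section solve_src

variable {n m : ℕ} {p : Fin n → Fin n → ℝ} {M lam : ℝ} {d : LD n} {u v g w : Fd n}

lemma Kop_zero (m : ℕ) (p : Fin n → Fin n → ℝ) (d : LD n) : Kop m p d (0 : Fd n) = 0 := by
  have := Kop_smul (m := m) (p := p) (d := d) (u := 0) 0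
  simpa using this

/-- A smooth bump in time, supported in the window of radius one around `k`. -/
def bump (k t : ℝ) : ℝ := ramp (k - 1) 1 t - ramp k 1 t

lemma bump_contDiff (k : ℝ) : ContDiff ℝ 2 (bump k) :=
  (ramp_contDiff _ _).sub (ramp_contDiff _ _)

lemma bump_abs_le (k t : ℝ) : |bump k t| ≤ 1 := by
  have h1 := ramp_mem (k - 1) 1 t
  have h2 := ramp_mem k 1 t
  rw [bump, abs_le]
  constructor <;> linarith [h1.1, h1.2, h2.1, h2.2]

lemma bump_eq_zero {k t : ℝ} (h : 1 ≤ |t - k|) : bump k t = 0 := by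
  rcases le_abs.mp h with h | h
  · rw [bump, ramp_one one_pos (by linarith), ramp_one one_pos (by linarith), sub_self]
  · rw [bump, ramp_zero one_pos (by linarith), ramp_zero one_pos (by linarith), sub_self]

variable {a : ℝ → ℝ → Fin n → ℝ} {b : ℝ → ℝ → Fin n → Fin n → ℝ} {U : ℝ → ℝ → L2 n →L[ℝ] L2 n}
  {ω K : ℝ}

lemma solve_src (hU : GeneratedBy n m p a b U) (hH : H3cond n p) (hd : Good m p M lam d)
    (hr : CoefRep a b d) (hω : 0 < ω) (hK : 1 ≤ K) (hdi : HasExpDichotomy U ω K) :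
    ∃ C : ℝ, 0 ≤ C ∧ ∀ (G : ℝ) (g : Fd n), TF g → (∀ j x t, |g j x t| ≤ G) → 0 ≤ G →
      ∃ u, TF u ∧ u = Kop m p d u + Fop m d g ∧ ∀ j x t, |u j x t| ≤ C * G := by
  obtain ⟨C, hC, hloc⟩ := solve_local hU hH hd hr hω hK hdi
  obtain ⟨S, hS, hsum⟩ := sum_exp_abs_le hω
  obtain ⟨C2, hC2, R, hR, hreg⟩ := reg_local hH m M lam
  have hM0 : 0 ≤ M := by linarith [hd.hM]
  refine ⟨C * (S + S), by positivity, fun G g hg hgG hG => ?_⟩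
  choose u hu hue hub using fun k : ℝ => hloc k G (tmul (bump k) g) (hg.tmul (bump_contDiff k))
    (fun j x t => by
      rw [tmul, abs_mul]
      exact (mul_le_mul (bump_abs_le k t) (hgG j x t) (abs_nonneg _) zero_le_one).trans_eq
        (one_mul G)) hG
    (fun j x t h => by rw [tmul, bump_eq_zero h, zero_mul])
  obtain ⟨f, f0, fs⟩ : ∃ f : ℕ → Fd n, f 0 = 0 ∧ ∀ i, f (i + 1) = f i + (u i + u (-i - 1)) :=
    ⟨fun i => Nat.rec 0 (fun i v => v + (u i + u (-i - 1))) i, rfl, fun _ => rfl⟩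
  have hf : ∀ i, TF (f i) := fun i => by
    induction i with
    | zero => rw [f0]; exact TF.zero
    | succ i ih => rw [fs]; exact ih.add ((hu _).add (hu _))
  set cut : ℕ → ℝ → ℝ := fun i t => ramp (-i - 1) 1 t - ramp (i - 1) 1 t with hcut
  have hcutC : ∀ i, ContDiff ℝ 2 (cut i) := fun i => (ramp_contDiff _ _).sub (ramp_contDiff _ _)
  have hfe : ∀ i, f i = Kop m p d (f i) + Fop m d (tmul (cut i) g) := fun i => by
    induction i with
    | zero =>
      have : tmul (cut 0) g = 0 := by
        funext j x t; simp [tmul, hcut]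
      rw [this, Fop_zero, f0, Kop_zero, add_zero]
    | succ i ih =>
      have e : tmul (cut (i + 1)) g =
          tmul (cut i) g + (tmul (bump i) g + tmul (bump (-i - 1)) g) := by
        funext j x t
        simp only [tmul, hcut, bump, Pi.add_apply]
        push_cast
        rw [show (i:ℝ) + 1 - 1 = i by ring, show -((i:ℝ) + 1) - 1 = -i - 1 - 1 by ring]
        ring
      have t1 := (hg.tmul (bump_contDiff i)).toCF
      have t2 := (hg.tmul (bump_contDiff (-i - 1))).toCF
      rw [e, Fop_add hd (hg.tmul (hcutC i)).toCF (t1.add t2), Fop_add hd t1 t2, fs,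
        Kop_add hd (hf i).toCF ((hu _).toCF.add (hu _).toCF), Kop_add hd (hu _).toCF (hu _).toCF]
      conv_lhs => rw [ih, hue i, hue (-i - 1)]
      abel
  have hsrc : ∀ k j x t, 1 ≤ |t - k| → tmul (bump k) g j x t = 0 := fun k j x t h => by
    rw [tmul, bump_eq_zero h, zero_mul]
  have hstep : ∀ T, ∃ C', ∃ i0, ∀ i ≥ i0,
      LB T 0 (C' * Real.exp (-ω) ^ i) (f (i + 1) - f i) ∧
      LB T 0 (C' * Real.exp (-ω) ^ i) (dF (f (i + 1)) - dF (f i)) := by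
    intro T
    obtain ⟨i0, hi0⟩ := exists_nat_ge (T + R + M + 2)
    have hone : ∀ k : ℝ, ∀ i : ℕ, i0 ≤ i → (i:ℝ) ≤ |k| →
        LB (T + R) 0 (C * G * Real.exp (ω * (T + R)) * Real.exp (-ω) ^ i) (u k) ∧
        LB T 0 (C2 * (C * G * Real.exp (ω * (T + R)) * Real.exp (-ω) ^ i)) (dF (u k)) := by
      intro k i hi hk
      have hi' : (i0:ℝ) ≤ i := by exact_mod_cast hi
      have h1 : LB (T + R) 0 (C * G * Real.exp (ω * (T + R)) * Real.exp (-ω) ^ i) (u k) := by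
        intro j x s hs
        refine (hub k j x s).trans ?_
        rw [mul_assoc (C * G)]
        refine mul_le_mul_of_nonneg_left ?_ (by positivity)
        rw [← Real.exp_nat_mul, ← Real.exp_add]
        refine Real.exp_le_exp.mpr ?_
        have := abs_sub_abs_le_abs_sub k s
        rw [abs_sub_comm] at this
        rw [sub_zero] at hs
        nlinarith
      refine ⟨h1, ?_⟩
      have h2 := hreg d hd (u k) (hu k) T 0 _ 0 h1 ?_
      · rwa [add_zero] at h2
      · rw [sub_eq_of_eq_add' (hue k)]
        refine LB.dF_zero (Fop_LB_zero hd fun j x s hs => ?_)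
        rw [hsrc, abs_zero]
        have := abs_sub_abs_le_abs_sub k s
        rw [abs_sub_comm] at this
        rw [sub_zero] at hs
        linarith
    refine ⟨max 1 C2 * (2 * (C * G * Real.exp (ω * (T + R)))), i0, fun i hi => ?_⟩
    obtain ⟨a1, a2⟩ := hone i i hi (le_abs_self _)
    obtain ⟨b1, b2⟩ := hone (-i - 1) i hi (by
      rw [show -(i:ℝ) - 1 = -(i + 1) by ring, abs_neg]; exact le_abs.mpr (Or.inl (by linarith)))
    have hpos : 0 ≤ 2 * (C * G * Real.exp (ω * (T + R))) * Real.exp (-ω) ^ i := by positivity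
    rw [fs, (hf i).dF_add ((hu _).add (hu _)), (hu _).dF_add (hu _), add_sub_cancel_left,
      add_sub_cancel_left, mul_assoc (max 1 C2)]
    constructor
    · refine ((a1.add b1).mono (R' := T) (t' := 0) (by simp; linarith) ?_)
      calc _ = 1 * (2 * (C * G * Real.exp (ω * (T + R))) * Real.exp (-ω) ^ i) := by ring
        _ ≤ _ := mul_le_mul_of_nonneg_right (le_max_left _ _) hpos
    · refine ((a2.add b2).mono (R' := T) (t' := 0) (by simp) ?_)
      calc _ = C2 * (2 * (C * G * Real.exp (ω * (T + R))) * Real.exp (-ω) ^ i) := by ring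
        _ ≤ _ := mul_le_mul_of_nonneg_right (le_max_right _ _) hpos
  have hr1 : Real.exp (-ω) < 1 := Real.exp_lt_one_iff.mpr (by linarith)
  obtain ⟨y, hy, hLC, -⟩ := TF.limit hf
    (LCauchy.of_geometric (Real.exp_pos (-ω)).le hr1 fun T =>
      (hstep T).imp fun C' h => h.imp fun i0 h i hi => (h i hi).1)
    (LCauchy.of_geometric (Real.exp_pos (-ω)).le hr1 fun T =>
      (hstep T).imp fun C' h => h.imp fun i0 h i hi => (h i hi).2)
  refine ⟨y, hy, LC.fixed hd (fun i => (hf i).toCF) hy.toCF hLC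
    (G := fun i => Fop m d (tmul (cut i) g)) ?_ hfe, fun j x t => ?_⟩
  · intro T ε hε
    obtain ⟨i0, hi0⟩ := exists_nat_ge (T + M + 1)
    refine ⟨i0, fun i hi => ?_⟩
    have hi' : (i0:ℝ) ≤ i := by exact_mod_cast hi
    rw [← Fop_sub hd hg.toCF (hg.tmul (hcutC i)).toCF]
    refine (Fop_LB_zero hd (R := T) (t := 0) fun k x s hs => ?_).mono (by simp) hε.le
    have h1 := abs_le.mp hs
    simp only [Pi.sub_apply, tmul, hcut]
    rw [ramp_one one_pos (by linarith [h1.1]), ramp_zero one_pos (by linarith [h1.2])]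
    simp
  · have hb : ∀ i : ℕ, |f i j x t| ≤ C * (S + S) * G := fun i => by
      have h1 : |f i j x t| ≤ C * G * (∑ l ∈ Finset.range i, Real.exp (-(ω * |t - l|)) +
          ∑ l ∈ Finset.range i, Real.exp (-(ω * |(-t - 1) - l|))) := by
        induction i with
        | zero => simp [f0]
        | succ i ih =>
          rw [fs, Finset.sum_range_succ, Finset.sum_range_succ]
          have e1 := hub i j x t
          have e2 := hub (-i - 1) j x t
          rw [show |t - (-(i:ℝ) - 1)| = |(-t - 1) - i| by rw [← abs_neg]; congr 1; ring] at e2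
          calc _ ≤ |f i j x t| + (|u i j x t| + |u (-i - 1) j x t|) :=
                (abs_add_le _ _).trans (add_le_add_right (abs_add_le _ _) _)
            _ ≤ _ := add_le_add ih (add_le_add e1 e2)
            _ = _ := by ring
      refine h1.trans ?_
      have := add_le_add (hsum t i) (hsum (-t - 1) i)
      calc _ ≤ C * G * (S + S) := by gcongr
        _ = _ := by ring
    exact le_of_tendsto (hLC.tendsto j x t).abs (Eventually.of_forall hb)

end solve_src

section inverse

variable {n m : ℕ} {p : Fin n → Fin n → ℝ} {M lam : ℝ} {d : LD n} {u v g w G : Fd n} {A B : ℝ}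

/-- A global sup bound for a field. -/
def GB (A : ℝ) (u : Fd n) : Prop := ∀ j x t, |u j x t| ≤ A

lemma GB.lb (h : GB A u) (R t : ℝ) : LB R t A u := fun j x s _ => h j x s

lemma GB.of_lb (h : ∀ t, LB 0 t A u) : GB A u := fun j x t => h t j x t (by simp)

lemma GB.mono (h : GB A u) (hA : A ≤ B) : GB B u := fun j x t => (h j x t).trans hA

lemma GB.add (hu : GB A u) (hv : GB B v) : GB (A + B) (u + v) := fun j x t =>
  (abs_add_le _ _).trans (add_le_add (hu j x t) (hv j x t))

lemma GB.sub (hu : GB A u) (hv : GB B v) : GB (A + B) (u - v) := fun j x t =>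
  (abs_sub _ _).trans (add_le_add (hu j x t) (hv j x t))

lemma Kop_GB (hd : Good m p M lam d) (h : GB A u) : GB (cK n M * A) (Kop m p d u) :=
  .of_lb fun t => Kop_bd hd (h.lb _ t)

lemma Fop_GB (hd : Good m p M lam d) (h : GB A g) : GB (Real.exp (2 * M) * A) (Fop m d g) :=
  .of_lb fun t => Fop_bd hd (h.lb _ t)

lemma Kiter_GB (hd : Good m p M lam d) (i : ℕ) (h : GB A u) :
    GB (cK n M ^ i * A) ((Kop m p d)^[i] u) :=
  .of_lb fun t => Kiter_bd hd i (h.lb _ t)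

lemma Kop_dt_GB (hd : Good m p M lam d) (hu : TF u) (h : GB A u) (h' : GB B (dF u)) :
    GB (cD n M * (A + B)) (dF (Kop m p d u)) :=
  .of_lb fun t => Kop_dt_bd hd hu (h.lb _ t) (h'.lb _ t)

lemma Fop_dt_GB (hd : Good m p M lam d) (hu : TF u) (h : GB A u) (h' : GB B (dF u)) :
    GB (cD n M * (A + B)) (dF (Fop m d u)) :=
  .of_lb fun t => Fop_dt_bd hd hu (h.lb _ t) (h'.lb _ t)

lemma Kiter_dt_GB (hH : H3cond n p) (m : ℕ) (M lam : ℝ) : ∃ C : ℝ, 0 ≤ C ∧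
    ∀ d : LD n, Good m p M lam d → ∀ u, TF u → ∀ A, GB A u →
      GB (C * A) (dF ((Kop m p d)^[n + 1] u)) := by
  obtain ⟨C, hC, R, -, h⟩ := Kiter_smoothing hH m M lam
  exact ⟨C, hC, fun d hd u hu A hA => .of_lb fun t => h d hd u hu 0 t A (hA.lb _ t)⟩

lemma reg_GB (hH : H3cond n p) (m : ℕ) (M lam : ℝ) : ∃ C : ℝ, 0 ≤ C ∧
    ∀ d : LD n, Good m p M lam d → ∀ u, TF u → ∀ A B, GB A u →
      GB B (dF (u - Kop m p d u)) → GB (C * (A + B)) (dF u) := by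
  obtain ⟨C, hC, R, -, h⟩ := reg_local hH m M lam
  exact ⟨C, hC, fun d hd u hu A B hA hB => .of_lb fun t => h d hd u hu 0 t A B (hA.lb _ t) (hB.lb _ t)⟩

lemma Kop_diff_GB (p : Fin n → Fin n → ℝ) (m : ℕ) (M lam : ℝ) : ∃ C : ℝ, 0 ≤ C ∧
    ∀ d d' : LD n, Good m p M lam d → Good m p M lam d' → ∀ ρ, Near ρ d d' → ∀ u, TF u →
    ∀ A B, GB A u → GB B (dF u) → GB (C * ρ * (A + B)) (Kop m p d u - Kop m p d' u) := by
  obtain ⟨C, hC, h⟩ := Kop_diff_bd p m M lam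
  exact ⟨C, hC, fun d d' hd hd' ρ hρ u hu A B hA hB => .of_lb fun t =>
    h d d' hd hd' ρ hρ u hu 0 t A B (hA.lb _ t) (hB.lb _ t)⟩

/-- Truncated Neumann series. -/
lemma exists_partial (p : Fin n → Fin n → ℝ) (m : ℕ) {M : ℝ} (hM : 1 ≤ M) (lam : ℝ) (N : ℕ) :
    ∃ C : ℝ, 0 ≤ C ∧ ∀ d : LD n, Good m p M lam d → ∀ G, TF G → ∃ S, TF S ∧
      S = Kop m p d S + (G - (Kop m p d)^[N] G) ∧ ∀ A B, 0 ≤ A → 0 ≤ B → GB A G →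
      GB (C * A) S ∧ (GB B (dF G) → GB (C * (A + B)) (dF S)) := by
  induction N with
  | zero =>
    refine ⟨0, le_rfl, fun d _ G _ => ⟨0, TF.zero, by simp [Kop_zero], fun A B hA hB _ => ?_⟩⟩
    have h0 : dF (0 : Fd n) = 0 := by funext j x t; simp [dF, dt]
    rw [h0]
    exact ⟨fun j x t => by simp, fun _ j x t => by simp⟩
  | succ N ih =>
    obtain ⟨C, hC, ih⟩ := ih
    have c1 := cK_nonneg n hM
    have c2 := cD_nonneg n hM
    refine ⟨cK n M * C + 2 * cD n M * C + 1, by positivity, fun d hd G hG => ?_⟩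
    obtain ⟨S, hS, he, hb⟩ := ih d hd G hG
    have hKS := Kop_TF hd hS
    have hI := Kiter_TF hd hG N
    have e2 : Kop m p d S + G = S + (Kop m p d)^[N] G := by
      conv_rhs => rw [he]
      abel
    refine ⟨Kop m p d S + G, hKS.add hG, ?_, fun A B hA hB hGA => ?_⟩
    · conv_rhs => rw [e2, Kop_add hd hS.toCF hI.toCF, Function.iterate_succ_apply']
      abel
    · obtain ⟨b1, b2⟩ := hb A B hA hB hGA
      have hx : 0 ≤ C * A := by positivity
      refine ⟨((Kop_GB hd b1).add hGA).mono ?_, fun hGB => ?_⟩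
      · nlinarith [mul_nonneg c2 hx]
      · rw [hKS.dF_add hG]
        refine ((Kop_dt_GB hd hS b1 (b2 hGB)).add hGB).mono ?_
        nlinarith [mul_nonneg c2 hx, mul_nonneg c1 hx, mul_nonneg c2 (mul_nonneg hC hB),
          mul_nonneg c1 (mul_nonneg hC hB)]

/-- The data with all coupling terms removed. -/
def LD.diagPart (d : LD n) : LD n := ⟨d.α, fun j k => if j = k then d.β j k else fun _ _ => 0⟩

lemma Good.diagPart (hd : Good m p M lam d) : Good m p M lam d.diagPart where
  hM := hd.hM
  hlam := hd.hlam
  hp := hd.hp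
  hα := hd.hα
  hβ j k := by
    have h0 : 0 ≤ M := zero_le_one.trans hd.hM
    by_cases h : j = k
    · simp only [LD.diagPart, if_pos h]; exact hd.hβ j k
    · simp only [LD.diagPart, if_neg h]
      have e : dt (fun _ _ : ℝ => (0:ℝ)) = fun _ _ => 0 := by funext x t; simp [dt]
      rw [e]
      exact ⟨⟨continuous_const, continuous_const, fun x t => hasDerivAt_const _ _⟩,
        fun x t => by simpa, fun x t => by simpa⟩
  αx := hd.αx
  βx j k h := by
    simp only [LD.diagPart, if_neg h]
    exact ⟨fun _ _ => 0, continuous_const, fun x t => by simpa using zero_le_one.trans hd.hM,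
      fun x _ t => hasDerivWithinAt_const _ _ _⟩
  pos := hd.pos
  neg := hd.neg
  sep := hd.sep

lemma off_diagPart (u : Fd n) (j : Fin n) : off d.diagPart u j = fun _ _ => 0 := by
  funext x t
  refine Finset.sum_eq_zero fun k hk => ?_
  simp [LD.diagPart, if_neg (Finset.ne_of_mem_erase hk).symm]

lemma Kop_eq_diagPart (hd : Good m p M lam d) (hu : CF u) :
    Kop m p d u = Kop m p d.diagPart u + Fop m d (off d u) := by
  funext j x t
  simp only [Kop, Fop, Pi.add_apply, off_diagPart]
  rw [show d.diagPart.β j j = d.β j j by simp [LD.diagPart], show d.diagPart.α = d.α from rfl,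
    ← Ls_add (hd.hα j) (hd.hβ j j) continuous_const (off_cont hd hu j)]
  simp

lemma Kiter_diagPart_row (i : ℕ) (j : Fin n) (h : ¬ RPath p i j)
    (x t : ℝ) : (Kop m p d.diagPart)^[i] u j x t = 0 := by
  induction i generalizing j x t with
  | zero => exact absurd trivial h
  | succ i ih =>
    have hq : bq m p ((Kop m p d.diagPart)^[i] u) j = fun _ => 0 := by
      funext s
      refine Finset.sum_eq_zero fun k _ => ?_
      by_cases hk : p j k = 0
      · rw [hk, zero_mul]
      · rw [ih k (fun hR => h ⟨k, hk, hR⟩), mul_zero]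
    rw [Function.iterate_succ_apply', Kop, hq, off_diagPart]
    simpa using Ls_smul (α := d.diagPart.α j) (b := d.diagPart.β j j) (x0 := xin m j)
      (q := fun _ => 0) (h := fun _ _ => 0) 0 x t

variable {a : ℝ → ℝ → Fin n → ℝ} {b : ℝ → ℝ → Fin n → Fin n → ℝ}
  {U : ℝ → ℝ → L2 n →L[ℝ] L2 n} {ω K : ℝ}

/-- Solvability of `z = K z + G` among bounded fields. -/
lemma solve_gen (hU : GeneratedBy n m p a b U) (hH : H3cond n p) (hd : Good m p M lam d)
    (hcl : ∀ j k x t, d.β j k (cl x) t = d.β j k x t)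
    (hr : CoefRep a b d) (hω : 0 < ω) (hK : 1 ≤ K) (hdi : HasExpDichotomy U ω K) :
    ∃ C : ℝ, 0 ≤ C ∧ ∀ (A : ℝ) (G : Fd n), 0 ≤ A → TF G → GB A G →
      ∃ z, TF z ∧ z = Kop m p d z + G ∧ GB (C * A) z := by
  obtain ⟨C, hC, hs⟩ := solve_src hU hH hd hr hω hK hdi
  obtain ⟨C1, hC1, hp⟩ := exists_partial p m hd.hM lam n
  have hM0 : 0 ≤ M := zero_le_one.trans hd.hM
  refine ⟨C1 + C * (n * M * C1), by positivity, fun A G hA hG hGA => ?_⟩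
  obtain ⟨S, hS, hSe, hSb⟩ := hp _ hd.diagPart G hG
  have hz : (Kop m p d.diagPart)^[n] G = 0 := by
    funext j x t
    exact Kiter_diagPart_row n j (hH.not_path j) x t
  rw [hz, sub_zero] at hSe
  obtain ⟨b1, -⟩ := hSb A 0 hA le_rfl hGA
  have hoff : TF (off d S) := ⟨fun j => (off_TD hd hS j).to_dt, fun j x t =>
    Finset.sum_congr rfl fun k _ => by rw [hcl, hS.clamp]⟩
  obtain ⟨y, hy, hye, hyb⟩ := hs (n * M * (C1 * A)) (off d S) hoff
    (fun j x t => off_bd hd (fun k => b1 k x t) j) (by positivity)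
  refine ⟨S + y, hS.add hy, ?_, (b1.add hyb).mono (le_of_eq (by ring))⟩
  rw [Kop_add hd hS.toCF hy.toCF, Kop_eq_diagPart hd hS.toCF]
  conv_lhs => rw [hSe, hye]
  abel

lemma CF.zero : CF (0 : Fd n) := TF.zero.toCF

lemma bounded_eq_zero (hU : GeneratedBy n m p a b U) (hH : H3cond n p) (hd : Good m p M lam d)
    (hr : CoefRep a b d) (hω : 0 < ω) (hdi : HasExpDichotomy U ω K)
    (hw : TF w) (hB : GB B w) (he : w = Kop m p d w) : w = 0 := by
  have hS : Sol m p d 0 w := Sol.of_eq hd hw.toCF CF.zero (by rwa [Fop_zero, add_zero])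
  have h0 : ∀ t, cls w t = 0 := hdi.orbit_eq_zero hω
    (fun s t hst => link hU hH hd hr hw CF.zero hS (s := s) (fun _ _ _ _ => rfl) hst)
    (fun t => cls_norm_le hw.toCF fun j x => hB j x t)
  obtain ⟨C, hC, R, hR, h⟩ := sup_L2_bd hH m hd.hM hd.hlam
  funext j x t
  have := h d hd 0 w CF.zero hw hS t 0 (fun s _ => ⟨fun _ _ => rfl, by rw [h0, norm_zero]⟩) j x
  rw [mul_zero] at this
  exact abs_nonpos_iff.mp this

lemma apriori_gen (hU : GeneratedBy n m p a b U) (hH : H3cond n p) (hd : Good m p M lam d)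
    (hcl : ∀ j k x t, d.β j k (cl x) t = d.β j k x t)
    (hr : CoefRep a b d) (hω : 0 < ω) (hK : 1 ≤ K) (hdi : HasExpDichotomy U ω K) :
    ∃ C : ℝ, 0 ≤ C ∧ ∀ (A B : ℝ) (w : Fd n), 0 ≤ A → TF w → GB B w →
      GB A (w - Kop m p d w) → GB (C * A) w := by
  obtain ⟨C, hC, h⟩ := solve_gen hU hH hd hcl hr hω hK hdi
  refine ⟨C, hC, fun A B w hA hw hB hG => ?_⟩
  obtain ⟨z, hz, hze, hzb⟩ := h A _ hA (hw.sub (Kop_TF hd hw)) hG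
  have := bounded_eq_zero hU hH hd hr hω hdi (hw.sub hz) (hB.sub hzb) (by
    rw [Kop_sub hd hw.toCF hz.toCF]
    conv_lhs => rw [hze]
    abel)
  rwa [sub_eq_zero.mp this]

end inverse

section perturbation

variable {n m : ℕ} {p : Fin n → Fin n → ℝ} {M lam : ℝ} {d d' : LD n} {u v g w G : Fd n} {A B : ℝ}

lemma Kiter_sub (hd : Good m p M lam d) (hu : TF u) (hv : TF v) (i : ℕ) :
    (Kop m p d)^[i] (u - v) = (Kop m p d)^[i] u - (Kop m p d)^[i] v := by
  induction i with
  | zero => rfl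
  | succ i ih =>
    simp only [Function.iterate_succ_apply', ih]
    exact Kop_sub hd (Kiter_TF hd hu i).toCF (Kiter_TF hd hv i).toCF

lemma sub_Kiter_GB (p : Fin n → Fin n → ℝ) (m : ℕ) {M : ℝ} (hM : 1 ≤ M) (lam : ℝ) (i : ℕ) :
    ∃ C : ℝ, 0 ≤ C ∧ ∀ d : LD n, Good m p M lam d → ∀ u, TF u → ∀ A,
      GB A (u - Kop m p d u) → GB (C * A) (u - (Kop m p d)^[i] u) := by
  induction i with
  | zero => exact ⟨0, le_rfl, fun d _ u _ A _ j x t => by simp⟩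
  | succ i ih =>
    obtain ⟨C, hC, ih⟩ := ih
    have c1 := cK_nonneg n hM
    refine ⟨1 + cK n M * C, by positivity, fun d hd u hu A hA => ?_⟩
    rw [sub_Kiter_succ hd hu]
    exact (hA.add (Kop_GB hd (ih d hd u hu A hA))).mono (le_of_eq (by ring))

/-- `d` is uniquely solvable among bounded fields, with constant `C`. -/
structure Solv (m : ℕ) (p : Fin n → Fin n → ℝ) (C : ℝ) (d : LD n) : Prop where
  solve : ∀ (A B : ℝ) (G : Fd n), 0 ≤ A → TF G → GB A G → GB B (dF G) →
    ∃ z, TF z ∧ z = Kop m p d z + G ∧ GB (C * A) z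
  apriori : ∀ (A B : ℝ) (w : Fd n), 0 ≤ A → TF w → GB B w → GB A (w - Kop m p d w) → GB (C * A) w

lemma GB.of_half (hA : 0 ≤ A) (h0 : GB B u) (h : ∀ B, GB B u → GB (A + B / 2) u) :
    GB (2 * A) u := by
  have hk : ∀ k : ℕ, GB (2 * A + B / 2 ^ k) u := by
    intro k
    induction k with
    | zero => exact h0.mono (by simp; linarith)
    | succ k ih => exact (h _ ih).mono (le_of_eq (by rw [pow_succ]; field_simp; ring))
  intro j x t
  have ht : Tendsto (fun k : ℕ => 2 * A + B / 2 ^ k) atTop (𝓝 (2 * A + 0)) := by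
    refine tendsto_const_nhds.add ?_
    have := (tendsto_pow_atTop_nhds_zero_of_lt_one (r := (1 / 2 : ℝ)) (by norm_num)
      (by norm_num)).const_mul B
    rw [mul_zero] at this
    refine this.congr fun k => ?_
    rw [one_div, inv_pow, div_eq_mul_inv]
  rw [add_zero] at ht
  exact ge_of_tendsto ht (Eventually.of_forall fun k => hk k j x t)

lemma apriori_near (hH : H3cond n p) {d0 : LD n} (h0 : Good m p M lam d0) {C0 : ℝ} (hC0 : 0 ≤ C0)
    (hI : Solv m p C0 d0) : ∃ C : ℝ, 0 ≤ C ∧ ∃ ρ : ℝ, 0 < ρ ∧ ∀ d, Good m p M lam d → Near ρ d d0 →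
      ∀ (A B : ℝ) (w : Fd n), 0 ≤ A → TF w → GB B w → GB A (w - Kop m p d w) → GB (C * A) w := by
  obtain ⟨C1, hC1, h1⟩ := sub_Kiter_GB p m h0.hM lam (n + 1)
  obtain ⟨C2, hC2, h2⟩ := Kiter_dt_GB hH m M lam
  obtain ⟨C3, hC3, h3⟩ := Kop_diff_GB p m M lam
  have c1 := cK_nonneg n h0.hM
  obtain ⟨κ, hκ⟩ : ∃ κ, κ = C0 * (C3 * (cK n M ^ (n + 1) + C2)) := ⟨_, rfl⟩
  have hκ0 : 0 ≤ κ := by rw [hκ]; positivity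
  refine ⟨2 * (C1 + C0 * cK n M ^ (n + 1)), by positivity, 1 / (2 * (κ + 1)), by positivity,
    fun d hd hN A B u hA hu hB hG => ?_⟩
  have hρ : κ * (1 / (2 * (κ + 1))) ≤ 1 / 2 := by
    rw [mul_one_div, div_le_div_iff₀ (by positivity) (by positivity)]; linarith
  rw [mul_assoc]
  rcases isEmpty_or_nonempty (Fin n) with hn | ⟨⟨i⟩⟩
  · exact fun j => hn.elim j
  refine GB.of_half (by positivity) hB fun B hB => ?_
  have hB0 : 0 ≤ B := (abs_nonneg _).trans (hB i 0 0)
  have hw := Kiter_TF hd hu (n + 1)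
  have hd1 := h3 d d0 hd h0 _ hN _ hw _ _ (Kiter_GB hd (n + 1) hB) (h2 d hd u hu B hB)
  have hKG := Kiter_GB hd (n + 1) hG
  rw [Kiter_sub hd hu (Kop_TF hd hu), ← Function.iterate_succ_apply,
    Function.iterate_succ_apply' (n := n + 1)] at hKG
  have hs := hKG.add hd1
  rw [sub_add_sub_cancel] at hs
  have hfin := hI.apriori _ _ _ (by positivity) hw (Kiter_GB hd (n + 1) hB) hs
  have := (h1 d hd u hu A hG).add hfin
  rw [sub_add_cancel] at this
  refine this.mono ?_
  have e : C0 * (cK n M ^ (n + 1) * A + C3 * (1 / (2 * (κ + 1))) * (cK n M ^ (n + 1) * B + C2 * B))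
      = C0 * cK n M ^ (n + 1) * A + κ * (1 / (2 * (κ + 1))) * B := by rw [hκ]; ring
  rw [e]
  nlinarith [mul_le_mul_of_nonneg_right hρ hB0]

lemma solve_step (hH : H3cond n p) {d0 : LD n} (h0 : Good m p M lam d0) {C0 : ℝ} (hC0 : 0 ≤ C0)
    (hI : Solv m p C0 d0) : ∃ C : ℝ, 0 ≤ C ∧ ∃ ρ : ℝ, 0 < ρ ∧ ∀ d, Good m p M lam d → Near ρ d d0 →
      ∀ (A : ℝ) (G : Fd n), 0 ≤ A → TF G → GB A G → ∃ V G', TF V ∧ TF G' ∧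
        V = Kop m p d V + (G - G') ∧ GB (C * A) V ∧ GB (A / 2) G' ∧ GB (C * A) (dF G') ∧
        ∀ B, 0 ≤ B → GB B (dF G) → GB (C * (A + B)) (dF V) := by
  obtain ⟨C1, hC1, h1⟩ := exists_partial p m h0.hM lam (n + 1)
  obtain ⟨C2, hC2, h2⟩ := Kiter_dt_GB hH m M lam
  obtain ⟨C3, hC3, h3⟩ := Kop_diff_GB p m M lam
  obtain ⟨C4, hC4, h4⟩ := reg_GB hH m M lam
  have c1 := cK_nonneg n h0.hM
  have c2 := cD_nonneg n h0.hM
  obtain ⟨z0, hz0⟩ : ∃ z0, z0 = C0 * cK n M ^ (n + 1) := ⟨_, rfl⟩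
  obtain ⟨z1, hz1⟩ : ∃ z1, z1 = C4 * (z0 + C2) := ⟨_, rfl⟩
  have p0 : 0 ≤ z0 := by rw [hz0]; positivity
  have p1 : 0 ≤ z1 := by rw [hz1]; positivity
  obtain ⟨κ, hκ⟩ : ∃ κ, κ = C3 * (z0 + z1) := ⟨_, rfl⟩
  have hκ0 : 0 ≤ κ := by rw [hκ]; positivity
  have hρ : κ * (1 / (2 * (κ + 1))) ≤ 1 / 2 := by
    rw [mul_one_div, div_le_div_iff₀ (by positivity) (by positivity)]; linarith
  refine ⟨C1 + z0 + z1 + 2 * (cD n M * (z0 + z1)), by positivity, 1 / (2 * (κ + 1)), by positivity,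
    fun d hd hN A G hA hG hGA => ?_⟩
  have hKG := Kiter_TF hd hG (n + 1)
  have hKd := h2 d hd G hG A hGA
  obtain ⟨z, hz, hze, hzb⟩ := hI.solve _ _ _ (by positivity) hKG (Kiter_GB hd (n + 1) hGA) hKd
  obtain ⟨S, hS, hSe, hSb⟩ := h1 d hd G hG
  have hzb : GB (z0 * A) z := hzb.mono (le_of_eq (by rw [hz0]; ring))
  have hzd : GB (z1 * A) (dF z) := (h4 d0 h0 z hz _ _ hzb (by
    rwa [sub_eq_of_eq_add' hze])).mono (le_of_eq (by rw [hz1]; ring))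
  have hKz := Kop_TF hd hz
  have hKz0 := Kop_TF h0 hz
  have hA' : 0 ≤ cD n M * (z0 + z1) * A := by positivity
  have hz0A : 0 ≤ z0 * A := by positivity
  have hz1A : 0 ≤ z1 * A := by positivity
  have hC1A : 0 ≤ C1 * A := by positivity
  refine ⟨S + z, Kop m p d z - Kop m p d0 z, hS.add hz, hKz.sub hKz0, ?_, ?_, ?_, ?_, ?_⟩
  · rw [Kop_add hd hS.toCF hz.toCF]
    conv_lhs => rw [hSe, hze]
    abel
  · exact ((hSb A 0 hA le_rfl hGA).1.add hzb).mono (by nlinarith)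
  · refine (h3 d d0 hd h0 _ hN z hz _ _ hzb hzd).mono ?_
    calc _ = κ * (1 / (2 * (κ + 1))) * A := by rw [hκ]; ring
      _ ≤ 1 / 2 * A := mul_le_mul_of_nonneg_right hρ hA
      _ = _ := by ring
  · rw [hKz.dF_sub hKz0]
    refine ((Kop_dt_GB hd hz hzb hzd).sub (Kop_dt_GB h0 hz hzb hzd)).mono ?_
    nlinarith
  · intro B hB hGB
    rw [hS.dF_add hz]
    refine (((hSb A B hA hB hGA).2 hGB).add hzd).mono ?_
    nlinarith [mul_nonneg p0 hB, mul_nonneg p1 hB, mul_nonneg (mul_nonneg c2 (add_nonneg p0 p1)) hB]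

lemma exists_solve_near (hH : H3cond n p) {d0 : LD n} (h0 : Good m p M lam d0) {C0 : ℝ}
    (hC0 : 0 ≤ C0) (hI : Solv m p C0 d0) : ∃ C : ℝ, 0 ≤ C ∧ ∃ ρ : ℝ, 0 < ρ ∧ ∀ d,
      Good m p M lam d → Near ρ d d0 → ∀ (A B : ℝ) (G : Fd n), 0 ≤ A → TF G → GB A G →
        GB B (dF G) → ∃ z, TF z ∧ z = Kop m p d z + G ∧ GB (C * A) z := by
  obtain ⟨C, hC, ρ, hρ, hstep⟩ := solve_step hH h0 hC0 hI
  refine ⟨2 * C, by positivity, ρ, hρ, fun d hd hN A B G hA hG hGA hGB => ?_⟩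
  have hstep := hstep d hd hN
  choose! V G' hV hG' hVe hVb hGb' hGd' hVd using hstep
  obtain ⟨F, F0, Fs⟩ : ∃ F : ℕ → Fd n, F 0 = G ∧ ∀ i, F (i + 1) = G' (A / 2 ^ i) (F i) :=
    ⟨fun i => Nat.rec G (fun i v => G' (A / 2 ^ i) v) i, rfl, fun _ => rfl⟩
  have hAi : ∀ i : ℕ, 0 ≤ A / 2 ^ i := fun i => by positivity
  have hF : ∀ i, TF (F i) ∧ GB (A / 2 ^ i) (F i) := by
    intro i
    induction i with
    | zero => rw [F0]; exact ⟨hG, by simpa using hGA⟩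
    | succ i ih =>
      rw [Fs]
      exact ⟨hG' _ _ (hAi i) ih.1 ih.2, (hGb' _ _ (hAi i) ih.1 ih.2).mono
        (le_of_eq (by rw [pow_succ]; field_simp))⟩
  obtain ⟨D, hD⟩ : ∃ D, D = |B| + 2 * (C * A) := ⟨_, rfl⟩
  have hD0 : 0 ≤ D := by rw [hD]; positivity
  have hFd : ∀ i : ℕ, GB (D / 2 ^ i) (dF (F i)) := by
    intro i
    cases i with
    | zero => rw [F0]; exact hGB.mono (by rw [hD]; nlinarith [le_abs_self B, mul_nonneg hC hA])
    | succ i =>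
      rw [Fs]
      refine (hGd' _ _ (hAi i) (hF i).1 (hF i).2).mono ?_
      calc C * (A / 2 ^ i) = 2 * (C * A) / 2 ^ (i + 1) := by rw [pow_succ]; field_simp
        _ ≤ _ := by gcongr; rw [hD]; linarith [abs_nonneg B]
  obtain ⟨f, f0, fs⟩ : ∃ f : ℕ → Fd n, f 0 = 0 ∧ ∀ i, f (i + 1) = f i + V (A / 2 ^ i) (F i) :=
    ⟨fun i => Nat.rec 0 (fun i v => v + V (A / 2 ^ i) (F i)) i, rfl, fun _ => rfl⟩
  have hVi := fun i => hV _ _ (hAi i) (hF i).1 (hF i).2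
  have hfT : ∀ i, TF (f i) := fun i => by
    induction i with
    | zero => rw [f0]; exact TF.zero
    | succ i ih => rw [fs]; exact ih.add (hVi i)
  have hfe : ∀ i, f i = Kop m p d (f i) + (G - F i) := fun i => by
    induction i with
    | zero => rw [f0, F0, Kop_zero, sub_self, add_zero]
    | succ i ih =>
      have h1 := hVe _ _ (hAi i) (hF i).1 (hF i).2
      rw [fs, Kop_add hd (hfT i).toCF (hVi i).toCF, Fs]
      conv_lhs => rw [ih, h1]
      abel
  have hfb : ∀ i : ℕ, GB (2 * C * A * (1 - 1 / 2 ^ i)) (f i) := fun i => by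
    induction i with
    | zero => rw [f0]; intro j x t; simp
    | succ i ih =>
      rw [fs]
      refine (ih.add (hVb _ _ (hAi i) (hF i).1 (hF i).2)).mono (le_of_eq ?_)
      rw [pow_succ]; field_simp; ring
  have hgeo : ∀ (a : ℝ) (i : ℕ), a / 2 ^ i = a * (1 / 2) ^ i := fun a i => by
    rw [one_div, inv_pow, div_eq_mul_inv]
  obtain ⟨y, hy, hLC, -⟩ := TF.limit hfT
    (LCauchy.of_geometric (r := 1 / 2) (by norm_num) (by norm_num) fun T =>
      ⟨C * A, 0, fun i _ => by
        rw [fs, add_sub_cancel_left]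
        refine ((hVb _ _ (hAi i) (hF i).1 (hF i).2).mono (le_of_eq ?_)).lb T 0
        rw [hgeo]; ring⟩)
    (LCauchy.of_geometric (r := 1 / 2) (by norm_num) (by norm_num) fun T =>
      ⟨C * (A + D), 0, fun i _ => by
        rw [fs, (hfT i).dF_add (hVi i), add_sub_cancel_left]
        refine ((hVd _ _ (hAi i) (hF i).1 (hF i).2 _ (by positivity) (hFd i)).mono
          (le_of_eq ?_)).lb T 0
        rw [hgeo, hgeo]; ring⟩)
  refine ⟨y, hy, LC.fixed hd (fun i => (hfT i).toCF) hy.toCF hLC (G := fun i => G - F i) ?_ hfe, ?_⟩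
  · intro T ε hε
    have ht : Tendsto (fun i : ℕ => A / 2 ^ i) atTop (𝓝 0) := by
      simp only [hgeo]
      simpa using (tendsto_pow_atTop_nhds_zero_of_lt_one (r := (1 / 2 : ℝ)) (by norm_num)
        (by norm_num)).const_mul A
    obtain ⟨i0, hi0⟩ := eventually_atTop.mp (ht.eventually (gt_mem_nhds hε))
    refine ⟨i0, fun i hi => ?_⟩
    rw [sub_sub_cancel]
    exact ((hF i).2.mono (hi0 i hi).le).lb T 0
  · intro j x t
    refine le_of_tendsto (hLC.tendsto j x t).abs (Eventually.of_forall fun i => ?_)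
    refine (hfb i j x t).trans ?_
    have : (0:ℝ) ≤ 1 / 2 ^ i := by positivity
    nlinarith [mul_nonneg hC hA]

lemma Near.mono {ρ ρ' : ℝ} (h : Near ρ d d') (hρ : ρ ≤ ρ') : Near ρ' d d' :=
  ⟨fun j x t => (h.1 j x t).trans hρ, fun j k x t => (h.2 j k x t).trans hρ⟩

lemma Solv.near (hH : H3cond n p) {d0 : LD n} (h0 : Good m p M lam d0) {C0 : ℝ} (hC0 : 0 ≤ C0)
    (hI : Solv m p C0 d0) : ∃ C : ℝ, 0 ≤ C ∧ ∃ ρ : ℝ, 0 < ρ ∧ ∀ d, Good m p M lam d →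
      Near ρ d d0 → Solv m p C d := by
  obtain ⟨C1, hC1, ρ1, hρ1, h1⟩ := apriori_near hH h0 hC0 hI
  obtain ⟨C2, hC2, ρ2, hρ2, h2⟩ := exists_solve_near hH h0 hC0 hI
  refine ⟨max C1 C2, by positivity, min ρ1 ρ2, by positivity, fun d hd hN =>
    ⟨fun A B G hA hG hGA hGB => ?_, fun A B w hA hw hB hG => ?_⟩⟩
  · obtain ⟨z, hz, he, hb⟩ := h2 d hd (hN.mono (min_le_right _ _)) A B G hA hG hGA hGB
    exact ⟨z, hz, he, hb.mono (mul_le_mul_of_nonneg_right (le_max_right _ _) hA)⟩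
  · exact (h1 d hd (hN.mono (min_le_left _ _)) A B w hA hw hB hG).mono
      (mul_le_mul_of_nonneg_right (le_max_left _ _) hA)

end perturbation

section second_order

variable {n m : ℕ} {p : Fin n → Fin n → ℝ} {M lam : ℝ} {d d' : LD n} {u v g w G : Fd n} {A B : ℝ}

lemma LC.cauchy {f : ℕ → Fd n} (h : LC f u) : LCauchy f := by
  intro T ε hε
  obtain ⟨N, hN⟩ := h T (ε / 2) (by positivity)
  refine ⟨N, fun i hi k hk j x s hs => ?_⟩
  have h1 := hN i hi j x s hs
  have h2 := hN k hk j x s hs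
  simp only [Pi.sub_apply, abs_le] at h1 h2 ⊢
  constructor <;> linarith [h1.1, h1.2, h2.1, h2.2]

lemma Kiter_CF (hd : Good m p M lam d) (hu : CF u) (i : ℕ) : CF ((Kop m p d)^[i] u) := by
  induction i with
  | zero => exact hu
  | succ i ih => rw [Function.iterate_succ_apply']; exact Kop_CF hd ih

lemma LC.Kiter {f : ℕ → Fd n} (hd : Good m p M lam d) (hf : ∀ i, CF (f i)) (hu : CF u)
    (h : LC f u) (k : ℕ) : LC (fun i => (_root_.Kop m p d)^[k] (f i)) ((_root_.Kop m p d)^[k] u) := by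
  induction k with
  | zero => exact h
  | succ k ih =>
    simp only [Function.iterate_succ_apply']
    exact LC.Kop hd (fun i => Kiter_CF hd (hf i) k) (Kiter_CF hd hu k) ih

/-- The operator smooths limits of regular fields. -/
lemma Kiter_TF_of_LC (hH : H3cond n p) (hd : Good m p M lam d) {f : ℕ → Fd n}
    (hf : ∀ i, TF (f i)) (hu : CF u) (h : LC f u) : TF ((Kop m p d)^[n + 1] u) := by
  obtain ⟨C, hC, R, hR, hs⟩ := Kiter_smoothing hH m M lam
  have hT := fun i => Kiter_TF hd (hf i) (n + 1)
  have hK := LC.Kiter hd (fun i => (hf i).toCF) hu h (n + 1)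
  obtain ⟨y, hy, hLy, -⟩ := TF.limit hT hK.cauchy (by
    intro T ε hε
    obtain ⟨N, hN⟩ := h.cauchy (T + R) (ε / (C + 1)) (by positivity)
    refine ⟨N, fun i hi k hk => ?_⟩
    have := hs d hd _ ((hf i).sub (hf k)) T 0 _ (hN i hi k hk)
    rw [Kiter_sub hd (hf i) (hf k), (hT i).dF_sub (hT k)] at this
    refine this.mono (by simp) ?_
    rw [mul_div_assoc', div_le_iff₀ (by positivity)]
    nlinarith)
  have : y = (Kop m p d)^[n + 1] u := by
    funext j x t
    exact tendsto_nhds_unique (hLy.tendsto j x t) (hK.tendsto j x t)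
  rwa [← this]

lemma TD.shift {f ft : ℝ → ℝ → ℝ} (h : TD f ft) (c : ℝ) :
    TD (fun x t => f x (t + c)) (fun x t => ft x (t + c)) :=
  ⟨h.cont.comp (continuous_fst.prodMk (continuous_snd.add continuous_const)),
    h.contt.comp (continuous_fst.prodMk (continuous_snd.add continuous_const)),
    fun x t => (h.deriv x (t + c)).comp_add_const t c⟩

lemma TF.clamp_dF (hu : TF u) (j : Fin n) (x t : ℝ) : dF u j (cl x) t = dF u j x t := by
  have : u j (cl x) = u j x := funext fun s => hu.clamp j x s
  simp only [dF, dt, this]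

lemma TF.dF_CF (hu : TF u) : CF (dF u) := ⟨fun j => (hu.td j).contt, hu.clamp_dF⟩

lemma TF.quotient (hu : TF u) : ∃ f : ℕ → Fd n, (∀ i, TF (f i)) ∧ LC f (dF u) := by
  refine ⟨fun i j x t => ((i:ℝ) + 1) * (u j x (t + 1 / ((i:ℝ) + 1)) - u j x t), fun i => ?_, ?_⟩
  · exact TD.to_TF (fun j => ⟨_, (((hu.td j).shift _).sub (hu.td j)).const_mul _⟩)
      fun j x t => by simp only [hu.clamp]
  intro T ε hε
  have hU : ∀ j, ∀ᶠ i : ℕ in atTop, ∀ x t, |t - 0| ≤ T → |dF u j x t -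
      ((i:ℝ) + 1) * (u j x (t + 1 / ((i:ℝ) + 1)) - u j x t)| ≤ ε := by
    intro j
    have hc : IsCompact (Icc (0:ℝ) 1 ×ˢ Icc (-T) (T + 1)) := isCompact_Icc.prod isCompact_Icc
    have huc := hc.uniformContinuousOn_of_continuous (hu.td j).contt.continuousOn
    obtain ⟨δ, hδ, h⟩ := Metric.uniformContinuousOn_iff.mp huc ε hε
    filter_upwards [tendsto_one_div_add_atTop_nhds_zero_nat.eventually (gt_mem_nhds hδ)] with i hi
    intro x t ht
    rw [sub_zero] at ht
    obtain ⟨h1, h2⟩ := abs_le.mp ht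
    have hr : (0:ℝ) < 1 / ((i:ℝ) + 1) := by positivity
    have hr1 : 1 / ((i:ℝ) + 1) ≤ 1 := by
      rw [div_le_one (by positivity)]; linarith [(Nat.cast_nonneg i : (0:ℝ) ≤ i)]
    obtain ⟨s, hs, he⟩ := exists_hasDerivAt_eq_slope (u j x) (dF u j x) (lt_add_of_pos_right t hr)
      (fun s _ => ((hu.td j).deriv x s).continuousAt.continuousWithinAt)
      (fun s _ => (hu.td j).deriv x s)
    have e : ((i:ℝ) + 1) * (u j x (t + 1 / ((i:ℝ) + 1)) - u j x t) = dF u j x s := by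
      rw [he, add_sub_cancel_left]; field_simp
    rw [e, ← hu.clamp_dF j x t, ← hu.clamp_dF j x s]
    refine (h (cl x, t) ⟨cl_mem x, by linarith, by linarith⟩ (cl x, s)
      ⟨cl_mem x, by linarith [hs.1], by linarith [hs.2]⟩ ?_).le
    rw [Prod.dist_eq, dist_self, Real.dist_eq, max_lt_iff]
    refine ⟨hδ, ?_⟩
    rw [abs_sub_comm, abs_of_pos (by linarith [hs.1])]
    linarith [hs.2]
  obtain ⟨N, hN⟩ := eventually_atTop.mp (eventually_all.mpr hU)
  exact ⟨N, fun i hi j x s hs => hN i hi j x s hs⟩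

/-- The data of the equation satisfied by the time derivative of a solution. -/
def LD.prime (d : LD n) : LD n :=
  ⟨d.α, fun j k => if j = k then fun x t => d.β j k x t + dt (d.α j) x t else d.β j k⟩

lemma LD.prime_sum (d : LD n) (w : Fd n) (j : Fin n) (x t : ℝ) :
    ∑ k, d.prime.β j k x t * w k x t =
      ∑ k, d.β j k x t * w k x t + dt (d.α j) x t * w j x t := by
  have : ∀ k, d.prime.β j k x t * w k x t =
      d.β j k x t * w k x t + if j = k then dt (d.α j) x t * w k x t else 0 := by
    intro k
    by_cases h : j = k
    · simp only [LD.prime, if_pos h]; ring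
    · simp only [LD.prime, if_neg h, add_zero]
  rw [Finset.sum_congr rfl fun k _ => this k, Finset.sum_add_distrib, Finset.sum_ite_eq]
  simp

structure RegD (m : ℕ) (p : Fin n → Fin n → ℝ) (M lam : ℝ) (d : LD n) : Prop where
  good : Good m p M lam d
  goodp : Good m p M lam d.prime
  hβ2 : ∀ j k, CT M (dt (d.β j k)) (dt (dt (d.β j k)))
  clβ : ∀ j k x t, d.β j k (cl x) t = d.β j k x t

/-- The source of the equation satisfied by the time derivative of a solution. -/
def srcP (d : LD n) (g u : Fd n) : Fd n := fun j x t =>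
  dF g j x t - ∑ k, dt (d.β j k) x t * u k x t

lemma srcP_TD (hd : RegD m p M lam d) (hu : TF u) (hg : TF (dF g)) (j : Fin n) :
    TD (srcP d g u j) (fun x t => dF (dF g) j x t -
      ∑ k, (dt (dt (d.β j k)) x t * u k x t + dt (d.β j k) x t * dF u k x t)) :=
  (hg.td j).sub (TD.sum _ fun k _ => (hd.hβ2 j k).toTD.mul (hu.td k))

lemma srcP_TF (hd : RegD m p M lam d) (hu : TF u) (hg : TF (dF g)) : TF (srcP d g u) := by
  refine TD.to_TF (fun j => ⟨_, srcP_TD hd hu hg j⟩) fun j x t => ?_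
  have : ∀ k, d.β j k (cl x) = d.β j k x := fun k => funext fun s => hd.clβ j k x s
  simp only [srcP, hg.clamp, hu.clamp, dt, this]

lemma Sol.time_deriv (hd : RegD m p M lam d) (hu : TF u) (hg : TF g)
    (h : Sol m p d g u) : Sol m p d.prime (srcP d g u) (dF u) where
  char j := by
    have hh : TD (fun x t => g j x t - ∑ k, d.β j k x t * u k x t) _ :=
      (hg.td j).sub (TD.sum _ fun k _ => (hd.good.hβ j k).toTD.mul (hu.td k))
    refine ((h.char j).deriv_t (hd.good.hα j) (hu.td j) hh).congr fun x _ t => ?_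
    rw [LD.prime_sum, srcP, Finset.sum_add_distrib]
    ring
  bc j t := by
    have h1 := ((hu.td j).deriv (xin m j) t).congr_of_eventuallyEq
      (Eventually.of_forall fun s => (h.bc j s).symm)
    exact h1.unique (bq_deriv hu j t)

lemma Sol.dF_TF (hH : H3cond n p) (hd : RegD m p M lam d) (hu : TF u) (hg : TF g)
    (hg' : TF (dF g)) (h : Sol m p d g u) : TF (dF u) := by
  obtain ⟨f, hf, hLC⟩ := hu.quotient
  have h1 := Kiter_TF_of_LC hH hd.goodp hf hu.dF_CF hLC
  have hs := srcP_TF hd hu hg'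
  have e := (h.time_deriv hd hu hg).eq hd.goodp hu.dF_CF hs.toCF
  have hk : ∀ k, ∃ y, TF y ∧ dF u = (Kop m p d.prime)^[k] (dF u) + y := by
    intro k
    induction k with
    | zero => exact ⟨0, TF.zero, by simp⟩
    | succ k ih =>
      obtain ⟨y, hy, he⟩ := ih
      refine ⟨Kop m p d.prime y + Fop m d.prime (srcP d g u),
        (Kop_TF hd.goodp hy).add (Fop_TF hd.goodp hs), ?_⟩
      rw [Function.iterate_succ_apply', ← add_assoc,
        ← Kop_add hd.goodp (Kiter_CF hd.goodp hu.dF_CF k) hy.toCF, ← he]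
      exact e
  obtain ⟨y, hy, he⟩ := hk (n + 1)
  rw [he]
  exact h1.add hy

/-- Fields that are twice differentiable in time and once in space, with bounds. -/
structure Adm (δ : ℝ) (v : Fd n) : Prop where
  tf : TF v
  tf' : TF (dF v)
  bd : GB δ v
  bd' : GB δ (dF v)
  bd'' : GB δ (dF (dF v))
  xd : ∀ j, XD δ (v j)

lemma sum_abs_le {f : Fin n → ℝ} (h : ∀ k, |f k| ≤ A) : |∑ k, f k| ≤ n * A := by
  refine (Finset.abs_sum_le_sum_abs _ _).trans ((Finset.sum_le_sum fun k _ => h k).trans ?_)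
  simp

lemma abs_mul_le {a b A B : ℝ} (ha : |a| ≤ A) (hb : |b| ≤ B) : |a * b| ≤ A * B := by
  rw [abs_mul]; exact mul_le_mul ha hb (abs_nonneg _) ((abs_nonneg _).trans ha)

lemma Sol.adm (hH : H3cond n p) (m : ℕ) {M : ℝ} (hM : 1 ≤ M) (lam : ℝ) : ∃ C : ℝ, 0 ≤ C ∧
    ∀ d : LD n, RegD m p M lam d → ∀ g u, TF g → TF (dF g) → TF u → Sol m p d g u → ∀ A, 0 ≤ A →
      GB A g → GB A (dF g) → GB A (dF (dF g)) → GB A u → Adm (C * A) u := by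
  obtain ⟨C, hC, hreg⟩ := reg_GB hH m M lam
  have c2 := cD_nonneg n hM
  have hM0 : 0 ≤ M := zero_le_one.trans hM
  obtain ⟨K1, hK1⟩ : ∃ K1, K1 = C * (1 + cD n M * 2) := ⟨_, rfl⟩
  have p1 : 0 ≤ K1 := by rw [hK1]; positivity
  obtain ⟨K2, hK2⟩ : ∃ K2, K2 = C * (K1 + cD n M * (1 + n * M + (1 + n * (M + M * K1)))) :=
    ⟨_, rfl⟩
  have p2 : 0 ≤ K2 := by rw [hK2]; positivity
  refine ⟨1 + K1 + K2 + (1 + n * M + M * K1), by positivity,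
    fun d hd g u hg hg' hu h A hA g0 g1 g2 u0 => ?_⟩
  have hu' := h.dF_TF hH hd hu hg hg'
  have hu1 : GB (K1 * A) (dF u) := (hreg d hd.good u hu _ _ u0 (by
    rw [h.sub_Kop_eq hd.good hu.toCF hg.toCF]
    exact Fop_dt_GB hd.good hg g0 g1)).mono (le_of_eq (by rw [hK1]; ring))
  have hs := srcP_TF hd hu hg'
  have hs0 : GB (A + n * (M * A)) (srcP d g u) := fun j x t =>
    (abs_sub _ _).trans (add_le_add (g1 j x t)
      (sum_abs_le fun k => abs_mul_le ((hd.good.hβ j k).bdt x t) (u0 k x t)))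
  have hs1 : GB (A + n * (M * A + M * (K1 * A))) (dF (srcP d g u)) := fun j x t => by
    rw [dF, ← (srcP_TD hd hu hg' j).eq_dt]
    exact (abs_sub _ _).trans (add_le_add (g2 j x t) (sum_abs_le fun k => (abs_add_le _ _).trans
      (add_le_add (abs_mul_le ((hd.hβ2 j k).bdt x t) (u0 k x t))
        (abs_mul_le ((hd.hβ2 j k).bd x t) (hu1 k x t)))))
  have hu2 : GB (K2 * A) (dF (dF u)) := (hreg d.prime hd.goodp _ hu' _ _ hu1 (by
    rw [(h.time_deriv hd hu hg).sub_Kop_eq hd.goodp hu.dF_CF hs.toCF]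
    exact Fop_dt_GB hd.goodp hs hs0 hs1)).mono (le_of_eq (by rw [hK2]; ring))
  have q0 : 0 ≤ n * M := by positivity
  have q1 := mul_nonneg p1 hA
  have q2 := mul_nonneg p2 hA
  have q3 := mul_nonneg hM0 q1
  have q4 := mul_nonneg q0 hA
  refine ⟨hu, hu', u0.mono (by nlinarith), hu1.mono (by nlinarith), hu2.mono (by nlinarith),
    fun j => ⟨dX d g u j, dX_cont hd.good hu hg.toCF j, fun x t => ?_,
      h.deriv_x hd.good hu j⟩⟩
  have := (abs_sub _ _).trans (add_le_add ((abs_sub _ _).trans (add_le_add (g0 j x t)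
    (sum_abs_le fun k => abs_mul_le ((hd.good.hβ j k).bd x t) (u0 k x t))))
    (abs_mul_le ((hd.good.hα j).bd x t) (hu1 j x t)))
  refine this.trans ?_
  nlinarith

/-- Solvability of the linear problem in the class of admissible fields. -/
lemma Solv.exists_adm (hH : H3cond n p) (m : ℕ) {M : ℝ} (hM : 1 ≤ M) (lam : ℝ) {C0 : ℝ}
    (hC0 : 0 ≤ C0) : ∃ C : ℝ, 0 ≤ C ∧
    ∀ d : LD n, RegD m p M lam d → Solv m p C0 d → ∀ g, TF g → TF (dF g) → ∀ A, 0 ≤ A →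
      GB A g → GB A (dF g) → GB A (dF (dF g)) → ∃ u, Sol m p d g u ∧ Adm (C * A) u := by
  obtain ⟨C, hC, hS⟩ := Sol.adm hH m hM lam
  refine ⟨C * (1 + C0 * Real.exp (2 * M)), by positivity, fun d hd hI g hg hg' A hA g0 g1 g2 => ?_⟩
  obtain ⟨u, hu, he, hb⟩ := hI.solve _ _ _ (by positivity) (Fop_TF hd.good hg)
    (Fop_GB hd.good g0) (Fop_dt_GB hd.good hg g0 g1)
  have h := Sol.of_eq hd.good hu.toCF hg.toCF he
  have hx : 0 ≤ C0 * (Real.exp (2 * M) * A) := by positivity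
  have hy : A ≤ (1 + C0 * Real.exp (2 * M)) * A := by nlinarith
  refine ⟨u, h, ?_⟩
  rw [mul_assoc]
  exact hS d hd g u hg hg' hu h _ (hA.trans hy) (g0.mono hy) (g1.mono hy) (g2.mono hy)
    (hb.mono (by nlinarith))

/-- Two solutions of the same linear problem are as close as their sources. -/
lemma Solv.compare {C0 A' : ℝ} (hd : Good m p M lam d) (hI : Solv m p C0 d) {g' : Fd n}
    (hg : CF g) (hg' : CF g') (hu : TF u) (hv : TF v) (h : Sol m p d g u) (h' : Sol m p d g' v)
    (hA : 0 ≤ A) (hgA : GB A (g - g')) (huB : GB B u) (hvB : GB A' v) :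
    GB (C0 * (Real.exp (2 * M) * A)) (u - v) := by
  refine hI.apriori _ _ _ (by positivity) (hu.sub hv) (huB.sub hvB) ?_
  rw [(h.sub h').sub_Kop_eq hd (hu.sub hv).toCF (hg.sub hg')]
  exact Fop_GB hd hgA

end second_order

section smooth

variable {E : Type*} [NormedAddCommGroup E] [NormedSpace ℝ E]

/-- `Φ` is `C²` on `S` with derivatives `F1`, `F2`, all bounded by `C`. -/
structure Sm (S : Set E) (C : ℝ) (Φ : E → ℝ) (F1 : E → E →L[ℝ] ℝ)
    (F2 : E → E →L[ℝ] E →L[ℝ] ℝ) : Prop where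
  c0 : ContinuousOn Φ S
  c1 : ContinuousOn F1 S
  c2 : ContinuousOn F2 S
  d1 : ∀ x ∈ S, HasFDerivWithinAt Φ (F1 x) S x
  d2 : ∀ x ∈ S, HasFDerivWithinAt F1 (F2 x) S x
  b0 : ∀ x ∈ S, |Φ x| ≤ C
  b1 : ∀ x ∈ S, ‖F1 x‖ ≤ C
  b2 : ∀ x ∈ S, ‖F2 x‖ ≤ C

lemma Sm.of_contDiffOn {S : Set E} (hS : UniqueDiffOn ℝ S) {C : ℝ} {Φ : E → ℝ}
    (h : ContDiffOn ℝ 2 Φ S)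
    (hb : ∀ i : ℕ, i ≤ 2 → ∀ q ∈ S, ‖iteratedFDerivWithin ℝ i Φ S q‖ ≤ C) :
    ∃ F1 F2, Sm S C Φ F1 F2 := by
  have h1 : ContDiffOn ℝ 1 (fderivWithin ℝ Φ S) S := h.fderivWithin hS (by norm_num)
  have h2 : ContDiffOn ℝ 0 (fderivWithin ℝ (fderivWithin ℝ Φ S) S) S :=
    h1.fderivWithin hS (by norm_num)
  refine ⟨fderivWithin ℝ Φ S, fderivWithin ℝ (fderivWithin ℝ Φ S) S, h.continuousOn,
    h1.continuousOn, h2.continuousOn,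
    fun x hx => ((h.differentiableOn (by norm_num)) x hx).hasFDerivWithinAt,
    fun x hx => ((h1.differentiableOn (by norm_num)) x hx).hasFDerivWithinAt,
    fun x hx => ?_, fun x hx => ?_, fun x hx => ?_⟩
  · have := hb 0 (by norm_num) x hx
    rwa [norm_iteratedFDerivWithin_zero] at this
  · have := hb 1 (by norm_num) x hx
    rwa [← norm_iteratedFDerivWithin_fderivWithin hS hx, norm_iteratedFDerivWithin_zero] at this
  · have := hb 2 le_rfl x hx
    rwa [← norm_iteratedFDerivWithin_fderivWithin hS hx,
      ← norm_iteratedFDerivWithin_fderivWithin hS hx, norm_iteratedFDerivWithin_zero] at this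

/-- Bounded `C¹` functions on the strip. -/
structure C1T (M : ℝ) (g : ℝ → ℝ → ℝ) : Prop where
  ct : CT M g (dt g)
  xd : XD M g

/-- Bounded `C¹` functions with a bounded continuous second time derivative. -/
structure C2T (M : ℝ) (g : ℝ → ℝ → ℝ) : Prop extends C1T M g where
  ct2 : CT M (dt g) (dt (dt g))

variable {S : Set E} {C : ℝ} {Φ : E → ℝ} {F1 : E → E →L[ℝ] ℝ} {F2 : E → E →L[ℝ] E →L[ℝ] ℝ}
  {γ γ1 γ2 γx : ℝ → ℝ → E}

lemma Sm.lip (h : Sm S C Φ F1 F2) (hS : Convex ℝ S) {x y : E} (hx : x ∈ S) (hy : y ∈ S) :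
    |Φ y - Φ x| ≤ C * ‖y - x‖ :=
  hS.norm_image_sub_le_of_norm_hasFDerivWithin_le h.d1 h.b1 hx hy

lemma Sm.comp_C1T (h : Sm S C Φ F1 F2) (hγ : ∀ x t, γ x t ∈ S)
    (cγ : Continuous fun q : ℝ × ℝ => γ q.1 q.2) (c1 : Continuous fun q : ℝ × ℝ => γ1 q.1 q.2)
    (d1 : ∀ x t, HasDerivAt (γ x) (γ1 x t) t) (b1 : ∀ x t, ‖γ1 x t‖ ≤ 1)
    (cx : Continuous fun q : ℝ × ℝ => γx q.1 q.2)
    (dx : ∀ x ∈ Icc (0:ℝ) 1, ∀ t, HasDerivWithinAt (fun s => γ s t) (γx x t) (Icc 0 1) x)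
    (bx : ∀ x t, ‖γx x t‖ ≤ 1) :
    C1T C (fun x t => Φ (γ x t)) ∧ TD (fun x t => Φ (γ x t)) fun x t => F1 (γ x t) (γ1 x t) := by
  have hC : 0 ≤ C := (abs_nonneg _).trans (h.b0 _ (hγ 0 0))
  have cF : Continuous fun q : ℝ × ℝ => F1 (γ q.1 q.2) :=
    h.c1.comp_continuous cγ fun q => hγ _ _
  have hb : ∀ x t (w : E), ‖w‖ ≤ 1 → |F1 (γ x t) w| ≤ C := fun x t w hw => by
    refine ((F1 (γ x t)).le_opNorm w).trans ?_
    have := h.b1 _ (hγ x t)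
    nlinarith [norm_nonneg w, norm_nonneg (F1 (γ x t))]
  have htd : TD (fun x t => Φ (γ x t)) fun x t => F1 (γ x t) (γ1 x t) :=
    ⟨h.c0.comp_continuous cγ fun q => hγ _ _, cF.clm_apply c1, fun x t =>
      (h.d1 _ (hγ x t)).comp_hasDerivAt t (d1 x t) (Eventually.of_forall fun s => hγ x s)⟩
  refine ⟨⟨?_, fun x t => F1 (γ x t) (γx x t), cF.clm_apply cx, fun x t => hb x t _ (bx x t),
    fun x hx t => ?_⟩, htd⟩
  · have : CT C (fun x t => Φ (γ x t)) fun x t => F1 (γ x t) (γ1 x t) :=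
      ⟨htd, fun x t => h.b0 _ (hγ x t), fun x t => hb x t _ (b1 x t)⟩
    exact this.to_dt
  · exact (h.d1 _ (hγ x t)).comp_hasDerivWithinAt x (dx x hx t) fun s _ => hγ s t

lemma CT.mono {M M' : ℝ} {g gt : ℝ → ℝ → ℝ} (h : CT M g gt) (hM : M ≤ M') : CT M' g gt :=
  ⟨h.toTD, fun x t => (h.bd x t).trans hM, fun x t => (h.bdt x t).trans hM⟩

lemma XD.mono {M M' : ℝ} {g : ℝ → ℝ → ℝ} (h : XD M g) (hM : M ≤ M') : XD M' g := by
  obtain ⟨gx, c, b, d⟩ := h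
  exact ⟨gx, c, fun x t => (b x t).trans hM, d⟩

lemma C1T.mono {M M' : ℝ} {g : ℝ → ℝ → ℝ} (h : C1T M g) (hM : M ≤ M') : C1T M' g :=
  ⟨h.ct.mono hM, h.xd.mono hM⟩

lemma C2T.mono {M M' : ℝ} {g : ℝ → ℝ → ℝ} (h : C2T M g) (hM : M ≤ M') : C2T M' g :=
  ⟨h.toC1T.mono hM, h.ct2.mono hM⟩

lemma Sm.comp_C2T (h : Sm S C Φ F1 F2) (hγ : ∀ x t, γ x t ∈ S)
    (cγ : Continuous fun q : ℝ × ℝ => γ q.1 q.2) (c1 : Continuous fun q : ℝ × ℝ => γ1 q.1 q.2)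
    (d1 : ∀ x t, HasDerivAt (γ x) (γ1 x t) t) (b1 : ∀ x t, ‖γ1 x t‖ ≤ 1)
    (c2 : Continuous fun q : ℝ × ℝ => γ2 q.1 q.2)
    (d2 : ∀ x t, HasDerivAt (γ1 x) (γ2 x t) t) (b2 : ∀ x t, ‖γ2 x t‖ ≤ 1)
    (cx : Continuous fun q : ℝ × ℝ => γx q.1 q.2)
    (dx : ∀ x ∈ Icc (0:ℝ) 1, ∀ t, HasDerivWithinAt (fun s => γ s t) (γx x t) (Icc 0 1) x)
    (bx : ∀ x t, ‖γx x t‖ ≤ 1) :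
    C2T (2 * C) (fun x t => Φ (γ x t)) := by
  have hC : 0 ≤ C := (abs_nonneg _).trans (h.b0 _ (hγ 0 0))
  obtain ⟨hc, htd⟩ := h.comp_C1T hγ cγ c1 d1 b1 cx dx bx
  refine ⟨hc.mono (by linarith), ?_⟩
  have cF : Continuous fun q : ℝ × ℝ => F1 (γ q.1 q.2) :=
    h.c1.comp_continuous cγ fun q => hγ _ _
  have cF2 : Continuous fun q : ℝ × ℝ => F2 (γ q.1 q.2) :=
    h.c2.comp_continuous cγ fun q => hγ _ _
  have ht2 : TD (fun x t => F1 (γ x t) (γ1 x t))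
      fun x t => F2 (γ x t) (γ1 x t) (γ1 x t) + F1 (γ x t) (γ2 x t) :=
    ⟨cF.clm_apply c1, ((cF2.clm_apply c1).clm_apply c1).add (cF.clm_apply c2), fun x t =>
      ((h.d2 _ (hγ x t)).comp_hasDerivAt t (d1 x t)
        (Eventually.of_forall fun s => hγ x s)).clm_apply (d2 x t)⟩
  have hb1 : ∀ x t (w : E), ‖w‖ ≤ 1 → |F1 (γ x t) w| ≤ C := fun x t w hw => by
    refine ((F1 (γ x t)).le_opNorm w).trans ?_
    have := h.b1 _ (hγ x t)
    nlinarith [norm_nonneg w, norm_nonneg (F1 (γ x t))]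
  have hb2 : ∀ x t (w : E), ‖w‖ ≤ 1 → |F2 (γ x t) w w| ≤ C := fun x t w hw => by
    refine ((F2 (γ x t)).le_opNorm₂ w w).trans ?_
    have := h.b2 _ (hγ x t)
    calc ‖F2 (γ x t)‖ * ‖w‖ * ‖w‖ ≤ C * 1 * 1 := by gcongr
      _ = C := by ring
  rw [← htd.eq_dt]
  refine CT.to_dt ⟨ht2, fun x t => (hb1 x t _ (b1 x t)).trans (by linarith), fun x t => ?_⟩
  refine (abs_add_le _ _).trans ?_
  have := hb1 x t _ (b2 x t)
  have := hb2 x t _ (b1 x t)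
  linarith

end smooth

section calculus

variable {M L : ℝ} {f g ft gt : ℝ → ℝ → ℝ}

lemma CT.mul (hf : CT M f ft) (hg : CT L g gt) :
    CT (2 * (M * L)) (fun x t => f x t * g x t) (fun x t => ft x t * g x t + f x t * gt x t) := by
  have hM := mul_nonneg hf.nonneg hg.nonneg
  refine ⟨hf.toTD.mul hg.toTD, fun x t => ?_, fun x t => ?_⟩
  · have := abs_mul_le (hf.bd x t) (hg.bd x t); linarith
  · have h1 := abs_mul_le (hf.bdt x t) (hg.bd x t)
    have h2 := abs_mul_le (hf.bd x t) (hg.bdt x t)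
    have := abs_add_le (ft x t * g x t) (f x t * gt x t); linarith

lemma CT.add (hf : CT M f ft) (hg : CT L g gt) :
    CT (M + L) (fun x t => f x t + g x t) (fun x t => ft x t + gt x t) :=
  ⟨hf.toTD.add hg.toTD, fun x t => (abs_add_le _ _).trans (add_le_add (hf.bd x t) (hg.bd x t)),
    fun x t => (abs_add_le _ _).trans (add_le_add (hf.bdt x t) (hg.bdt x t))⟩

lemma CT.neg (hf : CT M f ft) : CT M (fun x t => -f x t) (fun x t => -ft x t) :=
  ⟨hf.toTD.neg, fun x t => by rw [abs_neg]; exact hf.bd x t,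
    fun x t => by rw [abs_neg]; exact hf.bdt x t⟩

lemma XD.mul (hf : XD M f) (hg : XD L g) (bf : ∀ x t, |f x t| ≤ M) (bg : ∀ x t, |g x t| ≤ L)
    (cf : Continuous fun q : ℝ × ℝ => f q.1 q.2) (cg : Continuous fun q : ℝ × ℝ => g q.1 q.2) :
    XD (2 * (M * L)) (fun x t => f x t * g x t) := by
  obtain ⟨fx, c, b, d⟩ := hf
  obtain ⟨gx, c', b', d'⟩ := hg
  refine ⟨fun x t => fx x t * g x t + f x t * gx x t, (c.mul cg).add (cf.mul c'),
    fun x t => ?_, fun x hx t => (d x hx t).mul (d' x hx t)⟩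
  have h1 := abs_mul_le (b x t) (bg x t)
  have h2 := abs_mul_le (bf x t) (b' x t)
  have := abs_add_le (fx x t * g x t) (f x t * gx x t); linarith

lemma C1T.mul (hf : C1T M f) (hg : C1T L g) :
    C1T (2 * (M * L)) (fun x t => f x t * g x t) :=
  ⟨(hf.ct.mul hg.ct).to_dt, hf.xd.mul hg.xd hf.ct.bd hg.ct.bd hf.ct.cont hg.ct.cont⟩

lemma C2T.mul (hf : C2T M f) (hg : C2T L g) :
    C2T (4 * (M * L)) (fun x t => f x t * g x t) := by
  have hM := mul_nonneg hf.ct.nonneg hg.ct.nonneg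
  refine ⟨(hf.toC1T.mul hg.toC1T).mono (by linarith), ?_⟩
  rw [← (hf.ct.toTD.mul hg.ct.toTD).eq_dt]
  exact (((hf.ct2.mul hg.ct).add (hf.ct.mul hg.ct2)).mono (by linarith)).to_dt

/-- A bound for reciprocals of functions bounded by `M` and bounded below by `l`. -/
def cI (M l : ℝ) : ℝ := l⁻¹ + M * (l⁻¹ * l⁻¹)

lemma abs_inv_le {a l : ℝ} (hl : 0 < l) (h : l ≤ |a|) : |a⁻¹| ≤ l⁻¹ := by
  rw [abs_inv]; exact inv_anti₀ hl h

lemma abs_neg_div_sq_le {a b l : ℝ} (hl : 0 < l) (h : l ≤ |a|) (hb : |b| ≤ M) :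
    |-b / a ^ 2| ≤ cI M l := by
  have h1 := abs_inv_le hl h
  have : -b / a ^ 2 = -(b * (a⁻¹ * a⁻¹)) := by
    rw [neg_div, div_eq_mul_inv, pow_two, mul_inv]
  rw [this, abs_neg]
  have := abs_mul_le hb (abs_mul_le h1 h1)
  have := inv_pos.2 hl
  unfold cI; linarith

lemma C1T.inv (hf : C1T M f) {l : ℝ} (hl : 0 < l) (h : ∀ x t, l ≤ |f x t|) :
    C1T (cI M l) (fun x t => (f x t)⁻¹) := by
  have h0 : ∀ x t, f x t ≠ 0 := fun x t he => by have := h x t; rw [he, abs_zero] at this; linarith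
  have hM := hf.ct.nonneg
  have hc : l⁻¹ ≤ cI M l := by unfold cI; have : 0 ≤ M * (l⁻¹ * l⁻¹) := by positivity
                               linarith
  refine ⟨?_, ?_⟩
  · have : CT (cI M l) (fun x t => (f x t)⁻¹) (fun x t => -dt f x t / f x t ^ 2) :=
      ⟨hf.ct.toTD.inv h0, fun x t => (abs_inv_le hl (h x t)).trans hc,
        fun x t => abs_neg_div_sq_le hl (h x t) (hf.ct.bdt x t)⟩
    exact this.to_dt
  · obtain ⟨fx, c, b, d⟩ := hf.xd
    refine ⟨fun x t => -fx x t / f x t ^ 2, c.neg.div (hf.ct.cont.pow 2)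
      fun q => pow_ne_zero 2 (h0 _ _), fun x t => abs_neg_div_sq_le hl (h x t) (b x t),
      fun x hx t => (d x hx t).inv (h0 x t)⟩

lemma C2T.inv (hf : C2T M f) {l : ℝ} (hl : 0 < l) (h : ∀ x t, l ≤ |f x t|) :
    C2T (cI M l + 4 * (M * (cI M l * cI M l))) (fun x t => (f x t)⁻¹) := by
  have h0 : ∀ x t, f x t ≠ 0 := fun x t he => by have := h x t; rw [he, abs_zero] at this; linarith
  have hI := hf.toC1T.inv hl h
  have hM := hf.ct.nonneg
  have hc := hI.ct.nonneg
  have : 0 ≤ M * (cI M l * cI M l) := by positivity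
  refine ⟨hI.mono (by linarith), ?_⟩
  have h2 : dt (fun x t => (f x t)⁻¹) = fun x t => -(dt f x t * ((f x t)⁻¹ * (f x t)⁻¹)) := by
    rw [← (hf.ct.toTD.inv h0).eq_dt]
    funext x t
    rw [neg_div, div_eq_mul_inv, pow_two, mul_inv]
  rw [h2]
  exact ((hf.ct2.mul (hI.ct.mul hI.ct)).neg.mono (by linarith)).to_dt

end calculus

section coefficients

variable {n m : ℕ} {p : Fin n → Fin n → ℝ} {δ δ₀ Λ₀ C : ℝ} {v v' : Fd n}

/-- Clamped fields that are small in `C¹`. -/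
structure Sml (δ : ℝ) (v : Fd n) : Prop where
  tf : TF v
  bd : GB δ v
  bd' : GB δ (dF v)
  xd : ∀ j, XD δ (v j)

lemma Adm.sml (h : Adm δ v) : Sml δ v := ⟨h.tf, h.bd, h.bd', h.xd⟩

lemma vec_norm_le {x t : ℝ} {A : ℝ} (h : ∀ j, |v j x t| ≤ A) : ‖vec v x t‖ ≤ n * A := by
  by_cases hn : n = 0
  · subst hn
    have h2 := vec_norm_sq v x t
    rw [Finset.univ_eq_empty, Finset.sum_empty] at h2
    have := pow_eq_zero_iff (two_ne_zero) |>.mp h2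
    rw [this]; simp
  have hA : 0 ≤ A := (abs_nonneg _).trans (h ⟨0, by omega⟩)
  refine abs_le_of_sq_le_sq' ?_ (by positivity) |>.2
  rw [vec_norm_sq]
  have h1 : ∑ j, v j x t ^ 2 ≤ n * A ^ 2 := by
    refine (Finset.sum_le_sum (g := fun _ => A ^ 2) fun j _ => ?_).trans (by simp)
    rw [← sq_abs]; exact pow_le_pow_left₀ (abs_nonneg _) (h j) 2
  have h2 : (1:ℝ) ≤ n := by exact_mod_cast Nat.one_le_iff_ne_zero.2 hn
  nlinarith [sq_nonneg A, mul_nonneg (sub_nonneg.2 h2) (sq_nonneg A)]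

lemma hasDerivWithinAt_toLp {f : ℝ → Fin n → ℝ} {f' : Fin n → ℝ} {s : Set ℝ} {x : ℝ}
    (h : ∀ j, HasDerivWithinAt (fun y => f y j) (f' j) s x) :
    HasDerivWithinAt (fun y => (WithLp.toLp 2 (f y) : Vn n)) (WithLp.toLp 2 f') s x :=
  ((PiLp.continuousLinearEquiv 2 ℝ fun _ : Fin n => ℝ).symm.hasFDerivAt (x := f x)
    ).comp_hasDerivWithinAt x (hasDerivWithinAt_pi.2 h)

lemma TF.vec_deriv (hv : TF v) (x t : ℝ) : HasDerivAt (vec v x) (vec (dF v) x t) t := by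
  rw [← hasDerivWithinAt_univ]
  exact hasDerivWithinAt_toLp fun j => ((hv.td j).deriv x t).hasDerivWithinAt

/-- Evaluation of a coefficient along a field. -/
def ev (φ : ℝ → ℝ → Vn n → ℝ) (v : Fd n) (x t : ℝ) : ℝ := φ (cl x) t (vec v x t)

lemma uniqueDiffOn_qdom (n : ℕ) (hδ₀ : 0 < δ₀) : UniqueDiffOn ℝ (qdom n δ₀) := by
  refine uniqueDiffOn_Icc_zero_one.prod (uniqueDiffOn_univ.prod ?_)
  exact uniqueDiffOn_convex (convex_closedBall 0 δ₀)
    ⟨0, Metric.ball_subset_interior_closedBall (Metric.mem_ball_self hδ₀)⟩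

lemma convex_qdom (n : ℕ) (δ₀ : ℝ) : Convex ℝ (qdom n δ₀) :=
  (convex_Icc 0 1).prod (convex_univ.prod (convex_closedBall 0 δ₀))

lemma H1smooth.sm (hδ₀ : 0 < δ₀) {φ : ℝ → ℝ → Vn n → ℝ} (h : H1smooth n δ₀ φ C) :
    ∃ F1 F2, Sm (qdom n δ₀) C (fun q : ℝ × ℝ × Vn n => φ q.1 q.2.1 q.2.2) F1 F2 :=
  Sm.of_contDiffOn (uniqueDiffOn_qdom n hδ₀) h.1 h.2

lemma mem_qdom {x t : ℝ} {w : Vn n} (h : ‖w‖ ≤ δ₀) : (cl x, t, w) ∈ qdom n δ₀ :=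
  ⟨cl_mem x, mem_univ _, by simpa using h⟩

lemma H1smooth.lip (hδ₀ : 0 < δ₀) {φ : ℝ → ℝ → Vn n → ℝ} (h : H1smooth n δ₀ φ C) (x t : ℝ)
    {w w' : Vn n} (hw : ‖w‖ ≤ δ₀) (hw' : ‖w'‖ ≤ δ₀) :
    |φ (cl x) t w - φ (cl x) t w'| ≤ C * ‖w - w'‖ := by
  obtain ⟨F1, F2, hs⟩ := h.sm hδ₀
  refine (hs.lip (convex_qdom n δ₀) (mem_qdom (x := x) (t := t) hw') (mem_qdom hw)).trans ?_
  have hC : 0 ≤ C := (abs_nonneg _).trans (hs.b0 _ (mem_qdom (x := x) (t := t) hw))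
  refine mul_le_mul_of_nonneg_left ?_ hC
  simp [Prod.norm_def]

lemma GB.vec_le (h : GB δ v) (x t : ℝ) : ‖vec v x t‖ ≤ n * δ := vec_norm_le fun j => h j x t

lemma ev_C1T (hδ₀ : 0 < δ₀) {φ : ℝ → ℝ → Vn n → ℝ} (h : H1smooth n δ₀ φ C) (hv : Sml δ v)
    (h0 : n * δ ≤ δ₀) (h1 : n * δ ≤ 1) :
    C1T C (ev φ v) ∧ (Adm δ v → C2T (2 * C) (ev φ v)) := by
  obtain ⟨F1, F2, hs⟩ := h.sm hδ₀
  choose vx cvx bvx dvx using hv.xd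
  have cv : Continuous fun q : ℝ × ℝ => vec v q.1 q.2 :=
    vec_cont continuous_fst continuous_snd fun j => (hv.tf.td j).cont
  have cv1 : Continuous fun q : ℝ × ℝ => vec (dF v) q.1 q.2 :=
    vec_cont continuous_fst continuous_snd fun j => (hv.tf.td j).contt
  have cvx' : Continuous fun q : ℝ × ℝ => vec vx q.1 q.2 :=
    vec_cont continuous_fst continuous_snd cvx
  have hγ : ∀ x t, ((cl x, t, vec v x t) : ℝ × ℝ × Vn n) ∈ qdom n δ₀ := fun x t =>
    mem_qdom ((hv.bd.vec_le x t).trans h0)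
  have cγ : Continuous fun q : ℝ × ℝ => ((cl q.1, q.2, vec v q.1 q.2) : ℝ × ℝ × Vn n) :=
    (continuous_cl.comp continuous_fst).prodMk (continuous_snd.prodMk cv)
  have c1 : Continuous fun q : ℝ × ℝ => ((0, 1, vec (dF v) q.1 q.2) : ℝ × ℝ × Vn n) :=
    continuous_const.prodMk (continuous_const.prodMk cv1)
  have d1 : ∀ x t, HasDerivAt (fun t => ((cl x, t, vec v x t) : ℝ × ℝ × Vn n))
      (0, 1, vec (dF v) x t) t := fun x t =>
    (hasDerivAt_const t (cl x)).prodMk ((hasDerivAt_id t).prodMk (hv.tf.vec_deriv x t))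
  have b1 : ∀ x t, ‖((0, 1, vec (dF v) x t) : ℝ × ℝ × Vn n)‖ ≤ 1 := fun x t => by
    simp [Prod.norm_def, (hv.bd'.vec_le x t).trans h1]
  have cx : Continuous fun q : ℝ × ℝ => ((1, 0, vec vx q.1 q.2) : ℝ × ℝ × Vn n) :=
    continuous_const.prodMk (continuous_const.prodMk cvx')
  have dx : ∀ x ∈ Icc (0:ℝ) 1, ∀ t, HasDerivWithinAt
      (fun s => ((cl s, t, vec v s t) : ℝ × ℝ × Vn n)) (1, 0, vec vx x t) (Icc 0 1) x :=
    fun x hx t => by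
      have hc : HasDerivWithinAt cl 1 (Icc 0 1) x :=
        (hasDerivWithinAt_id x _).congr (fun y hy => cl_of_mem hy) (cl_of_mem hx)
      exact hc.prodMk ((hasDerivWithinAt_const x _ t).prodMk
        (hasDerivWithinAt_toLp fun j => dvx j x hx t))
  have bx : ∀ x t, ‖((1, 0, vec vx x t) : ℝ × ℝ × Vn n)‖ ≤ 1 := fun x t => by
    simp [Prod.norm_def, (vec_norm_le (v := vx) fun j => bvx j x t).trans h1]
  refine ⟨(hs.comp_C1T (γ := fun x t => (cl x, t, vec v x t))
    (γ1 := fun x t => (0, 1, vec (dF v) x t)) (γx := fun x t => (1, 0, vec vx x t))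
    hγ cγ c1 d1 b1 cx dx bx).1, fun hA => ?_⟩
  refine hs.comp_C2T (γ := fun x t => (cl x, t, vec v x t))
    (γ1 := fun x t => (0, 1, vec (dF v) x t)) (γx := fun x t => (1, 0, vec vx x t))
    (γ2 := fun x t => (0, 0, vec (dF (dF v)) x t)) hγ cγ c1 d1 b1 ?_ ?_ ?_ cx dx bx
  · exact continuous_const.prodMk (continuous_const.prodMk
      (vec_cont continuous_fst continuous_snd fun j => (hA.tf'.td j).contt))
  · exact fun x t => (hasDerivAt_const t (0:ℝ)).prodMk ((hasDerivAt_const t (1:ℝ)).prodMk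
      (hA.tf'.vec_deriv x t))
  · intro x t
    simp [Prod.norm_def, (hA.bd''.vec_le x t).trans h1]

lemma uniqueDiffOn_strip : UniqueDiffOn ℝ strip :=
  uniqueDiffOn_Icc_zero_one.prod uniqueDiffOn_univ

lemma src_C2T {f : ℝ → ℝ → Fin n → ℝ} {ε : ℝ} (h : FBC2le n f ε) (j : Fin n) :
    C2T (2 * ε) (fun x t => f (cl x) t j) := by
  obtain ⟨F1, F2, hs⟩ := Sm.of_contDiffOn uniqueDiffOn_strip (h.1 j) (h.2 j)
  refine hs.comp_C2T (γ := fun x t => (cl x, t)) (γ1 := fun _ _ => (0, 1))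
    (γ2 := fun _ _ => (0, 0)) (γx := fun _ _ => (1, 0)) (fun x t => ⟨cl_mem x, mem_univ _⟩)
    ((continuous_cl.comp continuous_fst).prodMk continuous_snd) continuous_const
    (fun x t => (hasDerivAt_const t (cl x)).prodMk (hasDerivAt_id t)) (fun x t => ?_)
    continuous_const (fun x t => hasDerivAt_const t _) (fun x t => ?_) continuous_const
    (fun x hx t => ?_) (fun x t => ?_)
  · simp [Prod.norm_def]
  · simp [Prod.norm_def]
  · have hc : HasDerivWithinAt cl 1 (Icc 0 1) x :=
      (hasDerivWithinAt_id x _).congr (fun y hy => cl_of_mem hy) (cl_of_mem hx)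
    exact hc.prodMk (hasDerivWithinAt_const x _ t)
  · simp [Prod.norm_def]

lemma sign_const {h : ℝ → ℝ → ℝ} (hc : Continuous fun q : ℝ × ℝ => h q.1 q.2) {l : ℝ}
    (hl : 0 < l) (hb : ∀ x t, l ≤ |h x t|) :
    (∀ x t, l ≤ h x t) ∨ (∀ x t, h x t ≤ -l) := by
  by_contra hcon
  push Not at hcon
  obtain ⟨⟨x, t, h1⟩, x', t', h2⟩ := hcon
  have h1' : h x t ≤ 0 := by
    by_contra h0
    have := hb x t
    rw [abs_of_pos (not_le.1 h0)] at this; linarith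
  have h2' : 0 ≤ h x' t' := by
    by_contra h0
    have := hb x' t'
    rw [abs_of_neg (not_le.1 h0)] at this; linarith
  obtain ⟨q, hq⟩ := mem_range_of_exists_le_of_exists_ge hc ⟨(x, t), h1'⟩ ⟨(x', t'), h2'⟩
  have := hb q.1 q.2
  simp only at hq
  rw [hq, abs_zero] at this; linarith

/-- The coefficients of the problem frozen along `v`, solved for `∂ₓu`. -/
def qd (A : ℝ → ℝ → Vn n → Fin n → ℝ) (B : ℝ → ℝ → Vn n → Fin n → Fin n → ℝ) (v : Fd n) :
    LD n where
  α j x t := (ev (fun x t w => A x t w j) v x t)⁻¹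
  β j k x t := ev (fun x t w => B x t w j k) v x t * (ev (fun x t w => A x t w j) v x t)⁻¹

/-- The right-hand side of the frozen problem. -/
def qg (A : ℝ → ℝ → Vn n → Fin n → ℝ) (f : ℝ → ℝ → Fin n → ℝ) (v : Fd n) : Fd n :=
  fun j x t => f (cl x) t j * (ev (fun x t w => A x t w j) v x t)⁻¹

/-- The standing assumptions on the coefficients. -/
structure QH (n m : ℕ) (δ₀ Λ₀ C : ℝ) (A : ℝ → ℝ → Vn n → Fin n → ℝ)
    (B : ℝ → ℝ → Vn n → Fin n → Fin n → ℝ) : Prop where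
  hδ : 0 < δ₀
  hΛ : 0 < Λ₀
  hC : 1 ≤ C
  hA : ∀ j, H1smooth n δ₀ (fun x t v => A x t v j) C
  hB : ∀ j k, H1smooth n δ₀ (fun x t v => B x t v j k) C
  sign : H1sign n m δ₀ Λ₀ A

variable {A : ℝ → ℝ → Vn n → Fin n → ℝ} {B : ℝ → ℝ → Vn n → Fin n → Fin n → ℝ}

lemma QH.abs_le (h : QH n m δ₀ Λ₀ C A B) (j : Fin n) (x t : ℝ) {w : Vn n} (hw : ‖w‖ ≤ δ₀) :
    |A (cl x) t w j| ≤ C := by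
  obtain ⟨F1, F2, hs⟩ := (h.hA j).sm h.hδ
  exact hs.b0 _ (mem_qdom (x := x) (t := t) hw)

lemma QH.absB_le (h : QH n m δ₀ Λ₀ C A B) (j k : Fin n) (x t : ℝ) {w : Vn n} (hw : ‖w‖ ≤ δ₀) :
    |B (cl x) t w j k| ≤ C := by
  obtain ⟨F1, F2, hs⟩ := (h.hB j k).sm h.hδ
  exact hs.b0 _ (mem_qdom (x := x) (t := t) hw)

lemma QH.le_abs (h : QH n m δ₀ Λ₀ C A B) (j : Fin n) (x t : ℝ) {w : Vn n} (hw : ‖w‖ ≤ δ₀) :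
    Λ₀ ≤ |A (cl x) t w j| := by
  have := (h.sign (cl x) (cl_mem x) t w hw).1 j
  rcases lt_or_ge (j : ℕ) m with hj | hj
  · exact (this.1 hj).trans (le_abs_self _)
  · have := this.2 hj
    exact (by linarith : Λ₀ ≤ -A (cl x) t w j).trans (neg_le_abs _)

lemma vec_clamp (hv : ∀ j x t, v j (cl x) t = v j x t) (x t : ℝ) :
    vec v (cl x) t = vec v x t := by
  unfold vec; simp only [hv]

lemma ev_clamp {φ : ℝ → ℝ → Vn n → ℝ} (hv : ∀ j x t, v j (cl x) t = v j x t) (x t : ℝ) :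
    ev φ v (cl x) t = ev φ v x t := by
  unfold ev; rw [cl_cl, vec_clamp hv]

lemma QH.exists_good (h : QH n m δ₀ Λ₀ C A B) (p : Fin n → Fin n → ℝ) :
    ∃ M lam : ℝ, 1 ≤ M ∧ ∀ v δ, n * δ ≤ δ₀ → n * δ ≤ 1 → Sml δ v →
      Good m p M lam (qd A B v) ∧
      (Adm δ v → RegD m p M lam (qd A B v) ∧ ∀ j, C2T M ((qd A B v).α j)) := by
  have hC := h.hC
  have hΛ := h.hΛ
  set P := ∑ j, ∑ k, |p j k| with hP
  have hpP : ∀ j k, |p j k| ≤ P := fun j k =>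
    (Finset.single_le_sum (f := fun k => |p j k|) (fun _ _ => abs_nonneg _)
      (Finset.mem_univ k)).trans
    (Finset.single_le_sum (f := fun j => ∑ k, |p j k|)
      (fun _ _ => Finset.sum_nonneg fun _ _ => abs_nonneg _) (Finset.mem_univ j))
  have hP0 : 0 ≤ P := Finset.sum_nonneg fun _ _ => Finset.sum_nonneg fun _ _ => abs_nonneg _
  have hcI : 0 ≤ cI C Λ₀ := by unfold cI; positivity
  have hcI2 : 0 ≤ cI (2 * C) Λ₀ := by unfold cI; positivity
  set K := cI (2 * C) Λ₀ + 4 * (2 * C * (cI (2 * C) Λ₀ * cI (2 * C) Λ₀)) with hK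
  have hK0 : 0 ≤ K := by positivity
  set M := 1 + P + cI C Λ₀ + 2 * (C * cI C Λ₀) + K + 4 * (2 * C * K) with hM
  have hCI : 0 ≤ C * cI C Λ₀ := by positivity
  have hCK : 0 ≤ 2 * C * K := by positivity
  set lam := min C⁻¹ (Λ₀ / (C * C)) with hlam
  have hlam0 : 0 < lam := by positivity
  refine ⟨M, lam, by linarith, fun v δ h0 h1 hv => ?_⟩
  have hw : ∀ x t, ‖vec v x t‖ ≤ δ₀ := fun x t => (hv.bd.vec_le x t).trans h0
  have hal : ∀ j x t, Λ₀ ≤ |ev (fun x t w => A x t w j) v x t| := fun j x t =>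
    h.le_abs j x t (hw x t)
  have ha : ∀ j, C1T C (ev (fun x t w => A x t w j) v) := fun j =>
    (ev_C1T h.hδ (h.hA j) hv h0 h1).1
  have hb : ∀ j k, C1T C (ev (fun x t w => B x t w j k) v) := fun j k =>
    (ev_C1T h.hδ (h.hB j k) hv h0 h1).1
  have hα : ∀ j, C1T (cI C Λ₀) ((qd A B v).α j) := fun j => (ha j).inv hΛ (hal j)
  have hβ : ∀ j k, C1T (2 * (C * cI C Λ₀)) ((qd A B v).β j k) := fun j k => (hb j k).mul (hα j)
  have hpos : ∀ j : Fin n, (j : ℕ) < m → ∀ x t, lam ≤ (qd A B v).α j x t := fun j hj x t => by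
    have h2 := ((h.sign (cl x) (cl_mem x) t _ (hw x t)).1 j).1 hj
    exact (min_le_left _ _).trans (inv_anti₀ (hΛ.trans_le h2)
      ((le_abs_self _).trans (h.abs_le j x t (hw x t))))
  have hneg : ∀ j : Fin n, m ≤ (j : ℕ) → ∀ x t, (qd A B v).α j x t ≤ -lam := fun j hj x t => by
    have h2 := ((h.sign (cl x) (cl_mem x) t _ (hw x t)).1 j).2 hj
    have h3 := (neg_le_abs _).trans (h.abs_le j x t (hw x t))
    have h4 : C⁻¹ ≤ (-A (cl x) t (vec v x t) j)⁻¹ := inv_anti₀ (by linarith) h3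
    rw [inv_neg] at h4
    have h5 : lam ≤ C⁻¹ := min_le_left _ _
    change (A (cl x) t (vec v x t) j)⁻¹ ≤ -lam
    linarith
  have hsep : ∀ j k : Fin n, j ≠ k → (∀ x t, lam ≤ (qd A B v).α j x t - (qd A B v).α k x t) ∨
      (∀ x t, lam ≤ (qd A B v).α k x t - (qd A B v).α j x t) := fun j k hjk => by
    have hl : ∀ x t, lam ≤ |(qd A B v).α j x t - (qd A B v).α k x t| := fun x t => by
      have hjl := hal j x t
      have hkl := hal k x t
      have h2 := (h.sign (cl x) (cl_mem x) t _ (hw x t)).2 j k hjk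
      have hj0 : ev (fun x t w => A x t w j) v x t ≠ 0 := fun he => by
        rw [he, abs_zero] at hjl; linarith
      have hk0 : ev (fun x t w => A x t w k) v x t ≠ 0 := fun he => by
        rw [he, abs_zero] at hkl; linarith
      have hjC : |ev (fun x t w => A x t w j) v x t| ≤ C := h.abs_le j x t (hw x t)
      have hkC : |ev (fun x t w => A x t w k) v x t| ≤ C := h.abs_le k x t (hw x t)
      change lam ≤ |(ev (fun x t w => A x t w j) v x t)⁻¹ - (ev (fun x t w => A x t w k) v x t)⁻¹|
      rw [inv_sub_inv hj0 hk0, abs_div, abs_mul, abs_sub_comm]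
      refine (min_le_right _ _).trans ?_
      refine div_le_div₀ (abs_nonneg _) h2 (mul_pos (by linarith) (by linarith)) ?_
      exact mul_le_mul hjC hkC (abs_nonneg _) (by linarith)
    rcases sign_const ((hα j).ct.cont.sub (hα k).ct.cont) hlam0 hl with h2 | h2
    · exact Or.inl h2
    · refine Or.inr fun x t => ?_
      have := h2 x t; linarith
  have hG : Good m p M lam (qd A B v) :=
    { hM := by linarith
      hlam := hlam0
      hp := fun j k => (hpP j k).trans (by linarith)
      hα := fun j => (hα j).ct.mono (by linarith)
      hβ := fun j k => (hβ j k).ct.mono (by linarith)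
      αx := fun j => (hα j).xd.mono (by linarith)
      βx := fun j k _ => (hβ j k).xd.mono (by linarith)
      pos := hpos
      neg := hneg
      sep := hsep }
  refine ⟨hG, fun hA => ?_⟩
  have ha2 : ∀ j, C2T (2 * C) (ev (fun x t w => A x t w j) v) := fun j =>
    (ev_C1T h.hδ (h.hA j) hv h0 h1).2 hA
  have hb2 : ∀ j k, C2T (2 * C) (ev (fun x t w => B x t w j k) v) := fun j k =>
    (ev_C1T h.hδ (h.hB j k) hv h0 h1).2 hA
  have hα2 : ∀ j, C2T K ((qd A B v).α j) := fun j => (ha2 j).inv hΛ (hal j)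
  have hβ2 : ∀ j k, C2T (4 * (2 * C * K)) ((qd A B v).β j k) := fun j k => (hb2 j k).mul (hα2 j)
  have hp : Good m p M lam (qd A B v).prime :=
    { hM := hG.hM
      hlam := hlam0
      hp := hG.hp
      hα := hG.hα
      hβ := fun j k => by
        unfold LD.prime
        simp only
        split_ifs
        · exact ((((hβ2 j k).ct.add (hα2 j).ct2).mono (by linarith)).to_dt)
        · exact hG.hβ j k
      αx := hG.αx
      βx := fun j k hjk => by
        unfold LD.prime
        simp only [if_neg hjk]
        exact hG.βx j k hjk
      pos := hpos
      neg := hneg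
      sep := hsep }
  refine ⟨⟨hG, hp, fun j k => (hβ2 j k).ct2.mono (by linarith), fun j k x t => ?_⟩,
    fun j => (hα2 j).mono (by linarith)⟩
  change ev _ v (cl x) t * (ev _ v (cl x) t)⁻¹ = _
  rw [ev_clamp hv.tf.clamp, ev_clamp hv.tf.clamp]
  rfl

end coefficients

section perturbation

variable {n m : ℕ} {p : Fin n → Fin n → ℝ} {δ δ₀ Λ₀ C M lam C0 ε e : ℝ} {d d' : LD n}
  {u u' v v' g g' : Fd n}

lemma perturb {η η' δ Bd : ℝ} (hd : Good m p M lam d) (hI : Solv m p C0 d)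
    (hcl : ∀ j x t, d.α j (cl x) t = d.α j x t) (hclβ : ∀ j k x t, d.β j k (cl x) t = d.β j k x t)
    (hα' : CF d'.α) (hβ' : ∀ j, CF (d'.β j)) (hg : CF g) (hg' : CF g') (hu : TF u) (hu' : TF u')
    (h : Sol m p d g u)
    (hx : ∀ j, ∀ x ∈ Icc (0:ℝ) 1, ∀ t,
      HasDerivWithinAt (fun s => u' j s t) (dX d' g' u' j x t) (Icc 0 1) x)
    (hbc : ∀ j t, u' j (xin m j) t = ∑ k, p j k * u' k (xout m k) t)
    (hη : 0 ≤ η) (hη' : 0 ≤ η') (hδ : 0 ≤ δ)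
    (hα : ∀ j x t, |d.α j x t - d'.α j x t| ≤ η)
    (hβ : ∀ j k x t, |d.β j k x t - d'.β j k x t| ≤ η) (hgg : GB η' (g - g'))
    (hb : GB δ u') (hb' : GB δ (dF u')) (hB : GB Bd u) :
    GB (C0 * (Real.exp (2 * M) * (η' + η * δ * (1 + n)))) (u - u') := by
  set r : Fd n := fun j x t => (d.α j x t - d'.α j x t) * dF u' j x t +
    ∑ k, (d.β j k x t - d'.β j k x t) * u' k x t with hr
  have hrC : CF r := by
    refine ⟨fun j => ?_, fun j x t => ?_⟩
    · exact (((hd.hα j).cont.sub (hα'.cont j)).mul (hu'.td j).contt).add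
        (continuous_finsetSum _ fun k _ =>
          ((hd.hβ j k).cont.sub ((hβ' j).cont k)).mul (hu'.td k).cont)
    · simp only [hr, hcl, hclβ, hα'.clamp, (hβ' j).clamp, hu'.clamp, hu'.clamp_dF]
  have hS : Sol m p d (g' + r) u' := by
    refine ⟨fun j => ?_, hbc⟩
    refine (CharD.of_partial (hd.hα j) (hu'.td j) (hx j)).congr fun x _ t => ?_
    simp only [dX, hr, Pi.add_apply, sub_mul, Finset.sum_sub_distrib]
    ring
  refine Solv.compare hd hI hg (hg'.add hrC) hu hu' h hS (by positivity) ?_ hB hb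
  intro j x t
  have h1 := hgg j x t
  have h2 := abs_mul_le (hα j x t) (hb' j x t)
  have h3 := sum_abs_le (f := fun k => (d.β j k x t - d'.β j k x t) * u' k x t)
    fun k => abs_mul_le (hβ j k x t) (hb k x t)
  simp only [Pi.sub_apply, Pi.add_apply, hr] at h1 ⊢
  rw [← sub_sub]
  refine (abs_sub _ _).trans ((add_le_add h1 ((abs_add_le _ _).trans (add_le_add h2 h3))).trans
    (le_of_eq (by ring)))

lemma abs_inv_sub_inv_le {a a' l e : ℝ} (hl : 0 < l) (h : l ≤ |a|) (h' : l ≤ |a'|)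
    (he : |a - a'| ≤ e) : |a⁻¹ - a'⁻¹| ≤ e * (l⁻¹ * l⁻¹) := by
  have h0 : a ≠ 0 := fun h0 => by rw [h0, abs_zero] at h; linarith
  have h0' : a' ≠ 0 := fun h0 => by rw [h0, abs_zero] at h'; linarith
  have : a⁻¹ - a'⁻¹ = -((a - a') * (a⁻¹ * a'⁻¹)) := by field_simp; ring
  rw [this, abs_neg]
  exact abs_mul_le he (abs_mul_le (abs_inv_le hl h) (abs_inv_le hl h'))

lemma abs_mul_inv_sub_le {a a' b b' l e e' C : ℝ} (hl : 0 < l) (h : l ≤ |a|) (hla : l ≤ |a'|)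
    (he : |a - a'| ≤ e) (hb : |b'| ≤ C) (hbb : |b - b'| ≤ e') :
    |b * a⁻¹ - b' * a'⁻¹| ≤ e' * l⁻¹ + C * (e * (l⁻¹ * l⁻¹)) := by
  have : b * a⁻¹ - b' * a'⁻¹ = (b - b') * a⁻¹ + b' * (a⁻¹ - a'⁻¹) := by ring
  rw [this]
  exact (abs_add_le _ _).trans (add_le_add (abs_mul_le hbb (abs_inv_le hl h))
    (abs_mul_le hb (abs_inv_sub_inv_le hl h hla he)))

/-- Time translation of a field. -/
def shF (τ : ℝ) (u : Fd n) : Fd n := fun j x t => u j x (t + τ)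

lemma shF_zero (u : Fd n) : shF 0 u = u := by
  funext j x t; simp [shF]

lemma CF.sh (h : CF u) (τ : ℝ) : CF (shF τ u) :=
  ⟨fun j => (h.cont j).comp (continuous_fst.prodMk (continuous_snd.add continuous_const)),
    fun j x t => h.clamp j x (t + τ)⟩

lemma TF.sh (h : TF u) (τ : ℝ) : TF (shF τ u) :=
  ⟨fun j => ((h.td j).shift τ).to_dt, (h.toCF.sh τ).clamp⟩

lemma TF.dF_sh (h : TF u) (τ : ℝ) : dF (shF τ u) = shF τ (dF u) := by
  funext j; exact ((h.td j).shift τ).eq_dt.symm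

lemma GB.sh {A : ℝ} (h : GB A u) (τ : ℝ) : GB A (shF τ u) := fun j x t => h j x (t + τ)

variable {A : ℝ → ℝ → Vn n → Fin n → ℝ} {B : ℝ → ℝ → Vn n → Fin n → Fin n → ℝ}
  {f : ℝ → ℝ → Fin n → ℝ}

lemma Sml.mono {δ δ' : ℝ} (h : Sml δ v) (hδ : δ ≤ δ') : Sml δ' v :=
  ⟨h.tf, h.bd.mono hδ, h.bd'.mono hδ, fun j => (h.xd j).mono hδ⟩

lemma Adm.mono {δ δ' : ℝ} (h : Adm δ v) (hδ : δ ≤ δ') : Adm δ' v :=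
  ⟨h.tf, h.tf', h.bd.mono hδ, h.bd'.mono hδ, h.bd''.mono hδ, fun j => (h.xd j).mono hδ⟩

/-- The frozen problems along all fields of `C¹`-size `δ` are uniformly well posed. -/
structure QS (n m : ℕ) (p : Fin n → Fin n → ℝ) (δ₀ Λ₀ C M lam C0 δ : ℝ)
    (A : ℝ → ℝ → Vn n → Fin n → ℝ) (B : ℝ → ℝ → Vn n → Fin n → Fin n → ℝ) : Prop
    extends QH n m δ₀ Λ₀ C A B where
  hH : H3cond n p
  hM : 1 ≤ M
  hC0 : 0 ≤ C0
  pos : 0 < δ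
  le₀ : n * δ ≤ δ₀
  good : ∀ v, Sml δ v → Good m p M lam (qd A B v)
  solv : ∀ v, Sml δ v → Solv m p C0 (qd A B v)
  reg : ∀ v, Adm δ v → RegD m p M lam (qd A B v) ∧ ∀ j, C2T M ((qd A B v).α j)

lemma qd_clamp (hv : TF v) (j : Fin n) (x t : ℝ) : (qd A B v).α j (cl x) t = (qd A B v).α j x t := by
  change (ev _ v (cl x) t)⁻¹ = (ev _ v x t)⁻¹
  rw [ev_clamp hv.clamp]

lemma qd_clampβ (hv : TF v) (j k : Fin n) (x t : ℝ) :
    (qd A B v).β j k (cl x) t = (qd A B v).β j k x t := by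
  change ev _ v (cl x) t * (ev _ v (cl x) t)⁻¹ = ev _ v x t * (ev _ v x t)⁻¹
  rw [ev_clamp hv.clamp, ev_clamp hv.clamp]

lemma QS.qg_CF (h : QS n m p δ₀ Λ₀ C M lam C0 δ A B) (hf : FBC2le n f ε) (hv : Sml δ v) :
    CF (qg A f v) :=
  ⟨fun j => (src_C2T hf j).ct.cont.mul ((h.good v hv).hα j).cont, fun j x t => by
    unfold qg; rw [cl_cl, ev_clamp hv.tf.clamp]⟩

lemma FBC2le.abs_le (hf : FBC2le n f ε) (j : Fin n) (x t : ℝ) : |f (cl x) t j| ≤ ε := by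
  have := hf.2 j 0 (by norm_num) (cl x, t) ⟨cl_mem x, mem_univ _⟩
  rwa [norm_iteratedFDerivWithin_zero] at this

lemma QS.compare (h : QS n m p δ₀ Λ₀ C M lam C0 δ A B) (hf : FBC2le n f ε) (hε : 0 ≤ ε)
    (hv : Sml δ v) (hv' : Sml δ v') (hu : TF u) (hu' : TF u')
    (hS : Sol m p (qd A B v) (qg A f v) u) (hS' : Sol m p (qd A B v') (qg A f v') u')
    (hb : GB δ u') (hb' : GB δ (dF u')) {Bd : ℝ} (hB : GB Bd u) {τ η : ℝ} (he : 0 ≤ e) (hη : 0 ≤ η)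
    (hAe : ∀ j x t (w : Vn n), ‖w‖ ≤ δ₀ → |A (cl x) (t + τ) w j - A (cl x) t w j| ≤ e)
    (hBe : ∀ j k x t (w : Vn n), ‖w‖ ≤ δ₀ → |B (cl x) (t + τ) w j k - B (cl x) t w j k| ≤ e)
    (hfe : ∀ j x t, |f (cl x) (t + τ) j - f (cl x) t j| ≤ e)
    (hvv : GB η (v - shF τ v')) :
    GB (C0 * Real.exp (2 * M) * cI C Λ₀ * (e + (e + C * (n * η)) * (ε + δ * (1 + n))))
      (u - shF τ u') := by
  have hC := h.hC
  have hΛ := h.hΛ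
  have hw : ∀ x t, ‖vec v x t‖ ≤ δ₀ := fun x t => (hv.bd.vec_le x t).trans h.le₀
  have hw' : ∀ x t, ‖vec v' x t‖ ≤ δ₀ := fun x t => (hv'.bd.vec_le x t).trans h.le₀
  have hvd : ∀ x t, ‖vec v x t - vec v' x (t + τ)‖ ≤ n * η := fun x t => hvv.vec_le x t
  set E := e + C * (n * η) with hE
  have hE0 : 0 ≤ E := by positivity
  have hcI : 0 ≤ cI C Λ₀ := by unfold cI; positivity
  have key : ∀ φ : ℝ → ℝ → Vn n → ℝ, H1smooth n δ₀ φ C →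
      (∀ x t (w : Vn n), ‖w‖ ≤ δ₀ → |φ (cl x) (t + τ) w - φ (cl x) t w| ≤ e) → ∀ x t,
      |ev φ v x t - ev φ v' x (t + τ)| ≤ E := fun φ hφ hφe x t => by
    have h1 := hφ.lip h.hδ x t (hw x t) (hw' x (t + τ))
    have h2 := hφe x t _ (hw' x (t + τ))
    have h3 := abs_sub_le (ev φ v x t) (φ (cl x) t (vec v' x (t + τ))) (ev φ v' x (t + τ))
    rw [abs_sub_comm] at h2
    have h4 : C * ‖vec v x t - vec v' x (t + τ)‖ ≤ C * (n * η) :=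
      mul_le_mul_of_nonneg_left (hvd x t) (by linarith)
    change _ ≤ |ev φ v x t - φ (cl x) t (vec v' x (t + τ))| + _ at h3
    have h5 : |ev φ v x t - φ (cl x) t (vec v' x (t + τ))| ≤ C * (n * η) := h1.trans h4
    have h6 : |φ (cl x) t (vec v' x (t + τ)) - ev φ v' x (t + τ)| ≤ e := h2
    linarith
  have hl : ∀ j x t, Λ₀ ≤ |ev (fun x t w => A x t w j) v x t| := fun j x t =>
    h.le_abs j x t (hw x t)
  have hl' : ∀ j x t, Λ₀ ≤ |ev (fun x t w => A x t w j) v' x t| := fun j x t =>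
    h.le_abs j x t (hw' x t)
  set l := Λ₀⁻¹ with hldef
  have hl0 : 0 < l := inv_pos.2 hΛ
  have hcIle : l * l ≤ cI C Λ₀ ∧ l ≤ cI C Λ₀ := by
    have h1 : (C - 1) * (l * l) ≥ 0 := mul_nonneg (by linarith) (by positivity)
    have h2 : 0 ≤ l * l := by positivity
    constructor <;> unfold cI <;> nlinarith
  have hG := h.good v hv
  have hG' := h.good v' hv'
  have hres := perturb (d := qd A B v) (d' := ⟨shF τ (qd A B v').α, fun j => shF τ ((qd A B v').β j)⟩)
    (g := qg A f v) (g' := shF τ (qg A f v')) (u := u) (u' := shF τ u') (η := E * cI C Λ₀)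
    (η' := cI C Λ₀ * (e + ε * E)) (δ := δ) hG (h.solv v hv)
    (qd_clamp hv.tf) (qd_clampβ hv.tf)
    (CF.sh ⟨fun j => (hG'.hα j).cont, qd_clamp hv'.tf⟩ τ)
    (fun j => CF.sh ⟨fun k => (hG'.hβ j k).cont, qd_clampβ hv'.tf j⟩ τ)
    (h.qg_CF hf hv) ((h.qg_CF hf hv').sh τ) hu (hu'.sh τ) hS ?_ ?_ (by positivity) (by positivity)
    h.pos.le ?_ ?_ ?_ (hb.sh τ) (by rw [hu'.dF_sh]; exact hb'.sh τ) hB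
  · refine hres.mono (le_of_eq ?_)
    ring
  · intro j x hx t
    have := hS'.deriv_x hG' hu' j x hx (t + τ)
    refine this.congr_deriv ?_
    unfold dX
    rw [hu'.dF_sh]
    rfl
  · exact fun j t => hS'.bc j (t + τ)
  · intro j x t
    refine (abs_inv_sub_inv_le hΛ (hl j x t) (hl' j x (t + τ))
      (key _ (h.hA j) (hAe j) x t)).trans ?_
    exact mul_le_mul_of_nonneg_left hcIle.1 hE0
  · intro j k x t
    refine (abs_mul_inv_sub_le hΛ (hl j x t) (hl' j x (t + τ)) (key _ (h.hA j) (hAe j) x t)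
      (h.absB_le j k x (t + τ) (hw' x (t + τ))) (key _ (h.hB j k) (hBe j k) x t)).trans
      (le_of_eq ?_)
    unfold cI; ring
  · intro j x t
    refine (abs_mul_inv_sub_le hΛ (hl j x t) (hl' j x (t + τ)) (key _ (h.hA j) (hAe j) x t)
      (hf.abs_le j x (t + τ)) (e' := e) (by rw [abs_sub_comm]; exact hfe j x t)).trans ?_
    have h1 := mul_le_mul_of_nonneg_left hcIle.2 he
    have h2 := mul_le_mul_of_nonneg_left hcIle.1 (mul_nonneg hε hE0)
    calc e * Λ₀⁻¹ + ε * (E * (Λ₀⁻¹ * Λ₀⁻¹)) = e * l + ε * E * (l * l) := by ring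
      _ ≤ e * cI C Λ₀ + ε * E * cI C Λ₀ := add_le_add h1 h2
      _ = _ := by ring

end perturbation

section almostPeriods

/-- `P e τ` behaves like the relation that `τ` is an `e`-almost period of a Bohr almost periodic
function. -/
structure AlmostPer (P : ℝ → ℝ → Prop) : Prop where
  sub : ∀ e e' τ τ', P e τ → P e' τ' → P (e + e') (τ - τ')
  mono : ∀ e e' τ, P e τ → e ≤ e' → P e' τ
  lip : ∃ L : ℝ, 0 ≤ L ∧ ∀ h, P (L * |h|) h
  dense : ∀ e : ℝ, 0 < e → ∃ l : ℝ, 0 < l ∧ ∀ r : ℝ, ∃ τ ∈ Icc r (r + l), P e τ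

lemma AlmostPer.of_fun {ι : Type*} (g : ι → ℝ → ℝ) {L : ℝ} (hL : 0 ≤ L)
    (hlip : ∀ i t h, |g i (t + h) - g i t| ≤ L * |h|)
    (hd : ∀ e : ℝ, 0 < e → ∃ l : ℝ, 0 < l ∧ ∀ r : ℝ, ∃ τ ∈ Icc r (r + l),
      ∀ i t, |g i (t + τ) - g i t| ≤ e) :
    AlmostPer fun e τ => ∀ i t, |g i (t + τ) - g i t| ≤ e where
  sub e e' τ τ' h h' i t := by
    have h1 := h i (t - τ')
    have h2 := h' i (t - τ')
    rw [sub_add_cancel, abs_sub_comm] at h2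
    rw [show t - τ' + τ = t + (τ - τ') by ring] at h1
    have := abs_sub_le (g i (t + (τ - τ'))) (g i (t - τ')) (g i t)
    linarith
  mono e e' τ h he i t := (h i t).trans he
  lip := ⟨L, hL, fun h i t => hlip i t h⟩
  dense := hd

lemma AlmostPer.and {P Q : ℝ → ℝ → Prop} (hP : AlmostPer P) (hQ : AlmostPer Q) :
    AlmostPer fun e τ => P e τ ∧ Q e τ where
  sub e e' τ τ' h h' := ⟨hP.sub _ _ _ _ h.1 h'.1, hQ.sub _ _ _ _ h.2 h'.2⟩
  mono e e' τ h he := ⟨hP.mono _ _ _ h.1 he, hQ.mono _ _ _ h.2 he⟩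
  lip := by
    obtain ⟨L, hL, h⟩ := hP.lip
    obtain ⟨L', hL', h'⟩ := hQ.lip
    exact ⟨max L L', hL.trans (le_max_left _ _), fun x =>
      ⟨hP.mono _ _ _ (h x) (mul_le_mul_of_nonneg_right (le_max_left _ _) (abs_nonneg _)),
        hQ.mono _ _ _ (h' x) (mul_le_mul_of_nonneg_right (le_max_right _ _) (abs_nonneg _))⟩⟩
  dense e he := by
    obtain ⟨l, hl, h1⟩ := hP.dense (e / 4) (by linarith)
    obtain ⟨l', hl', h2⟩ := hQ.dense (e / 4) (by linarith)
    obtain ⟨L, hL, hlip⟩ := hQ.lip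
    choose τ hτ hPτ using h1
    choose σ hσ hQσ using h2
    set D : Set ℝ := range fun r => τ r - σ r with hD
    have htb : TotallyBounded D := by
      refine (totallyBounded_Icc (-l') l).subset ?_
      rintro _ ⟨r, rfl⟩
      have := hτ r; have := hσ r
      simp only [mem_Icc] at *
      constructor <;> linarith
    have hh : 0 < e / (2 * (L + 1)) := by positivity
    obtain ⟨F, hFD, hF, hcov⟩ := htb.exists_subset (Metric.dist_mem_uniformity hh)
    choose! ρ hρ using fun y (hy : y ∈ F) => mem_range.1 (hFD hy)
    obtain ⟨R, hR⟩ := (hF.image ρ).isBounded.exists_norm_le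
    refine ⟨2 * |R| + 2 * l, by positivity, fun r => ?_⟩
    obtain ⟨y, hy, hyr⟩ := mem_iUnion₂.1 (hcov ⟨r + |R| + l, rfl⟩)
    obtain ⟨c, hc, rfl⟩ : ∃ c ∈ ρ '' F, τ c - σ c = y := ⟨ρ y, mem_image_of_mem _ hy, hρ y hy⟩
    set s := r + |R| + l with hs
    have hcR : |c| ≤ |R| := (hR c hc).trans (le_abs_self _)
    have hyr' : |(τ s - σ s) - (τ c - σ c)| < e / (2 * (L + 1)) := hyr
    have h3 := hτ s; have h4 := hτ c
    have hc' := abs_le.1 hcR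
    simp only [mem_Icc] at h3 h4
    refine ⟨τ s - τ c, ⟨by linarith, by linarith⟩, ?_, ?_⟩
    · exact hP.mono _ _ _ (hP.sub _ _ _ _ (hPτ s) (hPτ c)) (by linarith)
    · have h5 := hQ.sub _ _ _ _ (hQ.sub _ _ _ _ (hQσ s) (hQσ c))
        (hlip (-((τ s - σ s) - (τ c - σ c))))
      rw [abs_neg] at h5
      have h6 : L * |(τ s - σ s) - (τ c - σ c)| ≤ e / 2 := by
        calc L * |(τ s - σ s) - (τ c - σ c)| ≤ (L + 1) * (e / (2 * (L + 1))) :=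
              mul_le_mul (by linarith) hyr'.le (abs_nonneg _) (by linarith)
          _ = e / 2 := by field_simp
      have h7 := hQ.mono _ e _ h5 (by linarith)
      convert h7 using 1
      ring

lemma AlmostPer.all {κ : Type*} {P : κ → ℝ → ℝ → Prop} (h : ∀ k, AlmostPer (P k))
    (s : Finset κ) : AlmostPer fun e τ => ∀ k ∈ s, P k e τ := by
  classical
  induction s using Finset.induction_on with
  | empty =>
    exact ⟨by simp, by simp, ⟨0, le_rfl, by simp⟩, fun e he => ⟨1, one_pos, fun r =>
      ⟨r, ⟨le_rfl, by linarith⟩, by simp⟩⟩⟩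
  | insert a s _ ih =>
    have := (h a).and ih
    simpa only [Finset.forall_mem_insert] using this

end almostPeriods

section wellposed

variable {n m : ℕ} {p : Fin n → Fin n → ℝ} {δ δ₀ Λ₀ C M lam C0 ε e : ℝ} {u v v' : Fd n}
  {A : ℝ → ℝ → Vn n → Fin n → ℝ} {B : ℝ → ℝ → Vn n → Fin n → Fin n → ℝ}
  {f : ℝ → ℝ → Fin n → ℝ} {U : ℝ → ℝ → L2 n →L[ℝ] L2 n}

lemma dF_zero : dF (0 : Fd n) = 0 := by
  funext j; exact (TD.zero.eq_dt).symm

lemma GB.zero (hδ : 0 ≤ δ) : GB δ (0 : Fd n) := fun j x t => by simpa using hδ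

lemma Adm.zero (hδ : 0 ≤ δ) : Adm δ (0 : Fd n) where
  tf := TF.zero
  tf' := by rw [dF_zero]; exact TF.zero
  bd := GB.zero hδ
  bd' := by rw [dF_zero]; exact GB.zero hδ
  bd'' := by rw [dF_zero, dF_zero]; exact GB.zero hδ
  xd j := ⟨fun _ _ => 0, continuous_const, fun _ _ => by simpa using hδ,
    fun x _ t => hasDerivWithinAt_const x _ _⟩

lemma QH.near (h : QH n m δ₀ Λ₀ C A B) (hv : ∀ x t, ‖vec v x t‖ ≤ δ₀)
    (hv' : ∀ x t, ‖vec v' x t‖ ≤ δ₀) {η : ℝ} (hη : 0 ≤ η) (hvv : GB η (v - v')) :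
    Near (C * (n * η) * cI C Λ₀) (qd A B v) (qd A B v') := by
  have hC := h.hC
  have hΛ := h.hΛ
  have key : ∀ φ : ℝ → ℝ → Vn n → ℝ, H1smooth n δ₀ φ C → ∀ x t,
      |ev φ v x t - ev φ v' x t| ≤ C * (n * η) := fun φ hφ x t =>
    (hφ.lip h.hδ x t (hv x t) (hv' x t)).trans
      (mul_le_mul_of_nonneg_left (hvv.vec_le x t) (by linarith))
  have hl0 : 0 < Λ₀⁻¹ := inv_pos.2 hΛ
  have hE0 : 0 ≤ C * (n * η) := by positivity
  have hcI : Λ₀⁻¹ * Λ₀⁻¹ ≤ cI C Λ₀ := by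
    have h1 : (C - 1) * (Λ₀⁻¹ * Λ₀⁻¹) ≥ 0 := mul_nonneg (by linarith) (by positivity)
    unfold cI; linarith
  constructor
  · intro j x t
    refine (abs_inv_sub_inv_le hΛ (h.le_abs j x t (hv x t)) (h.le_abs j x t (hv' x t))
      (key _ (h.hA j) x t)).trans ?_
    exact mul_le_mul_of_nonneg_left hcI hE0
  · intro j k x t
    refine (abs_mul_inv_sub_le hΛ (h.le_abs j x t (hv x t)) (h.le_abs j x t (hv' x t))
      (key _ (h.hA j) x t) (h.absB_le j k x t (hv' x t)) (key _ (h.hB j k) x t)).trans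
      (le_of_eq ?_)
    unfold cI; ring

lemma QS.mono {δ' : ℝ} (h : QS n m p δ₀ Λ₀ C M lam C0 δ A B) (h0 : 0 < δ') (hδ : δ' ≤ δ) :
    QS n m p δ₀ Λ₀ C M lam C0 δ' A B :=
  { h with
    pos := h0
    le₀ := (mul_le_mul_of_nonneg_left hδ (Nat.cast_nonneg n)).trans h.le₀
    good := fun v hv => h.good v (hv.mono hδ)
    solv := fun v hv => h.solv v (hv.mono hδ)
    reg := fun v hv => h.reg v (hv.mono hδ) }

lemma exists_QS (h : QH n m δ₀ Λ₀ C A B) (hH : H3cond n p)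
    (hU : GeneratedBy n m p (fun x t => A x t 0) (fun x t => B x t 0) U) {ω K : ℝ}
    (hω : 0 < ω) (hK : 1 ≤ K) (hdi : HasExpDichotomy U ω K) :
    ∃ M lam C0 δ, QS n m p δ₀ Λ₀ C M lam C0 δ A B := by
  obtain ⟨M, lam, hM, hG⟩ := h.exists_good p
  have hC := h.hC
  have hδ := h.hδ
  have hΛ := h.hΛ
  have hvec0 : ∀ x t, vec (0 : Fd n) x t = 0 := fun x t => rfl
  have hG0 := (hG 0 0 (by simpa using hδ.le) (by simp) (Adm.zero le_rfl).sml).1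
  have hr : CoefRep (fun x t => A x t 0) (fun x t => B x t 0) (qd A B (0 : Fd n)) := by
    intro x hx t j
    have hA0 : A x t 0 j ≠ 0 := fun he => by
      have := h.le_abs j x t (w := 0) (by simpa using hδ.le)
      rw [cl_of_mem hx, he, abs_zero] at this; linarith
    simp only [qd, ev, hvec0, cl_of_mem hx]
    refine ⟨mul_inv_cancel₀ hA0, fun k => ?_⟩
    field_simp
  have hcl : ∀ j k x t, (qd A B (0 : Fd n)).β j k (cl x) t = (qd A B 0).β j k x t :=
    qd_clampβ TF.zero
  obtain ⟨C1, hC1, hs1⟩ := solve_gen hU hH hG0 hcl hr hω hK hdi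
  obtain ⟨C2, hC2, hs2⟩ := apriori_gen hU hH hG0 hcl hr hω hK hdi
  have hS0 : Solv m p (C1 + C2) (qd A B (0 : Fd n)) :=
    ⟨fun A B G hA hT hG _ => by
      obtain ⟨z, z1, z2, z3⟩ := hs1 A G hA hT hG
      exact ⟨z, z1, z2, z3.mono (mul_le_mul_of_nonneg_right (by linarith) hA)⟩,
    fun A B w hA h1 h2 h3 => (hs2 A B w hA h1 h2 h3).mono
      (mul_le_mul_of_nonneg_right (by linarith) hA)⟩
  obtain ⟨C0, hC0, ρ, hρ, hS⟩ := Solv.near hH hG0 (by positivity) hS0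
  have hcI : 0 ≤ cI C Λ₀ := by unfold cI; positivity
  set N : ℝ := n + C * (n * cI C Λ₀) + 1 with hN
  have hN' : 0 ≤ C * (n * cI C Λ₀) := by positivity
  have hNp : 0 < N := by positivity
  set δ := min (min δ₀ 1) ρ / N with hδd
  have hδp : 0 < δ := by positivity
  have hle : ∀ y, 0 ≤ y → y ≤ N → y * δ ≤ min (min δ₀ 1) ρ := fun y hy hyN => by
    rw [hδd, mul_div_assoc', div_le_iff₀ hNp, mul_comm]
    exact mul_le_mul_of_nonneg_left hyN (by positivity)
  have h1 := hle n (Nat.cast_nonneg n) (by linarith)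
  have h2 := hle (C * (n * cI C Λ₀)) hN' (by linarith [(Nat.cast_nonneg n : (0:ℝ) ≤ n)])
  have h1a := h1.trans ((min_le_left _ _).trans (min_le_left _ _))
  have h1b := h1.trans ((min_le_left _ _).trans (min_le_right _ _))
  have h2b := h2.trans (min_le_right _ _)
  refine ⟨M, lam, C0, δ, { h with
    hH := hH
    hM := hM
    hC0 := hC0
    pos := hδp
    le₀ := h1a
    good := fun v hv => (hG v δ h1a h1b hv).1
    solv := fun v hv => hS _ (hG v δ h1a h1b hv).1 ?_
    reg := fun v hv => (hG v δ h1a h1b hv.sml).2 hv }⟩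
  refine Near.mono (h.near (η := δ) (fun x t => (hv.bd.vec_le x t).trans h1a)
    (fun x t => by rw [hvec0, norm_zero]; exact hδ.le) hδp.le (by rw [sub_zero]; exact hv.bd)) ?_
  linarith

lemma QS.step (h : QS n m p δ₀ Λ₀ C M lam C0 δ A B) : ∃ C1 : ℝ, 0 ≤ C1 ∧
    ∀ f ε, 0 ≤ ε → FBC2le n f ε → ∀ v, Adm δ v →
      ∃ u, Sol m p (qd A B v) (qg A f v) u ∧ Adm (C1 * ε) u := by
  obtain ⟨C1, hC1, hs⟩ := Solv.exists_adm h.hH m h.hM lam h.hC0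
  have hM := h.hM
  refine ⟨C1 * (8 * M), by positivity, fun f ε hε hf v hv => ?_⟩
  obtain ⟨hR, hα⟩ := h.reg v hv
  have hg : ∀ j, C2T (4 * (2 * ε * M)) (qg A f v j) := fun j => (src_C2T hf j).mul (hα j)
  have hT : TF (qg A f v) := ⟨fun j => (hg j).ct.toTD, (h.qg_CF hf hv.sml).clamp⟩
  have hT' : TF (dF (qg A f v)) := ⟨fun j => (hg j).ct2.toTD, hT.clamp_dF⟩
  obtain ⟨u, hu, hA⟩ := hs _ hR (h.solv v hv.sml) _ hT hT' (4 * (2 * ε * M)) (by positivity)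
    (fun j => (hg j).ct.bd) (fun j => (hg j).ct.bdt) (fun j => (hg j).ct2.bdt)
  exact ⟨u, hu, hA.mono (le_of_eq (by ring))⟩

lemma GB.interp {η K r : ℝ} (hu : TF u) (hu' : TF (dF u)) (h : GB η u) (h2 : GB K (dF (dF u)))
    (hr : 0 < r) : GB (2 * η / r + K * r) (dF u) := by
  intro j x t
  obtain ⟨ξ, hξ, he⟩ := exists_hasDerivAt_eq_slope (u j x) (dF u j x) (by linarith : t < t + r)
    (fun s _ => ((hu.td j).deriv x s).continuousAt.continuousWithinAt)
    (fun s _ => (hu.td j).deriv x s)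
  have h1 : |dF u j x ξ| ≤ 2 * η / r := by
    rw [he, add_sub_cancel_left, abs_div, abs_of_pos hr]
    refine div_le_div_of_nonneg_right ?_ hr.le
    have := abs_sub (u j x (t + r)) (u j x t)
    have := h j x (t + r)
    have := h j x t
    linarith
  have h3 : |dF u j x t - dF u j x ξ| ≤ K * r := by
    have h4 := Convex.norm_image_sub_le_of_norm_hasDerivWithin_le (s := univ) (C := K)
      (f := dF u j x) (f' := dF (dF u) j x) (x := ξ) (y := t)
      (fun s _ => ((hu'.td j).deriv x s).hasDerivWithinAt) (fun s _ => h2 j x s) convex_univ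
      (mem_univ _) (mem_univ _)
    refine h4.trans (mul_le_mul_of_nonneg_left ?_ ((abs_nonneg _).trans (h2 j x t)))
    rw [Real.norm_eq_abs, abs_le]
    constructor <;> linarith [hξ.1, hξ.2]
  have := abs_sub_abs_le_abs_sub (dF u j x t) (dF u j x ξ)
  linarith

end wellposed

section iteration

variable {n m : ℕ} {p : Fin n → Fin n → ℝ} {δ δ' δ₀ Λ₀ C M lam C0 ε : ℝ} {u v : Fd n}
  {A : ℝ → ℝ → Vn n → Fin n → ℝ} {B : ℝ → ℝ → Vn n → Fin n → Fin n → ℝ}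
  {f : ℝ → ℝ → Fin n → ℝ}

lemma ev_cont {φ : ℝ → ℝ → Vn n → ℝ} (h : H1smooth n δ₀ φ C) (hu : CF u)
    (hw : ∀ x t, ‖vec u x t‖ ≤ δ₀) : Continuous fun q : ℝ × ℝ => ev φ u q.1 q.2 :=
  h.1.continuousOn.comp_continuous (f := fun q : ℝ × ℝ => (cl q.1, q.2, vec u q.1 q.2))
    ((continuous_cl.comp continuous_fst).prodMk
      (continuous_snd.prodMk (vec_cont continuous_fst continuous_snd hu.cont)))
    fun q => mem_qdom (hw q.1 q.2)

lemma ev_tendsto {φ : ℝ → ℝ → Vn n → ℝ} (h : H1smooth n δ₀ φ C) {F : ℕ → Fd n} (hF : LC F u)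
    (hw : ∀ x t, ‖vec u x t‖ ≤ δ₀) (hwF : ∀ i x t, ‖vec (F i) x t‖ ≤ δ₀) (x t : ℝ) :
    Tendsto (fun i => ev φ (F i) x t) atTop (𝓝 (ev φ u x t)) := by
  have hv : Tendsto (fun i => vec (F i) x t) atTop (𝓝 (vec u x t)) :=
    ((PiLp.continuous_toLp 2 _).tendsto (fun j => u j x t)).comp
      (tendsto_pi_nhds.mpr fun j => hF.tendsto j x t)
  exact (h.1.continuousOn (cl x, t, vec u x t) (mem_qdom (hw x t))).tendsto.comp
    (tendsto_nhdsWithin_iff.mpr ⟨tendsto_const_nhds.prodMk_nhds (tendsto_const_nhds.prodMk_nhds hv),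
      Eventually.of_forall fun i => mem_qdom (hwF i x t)⟩)

lemma GB.limit {F : ℕ → Fd n} {K : ℝ} (hF : LC F u) (h : ∀ i, GB K (F i)) : GB K u :=
  fun j x t => le_of_tendsto (hF.tendsto j x t).abs (Eventually.of_forall fun i => h i j x t)

lemma XD.abs_le {w : ℝ → ℝ → ℝ} {K x t d : ℝ} (h : XD K w) (hx : x ∈ Icc (0:ℝ) 1)
    (hd : HasDerivWithinAt (fun s => w s t) d (Icc 0 1) x) : |d| ≤ K := by
  obtain ⟨wx, -, hb, hw⟩ := h
  rw [(uniqueDiffOn_Icc zero_lt_one x hx).eq_deriv _ hd (hw x hx t)]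
  exact hb x t

lemma QS.limit (h : QS n m p δ₀ Λ₀ C M lam C0 δ A B) (hf : FBC2le n f ε) (hδ : δ' ≤ δ)
    {F : ℕ → Fd n} (hF : ∀ i, Sml δ' (F i))
    (hS : ∀ i, Sol m p (qd A B (F i)) (qg A f (F i)) (F (i + 1)))
    (hu : TF u) (h0 : LC F u) (h1 : LC (fun i => dF (F i)) (dF u)) :
    Sml δ' u ∧ Sol m p (qd A B u) (qg A f u) u := by
  have hb : GB δ' u := GB.limit h0 fun i => (hF i).bd
  have hb' : GB δ' (dF u) := GB.limit h1 fun i => (hF i).bd'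
  have hFδ : ∀ i, Sml δ (F i) := fun i => (hF i).mono hδ
  have hw : ∀ x t, ‖vec u x t‖ ≤ δ₀ := fun x t => ((hb.mono hδ).vec_le x t).trans h.le₀
  have hwF : ∀ i x t, ‖vec (F i) x t‖ ≤ δ₀ := fun i x t => ((hFδ i).bd.vec_le x t).trans h.le₀
  have hA0 : ∀ j x t, ev (fun x t w => A x t w j) u x t ≠ 0 := fun j x t h0 => by
    have := h.le_abs j x t (hw x t)
    change Λ₀ ≤ |ev (fun x t w => A x t w j) u x t| at this
    rw [h0, abs_zero] at this
    linarith [h.hΛ]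
  have hAc : ∀ j, Continuous fun q : ℝ × ℝ => (ev (fun x t w => A x t w j) u q.1 q.2)⁻¹ :=
    fun j => (ev_cont (h.hA j) hu.toCF hw).inv₀ fun q => hA0 j q.1 q.2
  have hAt : ∀ j x t, Tendsto (fun i => (ev (fun x t w => A x t w j) (F i) x t)⁻¹) atTop
      (𝓝 (ev (fun x t w => A x t w j) u x t)⁻¹) :=
    fun j x t => (ev_tendsto (h.hA j) h0 hw hwF x t).inv₀ (hA0 j x t)
  set D : Fd n := dX (qd A B u) (qg A f u) u with hD
  set Di : ℕ → Fd n := fun i => dX (qd A B (F i)) (qg A f (F i)) (F (i + 1)) with hDi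
  have hDc : ∀ j, Continuous fun q : ℝ × ℝ => D j q.1 q.2 := fun j =>
    (((src_C2T hf j).ct.cont.mul (hAc j)).sub (continuous_finsetSum _ fun k _ =>
      ((ev_cont (h.hB j k) hu.toCF hw).mul (hAc j)).mul (hu.td k).cont)).sub
      ((hAc j).mul (hu.td j).contt)
  have hDic : ∀ i j, Continuous fun q : ℝ × ℝ => Di i j q.1 q.2 := fun i j =>
    dX_cont (h.good _ (hFδ i)) (hF (i + 1)).tf (h.qg_CF hf (hFδ i)) j
  have hDt : ∀ j x t, Tendsto (fun i => Di i j x t) atTop (𝓝 (D j x t)) := fun j x t =>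
    ((tendsto_const_nhds.mul (hAt j x t)).sub (tendsto_finsetSum _ fun k _ =>
      ((ev_tendsto (h.hB j k) h0 hw hwF x t).mul (hAt j x t)).mul
        ((tendsto_add_atTop_iff_nat 1).mpr (h0.tendsto k x t)))).sub
      ((hAt j x t).mul ((tendsto_add_atTop_iff_nat 1).mpr (h1.tendsto j x t)))
  have hdx : ∀ i j, ∀ x ∈ Icc (0:ℝ) 1, ∀ t,
      HasDerivWithinAt (fun s => F (i + 1) j s t) (Di i j x t) (Icc 0 1) x := fun i j =>
    (hS i).deriv_x (h.good _ (hFδ i)) (hF (i + 1)).tf j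
  have hDib : ∀ i j, ∀ x ∈ Icc (0:ℝ) 1, ∀ t, |Di i j x t| ≤ δ' := fun i j x hx t =>
    ((hF (i + 1)).xd j).abs_le hx (hdx i j x hx t)
  have hux : ∀ j, ∀ x ∈ Icc (0:ℝ) 1, ∀ t,
      HasDerivWithinAt (fun s => u j s t) (D j x t) (Icc 0 1) x := fun j x hx t => by
    have hc : Continuous fun s => D j s t := (hDc j).comp (continuous_id.prodMk continuous_const)
    have key : ∀ y ∈ Icc (0:ℝ) 1, u j y t = u j 0 t + ∫ s in (0:ℝ)..y, D j s t := fun y hy => by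
      have hz : (0:ℝ) ∈ Icc (0:ℝ) 1 := ⟨le_rfl, zero_le_one⟩
      have e1 : Tendsto (fun i => ∫ s in (0:ℝ)..y, Di i j s t) atTop
          (𝓝 (∫ s in (0:ℝ)..y, D j s t)) := by
        refine intervalIntegral.tendsto_integral_filter_of_dominated_convergence (fun _ => δ')
          (Eventually.of_forall fun i => ((hDic i j).comp
            (continuous_id.prodMk continuous_const)).aestronglyMeasurable)
          (Eventually.of_forall fun i => Eventually.of_forall fun s hs => ?_)
          intervalIntegrable_const (Eventually.of_forall fun s _ => hDt j s t)
        exact hDib i j s (uIcc_subset_Icc hz hy (uIoc_subset_uIcc hs)) t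
      have e2 : Tendsto (fun i => ∫ s in (0:ℝ)..y, Di i j s t) atTop
          (𝓝 (u j y t - u j 0 t)) := by
        simp_rw [fun i => integral_eq_of_deriv_Icc (fun x hx => hdx i j x hx t)
          ((hDic i j).comp (continuous_id.prodMk continuous_const)).continuousOn hz hy]
        exact ((tendsto_add_atTop_iff_nat 1).mpr (h0.tendsto j y t)).sub
          ((tendsto_add_atTop_iff_nat 1).mpr (h0.tendsto j 0 t))
      rw [tendsto_nhds_unique e1 e2]; ring
    exact ((deriv_integral_Icc hc 0 x (Icc 0 1)).const_add (u j 0 t)).congr key (key x hx)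
  have hDb : ∀ j x t, |D j (cl x) t| ≤ δ' := fun j x t =>
    le_of_tendsto (hDt j (cl x) t).abs (Eventually.of_forall fun i => hDib i j _ (cl_mem x) t)
  have hsm : Sml δ' u := ⟨hu, hb, hb', fun j => ⟨fun x t => D j (cl x) t,
    (hDc j).comp ((continuous_cl.comp continuous_fst).prodMk continuous_snd), hDb j,
    fun x hx t => by simpa only [cl_of_mem hx] using hux j x hx t⟩⟩
  refine ⟨hsm, fun j => ?_, fun j t => ?_⟩
  · refine (CharD.of_partial ((h.good u (hsm.mono hδ)).hα j) (hu.td j) (hux j)).congr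
      fun x _ t => ?_
    simp only [hD, dX]; ring
  · exact tendsto_nhds_unique ((tendsto_add_atTop_iff_nat 1).mpr (h0.tendsto j (xin m j) t))
      ((tendsto_finsetSum _ fun k _ => tendsto_const_nhds.mul
        ((tendsto_add_atTop_iff_nat 1).mpr (h0.tendsto k (xout m k) t))).congr
          fun i => ((hS i).bc j t).symm)

/-- The contraction factor of the iteration. -/
def qK (n : ℕ) (C Λ₀ M C0 : ℝ) : ℝ := C0 * Real.exp (2 * M) * cI C Λ₀ * (C * n)

lemma QS.contract (h : QS n m p δ₀ Λ₀ C M lam C0 δ A B) (hf : FBC2le n f ε) (hε : 0 ≤ ε)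
    (hs : qK n C Λ₀ M C0 * (ε + δ * (1 + n)) ≤ 1 / 4) {v v' u u' : Fd n}
    (hv : Sml δ v) (hv' : Sml δ v') (hu : Sml δ u) (hu' : Sml δ u')
    (hS : Sol m p (qd A B v) (qg A f v) u) (hS' : Sol m p (qd A B v') (qg A f v') u')
    {η : ℝ} (hη : 0 ≤ η) (hvv : GB η (v - v')) : GB (η / 4) (u - u') := by
  have h1 := h.compare hf hε hv hv' hu.tf hu'.tf hS hS' hu'.bd hu'.bd' hu.bd (τ := 0) le_rfl hη
    (fun j x t w _ => by simp) (fun j k x t w _ => by simp) (fun j x t => by simp)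
    (by rwa [shF_zero])
  rw [shF_zero] at h1
  refine h1.mono ?_
  have h2 := mul_le_mul_of_nonneg_left hs hη
  unfold qK at h2
  linarith [h2]

lemma QS.exists_sol (h : QS n m p δ₀ Λ₀ C M lam C0 δ A B) (hf : FBC2le n f ε) (hε : 0 ≤ ε)
    (hs : qK n C Λ₀ M C0 * (ε + δ * (1 + n)) ≤ 1 / 4) (hδ0 : 0 ≤ δ') (hδ : δ' ≤ δ)
    (hstep : ∀ v, Adm δ v → ∃ u, Sol m p (qd A B v) (qg A f v) u ∧ Adm δ' u) :
    ∃ u, Sml δ' u ∧ Sol m p (qd A B u) (qg A f u) u := by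
  choose! S hS hA using hstep
  obtain ⟨F, F0, Fs⟩ : ∃ F : ℕ → Fd n, F 0 = 0 ∧ ∀ i, F (i + 1) = S (F i) :=
    ⟨fun i => Nat.rec 0 (fun _ v => S v) i, rfl, fun _ => rfl⟩
  have hF : ∀ i, Adm δ' (F i) := fun i => by
    induction i with
    | zero => rw [F0]; exact Adm.zero hδ0
    | succ i ih => rw [Fs]; exact hA _ (ih.mono hδ)
  have hFδ : ∀ i, Sml δ (F i) := fun i => ((hF i).mono hδ).sml
  have hSF : ∀ i, Sol m p (qd A B (F i)) (qg A f (F i)) (F (i + 1)) := fun i => by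
    rw [Fs]; exact hS _ ((hF i).mono hδ)
  have hd : ∀ i, GB (2 * δ' * (1 / 4) ^ i) (F (i + 1) - F i) := fun i => by
    induction i with
    | zero => exact ((hF 1).bd.sub (hF 0).bd).mono (by simp; linarith)
    | succ i ih =>
      refine (h.contract hf hε hs (hFδ _) (hFδ _) (hFδ _) (hFδ _) (hSF _) (hSF _)
        (by positivity) ih).mono (le_of_eq (by ring))
  have hd' : ∀ i, GB (6 * δ' * (1 / 2) ^ i) (dF (F (i + 1)) - dF (F i)) := fun i => by
    have h1 := (hF (i + 1)).tf.dF_sub (hF i).tf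
    have h2 := (hF (i + 1)).tf'.dF_sub (hF i).tf'
    have h3 := GB.interp (r := (1 / 2) ^ i) ((hF (i + 1)).tf.sub (hF i).tf)
      (by rw [h1]; exact (hF (i + 1)).tf'.sub (hF i).tf') (hd i)
      (by rw [h1, h2]; exact (hF (i + 1)).bd''.sub (hF i).bd'') (by positivity)
    rw [h1] at h3
    refine h3.mono (le_of_eq ?_)
    have : ((1:ℝ) / 4) ^ i = (1 / 2) ^ i * (1 / 2) ^ i := by rw [← mul_pow]; norm_num
    rw [this]
    have : ((1:ℝ) / 2) ^ i ≠ 0 := by positivity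
    field_simp
    ring
  obtain ⟨u, hu, h0, h1⟩ := TF.limit (fun i => (hF i).tf)
    (LCauchy.of_geometric (r := 1 / 4) (by norm_num) (by norm_num)
      fun T => ⟨2 * δ', 0, fun i _ => (hd i).lb T 0⟩)
    (LCauchy.of_geometric (r := 1 / 2) (by norm_num) (by norm_num)
      fun T => ⟨6 * δ', 0, fun i _ => (hd' i).lb T 0⟩)
  exact ⟨u, h.limit hf hδ (fun i => (hF i).sml) hSF hu h0 h1⟩

end iteration

section quasilinear

variable {n m : ℕ} {p : Fin n → Fin n → ℝ} {δ δ' δ₀ Λ₀ C M lam C0 ε : ℝ} {v : Fd n}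
  {A : ℝ → ℝ → Vn n → Fin n → ℝ} {B : ℝ → ℝ → Vn n → Fin n → Fin n → ℝ}
  {f : ℝ → ℝ → Fin n → ℝ} {u ux ut : ℝ → ℝ → Vn n}

/-- The components of a function on the strip, extended constantly in `x`. -/
def fd (u : ℝ → ℝ → Vn n) : Fd n := fun j x t => u (cl x) t j

lemma fd_cont (h : ContinuousOn (fun q : ℝ × ℝ => u q.1 q.2) strip) (j : Fin n) :
    Continuous fun q : ℝ × ℝ => fd u j q.1 q.2 :=
  ((EuclideanSpace.proj (𝕜 := ℝ) j).continuous.comp_continuousOn h).comp_continuous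
    (f := fun q : ℝ × ℝ => (cl q.1, q.2))
    ((continuous_cl.comp continuous_fst).prodMk continuous_snd) fun q => ⟨cl_mem q.1, mem_univ _⟩

lemma fd_abs_le (h : ∀ x ∈ Icc (0:ℝ) 1, ∀ t, ‖u x t‖ ≤ δ) : GB δ (fd u) := fun j x t =>
  (PiLp.norm_apply_le (u (cl x) t) j).trans (h _ (cl_mem x) t)

lemma QS.of_isQLSol (h : QS n m p δ₀ Λ₀ C M lam C0 δ A B) (hq : IsQLSol n m p A B f u ux ut)
    (hb : BC1le n u ux ut δ) :
    Sml δ (fd u) ∧ Sol m p (qd A B (fd u)) (qg A f (fd u)) (fd u) := by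
  obtain ⟨hc, hcx, hct, hd, heq, hbc⟩ := hq
  have htd : ∀ j, TD (fd u j) (fd ut j) := fun j =>
    ⟨fd_cont hc j, fd_cont hct j, fun x t => (hd _ (cl_mem x) t j).2⟩
  have hdF : dF (fd u) = fd ut := funext fun j => (htd j).eq_dt.symm
  have htf : TF (fd u) := TD.to_TF (fun j => ⟨_, htd j⟩) fun j x t => by simp only [fd, cl_cl]
  have hx : ∀ j, ∀ x ∈ Icc (0:ℝ) 1, ∀ t,
      HasDerivWithinAt (fun s => fd u j s t) (fd ux j x t) (Icc 0 1) x := fun j x hx t => by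
    have h1 := (hd x hx t j).1
    simp only [fd, cl_of_mem hx]
    exact h1.congr (fun y hy => by rw [cl_of_mem hy]) (by rw [cl_of_mem hx])
  have hs : Sml δ (fd u) := ⟨htf, fd_abs_le fun x hx t => (hb x hx t).1,
    hdF ▸ fd_abs_le fun x hx t => (hb x hx t).2.2,
    fun j => ⟨fd ux j, fd_cont hcx j, fd_abs_le (fun x hx t => (hb x hx t).2.1) j, hx j⟩⟩
  refine ⟨hs, fun j => ?_, fun j t => ?_⟩
  · refine (CharD.of_partial ((h.good _ hs).hα j) (htd j) (hx j)).congr fun x hx t => ?_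
    have h1 := heq (cl x) (cl_mem x) t j
    have h2 := h.le_abs j x t ((hs.bd.vec_le x t).trans h.le₀)
    have h3 : A (cl x) t (u (cl x) t) j ≠ 0 := fun h0 => by
      change Λ₀ ≤ |A (cl x) t (u (cl x) t) j| at h2
      rw [h0, abs_zero] at h2
      linarith [h.hΛ]
    change ux (cl x) t j + (A (cl x) t (u (cl x) t) j)⁻¹ * ut (cl x) t j =
      f (cl x) t j * (A (cl x) t (u (cl x) t) j)⁻¹ - ∑ k, B (cl x) t (u (cl x) t) j k *
        (A (cl x) t (u (cl x) t) j)⁻¹ * u (cl x) t k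
    rw [← h1]
    simp_rw [fun k => mul_right_comm (B (cl x) t (u (cl x) t) j k)
      (A (cl x) t (u (cl x) t) j)⁻¹ (u (cl x) t k)]
    rw [← Finset.sum_mul]
    field_simp
    ring
  · refine (bcRel_iff (u 0 t) (u 1 t) (fd u) t (fun j => ?_) fun j => ?_).mp (hbc t) j
    · simp only [fd, cl_of_mem (left_mem_Icc.mpr (zero_le_one' ℝ))]
    · simp only [fd, cl_of_mem (right_mem_Icc.mpr (zero_le_one' ℝ))]

lemma QS.isQLSol (h : QS n m p δ₀ Λ₀ C M lam C0 δ A B) (hf : FBC2le n f ε) (hδ : δ' ≤ δ)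
    (hδn : n * δ' ≤ δ) (hv : Sml δ' v) (hS : Sol m p (qd A B v) (qg A f v) v) :
    IsQLSol n m p A B f (vec v) (vec (dX (qd A B v) (qg A f v) v)) (vec (dF v)) ∧
      BC1le n (vec v) (vec (dX (qd A B v) (qg A f v) v)) (vec (dF v)) δ := by
  have hG := h.good v (hv.mono hδ)
  have hx := hS.deriv_x hG hv.tf
  have hcont : ∀ w : Fd n, (∀ j, Continuous fun q : ℝ × ℝ => w j q.1 q.2) →
      ContinuousOn (fun q : ℝ × ℝ => vec w q.1 q.2) strip := fun w hw =>
    (vec_cont continuous_fst continuous_snd hw).continuousOn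
  refine ⟨⟨hcont _ hv.tf.toCF.cont, hcont _ (dX_cont hG hv.tf (h.qg_CF hf (hv.mono hδ))),
    hcont _ fun j => (hv.tf.td j).contt,
    fun x hx' t j => ⟨hx j x hx' t, (hv.tf.td j).deriv x t⟩, fun x hx t j => ?_, fun t =>
      (bcRel_iff _ _ v t (fun _ => rfl) fun _ => rfl).mpr fun j => hS.bc j t⟩, fun x hx' t => ?_⟩
  · have h2 := h.le_abs j x t (((hv.mono hδ).bd.vec_le x t).trans h.le₀)
    rw [cl_of_mem hx] at h2
    have h3 : A x t (vec v x t) j ≠ 0 := fun h0 => by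
      rw [h0, abs_zero] at h2
      linarith [h.hΛ]
    simp only [vec_apply, dX, qg, qd, ev, cl_of_mem hx]
    simp_rw [fun k => mul_right_comm (B x t (vec v x t) j k)
      (A x t (vec v x t) j)⁻¹ (v k x t)]
    rw [← Finset.sum_mul]
    field_simp
    ring
  · exact ⟨(hv.bd.vec_le x t).trans hδn,
      (vec_norm_le fun j => (hv.xd j).abs_le hx' (hx j x hx' t)).trans hδn,
      (hv.bd'.vec_le x t).trans hδn⟩

lemma QS.unique (h : QS n m p δ₀ Λ₀ C M lam C0 δ A B) (hf : FBC2le n f ε) (hε : 0 ≤ ε)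
    (hs : qK n C Λ₀ M C0 * (ε + δ * (1 + n)) ≤ 1 / 4) {v v' : Fd n}
    (hv : Sml δ v) (hv' : Sml δ v') (hS : Sol m p (qd A B v) (qg A f v) v)
    (hS' : Sol m p (qd A B v') (qg A f v') v') : v = v' := by
  have h0 := GB.of_half le_rfl (hv.bd.sub hv'.bd) fun b hb j x t => by
    have hb0 : 0 ≤ b := (abs_nonneg _).trans (hb j x t)
    exact (h.contract hf hε hs hv hv' hv hv' hS hS' hb0 hb j x t).trans (by linarith)
  funext j x t
  have := h0 j x t
  rw [mul_zero] at this
  exact sub_eq_zero.mp (abs_nonpos_iff.mp this)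

lemma QS.shift_le (h : QS n m p δ₀ Λ₀ C M lam C0 δ A B) (hf : FBC2le n f ε) (hε : 0 ≤ ε)
    (hs : qK n C Λ₀ M C0 * (ε + δ * (1 + n)) ≤ 1 / 4)
    (hv : Sml δ v) (hS : Sol m p (qd A B v) (qg A f v) v) {e τ : ℝ} (he : 0 ≤ e)
    (hAe : ∀ j x t (w : Vn n), ‖w‖ ≤ δ₀ → |A (cl x) (t + τ) w j - A (cl x) t w j| ≤ e)
    (hBe : ∀ j k x t (w : Vn n), ‖w‖ ≤ δ₀ → |B (cl x) (t + τ) w j k - B (cl x) t w j k| ≤ e)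
    (hfe : ∀ j x t, |f (cl x) (t + τ) j - f (cl x) t j| ≤ e) :
    GB (2 * (C0 * Real.exp (2 * M) * cI C Λ₀ * (1 + (ε + δ * (1 + n))) * e)) (v - shF τ v) := by
  have hC := h.hC
  have hΛ := h.hΛ
  have hC0 := h.hC0
  have hδ := h.pos
  have hcI : 0 ≤ cI C Λ₀ := by unfold cI; positivity
  refine GB.of_half (by positivity) (hv.bd.sub (hv.bd.sh τ)) fun b hb j x t => ?_
  have hb0 : 0 ≤ b := (abs_nonneg _).trans (hb j x t)
  refine (h.compare hf hε hv hv hv.tf hv.tf hS hS hv.bd hv.bd' hv.bd he hb0 hAe hBe hfe hb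
    j x t).trans ?_
  have h2 := mul_le_mul_of_nonneg_left hs hb0
  unfold qK at h2
  linarith [h2]

lemma almostPer_coef (hδ₀ : 0 < δ₀) (hC : 0 ≤ C) {φ : ℝ → ℝ → Vn n → ℝ} (h : H1smooth n δ₀ φ C)
    (ha : APcoef n δ₀ φ) : AlmostPer fun e τ =>
      ∀ (q : ℝ × {w : Vn n // ‖w‖ ≤ δ₀}) t, |φ (cl q.1) (t + τ) q.2 - φ (cl q.1) t q.2| ≤ e := by
  refine AlmostPer.of_fun (fun (q : ℝ × {w : Vn n // ‖w‖ ≤ δ₀}) t => φ (cl q.1) t q.2) hC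
    (fun q t s => ?_) fun e he => ?_
  · obtain ⟨F1, F2, hS⟩ := h.sm hδ₀
    refine (hS.lip (convex_qdom n δ₀) (mem_qdom (x := q.1) (t := t) q.2.2)
      (mem_qdom (x := q.1) (t := t + s) q.2.2)).trans (le_of_eq ?_)
    simp [Prod.norm_def]
  · obtain ⟨l, hl, hr⟩ := ha e he
    refine ⟨l, hl, fun r => ?_⟩
    obtain ⟨τ, hτ, h1⟩ := hr r
    exact ⟨τ, hτ, fun q t => (h1 _ (cl_mem q.1) t _ q.2.2).le⟩

lemma almostPer_src (hf : FBC2le n f ε) (hε : 0 ≤ ε) (ha : APfun n f) : AlmostPer fun e τ =>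
    ∀ (q : ℝ × Fin n) t, |f (cl q.1) (t + τ) q.2 - f (cl q.1) t q.2| ≤ e := by
  refine AlmostPer.of_fun (fun (q : ℝ × Fin n) t => f (cl q.1) t q.2) (L := 2 * ε) (by positivity)
    (fun q t s => ?_) fun e he => ?_
  · simpa using (src_C2T hf q.2).ct.lip q.1 t (t + s)
  · obtain ⟨l, hl, hr⟩ := ha e he
    refine ⟨l, hl, fun r => ?_⟩
    obtain ⟨τ, hτ, h1⟩ := hr r
    exact ⟨τ, hτ, fun q t => (h1 _ (cl_mem q.1) t q.2).le⟩

lemma QS.apsol (h : QS n m p δ₀ Λ₀ C M lam C0 δ A B) (hf : FBC2le n f ε) (hε : 0 ≤ ε)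
    (hs : qK n C Λ₀ M C0 * (ε + δ * (1 + n)) ≤ 1 / 4)
    (hapA : ∀ j, APcoef n δ₀ (fun x t v => A x t v j))
    (hapB : ∀ j k, APcoef n δ₀ (fun x t v => B x t v j k)) (hapf : APfun n f)
    (hv : Sml δ (fd u)) (hS : Sol m p (qd A B (fd u)) (qg A f (fd u)) (fd u)) : APsol n u := by
  have hC := h.hC
  have hΛ := h.hΛ
  have hC0 := h.hC0
  have hδ := h.pos
  have hcI : 0 ≤ cI C Λ₀ := by unfold cI; positivity
  set K := 2 * (C0 * Real.exp (2 * M) * cI C Λ₀ * (1 + (ε + δ * (1 + n)))) with hK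
  have hK0 : 0 ≤ K := by positivity
  have hP := ((AlmostPer.all (fun j => almostPer_coef h.hδ (by linarith) (h.hA j) (hapA j))
    Finset.univ).and (AlmostPer.all (fun q : Fin n × Fin n =>
      almostPer_coef h.hδ (by linarith) (h.hB q.1 q.2) (hapB q.1 q.2)) Finset.univ)).and
    (almostPer_src hf hε hapf)
  intro e he
  obtain ⟨l, hl, hr⟩ := hP.dense (e / (n * K + 1)) (by positivity)
  refine ⟨l, hl, fun r => ?_⟩
  obtain ⟨τ, hτ, ⟨hA, hB⟩, hF⟩ := hr r
  refine ⟨τ, hτ, fun x hx t => ?_⟩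
  have h1 := (h.shift_le hf hε hs hv hS (by positivity)
    (fun j x t w hw => hA j (Finset.mem_univ _) (x, ⟨w, hw⟩) t)
    (fun j k x t w hw => hB (j, k) (Finset.mem_univ _) (x, ⟨w, hw⟩) t)
    (fun j x t => hF (x, j) t)).vec_le x t
  have h2 : vec (fd u - shF τ (fd u)) x t = u x t - u x (t + τ) := by
    rw [vec_sub]
    change u (cl x) t - u (cl x) (t + τ) = _
    rw [cl_of_mem hx]
  rw [h2, norm_sub_rev] at h1
  refine h1.trans_lt ?_
  have h3 : n * (2 * (C0 * Real.exp (2 * M) * cI C Λ₀ * (1 + (ε + δ * (1 + n))) *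
      (e / (n * K + 1)))) = n * K * e / (n * K + 1) := by rw [hK]; ring
  rw [h3, div_lt_iff₀ (by positivity)]
  linarith

end quasilinear

/- STATEMENT 2: if moreover `A`, `B`, `f` are Bohr almost periodic in `t`
(uniformly in the other variables), then the unique small bounded classical
solution is Bohr almost periodic in `t` uniformly in `x`. -/
theorem stmt_2
    (n m : ℕ) (hn : 1 ≤ n) (hmn : m ≤ n)
    (p : Fin n → Fin n → ℝ) (hH3 : H3cond n p)
    (A : ℝ → ℝ → Vn n → Fin n → ℝ) (B : ℝ → ℝ → Vn n → Fin n → Fin n → ℝ)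
    (δ₀ Λ₀ : ℝ) (hδ₀ : 0 < δ₀) (hΛ₀ : 0 < Λ₀)
    -- (H1): smoothness and boundedness of `A`, `B` ...
    (hH1s : ∃ C : ℝ, ∀ j : Fin n, H1smooth n δ₀ (fun x t v => A x t v j) C ∧
      ∀ k : Fin n, H1smooth n δ₀ (fun x t v => B x t v j k) C)
    -- ... and the sign/separation conditions on `A`
    (hH1 : H1sign n m δ₀ Λ₀ A)
    -- the evolution family generated by the linearized problem ...
    (U : ℝ → ℝ → L2 n →L[ℝ] L2 n)
    (hU : GeneratedBy n m p (fun x t => A x t 0) (fun x t => B x t 0) U)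
    -- ... has an exponential dichotomy on ℝ
    (hdich : ∃ α : ℝ, 0 < α ∧ ∃ M : ℝ, 1 ≤ M ∧ HasExpDichotomy U α M)
    -- `A` and `B` are Bohr almost periodic in `t` uniformly in `x`, `v`
    (hapA : ∀ j : Fin n, APcoef n δ₀ (fun x t v => A x t v j))
    (hapB : ∀ j k : Fin n, APcoef n δ₀ (fun x t v => B x t v j k)) :
    ∃ ε : ℝ, 0 < ε ∧ ∃ δ : ℝ, 0 < δ ∧
      ∀ f : ℝ → ℝ → Fin n → ℝ, FBC2le n f ε → APfun n f →
        (∃ u ux ut : ℝ → ℝ → Vn n,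
          (IsQLSol n m p A B f u ux ut ∧ BC1le n u ux ut δ) ∧
          ∀ u' ux' ut' : ℝ → ℝ → Vn n,
            IsQLSol n m p A B f u' ux' ut' → BC1le n u' ux' ut' δ →
            ∀ x ∈ Set.Icc (0:ℝ) 1, ∀ t : ℝ, u' x t = u x t) ∧
        ∀ u ux ut : ℝ → ℝ → Vn n,
          IsQLSol n m p A B f u ux ut → BC1le n u ux ut δ →
          APsol n u := by
  obtain ⟨C', hC'⟩ := hH1s
  have hmono : ∀ φ : ℝ → ℝ → Vn n → ℝ, H1smooth n δ₀ φ C' → H1smooth n δ₀ φ (max C' 1) :=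
    fun φ h => ⟨h.1, fun i hi q hq => (h.2 i hi q hq).trans (le_max_left _ _)⟩
  obtain ⟨ω, hω, K, hK, hdi⟩ := hdich
  set C := max C' 1
  have hQ : QH n m δ₀ Λ₀ C A B := ⟨hδ₀, hΛ₀, le_max_right _ _, fun j => hmono _ (hC' j).1,
    fun j k => hmono _ ((hC' j).2 k), hH1⟩
  obtain ⟨M, lam, C0, δ1, h1⟩ := exists_QS hQ hH3 hU hω hK hdi
  have hC1 := h1.hC
  have hC0 := h1.hC0
  have hn' : (1:ℝ) ≤ n := by exact_mod_cast hn
  have hq0 : 0 ≤ qK n C Λ₀ M C0 := by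
    have : 0 ≤ cI C Λ₀ := by unfold cI; positivity
    unfold qK; positivity
  set q := qK n C Λ₀ M C0
  set δ := min δ1 (1 / (8 * (q * (1 + n) + 1)))
  have hδ : 0 < δ := lt_min h1.pos (by positivity)
  have h := h1.mono hδ (min_le_left _ _)
  have hδq : q * (δ * (1 + n)) ≤ 1 / 8 := by
    have e1 : δ ≤ 1 / (8 * (q * (1 + n) + 1)) := min_le_right _ _
    rw [le_div_iff₀ (by positivity)] at e1
    linarith
  obtain ⟨c1, hc1, hstep⟩ := h.step
  set ε := min (1 / (8 * (q + 1))) (δ / n / (c1 + 1))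
  have hε : 0 < ε := lt_min (by positivity) (by positivity)
  have hεq : q * ε ≤ 1 / 8 := by
    have e1 : ε ≤ 1 / (8 * (q + 1)) := min_le_left _ _
    rw [le_div_iff₀ (by positivity)] at e1
    linarith
  have hεc : c1 * ε ≤ δ / n := by
    have e1 : ε ≤ δ / n / (c1 + 1) := min_le_right _ _
    rw [le_div_iff₀ (by positivity)] at e1
    linarith
  have hs : q * (ε + δ * (1 + n)) ≤ 1 / 4 := by linarith
  have hδn : (n:ℝ) * (δ / n) = δ := by field_simp
  have hδ' : δ / n ≤ δ := div_le_self hδ.le hn'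
  refine ⟨ε, hε, δ, hδ, fun f hf hapf => ⟨?_, fun u ux ut hu hb => ?_⟩⟩
  · obtain ⟨v, hv, hS⟩ := h.exists_sol hf hε.le hs (by positivity) hδ' fun v hv => by
      obtain ⟨w, hw, hwa⟩ := hstep f ε hε.le hf v hv
      exact ⟨w, hw, hwa.mono hεc⟩
    refine ⟨_, _, _, h.isQLSol hf hδ' hδn.le hv hS, fun u' ux' ut' hu' hb' x hx t => ?_⟩
    obtain ⟨hv', hS'⟩ := h.of_isQLSol hu' hb'
    rw [← h.unique hf hε.le hs hv' (hv.mono hδ') hS' hS]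
    change u' x t = u' (cl x) t
    rw [cl_of_mem hx]
  · obtain ⟨hv, hS⟩ := h.of_isQLSol hu hb
    exact h.apsol hf hε.le hs hapA hapB hapf hv hS
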